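/- Let G be a finitely generated solvable minimax group with spectrum π, and let ω be a set of primes. Let A be a ℤG-module whose underlying abelian group is a Černikov ω-group, and suppose that A has no infinite ℤG-submodule that is a ℤG-module quotient of some ℤG-module whose underlying abelian group is torsion-free of finite rank and π-spectral. Then the group cohomology H^n(G,A) is a Černikov ω-group for all n ≥ 0. -/

import Mathlib

/-!
Statement 4: Theorem B for finitely generated solvable minimax groups.
-/

open CategoryTheory

noncomputable section




/-- The rational circle `ℚ/ℤ`. -/
abbrev RatCircle : Type := ℚ ⧸ AddSubgroup.zmultiples (1 : ℚ)

/-- The quasicyclic (Prüfer) `p`-group, realized as the `p`-primary part of `ℚ/ℤ`. -/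
def pruferSubgroup (p : ℕ) : AddSubgroup RatCircle where
  carrier := {x | ∃ n : ℕ, (p ^ n : ℕ) • x = 0}
  zero_mem' := ⟨0, smul_zero _⟩
  add_mem' := by
    rintro a b ⟨m, hm⟩ ⟨n, hn⟩
    refine ⟨m + n, ?_⟩
    have ha : (p ^ m * p ^ n) • a = 0 := by rw [mul_comm, mul_smul, hm, smul_zero]
    have hb : (p ^ m * p ^ n) • b = 0 := by rw [mul_smul, hn, smul_zero]
    rw [smul_add, pow_add, ha, hb, add_zero]
  neg_mem' := by
    rintro a ⟨m, hm⟩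
    exact ⟨m, by rw [smul_neg, hm, neg_zero]⟩

/-- A group has a quasicyclic `p`-section if some quotient of a subgroup is
isomorphic to the Prüfer `p`-group. -/
def HasQuasicyclicSection (G : Type*) [Group G] (p : ℕ) : Prop :=
  ∃ (H : Subgroup G) (K : Subgroup H) (_ : K.Normal),
    Nonempty ((H ⧸ K) ≃* Multiplicative (pruferSubgroup p))

/-- The spectrum of a group: the set of primes `p` such that the group has a
section isomorphic to the quasicyclic `p`-group. -/
def groupSpectrum (G : Type*) [Group G] : Set ℕ :=
  {p | p.Prime ∧ HasQuasicyclicSection G p}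

/-- The spectrum of an (additive) abelian group, via `Multiplicative`. -/
abbrev addSpectrum (A : Type*) [AddGroup A] : Set ℕ :=
  groupSpectrum (Multiplicative A)

/-- An abelian group has finite rank if its torsion-free rank and all of its
`p`-ranks are finite. -/
def FiniteRankAbelian (A : Type*) [AddCommGroup A] : Prop :=
  (∃ n : ℕ, ∀ k : ℕ, (∃ f : (Fin k →₀ ℤ) →+ A, Function.Injective f) → k ≤ n) ∧
  ∀ p : ℕ, p.Prime → {a : A | (p : ℕ) • a = 0}.Finite

/-- A group has finite rank (in the sense appropriate for abelian groups:
finite torsion-free rank and finite `p`-ranks). -/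
def FiniteRankGroup (G : Type*) [Group G] : Prop :=
  (∃ n : ℕ, ∀ k : ℕ,
    (∃ f : Multiplicative (Fin k →₀ ℤ) →* G, Function.Injective f) → k ≤ n) ∧
  ∀ p : ℕ, p.Prime → {g : G | g ^ p = 1}.Finite

/-- A solvable group of finite rank: a solvable group all of whose abelian
sections have finite rank. -/
def SolvableOfFiniteRank (G : Type*) [Group G] : Prop :=
  IsSolvable G ∧
    ∀ (H : Subgroup G) (K : Subgroup H) (_ : K.Normal),
      (∀ x y : H ⧸ K, x * y = y * x) → FiniteRankGroup (H ⧸ K)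

/-- A group is virtually abelian. -/
def VirtuallyAbelian (G : Type*) [Group G] : Prop :=
  ∃ H : Subgroup G, H.index ≠ 0 ∧ ∀ x y : H, x * y = y * x

/-- A `ℤG`-module (given as an object of `Rep ℤ G`) whose underlying abelian group
is torsion-free, of finite rank, and `π`-spectral. -/
def NiceRep {G : Type} [Group G] (π : Set ℕ) (M : Rep.{0} ℤ G) : Prop :=
  (∀ g : M, g ≠ 0 → ¬IsOfFinAddOrder g) ∧ FiniteRankAbelian M ∧ addSpectrum M ⊆ π

/-- The class `𝒰` of solvable groups of finite rank. -/
def MemClassU (G : Type) [Group G] : Prop :=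
  SolvableOfFiniteRank G ∧
  ∃ (N : Subgroup G) (_ : N.Normal),
    Group.IsNilpotent N ∧
    Group.FG (G ⧸ N) ∧ VirtuallyAbelian (G ⧸ N) ∧
    ∃ (r : ℕ) (T : Fin (r + 1) → Subgroup G),
      Monotone T ∧ T 0 = ⊥ ∧
      ((T (Fin.last r) : Set G) = {g : G | g ∈ N ∧ IsOfFinOrder g}) ∧
      (∀ (i : Fin (r + 1)) (g t : G), t ∈ T i → g * t * g⁻¹ ∈ T i) ∧
      (∀ (i : Fin r) (n t : G), n ∈ N → t ∈ T i.succ →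
        n * t * n⁻¹ * t⁻¹ ∈ T i.castSucc) ∧
      (∀ i : Fin r, (T i.castSucc).relIndex (T i.succ) = 0 →
        ∃ M : Rep.{0} ℤ (G ⧸ N), NiceRep (groupSpectrum G) M ∧
          ∃ φ : M → G,
            (∀ m : M, φ m ∈ T i.succ) ∧
            (∀ m m' : M, (φ (m + m'))⁻¹ * (φ m * φ m') ∈ T i.castSucc) ∧
            (∀ t : G, t ∈ T i.succ → ∃ m : M, (φ m)⁻¹ * t ∈ T i.castSucc) ∧
            (∀ (g : G) (m : M),
              (φ (M.ρ (QuotientGroup.mk g) m))⁻¹ * (g * φ m * g⁻¹) ∈ T i.castSucc))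

/-- A solvable minimax group: there is a subnormal series of finite length each of
whose factors is cyclic or quasicyclic. -/
def IsMinimax (G : Type*) [Group G] : Prop :=
  ∃ (r : ℕ) (c : Fin (r + 1) → Subgroup G),
    Monotone c ∧ c 0 = ⊥ ∧ c (Fin.last r) = ⊤ ∧
    ∀ i : Fin r, ∃ _ : ((c i.castSucc).subgroupOf (c i.succ)).Normal,
      IsCyclic ((c i.succ) ⧸ (c i.castSucc).subgroupOf (c i.succ)) ∨
      ∃ p : ℕ, p.Prime ∧
        Nonempty (((c i.succ) ⧸ (c i.castSucc).subgroupOf (c i.succ)) ≃*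
          Multiplicative (pruferSubgroup p))
/-- A Černikov abelian group: it has a subgroup of finite index that is a direct
sum of finitely many quasicyclic groups. -/
def IsCernikov (A : Type*) [AddCommGroup A] : Prop :=
  ∃ (S : AddSubgroup A) (r : ℕ) (p : Fin r → ℕ),
    S.index ≠ 0 ∧ (∀ i, (p i).Prime) ∧
    Nonempty (S ≃+ ((i : Fin r) → pruferSubgroup (p i)))

/-- A torsion `ω`-group: every element has finite order divisible only by primes
in `ω`. -/
def IsOmegaTorsion (ω : Set ℕ) (A : Type*) [AddGroup A] : Prop :=
  ∀ a : A, IsOfFinAddOrder a ∧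
    ∀ p : ℕ, p.Prime → (p : ℤ) ∣ (addOrderOf a : ℤ) → p ∈ ω

/-- A Černikov `ω`-group. -/
def IsCernikovOmega (ω : Set ℕ) (A : Type*) [AddCommGroup A] : Prop :=
  IsCernikov A ∧ IsOmegaTorsion ω A

/-- The subgroup `S` of (the underlying abelian group of) the representation `A`
is a `ℤG`-module quotient of some `ℤG`-module whose underlying abelian group is
torsion-free, of finite rank and `π`-spectral. -/
def IsQuotientOfNiceRep {G : Type} [Group G] (π : Set ℕ) (A : Rep.{0} ℤ G)
    (S : AddSubgroup A) : Prop :=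
  ∃ M : Rep.{0} ℤ G, NiceRep π M ∧
    ∃ ψ : (M : Type) →+ (A : Type),
      (∀ m : M, ψ m ∈ S) ∧ (∀ a ∈ S, ∃ m : M, ψ m = a) ∧
      ∀ (g : G) (m : M), ψ (M.ρ g m) = A.ρ g (ψ m)


section TBsec
set_option linter.all false

namespace TB

/-- A raw cochain complex of modules. -/
structure RC (k : Type) [CommRing k] where
  X : ℕ → Type
  [acg : ∀ n, AddCommGroup (X n)]
  [mod : ∀ n, Module k (X n)]
  d : ∀ n, X n →ₗ[k] X (n + 1)
  dd : ∀ n x, d (n + 1) (d n x) = 0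

attribute [instance] RC.acg RC.mod

variable {k : Type} [CommRing k]

namespace RC

/-- Coboundaries. -/
def B (C : RC k) : ∀ n, Submodule k (C.X n)
  | 0 => ⊥
  | n + 1 => LinearMap.range (C.d n)

/-- Cocycles. -/
abbrev Z (C : RC k) (n : ℕ) : Submodule k (C.X n) := LinearMap.ker (C.d n)

/-- Cohomology. -/
abbrev H (C : RC k) (n : ℕ) : Type := C.Z n ⧸ (C.B n).comap (C.Z n).subtype

/-- Class of a cocycle. -/
def cl (C : RC k) (n : ℕ) (x : C.X n) (hx : C.d n x = 0) : C.H n :=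
  Submodule.Quotient.mk ⟨x, hx⟩

lemma cl_surj (C : RC k) (n : ℕ) (c : C.H n) : ∃ x hx, C.cl n x hx = c := by
  obtain ⟨⟨x, hx⟩, rfl⟩ := Submodule.Quotient.mk_surjective _ c
  exact ⟨x, hx, rfl⟩

lemma cl_eq_zero (C : RC k) (n : ℕ) (x : C.X n) (hx : C.d n x = 0) :
    C.cl n x hx = 0 ↔ x ∈ C.B n := by
  unfold cl
  rw [Submodule.Quotient.mk_eq_zero]
  rfl

lemma cl_add (C : RC k) (n : ℕ) (x y : C.X n) (hx : C.d n x = 0) (hy : C.d n y = 0) :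
    C.cl n x hx + C.cl n y hy = C.cl n (x + y) (by rw [map_add, hx, hy, add_zero]) := rfl

lemma cl_sub (C : RC k) (n : ℕ) (x y : C.X n) (hx : C.d n x = 0) (hy : C.d n y = 0) :
    C.cl n x hx - C.cl n y hy = C.cl n (x - y) (by rw [map_sub, hx, hy, sub_zero]) := rfl

lemma cl_smul (C : RC k) (n : ℕ) (r : k) (x : C.X n) (hx : C.d n x = 0) :
    r • C.cl n x hx = C.cl n (r • x) (by rw [map_smul, hx, smul_zero]) := rfl

lemma cl_nsmul (C : RC k) (n : ℕ) (r : ℕ) (x : C.X n) (hx : C.d n x = 0) :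
    r • C.cl n x hx = C.cl n (r • x) (by rw [map_nsmul, hx, smul_zero]) := rfl

lemma cl_eq_cl (C : RC k) (n : ℕ) (x y : C.X n) (hx : C.d n x = 0) (hy : C.d n y = 0) :
    C.cl n x hx = C.cl n y hy ↔ x - y ∈ C.B n := by
  rw [← sub_eq_zero, cl_sub, cl_eq_zero]

lemma d_mem_B (C : RC k) (n : ℕ) (x : C.X n) : C.d n x ∈ C.B (n + 1) := ⟨x, rfl⟩

end RC

/-- Morphism of raw complexes. -/
structure RHom (C D : RC k) where
  f : ∀ n, C.X n →ₗ[k] D.X n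
  comm : ∀ n x, f (n + 1) (C.d n x) = D.d n (f n x)

namespace RHom
variable {A B C D : RC k}

lemma map_B (φ : RHom C D) (n : ℕ) (x : C.X n) (hx : x ∈ C.B n) : φ.f n x ∈ D.B n := by
  cases n with
  | zero => 
    have : x = 0 := hx
    rw [this, map_zero]; exact Submodule.zero_mem _
  | succ n =>
    obtain ⟨y, rfl⟩ := hx
    rw [φ.comm]; exact ⟨_, rfl⟩

lemma map_Z (φ : RHom C D) (n : ℕ) (x : C.X n) (hx : C.d n x = 0) : D.d n (φ.f n x) = 0 := by
  rw [← φ.comm, hx, map_zero]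

/-- Induced map on cohomology. -/
def H (φ : RHom C D) (n : ℕ) : C.H n →ₗ[k] D.H n :=
  Submodule.mapQ _ _ ((φ.f n).restrict (fun x hx => φ.map_Z n x hx)) (by
    rintro ⟨x, hx⟩ h
    exact φ.map_B n x h)

@[simp] lemma H_cl (φ : RHom C D) (n : ℕ) (x : C.X n) (hx : C.d n x = 0) :
    φ.H n (C.cl n x hx) = D.cl n (φ.f n x) (φ.map_Z n x hx) := rfl

/-- identity -/
def id (C : RC k) : RHom C C := ⟨fun _ => LinearMap.id, fun _ _ => rfl⟩
/-- composition -/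
def comp (ψ : RHom B C) (φ : RHom A B) : RHom A C :=
  ⟨fun n => (ψ.f n).comp (φ.f n), fun n x => by simp [φ.comm, ψ.comm]⟩

end RHom

/-- Short exact sequence of raw complexes. -/
structure RSES {A B C : RC k} (i : RHom A B) (p : RHom B C) : Prop where
  inj : ∀ n, Function.Injective (i.f n)
  surj : ∀ n, Function.Surjective (p.f n)
  zero : ∀ n x, p.f n (i.f n x) = 0
  ex : ∀ n y, p.f n y = 0 → ∃ x, i.f n x = y

namespace RSES
variable {A B C : RC k} {i : RHom A B} {p : RHom B C}

lemma delta_exists (h : RSES i p) (n : ℕ) (c : C.H n) : ∃ (a : A.H (n + 1)) (y : B.X n) (x : A.X (n + 1))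
    (hy : C.d n (p.f n y) = 0) (hx : A.d (n + 1) x = 0), i.f (n + 1) x = B.d n y ∧
    C.cl n _ hy = c ∧ A.cl _ x hx = a := by
  obtain ⟨z, hz, rfl⟩ := C.cl_surj n c
  obtain ⟨y, rfl⟩ := h.surj n z
  obtain ⟨x, hx⟩ := h.ex (n + 1) (B.d n y) (by rw [p.comm, hz])
  have hx0 : A.d (n + 1) x = 0 := by
    apply h.inj; rw [i.comm, hx, B.dd, map_zero]
  exact ⟨_, y, x, hz, hx0, hx, rfl, rfl⟩

lemma delta_unique (h : RSES i p) (n : ℕ) (y y' : B.X n) (x x' : A.X (n + 1))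
    (hy : C.d n (p.f n y) = 0) (hx : A.d (n + 1) x = 0) (hxy : i.f (n + 1) x = B.d n y)
    (hy' : C.d n (p.f n y') = 0) (hx' : A.d (n + 1) x' = 0) (hxy' : i.f (n + 1) x' = B.d n y')
    (e : C.cl n _ hy = C.cl n _ hy') : A.cl _ x hx = A.cl _ x' hx' := by
  rw [RC.cl_eq_cl] at e ⊢
  have key : ∀ w : B.X n, p.f n w = 0 → B.d n (y - y') = B.d n w → x - x' ∈ A.B (n + 1) := by
    intro w hw e2
    obtain ⟨a, rfl⟩ := h.ex n w hw
    refine ⟨a, ?_⟩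
    apply h.inj
    rw [i.comm, ← e2, map_sub, map_sub, hxy, hxy']
  cases n with
  | zero =>
    have e : p.f 0 y - p.f 0 y' = 0 := e
    exact key (y - y') (by rw [map_sub, e]) rfl
  | succ n =>
    obtain ⟨c, hc⟩ := e
    obtain ⟨b, rfl⟩ := h.surj n c
    refine key (y - y' - B.d n b) (by rw [map_sub, map_sub, p.comm, hc, sub_self]) ?_
    rw [map_sub _ (y - y'), B.dd, sub_zero]

/-- Connecting homomorphism. -/
def δ (h : RSES i p) (n : ℕ) : C.H n →ₗ[k] A.H (n + 1) where
  toFun c := (h.delta_exists n c).choose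
  map_add' c c' := by
    obtain ⟨y, x, hy, hx, hxy, e, ea⟩ := (h.delta_exists n c).choose_spec
    obtain ⟨y', x', hy', hx', hxy', e', ea'⟩ := (h.delta_exists n c').choose_spec
    obtain ⟨y2, x2, hy2, hx2, hxy2, e2, ea2⟩ := (h.delta_exists n (c + c')).choose_spec
    rw [← ea, ← ea', ← ea2, A.cl_add]
    refine h.delta_unique n _ (y + y') _ _ hy2 hx2 hxy2 (by rw [map_add, map_add, hy, hy', add_zero])
      _ (by rw [map_add, map_add, hxy, hxy']) ?_
    rw [e2, ← e, ← e', RC.cl_add]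
    congr 1; rw [map_add]
  map_smul' r c := by
    obtain ⟨y, x, hy, hx, hxy, e, ea⟩ := (h.delta_exists n c).choose_spec
    obtain ⟨y2, x2, hy2, hx2, hxy2, e2, ea2⟩ := (h.delta_exists n (r • c)).choose_spec
    rw [RingHom.id_apply, ← ea, ← ea2, A.cl_smul]
    refine h.delta_unique n _ (r • y) _ _ hy2 hx2 hxy2 (by rw [map_smul, map_smul, hy, smul_zero])
      _ (by rw [map_smul, map_smul, hxy]) ?_
    rw [e2, ← e, RC.cl_smul]
    congr 1; rw [map_smul]

lemma δ_cl (h : RSES i p) (n : ℕ) (y : B.X n) (x : A.X (n + 1))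
    (hy : C.d n (p.f n y) = 0) (hx : A.d (n + 1) x = 0) (hxy : i.f (n + 1) x = B.d n y) :
    h.δ n (C.cl n _ hy) = A.cl _ x hx := by
  obtain ⟨y2, x2, hy2, hx2, hxy2, e2, ea2⟩ := (h.delta_exists n (C.cl n _ hy)).choose_spec
  change (h.delta_exists n (C.cl n _ hy)).choose = _
  rw [← ea2]
  exact h.delta_unique n _ _ _ _ hy2 hx2 hxy2 hy hx hxy e2

lemma exact2 (h : RSES i p) (n : ℕ) (b : B.H n) (hb : p.H n b = 0) : ∃ a, i.H n a = b := by
  obtain ⟨y, hy, rfl⟩ := B.cl_surj n b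
  rw [RHom.H_cl, RC.cl_eq_zero] at hb
  have key : ∀ w ∈ B.B n, p.f n (y - w) = 0 → ∃ a, i.H n a = B.cl n y hy := by
    intro w hw e
    obtain ⟨x, hx⟩ := h.ex n _ e
    have hdw : B.d n w = 0 := by
      cases n with
      | zero => have : w = 0 := hw
                rw [this, map_zero]
      | succ n => obtain ⟨v, rfl⟩ := hw; exact B.dd _ _
    have hx0 : A.d n x = 0 := by
      apply h.inj; rw [i.comm, hx, map_sub, hy, hdw, sub_zero, map_zero]
    refine ⟨A.cl n x hx0, ?_⟩
    rw [RHom.H_cl, RC.cl_eq_cl, hx]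
    simpa using Submodule.neg_mem _ hw
  cases n with
  | zero => have : p.f 0 y = 0 := hb
            exact key 0 (Submodule.zero_mem _) (by rw [sub_zero, this])
  | succ n =>
    obtain ⟨c, hc⟩ := hb
    obtain ⟨b, rfl⟩ := h.surj n c
    exact key (B.d n b) ⟨b, rfl⟩ (by rw [map_sub, p.comm, hc, sub_self])

lemma exact2' (h : RSES i p) (n : ℕ) (a : A.H n) : p.H n (i.H n a) = 0 := by
  obtain ⟨x, hx, rfl⟩ := A.cl_surj n a
  rw [RHom.H_cl, RHom.H_cl, RC.cl_eq_zero, h.zero]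
  exact Submodule.zero_mem _

lemma exact3 (h : RSES i p) (n : ℕ) (c : C.H n) (hc : h.δ n c = 0) : ∃ b, p.H n b = c := by
  obtain ⟨a, y, x, hy, hx, hxy, rfl, rfl⟩ := h.delta_exists n c
  rw [h.δ_cl n y x hy hx hxy, RC.cl_eq_zero] at hc
  obtain ⟨w, rfl⟩ := hc
  have hb : B.d n (y - i.f n w) = 0 := by rw [map_sub, ← i.comm, hxy, sub_self]
  refine ⟨B.cl n (y - i.f n w) hb, ?_⟩
  rw [RHom.H_cl]
  congr 1; rw [map_sub, h.zero, sub_zero]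

lemma exact3' (h : RSES i p) (n : ℕ) (b : B.H n) : h.δ n (p.H n b) = 0 := by
  obtain ⟨y, hy, rfl⟩ := B.cl_surj n b
  rw [RHom.H_cl, h.δ_cl n y 0 _ (map_zero _) (by rw [map_zero, hy]), RC.cl_eq_zero]
  exact Submodule.zero_mem _

lemma exact1 (h : RSES i p) (n : ℕ) (a : A.H (n + 1)) (ha : i.H (n + 1) a = 0) : ∃ c, h.δ n c = a := by
  obtain ⟨x, hx, rfl⟩ := A.cl_surj _ a
  rw [RHom.H_cl, RC.cl_eq_zero] at ha
  obtain ⟨y, hy⟩ := ha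
  have : C.d n (p.f n y) = 0 := by rw [← p.comm, hy, h.zero]
  exact ⟨C.cl n _ this, h.δ_cl n y x this hx hy.symm⟩

lemma exact1' (h : RSES i p) (n : ℕ) (c : C.H n) : i.H (n + 1) (h.δ n c) = 0 := by
  obtain ⟨a, y, x, hy, hx, hxy, rfl, rfl⟩ := h.delta_exists n c
  rw [h.δ_cl n y x hy hx hxy, RHom.H_cl, RC.cl_eq_zero, hxy]
  exact ⟨_, rfl⟩

lemma inj0 (h : RSES i p) : Function.Injective (i.H 0) := by
  rw [injective_iff_map_eq_zero]
  intro a ha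
  obtain ⟨x, hx, rfl⟩ := A.cl_surj _ a
  rw [RHom.H_cl, RC.cl_eq_zero] at ha
  have : i.f 0 x = 0 := ha
  have : x = 0 := h.inj 0 (by rw [this, map_zero])
  rw [RC.cl_eq_zero, this]; exact Submodule.zero_mem _

/-- naturality of the connecting map -/
lemma δ_nat (h : RSES i p) {A' B' C' : RC k} {i' : RHom A' B'} {p' : RHom B' C'} (h' : RSES i' p')
    (fA : RHom A A') (fB : RHom B B') (fC : RHom C C')
    (e1 : ∀ n x, fB.f n (i.f n x) = i'.f n (fA.f n x))
    (e2 : ∀ n x, fC.f n (p.f n x) = p'.f n (fB.f n x)) (n : ℕ) (c : C.H n) :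
    fA.H (n + 1) (h.δ n c) = h'.δ n (fC.H n c) := by
  obtain ⟨a, y, x, hy, hx, hxy, rfl, rfl⟩ := h.delta_exists n c
  rw [h.δ_cl n y x hy hx hxy, RHom.H_cl, RHom.H_cl]
  have hz : C'.d n (p'.f n (fB.f n y)) = 0 := by rw [← e2]; exact fC.map_Z _ _ hy
  have := h'.δ_cl n (fB.f n y) (fA.f (n + 1) x) hz (fA.map_Z _ _ hx)
    (by rw [← e1, hxy, fB.comm])
  rw [← this]
  congr 2; rw [e2]

end RSES

end TB

namespace TB

section cochains
variable {k : Type} [CommRing k] {H : Type} [Group H] {V : Type} [AddCommGroup V] [Module k V]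

/-- The part of the bar differential not involving the action. -/
def dp : ∀ n : ℕ, ((Fin n → H) → V) → ((Fin (n + 1) → H) → V)
  | 0, F, t => - F (Fin.tail t)
  | n + 1, F, t => - F (Fin.cons (t 0 * t 1) (Fin.tail (Fin.tail t)))
      - dp n (fun s => F (Fin.cons (t 0) s)) (Fin.tail t)

/-- The bar differential. -/
def dfun (σ : Representation k H V) (n : ℕ) (F : (Fin n → H) → V) (t : Fin (n + 1) → H) : V :=
  σ (t 0) (F (Fin.tail t)) + dp n F t

lemma dp_zero (F : (Fin 0 → H) → V) (t : Fin 1 → H) : dp 0 F t = - F (Fin.tail t) := rfl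

lemma dp_cons (n : ℕ) (F : (Fin (n + 1) → H) → V) (a : H) (t : Fin (n + 1) → H) :
    dp (n + 1) F (Fin.cons a t : Fin (n + 2) → H) =
      - F (Fin.cons (a * t 0) (Fin.tail t)) - dp n (fun s => F (Fin.cons a s)) t := rfl

lemma dfun_cons (σ : Representation k H V) (n : ℕ) (F : (Fin n → H) → V) (a : H) (t : Fin n → H) :
    dfun σ n F (Fin.cons a t : Fin (n + 1) → H) = σ a (F t) + dp n F (Fin.cons a t : Fin (n + 1) → H) := rfl

lemma contract_zero {n : ℕ} (g : Fin (n + 2) → H) :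
    Fin.contractNth 0 (· * ·) g = Fin.cons (g 0 * g 1) (Fin.tail (Fin.tail g)) := by
  ext i
  refine Fin.cases ?_ (fun i => ?_) i
  · rw [Fin.contractNth_apply_of_eq _ _ _ _ rfl]; rfl
  · rw [Fin.contractNth_apply_of_gt _ _ _ _ (by simp)]; rfl

lemma contract_succ {n : ℕ} (j : Fin (n + 1)) (g : Fin (n + 2) → H) :
    Fin.contractNth j.succ (· * ·) g = Fin.cons (g 0) (Fin.contractNth j (· * ·) (Fin.tail g)) := by
  ext i
  refine Fin.cases ?_ (fun i => ?_) i
  · rw [Fin.contractNth_apply_of_lt _ _ _ _ (by simp)]; rfl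
  · simp only [Fin.contractNth, Fin.cons_succ, Fin.val_succ, Fin.tail]
    simp only [Nat.add_lt_add_iff_right, Nat.add_right_cancel_iff]
    rfl

lemma dp_eq_sum (n : ℕ) (F : (Fin n → H) → V) (t : Fin (n + 1) → H) :
    dp n F t = ∑ j : Fin (n + 1), (-1 : k) ^ ((j : ℕ) + 1) • F (Fin.contractNth j (· * ·) t) := by
  induction n with
  | zero => simp [dp_zero]; congr 1; ext i; exact i.elim0
  | succ n ih =>
    rw [Fin.sum_univ_succ, contract_zero]
    simp only [contract_succ]
    rw [dp, ih, sub_eq_add_neg, ← Finset.sum_neg_distrib]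
    congr 1
    · simp
    · refine Finset.sum_congr rfl fun j _ => ?_
      rw [Fin.val_succ, pow_succ _ ((j : ℕ) + 1), mul_neg_one, neg_smul]

lemma dfun_eq (σ : Representation k H V) (n : ℕ) (F : (Fin n → H) → V) :
    dfun σ n F = (inhomogeneousCochains.d (Rep.of σ) n).hom F := by
  ext t
  rw [inhomogeneousCochains.d_hom_apply, dfun, dp_eq_sum (k := k)]
  rfl

lemma dfun_dfun (σ : Representation k H V) (n : ℕ) (F : (Fin n → H) → V) :
    dfun σ (n + 1) (dfun σ n F) = 0 := by
  rw [dfun_eq, dfun_eq]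
  have := congrArg (fun f => f.hom F) (groupCohomology.inhomogeneousCochains.d_comp_d n (Rep.of σ))
  exact this

/-- The complex of inhomogeneous cochains. -/
def gc (σ : Representation k H V) : RC k where
  X n := (Fin n → H) → V
  d n :=
    { toFun := dfun σ n
      map_add' := fun F G => by rw [dfun_eq, dfun_eq, dfun_eq, map_add]
      map_smul' := fun F G => by rw [dfun_eq, dfun_eq, map_smul, RingHom.id_apply] }
  dd n x := dfun_dfun σ n x

/-- Group cohomology (elementary version). -/
abbrev gH (σ : Representation k H V) (n : ℕ) : Type := (gc σ).H n

lemma gc_d (σ : Representation k H V) (n : ℕ) (F : (Fin n → H) → V) :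
    (gc σ).d n F = dfun σ n F := rfl

variable {H' : Type} [Group H'] {V' : Type} [AddCommGroup V'] [Module k V']

lemma dp_map (α : H' →* H) (φ : V →ₗ[k] V') (n : ℕ) (F : (Fin n → H) → V) (t : Fin (n + 1) → H') :
    dp n (fun s => φ (F (α ∘ s))) t = φ (dp n F (α ∘ t)) := by
  induction n with
  | zero => simp [dp_zero]; congr 2
  | succ n ih =>
    rw [dp, dp, map_sub, map_neg]
    congr 1
    · congr 3
      ext i; refine Fin.cases ?_ (fun i => ?_) i
      · simp
      · simp [Fin.tail]
    · have := ih (fun s => F (Fin.cons ((α ∘ t) 0) s)) (Fin.tail t)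
      refine Eq.trans ?_ this
      congr 1; ext s
      congr 2
      ext i; refine Fin.cases ?_ (fun i => ?_) i
      · simp
      · simp

lemma dfun_map {σ : Representation k H V} {τ : Representation k H' V'} (α : H' →* H) (φ : V →ₗ[k] V')
    (h : ∀ x v, φ (σ (α x) v) = τ x (φ v)) (n : ℕ) (F : (Fin n → H) → V) :
    (fun t => φ (dfun σ n F (α ∘ t))) = dfun τ n (fun s => φ (F (α ∘ s))) := by
  ext t
  simp only [dfun]
  rw [dp_map, map_add]
  congr 1
  exact h _ _

/-- Functoriality of cochains. -/
def gmap {σ : Representation k H V} {τ : Representation k H' V'} (α : H' →* H) (φ : V →ₗ[k] V')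
    (h : ∀ x v, φ (σ (α x) v) = τ x (φ v)) : RHom (gc σ) (gc τ) where
  f n :=
    { toFun := fun F t => φ (F (α ∘ t))
      map_add' := fun F G => funext fun t => map_add φ _ _
      map_smul' := fun r F => funext fun t => map_smul φ _ _ }
  comm n F := dfun_map α φ h n F

lemma gmap_f {σ : Representation k H V} {τ : Representation k H' V'} (α : H' →* H) (φ : V →ₗ[k] V')
    (h : ∀ x v, φ (σ (α x) v) = τ x (φ v)) (n : ℕ) (F : (Fin n → H) → V) (t : Fin n → H') :
    (gmap α φ h).f n F t = φ (F (α ∘ t)) := rfl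

variable {V'' : Type} [AddCommGroup V''] [Module k V'']

lemma gses {σ : Representation k H V} {τ : Representation k H V'} {υ : Representation k H V''}
    (i : V →ₗ[k] V') (p : V' →ₗ[k] V'')
    (hi : ∀ x v, i (σ x v) = τ x (i v)) (hp : ∀ x v, p (τ x v) = υ x (p v))
    (inj : Function.Injective i) (surj : Function.Surjective p) (ex : ∀ v, p v = 0 ↔ ∃ w, i w = v) :
    RSES (gmap (σ := σ) (τ := τ) (MonoidHom.id H) i hi) (gmap (σ := τ) (τ := υ) (MonoidHom.id H) p hp) where
  inj n F G e := by
    exact funext fun t => inj (congrFun e t)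
  surj n F := ⟨fun t => (surj (F t)).choose, funext fun t => (surj (F t)).choose_spec⟩
  zero n F := by
    exact funext fun t => (ex _).2 ⟨_, rfl⟩
  ex n F e := by
    have := fun t => (ex (F t)).1 (congrFun e t)
    choose G hG using this
    exact ⟨G, funext fun t => hG t⟩

end cochains
end TB

namespace TB

section
variable {k : Type} [CommRing k] {H : Type} [Group H] {V : Type} [AddCommGroup V] [Module k V]
variable {H' : Type} [Group H'] {V' : Type} [AddCommGroup V'] [Module k V']
variable {H'' : Type} [Group H''] {V'' : Type} [AddCommGroup V''] [Module k V'']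

lemma dp_lin (φ : V →ₗ[k] V') (n : ℕ) (F : (Fin n → H) → V) (t : Fin (n + 1) → H) :
    dp n (fun s => φ (F s)) t = φ (dp n F t) := dp_map (MonoidHom.id H) φ n F t

/-- class of a cocycle -/
def gcl (σ : Representation k H V) (n : ℕ) (F : (Fin n → H) → V) (hF : dfun σ n F = 0) : gH σ n :=
  (gc σ).cl n F hF

lemma gcl_surj (σ : Representation k H V) (n : ℕ) (c : gH σ n) :
    ∃ (F : (Fin n → H) → V) (hF : dfun σ n F = 0), gcl σ n F hF = c := RC.cl_surj _ _ c

lemma gcl_succ (σ : Representation k H V) (n : ℕ) (F : (Fin (n + 1) → H) → V)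
    (hF : dfun σ (n + 1) F = 0) :
    gcl σ (n + 1) F hF = 0 ↔ ∃ s : (Fin n → H) → V, dfun σ n s = F := RC.cl_eq_zero _ _ _ _

lemma gcl_zero (σ : Representation k H V) (F : (Fin 0 → H) → V) (hF : dfun σ 0 F = 0) :
    gcl σ 0 F hF = 0 ↔ F = 0 := RC.cl_eq_zero _ _ _ _

lemma gcl_congr (σ : Representation k H V) (n : ℕ) (F F' : (Fin n → H) → V) (hF : dfun σ n F = 0)
    (e : F = F') : gcl σ n F hF = gcl σ n F' (e ▸ hF) := by subst e; rfl

lemma dfun_add (σ : Representation k H V) (n : ℕ) (F G : (Fin n → H) → V) :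
    dfun σ n (F + G) = dfun σ n F + dfun σ n G := ((gc σ).d n).map_add F G
lemma dfun_sub (σ : Representation k H V) (n : ℕ) (F G : (Fin n → H) → V) :
    dfun σ n (F - G) = dfun σ n F - dfun σ n G := ((gc σ).d n).map_sub F G
lemma dfun_smul (σ : Representation k H V) (n : ℕ) (r : k) (F : (Fin n → H) → V) :
    dfun σ n (r • F) = r • dfun σ n F := ((gc σ).d n).map_smul r F
lemma dfun_neg (σ : Representation k H V) (n : ℕ) (F : (Fin n → H) → V) :
    dfun σ n (-F) = - dfun σ n F := ((gc σ).d n).map_neg F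
lemma dfun_map_zero (σ : Representation k H V) (n : ℕ) :
    dfun σ n (0 : (Fin n → H) → V) = 0 := ((gc σ).d n).map_zero
lemma gcl_add (σ : Representation k H V) (n : ℕ) (F G : (Fin n → H) → V) (hF hG) :
    gcl σ n F hF + gcl σ n G hG = gcl σ n (F + G) (by rw [dfun_add, hF, hG, add_zero]) := rfl
lemma gcl_sub (σ : Representation k H V) (n : ℕ) (F G : (Fin n → H) → V) (hF hG) :
    gcl σ n F hF - gcl σ n G hG = gcl σ n (F - G) (by rw [dfun_sub, hF, hG, sub_zero]) := rfl
lemma gcl_smul (σ : Representation k H V) (n : ℕ) (r : k) (F : (Fin n → H) → V) (hF) :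
    r • gcl σ n F hF = gcl σ n (r • F) (by rw [dfun_smul, hF, smul_zero]) := rfl

lemma gmap_comp {σ : Representation k H V} {σ' : Representation k H' V'}
    {σ'' : Representation k H'' V''} (α : H' →* H) (φ : V →ₗ[k] V')
    (h : ∀ x v, φ (σ (α x) v) = σ' x (φ v)) (α' : H'' →* H') (φ' : V' →ₗ[k] V'')
    (h' : ∀ x v, φ' (σ' (α' x) v) = σ'' x (φ' v)) (β : H'' →* H) (ψ : V →ₗ[k] V'')
    (hb : ∀ x v, ψ (σ (β x) v) = σ'' x (ψ v)) (e1 : ∀ x, β x = α (α' x))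
    (e2 : ∀ v, ψ v = φ' (φ v)) (n : ℕ) (c : gH σ n) :
    (gmap α' φ' h').H n ((gmap α φ h).H n c) = (gmap β ψ hb).H n c := by
  obtain rfl : β = α.comp α' := MonoidHom.ext e1
  obtain rfl : ψ = φ'.comp φ := LinearMap.ext e2
  obtain ⟨x, hx, rfl⟩ := RC.cl_surj _ _ c
  rfl

lemma gmap_id {σ : Representation k H V} (α : H →* H) (φ : V →ₗ[k] V)
    (h : ∀ x v, φ (σ (α x) v) = σ x (φ v)) (e1 : ∀ x, α x = x) (e2 : ∀ v, φ v = v)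
    (n : ℕ) (c : gH σ n) : (gmap α φ h).H n c = c := by
  obtain rfl : α = MonoidHom.id H := MonoidHom.ext e1
  obtain rfl : φ = LinearMap.id := LinearMap.ext e2
  obtain ⟨x, hx, rfl⟩ := RC.cl_surj _ _ c
  rfl

lemma gmap_Z {σ : Representation k H V} {τ : Representation k H' V'} (α : H' →* H) (φ : V →ₗ[k] V')
    (h : ∀ x v, φ (σ (α x) v) = τ x (φ v)) (n : ℕ) (F : (Fin n → H) → V) (hF : dfun σ n F = 0) :
    dfun τ n (fun t => φ (F (α ∘ t))) = 0 := by
  rw [← dfun_map α φ h, hF]; funext t; exact map_zero φ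

lemma gmap_cl {σ : Representation k H V} {τ : Representation k H' V'} (α : H' →* H) (φ : V →ₗ[k] V')
    (h : ∀ x v, φ (σ (α x) v) = τ x (φ v)) (n : ℕ) (F : (Fin n → H) → V) (hF) :
    (gmap α φ h).H n (gcl σ n F hF) = gcl τ n (fun t => φ (F (α ∘ t))) (gmap_Z α φ h n F hF) := rfl

/-! ### Acyclicity -/

lemma acyclic (τ : Representation k H V) {Ω A : Type} [AddCommGroup A] [Module k A]
    (e : V ≃ₗ[k] (Ω → A)) (m : Ω → H → Ω) (m1 : ∀ x, m x 1 = x) (mm : ∀ x a b, m (m x a) b = m x (a * b))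
    (r : Ω → H) (hr : ∀ x a, r (m x a) = r x * a) (he : ∀ h v x, e (τ h v) x = e v (m x h))
    (n : ℕ) (c : gH τ (n + 1)) : c = 0 := by
  obtain ⟨φ, hφ, rfl⟩ := gcl_surj _ _ c
  rw [gcl_succ]
  let s : (Fin n → H) → V := fun t => e.symm (fun x => e (φ (Fin.cons (r x) t : Fin (n+1) → H)) (m x (r x)⁻¹))
  refine ⟨s, ?_⟩
  funext t
  apply e.injective
  funext x
  set y := m x (r x)⁻¹ with hy
  have hyx : m y (r x) = x := by rw [hy, mm, inv_mul_cancel, m1]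
  have hs : ∀ t z, e (s t) z = e (φ (Fin.cons (r z) t : Fin (n+1) → H)) (m z (r z)⁻¹) := by
    intro t z; simp [s]
  have h0 : e (dfun τ (n + 1) φ (Fin.cons (r x) t : Fin (n+2) → H)) y = 0 := by
    rw [hφ]; simp
  let Lx : V →ₗ[k] A := (LinearMap.proj x).comp e.toLinearMap
  let Ly : V →ₗ[k] A := (LinearMap.proj y).comp e.toLinearMap
  have h1 : e (dp n s t) x = e (dp n (fun u => φ (Fin.cons (r x) u : Fin (n+1) → H)) t) y := by
    change Lx (dp n s t) = Ly (dp n (fun u => φ (Fin.cons (r x) u : Fin (n+1) → H)) t)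
    rw [← dp_lin Lx, ← dp_lin Ly]
    congr 1
    funext u
    exact hs u x
  rw [dfun_cons, dp_cons, map_add, map_sub, map_neg, Pi.add_apply, Pi.sub_apply, Pi.neg_apply, he, hyx] at h0
  rw [dfun, map_add, Pi.add_apply, h1, he, hs, hr, mm]
  have e3 : m x (t 0 * (r x * t 0)⁻¹) = y := by rw [hy]; congr 1; group
  rw [e3]
  have := h0
  rw [← sub_eq_zero, ← neg_eq_zero, ← h0]
  abel

/-! ### Degree zero -/

lemma dfun_zero (σ : Representation k H V) (F : (Fin 0 → H) → V) (t : Fin 1 → H) :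
    dfun σ 0 F t = σ (t 0) (F Fin.elim0) - F Fin.elim0 := by
  rw [dfun, dp_zero, sub_eq_add_neg, Subsingleton.elim (Fin.tail t) Fin.elim0]

/-- The value of a zeroth cohomology class. -/
def h0 (σ : Representation k H V) : gH σ 0 →ₗ[k] V :=
  Submodule.liftQ _ ((LinearMap.proj (R := k) (φ := fun _ : (Fin 0 → H) => V) Fin.elim0).comp
    ((gc σ).Z 0).subtype) (by
      rintro ⟨x, hx⟩ h
      have : x = 0 := h
      subst this
      rfl)

lemma h0_cl (σ : Representation k H V) (F : (Fin 0 → H) → V) (hF) :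
    h0 σ (gcl σ 0 F hF) = F Fin.elim0 := rfl

lemma h0_inj (σ : Representation k H V) : Function.Injective (h0 σ) := by
  rw [injective_iff_map_eq_zero]
  intro c hc
  obtain ⟨F, hF, rfl⟩ := gcl_surj _ _ c
  rw [h0_cl] at hc
  rw [gcl_zero]
  funext t
  rw [Subsingleton.elim t Fin.elim0]; exact hc

lemma h0_inv (σ : Representation k H V) (c : gH σ 0) (x : H) : σ x (h0 σ c) = h0 σ c := by
  obtain ⟨F, hF, rfl⟩ := gcl_surj _ _ c
  rw [h0_cl]
  have := congrFun hF (fun _ => x)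
  rw [dfun_zero] at this
  exact sub_eq_zero.1 this

lemma h0_surj (σ : Representation k H V) (v : V) (hv : ∀ x, σ x v = v) : ∃ c, h0 σ c = v := by
  refine ⟨gcl σ 0 (fun _ => v) ?_, rfl⟩
  funext t
  rw [dfun_zero, hv, sub_self]; rfl

lemma h0_gmap {σ : Representation k H V} {τ : Representation k H' V'} (α : H' →* H) (φ : V →ₗ[k] V')
    (h : ∀ x v, φ (σ (α x) v) = τ x (φ v)) (c : gH σ 0) :
    h0 τ ((gmap α φ h).H 0 c) = φ (h0 σ c) := by
  obtain ⟨F, hF, rfl⟩ := gcl_surj _ _ c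
  rw [gmap_cl, h0_cl, h0_cl, Subsingleton.elim (α ∘ Fin.elim0) Fin.elim0]

/-! ### Action on cohomology -/

variable {Γ : Type} [Group Γ]

/-- action on the cohomology of a normal subgroup -/
def HHrep (θ : Γ →* MulAut H) (ρ : Representation k Γ V) (σ : Representation k H V)
    (hc : ∀ g h v, ρ g (σ h v) = σ (θ g h) (ρ g v)) (n : ℕ) : Representation k Γ (gH σ n) where
  toFun g := (gmap (σ := σ) (τ := σ) (θ g⁻¹).toMonoidHom (ρ g) (fun x v => by
    rw [hc]; simp)).H n
  map_one' := by
    apply LinearMap.ext; intro c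
    exact gmap_id _ _ _ (by simp) (by simp) n c
  map_mul' a b := by
    apply LinearMap.ext; intro c
    refine (gmap_comp _ _ _ _ _ _ _ _ _ ?_ ?_ n c).symm
    · intro x; simp
    · intro x; simp

lemma HHrep_apply (θ : Γ →* MulAut H) (ρ : Representation k Γ V) (σ : Representation k H V)
    (hc : ∀ g h v, ρ g (σ h v) = σ (θ g h) (ρ g v)) (n : ℕ) (g : Γ) (c) :
  HHrep θ ρ σ hc n g c = (gmap (σ := σ) (τ := σ) (θ g⁻¹).toMonoidHom (ρ g) (fun x v => by
    rw [hc]; simp)).H n c := rfl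

lemma HHrep_cl (θ : Γ →* MulAut H) (ρ : Representation k Γ V) (σ : Representation k H V)
    (hc : ∀ g h v, ρ g (σ h v) = σ (θ g h) (ρ g v)) (n : ℕ) (g : Γ) (F : (Fin n → H) → V) (hF) :
    ∃ h, HHrep θ ρ σ hc n g (gcl σ n F hF) =
     gcl σ n (fun t => ρ g (F (fun i => θ g⁻¹ (t i)))) h := ⟨_, rfl⟩

/-! ### Coinduced module -/

/-- functions on the group -/
def coind (k Γ V : Type) [CommRing k] [Group Γ] [AddCommGroup V] [Module k V] :
    Representation k Γ (Γ → V) where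
  toFun g := { toFun := fun F x => F (x * g), map_add' := fun _ _ => rfl, map_smul' := fun _ _ => rfl }
  map_one' := by ext F x; simp
  map_mul' a b := by
    apply LinearMap.ext; intro F; funext x
    change F (x * (a * b)) = F (x * a * b)
    rw [mul_assoc]

lemma coind_apply (g : Γ) (F : Γ → V) (x : Γ) : coind k Γ V g F x = F (x * g) := rfl

/-- embedding in the coinduced module -/
def iE (ρ : Representation k Γ V) : V →ₗ[k] (Γ → V) where
  toFun v x := ρ x v
  map_add' _ _ := by funext x; exact map_add _ _ _
  map_smul' _ _ := by funext x; exact map_smul _ _ _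

lemma iE_apply (ρ : Representation k Γ V) (v : V) (x : Γ) : iE ρ v x = ρ x v := rfl

lemma iE_inj (ρ : Representation k Γ V) : Function.Injective (iE ρ) := by
  intro v w h
  have := congrFun h 1
  simpa [iE_apply] using this

lemma iE_eq (ρ : Representation k Γ V) (g : Γ) (v : V) : iE ρ (ρ g v) = coind k Γ V g (iE ρ v) := by
  funext x
  rw [iE_apply, coind_apply, iE_apply, map_mul]; rfl

/-- The cokernel of the embedding. -/
abbrev Sh (ρ : Representation k Γ V) : Type := (Γ → V) ⧸ LinearMap.range (iE ρ)

/-- the quotient rep -/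
def shift (ρ : Representation k Γ V) : Representation k Γ (Sh ρ) :=
  (coind k Γ V).quotient (LinearMap.range (iE ρ)) (by
    rintro g _ ⟨v, rfl⟩
    exact ⟨ρ g v, iE_eq ρ g v⟩)

/-- projection -/
def pE (ρ : Representation k Γ V) : (Γ → V) →ₗ[k] Sh ρ := Submodule.mkQ _

lemma pE_eq (ρ : Representation k Γ V) (g : Γ) (F) : pE ρ (coind k Γ V g F) = shift ρ g (pE ρ F) := rfl

lemma pE_zero (ρ : Representation k Γ V) (F) : pE ρ F = 0 ↔ ∃ v, iE ρ v = F := by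
  rw [pE, Submodule.mkQ_apply, Submodule.Quotient.mk_eq_zero]; rfl

/-- restricted representation -/
abbrev res (α : H →* Γ) (ρ : Representation k Γ V) : Representation k H V := ρ.comp α

lemma shiftSES (α : H →* Γ) (ρ : Representation k Γ V) :
    RSES (gmap (σ := res α ρ) (τ := res α (coind k Γ V)) (MonoidHom.id H) (iE ρ) (fun x v => iE_eq ρ _ v))
     (gmap (σ := res α (coind k Γ V)) (τ := res α (shift ρ)) (MonoidHom.id H) (pE ρ) (fun x v => pE_eq ρ _ v)) :=
  gses _ _ _ _ (iE_inj ρ) (Submodule.mkQ_surjective _) (pE_zero ρ)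

lemma coind_acyclic (K : Subgroup Γ) (n : ℕ) (c : gH (res K.subtype (coind k Γ V)) (n + 1)) : c = 0 := by
  have hx : ∀ x : Γ, ((QuotientGroup.mk x : Γ ⧸ K).out)⁻¹ * x ∈ K := fun x => by
    rw [← QuotientGroup.eq]; exact QuotientGroup.out_eq' _
  refine acyclic (H := K) _ (LinearEquiv.refl k _) (fun (x : Γ) (a : K) => x * (a : Γ)) (by simp) (by simp [mul_assoc])
    (fun x => (⟨((QuotientGroup.mk x : Γ ⧸ K).out)⁻¹ * x, hx x⟩ : K)) ?_ ?_ n c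
  · intro x a
    ext
    have : (QuotientGroup.mk (x * (a : Γ)) : Γ ⧸ K) = QuotientGroup.mk x := by
      rw [QuotientGroup.eq]; simp
    simp [this, mul_assoc]
  · intro h v x; rfl

lemma coind_acyclic' (n : ℕ) (c : gH (coind k Γ V) (n + 1)) : c = 0 := by
  refine acyclic _ (LinearEquiv.refl k _) (fun x a => x * (a : Γ)) (by simp) (by simp [mul_assoc])
    (fun x => x) ?_ ?_ n c
  · intro x a
    rfl
  · intro h v x; rfl

end
end TB

namespace TB

/-- Serre class of modules -/
structure SC (k : Type) [CommRing k] (P : ∀ (M : Type) [AddCommGroup M] [Module k M], Prop) : Prop where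
  zero : ∀ (M : Type) [AddCommGroup M] [Module k M], (∀ x : M, x = 0) → P M
  mid : ∀ (X Y Z : Type) [AddCommGroup X] [Module k X] [AddCommGroup Y] [Module k Y]
    [AddCommGroup Z] [Module k Z] (f : X →ₗ[k] Y) (g : Y →ₗ[k] Z), (∀ y, g y = 0 → ∃ x, f x = y) →
    P X → P Z → P Y

section
variable {k : Type} [CommRing k] {P : ∀ (M : Type) [AddCommGroup M] [Module k M], Prop}

lemma SC.sub (hP : SC k P) {Y Z : Type} [AddCommGroup Y] [Module k Y]
    [AddCommGroup Z] [Module k Z] (g : Y →ₗ[k] Z) (hg : Function.Injective g) (hZ : P Z) : P Y :=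
  hP.mid PUnit Y Z 0 g (fun y hy => ⟨0, by rw [map_zero]; exact (hg (by rw [hy, map_zero])).symm⟩)
    (hP.zero _ (fun _ => rfl)) hZ

lemma SC.quo (hP : SC k P) {X Y : Type} [AddCommGroup Y] [Module k Y]
    [AddCommGroup X] [Module k X] (f : X →ₗ[k] Y) (hf : Function.Surjective f) (hX : P X) : P Y :=
  hP.mid X Y PUnit f 0 (fun y _ => hf y) hX (hP.zero _ (fun _ => rfl))

lemma SC.quot_of (hP : SC k P) {A Y Z : Type} [AddCommGroup Y] [Module k Y] [AddCommGroup A] [Module k A]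
    [AddCommGroup Z] [Module k Z] (f : A →ₗ[k] Z) (q : A →ₗ[k] Y) (hq : Function.Surjective q)
    (h : ∀ a, f a = 0 → q a = 0) (hZ : P Z) : P Y := by
  have h1 : P (A ⧸ LinearMap.ker f) := hP.sub ((LinearMap.ker f).liftQ f le_rfl)
    (LinearMap.ker_eq_bot.1 (Submodule.ker_liftQ_eq_bot _ _ _ le_rfl)) hZ
  refine hP.quo ((LinearMap.ker f).liftQ q (fun a ha => h a ha)) ?_ h1
  intro y
  obtain ⟨a, rfl⟩ := hq y
  exact ⟨Submodule.Quotient.mk a, rfl⟩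

variable {Γ : Type} [Group Γ] {Γ' : Type} [Group Γ']
variable {V : Type} [AddCommGroup V] [Module k V] {V' : Type} [AddCommGroup V'] [Module k V']

lemma SC.congr (hP : SC k P) {τ : Representation k Γ V} {τ' : Representation k Γ V'} (T : V →ₗ[k] V')
    (hT : ∀ g v, T (τ g v) = τ' g (T v)) (hb : Function.Bijective T) (n : ℕ) (h : P (gH τ n)) :
    P (gH τ' n) := by
  let T' := LinearEquiv.ofBijective T hb
  have hT' : ∀ g v, T'.symm (τ' g v) = τ g (T'.symm v) := by
    intro g v
    apply hb.1
    rw [hT]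
    have : ∀ v, T (T'.symm v) = v := fun v => T'.apply_symm_apply v
    rw [this, this]
  refine hP.quo ((gmap (MonoidHom.id Γ) T hT).H n) ?_ h
  intro c
  refine ⟨(gmap (σ := τ') (τ := τ) (MonoidHom.id Γ) T'.symm.toLinearMap hT').H n c, ?_⟩
  refine (gmap_comp _ _ _ _ _ _ (MonoidHom.id Γ) LinearMap.id (fun _ _ => rfl) (fun _ => rfl)
    (fun v => (T'.apply_symm_apply v).symm) _ _).trans ?_
  exact gmap_id _ _ _ (fun _ => rfl) (fun _ => rfl) n c

/-- sub-representation -/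
def srep (τ : Representation k Γ V) (W : Submodule k V) (hW : ∀ g, ∀ v ∈ W, τ g v ∈ W) :
    Representation k Γ W where
  toFun g := (τ g).restrict (hW g)
  map_one' := by ext v; simp
  map_mul' a b := by ext v; simp

lemma srep_apply (τ : Representation k Γ V) (W : Submodule k V) (hW) (g : Γ) (w : W) :
    (srep τ W hW g w : V) = τ g w := rfl

/-- quotient representation -/
def qrep (τ : Representation k Γ V) (W : Submodule k V) (hW : ∀ g, ∀ v ∈ W, τ g v ∈ W) :
    Representation k Γ (V ⧸ W) :=
  τ.quotient W (fun g v hv => hW g v hv)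

lemma qrep_apply (τ : Representation k Γ V) (W : Submodule k V) (hW) (g : Γ) (w : V) :
    qrep τ W hW g (W.mkQ w) = W.mkQ (τ g w) := rfl

lemma subSES (τ : Representation k Γ V) (W : Submodule k V) (hW : ∀ g, ∀ v ∈ W, τ g v ∈ W) :
    RSES (gmap (σ := srep τ W hW) (τ := τ) (MonoidHom.id Γ) W.subtype (fun _ _ => rfl))
     (gmap (σ := τ) (τ := qrep τ W hW) (MonoidHom.id Γ) W.mkQ (fun _ _ => rfl)) :=
  gses _ _ _ _ W.subtype_injective (Submodule.mkQ_surjective _) (fun v => by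
    rw [Submodule.mkQ_apply, Submodule.Quotient.mk_eq_zero]
    exact ⟨fun h => ⟨⟨v, h⟩, rfl⟩, by rintro ⟨w, rfl⟩; exact w.2⟩)

/-- four term exact sequence -/
lemma fourTerm (hP : SC k P) {X1 X2 X3 X4 : Type} [AddCommGroup X1] [Module k X1]
    [AddCommGroup X2] [Module k X2] [AddCommGroup X3] [Module k X3] [AddCommGroup X4] [Module k X4]
    (τ1 : Representation k Γ X1) (τ2 : Representation k Γ X2) (τ3 : Representation k Γ X3)
    (τ4 : Representation k Γ X4) (a : X1 →ₗ[k] X2) (b : X2 →ₗ[k] X3) (c : X3 →ₗ[k] X4)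
    (ha : ∀ g v, a (τ1 g v) = τ2 g (a v)) (hb : ∀ g v, b (τ2 g v) = τ3 g (b v))
    (hc : ∀ g v, c (τ3 g v) = τ4 g (c v)) (ia : Function.Injective a)
    (eb : ∀ v, b v = 0 ↔ ∃ w, a w = v) (ec : ∀ v, c v = 0 ↔ ∃ w, b w = v)
    (sc : Function.Surjective c) (i : ℕ) {Y : Type} [AddCommGroup Y] [Module k Y]
    (q : gH τ3 i →ₗ[k] Y) (sq : Function.Surjective q)
    (hq : ∀ x, q ((gmap (σ := τ2) (τ := τ3) (MonoidHom.id Γ) b hb).H i x) = 0)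
    (h4 : P (gH τ4 i)) (h1 : P (gH τ1 (i + 1))) : P Y := by
  have hW : ∀ g, ∀ v ∈ LinearMap.range b, τ3 g v ∈ LinearMap.range b := by
    rintro g _ ⟨v, rfl⟩; exact ⟨τ2 g v, hb g v⟩
  let τB := srep τ3 (LinearMap.range b) hW
  have S1 := gses (σ := τ1) (τ := τ2) (υ := τB) a b.rangeRestrict ha
    (fun g v => Subtype.ext (hb g v)) ia (LinearMap.surjective_rangeRestrict _) (fun v => by
      rw [← eb v, ← Subtype.coe_inj]; rfl)
  have S2 := gses (σ := τB) (τ := τ3) (υ := τ4) (LinearMap.range b).subtype c (fun _ _ => rfl)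
    hc (Submodule.subtype_injective _) sc (fun v => by
      rw [ec]
      exact ⟨fun ⟨w, h⟩ => ⟨⟨v, w, h⟩, rfl⟩, by rintro ⟨⟨_, w, rfl⟩, rfl⟩; exact ⟨w, rfl⟩⟩)
  let jB := (gmap (σ := τB) (τ := τ3) (MonoidHom.id Γ) (LinearMap.range b).subtype (fun _ _ => rfl)).H i
  have hY' : P (LinearMap.range (q.comp jB)) := by
    refine hP.quot_of (S1.δ i) (q.comp jB).rangeRestrict (LinearMap.surjective_rangeRestrict _) ?_ h1
    intro x hx
    obtain ⟨y, rfl⟩ := S1.exact3 i x hx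
    apply Subtype.ext
    change q (jB _) = 0
    rw [← hq y]
    congr 1
    exact gmap_comp _ _ _ _ _ _ _ _ _ (fun _ => rfl) (fun _ => rfl) _ _
  have hY'' : P (Y ⧸ LinearMap.range (q.comp jB)) := by
    refine hP.quot_of (A := gH τ3 i) ((gmap (σ := τ3) (τ := τ4) (MonoidHom.id Γ) c hc).H i)
      ((LinearMap.range (q.comp jB)).mkQ.comp q) ?_ ?_ h4
    · exact (Submodule.mkQ_surjective _).comp sq
    · intro x hx
      obtain ⟨y, rfl⟩ := S2.exact2 i x hx
      rw [LinearMap.comp_apply, Submodule.mkQ_apply, Submodule.Quotient.mk_eq_zero]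
      exact ⟨y, rfl⟩
  refine hP.mid _ Y _ (LinearMap.range (q.comp jB)).subtype (Submodule.mkQ _) ?_ hY' hY''
  intro y hy
  rw [Submodule.mkQ_apply, Submodule.Quotient.mk_eq_zero] at hy
  exact ⟨⟨y, hy⟩, rfl⟩

/-- descended representation -/
def desc (f : Γ →* Γ') (hf : Function.Surjective f) (W : Representation k Γ V)
    (hW : ∀ x, f x = 1 → W x = 1) : Representation k Γ' V :=
  have key : ∀ a b, f a = f b → W a = W b := by
    intro a b h
    have : W (a * b⁻¹) = 1 := hW _ (by rw [map_mul, map_inv, h, mul_inv_cancel])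
    calc W a = W (a * b⁻¹ * b) := by rw [inv_mul_cancel_right]
      _ = W b := by rw [map_mul, this, one_mul]
  { toFun := fun y => W (Function.surjInv hf y)
    map_one' := by rw [← map_one W]; apply key; rw [Function.surjInv_eq hf, map_one]
    map_mul' := fun a b => by rw [← map_mul]; apply key; rw [map_mul]; simp only [Function.surjInv_eq hf] }

lemma desc_apply (f : Γ →* Γ') (hf : Function.Surjective f) (W : Representation k Γ V)
    (hW : ∀ x, f x = 1 → W x = 1) (g : Γ) : desc f hf W hW (f g) = W g := by
  change W (Function.surjInv hf (f g)) = W g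
  have : W (Function.surjInv hf (f g) * g⁻¹) = 1 := hW _ (by rw [map_mul, map_inv, Function.surjInv_eq hf, mul_inv_cancel])
  calc _ = W (Function.surjInv hf (f g) * g⁻¹ * g) := by rw [inv_mul_cancel_right]
      _ = W g := by rw [map_mul, this, one_mul]

lemma desc_equiv (f : Γ →* Γ') (hf : Function.Surjective f) {W : Representation k Γ V} {W' : Representation k Γ V'}
    (hW : ∀ x, f x = 1 → W x = 1) (hW' : ∀ x, f x = 1 → W' x = 1) (T : V →ₗ[k] V')
    (hT : ∀ g v, T (W g v) = W' g (T v)) (y : Γ') (v : V) :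
    T (desc f hf W hW y v) = desc f hf W' hW' y (T v) := hT _ _

variable (f : Γ →* Γ')

abbrev HK (ρ : Representation k Γ V) (j : ℕ) : Type := gH (res f.ker.subtype ρ) j

lemma conj_compat (ρ : Representation k Γ V) (K : Subgroup Γ) [K.Normal] (g : Γ) (h : K) (v : V) :
    ρ g (res K.subtype ρ h v) = res K.subtype ρ (MulAut.conjNormal g h) (ρ g v) := by
  change ρ g (ρ h v) = ρ _ (ρ g v)
  rw [← Module.End.mul_apply, ← map_mul, ← Module.End.mul_apply, ← map_mul]
  congr 2
  simp [MulAut.conjNormal_apply]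

/-- action of Γ -/
def hrep (ρ : Representation k Γ V) (j : ℕ) : Representation k Γ (HK f ρ j) :=
  HHrep MulAut.conjNormal ρ (res f.ker.subtype ρ) (conj_compat ρ f.ker) j

/-- map on HK -/
abbrev hmap {ρ : Representation k Γ V} {ρ' : Representation k Γ V'} (T : V →ₗ[k] V')
    (hT : ∀ g v, T (ρ g v) = ρ' g (T v)) (j : ℕ) : HK f ρ j →ₗ[k] HK f ρ' j :=
  (gmap (σ := res f.ker.subtype ρ) (τ := res f.ker.subtype ρ') (MonoidHom.id _) T (fun _ _ => hT _ _)).H j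

lemma hmap_eq {ρ : Representation k Γ V} {ρ' : Representation k Γ V'} (T : V →ₗ[k] V')
    (hT : ∀ g v, T (ρ g v) = ρ' g (T v)) (j : ℕ) (g : Γ) (c : HK f ρ j) :
    hmap f T hT j (hrep f ρ j g c) = hrep f ρ' j g (hmap f T hT j c) := by
  rw [hrep, hrep, HHrep_apply, HHrep_apply, hmap]
  rw [gmap_comp (β := (MulAut.conjNormal g⁻¹ : MulAut f.ker).toMonoidHom) (ψ := T.comp (ρ g)) (e1 := fun _ => rfl) (e2 := fun _ => rfl),
    gmap_comp (β := (MulAut.conjNormal g⁻¹ : MulAut f.ker).toMonoidHom) (ψ := T.comp (ρ g)) (e1 := fun _ => rfl) (e2 := fun v => hT g v)]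
  intro x v
  change T (ρ g (ρ _ v)) = ρ' _ (T (ρ g v))
  rw [← hT]
  congr 1
  rw [← Module.End.mul_apply, ← map_mul, ← Module.End.mul_apply, ← map_mul]
  congr 2
  simp [MulAut.conjNormal_apply, mul_assoc]

lemma hdelta_eq (ρ : Representation k Γ V) (j : ℕ) (g : Γ) (c : HK f (shift ρ) j) :
    (shiftSES f.ker.subtype ρ).δ j (hrep f (shift ρ) j g c) =
      hrep f ρ (j + 1) g ((shiftSES f.ker.subtype ρ).δ j c) := by
  symm
  rw [hrep, hrep, HHrep_apply, HHrep_apply]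
  refine (shiftSES f.ker.subtype ρ).δ_nat (shiftSES f.ker.subtype ρ) _
    (gmap (σ := res f.ker.subtype (coind k Γ V)) (τ := res f.ker.subtype (coind k Γ V))
     (MulAut.conjNormal g⁻¹ : MulAut f.ker).toMonoidHom (coind k Γ V g) ?_) _ ?_ ?_ j c
  · intro x v
    rw [conj_compat]; simp
  · intro n x
    funext t
    exact (iE_eq ρ g _).symm
  · intro n x; rfl

lemma hdelta_surj (ρ : Representation k Γ V) (j : ℕ) :
    Function.Surjective ((shiftSES f.ker.subtype ρ).δ j) := fun a =>
  (shiftSES f.ker.subtype ρ).exact1 j a (coind_acyclic _ _ _)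

lemma hdelta_inj (ρ : Representation k Γ V) (j : ℕ) :
    Function.Injective ((shiftSES f.ker.subtype ρ).δ (j + 1)) := by
  rw [injective_iff_map_eq_zero]
  intro c hc
  obtain ⟨b, rfl⟩ := (shiftSES f.ker.subtype ρ).exact3 _ c hc
  rw [coind_acyclic f.ker j b, map_zero]

lemma h0_hrep (ρ : Representation k Γ V) (g : Γ) (c : HK f ρ 0) :
    h0 _ (hrep f ρ 0 g c) = ρ g (h0 _ c) := by
  rw [hrep, HHrep_apply, h0_gmap]

lemma hrep_triv (ρ : Representation k Γ V) (j : ℕ) (x : Γ) (hx : f x = 1) : hrep f ρ j x = 1 := by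
  induction j generalizing V with
  | zero =>
    apply LinearMap.ext; intro c
    apply h0_inj
    rw [h0_hrep]
    exact h0_inv _ c ⟨x, hx⟩
  | succ j ih =>
    apply LinearMap.ext; intro c
    obtain ⟨b, rfl⟩ := hdelta_surj f ρ j c
    rw [← hdelta_eq, ih]; rfl

variable (hf : Function.Surjective f)

/-- action of the quotient on HK -/
def hQ (ρ : Representation k Γ V) (j : ℕ) : Representation k Γ' (HK f ρ j) :=
  desc f hf (hrep f ρ j) (hrep_triv f ρ j)

lemma hQ_apply (ρ : Representation k Γ V) (j : ℕ) (g : Γ) : hQ f hf ρ j (f g) = hrep f ρ j g :=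
  desc_apply _ _ _ _ _

lemma hQ_coind (n : ℕ) (c : gH (hQ f hf (coind k Γ V) 0) (n + 1)) : c = 0 := by
  let e0 : HK f (coind k Γ V) 0 →ₗ[k] (Γ' → V) :=
    { toFun := fun c y => h0 _ c (Function.surjInv hf y)
      map_add' := fun c d => by funext y; rw [map_add]; rfl
      map_smul' := fun r c => by funext y; rw [map_smul]; rfl }
  have he0 : ∀ c x, e0 c (f x) = h0 _ c x := by
    intro c x
    change h0 _ c (Function.surjInv hf (f x)) = _
    have hk : (Function.surjInv hf (f x))⁻¹ * x ∈ f.ker := by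
      rw [MonoidHom.mem_ker, map_mul, map_inv, Function.surjInv_eq hf, inv_mul_cancel]
    have := congrFun (h0_inv _ c ⟨_, hk⟩) (Function.surjInv hf (f x))
    rw [← this]
    change h0 _ c (_ * (_ * x)) = _
    rw [mul_inv_cancel_left]
  have hb : Function.Bijective e0 := by
    constructor
    · intro c d h
      apply h0_inj
      funext x
      rw [← he0, ← he0, h]
    · intro G
      obtain ⟨c, hc⟩ := h0_surj (res f.ker.subtype (coind k Γ V)) (fun x => G (f x)) (by
        rintro ⟨x, hx⟩
        funext y
        change G (f (y * x)) = G (f y)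
        rw [map_mul, hx, mul_one])
      refine ⟨c, ?_⟩
      funext y
      obtain ⟨x, rfl⟩ := hf y
      rw [he0, hc]
  refine acyclic _ (LinearEquiv.ofBijective e0 hb) (fun x a => x * a) (by simp) (by simp [mul_assoc])
    (fun x => x) (fun _ _ => rfl) ?_ n c
  intro h v x
  obtain ⟨g, rfl⟩ := hf h
  obtain ⟨y, rfl⟩ := hf x
  change e0 _ _ = e0 _ _
  rw [← map_mul, he0, he0, hQ_apply, h0_hrep]; rfl

/-- inflation -/
def infl (ρ : Representation k Γ V) : RHom (gc (hQ f hf ρ 0)) (gc ρ) :=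
  gmap f (h0 _) (fun x v => by rw [hQ_apply, h0_hrep])

lemma lhsFour (hP : SC k P) (ρ : Representation k Γ V) (i : ℕ)
    {Y : Type} [AddCommGroup Y] [Module k Y]
    (q : gH (hQ f hf (shift ρ) 0) i →ₗ[k] Y) (sq : Function.Surjective q)
    (hq : ∀ x, q ((gmap (σ := hQ f hf (coind k Γ V) 0) (τ := hQ f hf (shift ρ) 0) (MonoidHom.id Γ') (hmap f (pE ρ) (pE_eq ρ) 0)
          (desc_equiv _ _ _ _ _ (hmap_eq f _ _ 0))).H i x) = 0)
    (h4 : P (gH (hQ f hf ρ 1) i)) (h1 : P (gH (hQ f hf ρ 0) (i + 1))) : P Y := by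
  have S := shiftSES f.ker.subtype ρ
  refine fourTerm hP (hQ f hf ρ 0) (hQ f hf (coind k Γ V) 0) (hQ f hf (shift ρ) 0) (hQ f hf ρ 1)
      (hmap f (iE ρ) (iE_eq ρ) 0) (hmap f (pE ρ) (pE_eq ρ) 0) ((shiftSES f.ker.subtype ρ).δ 0)
      ?_ ?_ ?_ ?_ ?_ ?_ (hdelta_surj f ρ 0) i q sq hq h4 h1
  · exact desc_equiv _ _ _ _ _ (hmap_eq f _ _ 0)
  · exact desc_equiv _ _ _ _ _ (hmap_eq f _ _ 0)
  · exact desc_equiv _ _ _ _ _ (hdelta_eq f ρ 0)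
  · exact (shiftSES f.ker.subtype ρ).inj0
  · exact fun v => ⟨(shiftSES f.ker.subtype ρ).exact2 0 v, by
        rintro ⟨w, rfl⟩; exact (shiftSES f.ker.subtype ρ).exact2' 0 w⟩
  · exact fun v => ⟨(shiftSES f.ker.subtype ρ).exact3 0 v, by
        rintro ⟨w, rfl⟩; exact (shiftSES f.ker.subtype ρ).exact3' 0 w⟩

lemma h0_infl (ρ : Representation k Γ V) (c : gH (hQ f hf ρ 0) 0) :
    h0 ρ ((infl f hf ρ).H 0 c) = h0 (res f.ker.subtype ρ) (h0 (hQ f hf ρ 0) c) := h0_gmap _ _ _ _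

lemma infl_surj (ρ : Representation k Γ V) : Function.Surjective ((infl f hf ρ).H 0) := by
  intro z
  obtain ⟨w, hw⟩ := h0_surj (res f.ker.subtype ρ) (h0 _ z) (fun x => h0_inv ρ z x)
  obtain ⟨c, hc⟩ := h0_surj (hQ f hf ρ 0) w (by
    intro y
    obtain ⟨g, rfl⟩ := hf y
    apply h0_inj
    rw [hQ_apply, h0_hrep, hw]
    exact h0_inv _ z g)
  refine ⟨c, ?_⟩
  apply h0_inj
  rw [h0_infl, hc, hw]

lemma infl_nat {ρ : Representation k Γ V} {ρ' : Representation k Γ V'} (T : V →ₗ[k] V')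
    (hT : ∀ g v, T (ρ g v) = ρ' g (T v)) (x) :
    (infl f hf ρ').H 0 ((gmap (σ := hQ f hf ρ 0) (τ := hQ f hf ρ' 0) (MonoidHom.id Γ') (hmap f T hT 0)
          (desc_equiv _ _ _ _ _ (hmap_eq f _ _ 0))).H 0 x) =
      (gmap (σ := ρ) (τ := ρ') (MonoidHom.id Γ) T hT).H 0 ((infl f hf ρ).H 0 x) := by
  apply h0_inj
  rw [h0_infl]
  refine (congrArg _ (h0_gmap _ _ _ _)).trans ?_
  refine Eq.trans ?_ (h0_gmap _ _ _ _).symm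
  rw [h0_infl]
  exact h0_gmap _ _ _ _

/-- shift SES for ρ itself -/
lemma shiftSES1 (ρ : Representation k Γ V) :
    RSES (gmap (σ := ρ) (τ := coind k Γ V) (MonoidHom.id Γ) (iE ρ) (iE_eq ρ))
      (gmap (σ := coind k Γ V) (τ := shift ρ) (MonoidHom.id Γ) (pE ρ) (pE_eq ρ)) :=
  shiftSES (MonoidHom.id Γ) ρ

lemma shift_surj (ρ : Representation k Γ V) (n : ℕ) : Function.Surjective ((shiftSES1 ρ).δ n) :=
  fun y => (shiftSES1 ρ).exact1 _ y (coind_acyclic' _ _)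

lemma lhs_zero (hP : SC k P) (ρ : Representation k Γ V)
    (h : ∀ i j, (i ≠ 0 ∨ j ≠ 0) → P (gH (hQ f hf ρ j) i)) : P (gH ρ 1) := by
  refine lhsFour f hf hP ρ 0 (((shiftSES1 ρ).δ 0).comp ((infl f hf (shift ρ)).H 0))
    ((shift_surj ρ 0).comp (infl_surj f hf _)) ?_ (h 0 1 (by simp)) (h 1 0 (by simp))
  intro x
  exact (congrArg ((shiftSES1 ρ).δ 0) (infl_nat f hf _ _ x)).trans ((shiftSES1 ρ).exact3' 0 _)

lemma lhs_shift (hP : SC k P) (ρ : Representation k Γ V) (i j : ℕ)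
    (h : P (gH (hQ f hf ρ (j + 2)) i)) : P (gH (hQ f hf (shift ρ) (j + 1)) i) := by
  have hb : Function.Bijective ((shiftSES f.ker.subtype ρ).δ (j + 1)) := ⟨hdelta_inj f ρ j, hdelta_surj f ρ _⟩
  let e := LinearEquiv.ofBijective _ hb
  refine hP.congr (τ := hQ f hf ρ (j + 2)) (τ' := hQ f hf (shift ρ) (j + 1)) e.symm.toLinearMap ?_ e.symm.bijective i h
  intro g v
  apply hb.1
  have h1 : ∀ v, (shiftSES f.ker.subtype ρ).δ (j + 1) (e.symm v) = v := e.apply_symm_apply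
  have h2 := desc_equiv f hf (hrep_triv f (shift ρ) (j + 1)) (hrep_triv f ρ (j + 2)) _ (hdelta_eq f ρ (j + 1)) g (e.symm v)
  refine (h1 _).trans ?_
  refine Eq.trans ?_ h2.symm
  rw [h1]; rfl

/-- Hochschild–Serre for Serre classes. -/
theorem LHS (hP : SC k P) (ρ : Representation k Γ V)
    (h : ∀ i j, (i ≠ 0 ∨ j ≠ 0) → P (gH (hQ f hf ρ j) i)) (n : ℕ) : P (gH ρ (n + 1)) := by
  induction n generalizing V with
  | zero => exact lhs_zero f hf hP ρ h
  | succ n ih =>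
    refine hP.quo ((shiftSES1 ρ).δ (n + 1)) (shift_surj ρ (n + 1)) (ih (shift ρ) ?_)
    intro i j hij
    rcases j with _ | j
    · obtain ⟨i, rfl⟩ : ∃ i', i = i' + 1 := ⟨i - 1, by omega⟩
      refine lhsFour f hf hP ρ (i + 1)
        LinearMap.id (fun x => ⟨x, rfl⟩) ?_ (h _ 1 (by simp)) (h _ 0 (by simp))
      intro x
      have hx : x = 0 := hQ_coind f hf i x
      rw [hx]
      exact map_zero _
    · exact lhs_shift f hf hP ρ i j (h _ _ (by simp))

end
end TB

namespace TB

section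
variable {k : Type} [CommRing k] {Γ : Type} [Group Γ]
variable {V : Type} [AddCommGroup V] [Module k V] {V' : Type} [AddCommGroup V'] [Module k V']

lemma comm_eq (ρ : Representation k Γ V) (κ : Γ) (hκ : ∀ x, κ * x = x * κ) (x : Γ) (v : V) :
    ρ κ (ρ x v) = ρ x (ρ κ v) := by
  rw [← Module.End.mul_apply, ← map_mul, hκ, map_mul]; rfl

/-- A central element acts trivially on cohomology. -/
lemma central_triv (ρ : Representation k Γ V) (κ : Γ) (hκ : ∀ x, κ * x = x * κ) (n : ℕ) (c : gH ρ n) :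
    (gmap (σ := ρ) (τ := ρ) (MonoidHom.id Γ) (ρ κ) (fun x v => comm_eq ρ κ hκ x v)).H n c = c := by
  induction n generalizing V with
  | zero =>
    apply h0_inj
    rw [h0_gmap]
    exact h0_inv _ _ _
  | succ n ih =>
    obtain ⟨b, rfl⟩ := shift_surj ρ n c
    conv_rhs => rw [← ih (shift ρ) b]
    refine (shiftSES1 ρ).δ_nat (shiftSES1 ρ) _
      (gmap (σ := coind k Γ V) (τ := coind k Γ V) (MonoidHom.id Γ) (coind k Γ V κ) (fun x v => comm_eq _ κ hκ x v))
      _ ?_ ?_ n b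
    · intro m x
      funext t
      exact (iE_eq ρ κ _).symm
    · intro m x
      rfl

/-- functoriality: composite of coefficient maps through something acyclic -/
lemma kill_of_factor {σ : Representation k Γ V} {τ : Representation k Γ V'} (i : V →ₗ[k] V') (q : V' →ₗ[k] V)
    (hi : ∀ x v, i (σ x v) = τ x (i v)) (hq : ∀ x v, q (τ x v) = σ x (q v)) (r : k) (h : ∀ v, q (i v) = r • v)
    (n : ℕ) (c : gH σ n) (hc : (gmap (σ := σ) (τ := τ) (MonoidHom.id Γ) i hi).H n c = 0) : r • c = 0 := by
  have e : (gmap (σ := τ) (τ := σ) (MonoidHom.id Γ) q hq).H n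
      ((gmap (σ := σ) (τ := τ) (MonoidHom.id Γ) i hi).H n c) = r • c := by
    obtain ⟨F, hF, rfl⟩ := gcl_surj _ _ c
    rw [gmap_cl, gmap_cl, gcl_smul]
    apply gcl_congr
    funext t
    exact h _
  rw [← e, hc, map_zero]

lemma finite_kill [Fintype Γ] (ρ : Representation k Γ V) (n : ℕ) (c : gH ρ (n + 1)) :
    (Fintype.card Γ : k) • c = 0 := by
  let q : (Γ → V) →ₗ[k] V := ∑ x : Γ, (ρ x⁻¹).comp (LinearMap.proj x)
  have hq : ∀ F, q F = ∑ x : Γ, ρ x⁻¹ (F x) := fun F => by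
    simp only [q, LinearMap.sum_apply]; rfl
  refine kill_of_factor (τ := coind k Γ V) (iE ρ) q (iE_eq ρ) ?_ _ ?_ (n + 1) c (coind_acyclic' n _)
  · intro g F
    rw [hq, hq, map_sum]
    rw [← Equiv.sum_comp (Equiv.mulRight g) (fun x => ρ g (ρ x⁻¹ (F x)))]
    apply Finset.sum_congr rfl
    intro x _
    rw [coind_apply, ← Module.End.mul_apply, ← map_mul]
    simp
  · intro v
    rw [hq]
    have : ∀ x, ρ x⁻¹ (iE ρ v x) = v := fun x => by
      rw [iE_apply, ← Module.End.mul_apply, ← map_mul]; simp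
    simp [this, Finset.card_univ, Nat.cast_smul_eq_nsmul]

/-! ### Solving linear systems -/

/-- finitely supported linear map -/
def FS {I : Type} (Φ : (I → V) →ₗ[k] V) : Prop := ∃ s : Finset I, ∀ F, (∀ i ∈ s, F i = 0) → Φ F = 0

variable (k V) in
/-- linear compactness in the sense of solvability of systems -/
def LS : Prop := ∀ (I J : Type) (Φ : J → ((I → V) →ₗ[k] V)) (y : J → V), (∀ j, FS (Φ j)) →
  (∀ T : Finset J, ∃ F, ∀ j ∈ T, Φ j F = y j) → ∃ F, ∀ j, Φ j F = y j

lemma FS_proj {I : Type} (i : I) : FS (LinearMap.proj i : (I → V) →ₗ[k] V) :=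
  ⟨{i}, fun F h => h i (by simp)⟩

lemma FS_comp {I : Type} (Φ : (I → V) →ₗ[k] V) (h : FS Φ) (a : V →ₗ[k] V) : FS (a.comp Φ) := by
  obtain ⟨s, hs⟩ := h
  exact ⟨s, fun F hF => by rw [LinearMap.comp_apply, hs F hF, map_zero]⟩

lemma FS_add {I : Type} {Φ Ψ : (I → V) →ₗ[k] V} (h : FS Φ) (h' : FS Ψ) : FS (Φ + Ψ) := by
  classical
  obtain ⟨s, hs⟩ := h
  obtain ⟨s', hs'⟩ := h'
  refine ⟨s ∪ s', fun F hF => ?_⟩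
  rw [LinearMap.add_apply, hs F (fun i hi => hF i (by simp [hi])), hs' F (fun i hi => hF i (by simp [hi])), add_zero]

lemma FS_sub {I : Type} {Φ Ψ : (I → V) →ₗ[k] V} (h : FS Φ) (h' : FS Ψ) : FS (Φ - Ψ) := by
  classical
  obtain ⟨s, hs⟩ := h
  obtain ⟨s', hs'⟩ := h'
  refine ⟨s ∪ s', fun F hF => ?_⟩
  rw [LinearMap.sub_apply, hs F (fun i hi => hF i (by simp [hi])), hs' F (fun i hi => hF i (by simp [hi])), sub_zero]

/-- the value of `dp` only depends on finitely many values -/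
lemma dp_FS (n : ℕ) (t : Fin (n + 1) → Γ) : ∃ s : Finset (Fin n → Γ), ∀ F : (Fin n → Γ) → V,
    (∀ i ∈ s, F i = 0) → dp n F t = 0 := by
  classical
  induction n with
  | zero => exact ⟨{Fin.tail t}, fun F h => by rw [dp_zero, h _ (by simp), neg_zero]⟩
  | succ n ih =>
    induction t using Fin.consCases with
    | cons a t =>
    obtain ⟨s, hs⟩ := ih t
    refine ⟨insert (Fin.cons (a * t 0) (Fin.tail t)) (s.image (fun u => Fin.cons a u)), fun F h => ?_⟩
    rw [dp_cons, h _ (by simp), hs _ (fun i hi => h _ (by simp [hi]))]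
    simp

lemma dfun_FS (ρ : Representation k Γ V) (n : ℕ) (t : Fin (n + 1) → Γ) :
    FS (((LinearMap.proj t : ((Fin (n + 1) → Γ) → V) →ₗ[k] V)).comp ((gc ρ).d n)) := by
  classical
  obtain ⟨s, hs⟩ := dp_FS (V := V) n t
  refine ⟨insert (Fin.tail t) s, fun F h => ?_⟩
  change dfun ρ n F t = 0
  rw [dfun, h _ (by simp), hs F (fun i hi => h i (by simp [hi])), map_zero, add_zero]

/-- restriction to a subgroup -/
abbrev rst (ρ : Representation k Γ V) (Q : Subgroup Γ) (n : ℕ) : gH ρ n →ₗ[k] gH (res Q.subtype ρ) n :=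
  (gmap (σ := ρ) (τ := res Q.subtype ρ) Q.subtype LinearMap.id (fun _ _ => rfl)).H n

lemma local_zero (hV : LS k V) (ρ : Representation k Γ V) (n : ℕ) (c : gH ρ (n + 1))
    (h : ∀ T : Finset Γ, rst ρ (Subgroup.closure (T : Set Γ)) (n + 1) c = 0) : c = 0 := by
  classical
  obtain ⟨F, hF, rfl⟩ := gcl_surj _ _ c
  rw [gcl_succ]
  obtain ⟨s, hs⟩ := hV (Fin n → Γ) (Fin (n + 1) → Γ)
    (fun t => ((LinearMap.proj t : ((Fin (n + 1) → Γ) → V) →ₗ[k] V)).comp ((gc ρ).d n)) F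
    (fun t => dfun_FS ρ n t) (by
      intro T
      let T' : Finset Γ := T.biUnion (fun t => Finset.univ.image t)
      let Q := Subgroup.closure (T' : Set Γ)
      obtain ⟨s, hs⟩ := (gcl_succ _ _ _ _).1 (h T')
      have hex : ∀ x : Γ, ∃ y : Q, x ∈ Q → (y : Γ) = x := fun x => by
        by_cases hx : x ∈ Q
        · exact ⟨⟨x, hx⟩, fun _ => rfl⟩
        · exact ⟨1, fun h => absurd h hx⟩
      let s' : (Fin n → Γ) → V := fun t => if ht : ∀ i, t i ∈ Q then s (fun i => ⟨t i, ht i⟩) else 0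
      have hs' : s = fun t => LinearMap.id (R := k) (s' (Q.subtype ∘ t)) := by
        funext t
        simp only [s', LinearMap.id_apply]
        have hh : ∀ i, (Q.subtype ∘ t) i ∈ Q := fun i => (t i).2
        rw [dif_pos hh]
        rfl
      refine ⟨s', ?_⟩
      intro t ht
      change dfun ρ n s' t = F t
      have htQ : ∀ i, t i ∈ Q := fun i => Subgroup.subset_closure (by
        simp only [T', Finset.coe_biUnion, Set.mem_iUnion]
        exact ⟨t, ht, by simp⟩)
      have e := congrFun hs (fun i => ⟨t i, htQ i⟩)
      rw [hs', ← dfun_map (σ := ρ) (τ := res Q.subtype ρ) Q.subtype LinearMap.id (fun _ _ => rfl)] at e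
      exact e)
  exact ⟨s, funext hs⟩

lemma rst_mono (ρ : Representation k Γ V) {Q Q' : Subgroup Γ} (h : Q ≤ Q') (n : ℕ) (c : gH ρ n)
    (hc : rst ρ Q' n c = 0) : rst ρ Q n c = 0 := by
  have := gmap_comp (σ := ρ) (σ' := res Q'.subtype ρ) (σ'' := res Q.subtype ρ) Q'.subtype LinearMap.id (fun _ _ => rfl)
    (Subgroup.inclusion h) LinearMap.id (fun _ _ => rfl) Q.subtype LinearMap.id (fun _ _ => rfl) (fun _ => rfl)
    (fun _ => rfl) n c
  rw [← this]
  exact (congrArg _ hc).trans (map_zero _)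

end
end TB

namespace TB

section
variable {k : Type} [CommRing k] 
variable {V : Type} [AddCommGroup V] [Module k V] {V' : Type} [AddCommGroup V'] [Module k V']

lemma FS_sum {I : Type} [DecidableEq I] (Φ : (I → V) →ₗ[k] V) (s : Finset I) (hs : ∀ F, (∀ i ∈ s, F i = 0) → Φ F = 0)
    (F : I → V) : Φ F = ∑ i ∈ s, Φ (LinearMap.single k (fun _ : I => V) i (F i)) := by
  rw [← map_sum, ← sub_eq_zero, ← map_sub]
  apply hs
  intro i hi
  rw [Pi.sub_apply, Finset.sum_apply, sub_eq_zero]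
  rw [Finset.sum_eq_single i]
  · simp
  · intro j _ hj
    simp [Pi.single_apply, hj.symm]
  · exact fun h => absurd hi h

lemma LS_top [TopologicalSpace V] [CompactSpace V] [T2Space V] [ContinuousAdd V]
    (hc : ∀ a : V →ₗ[k] V, Continuous a) : LS k V := by
  classical
  intro I J Φ y hΦ hfin
  have hcl : ∀ j, IsClosed {F : I → V | Φ j F = y j} := by
    intro j
    obtain ⟨s, hs⟩ := hΦ j
    have : Continuous (Φ j) := by
      have e : (Φ j : (I → V) → V) = fun F => ∑ i ∈ s, Φ j (LinearMap.single k (fun _ : I => V) i (F i)) := by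
        funext F; exact FS_sum _ s hs F
      rw [e]
      refine continuous_finsetSum _ (fun i _ => ?_)
      exact (hc ((Φ j).comp (LinearMap.single k (fun _ : I => V) i))).comp (continuous_apply i)
    exact isClosed_eq this continuous_const
  obtain ⟨F, -, hF⟩ := isCompact_univ.inter_iInter_nonempty _ hcl (by
    intro T
    obtain ⟨F, hF⟩ := hfin T
    exact ⟨F, trivial, by simpa using hF⟩)
  exact ⟨F, fun j => by simpa using Set.mem_iInter.1 hF j⟩

lemma LS_finite [Finite V] : LS k V := by
  letI : TopologicalSpace V := ⊥
  haveI : DiscreteTopology V := ⟨rfl⟩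
  exact LS_top (fun a => continuous_of_discreteTopology)

lemma LS_equiv (e : V ≃ₗ[k] V') (h : LS k V) : LS k V' := by
  intro I J Φ y hΦ hfin
  let E : (I → V) →ₗ[k] (I → V') := LinearMap.pi (fun i => e.toLinearMap.comp (LinearMap.proj i))
  let E' : (I → V') →ₗ[k] (I → V) := LinearMap.pi (fun i => e.symm.toLinearMap.comp (LinearMap.proj i))
  have hE : ∀ F i, E F i = e (F i) := fun _ _ => rfl
  have hE' : ∀ F, E (E' F) = F := fun F => by funext i; exact e.apply_symm_apply _
  obtain ⟨F, hF⟩ := h I J (fun j => (e.symm.toLinearMap.comp (Φ j)).comp E) (fun j => e.symm (y j)) (by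
    intro j
    obtain ⟨s, hs⟩ := hΦ j
    refine ⟨s, fun F hF => ?_⟩
    simp only [LinearMap.comp_apply]
    rw [hs _ (fun i hi => by rw [hE, hF i hi, map_zero]), map_zero]) (by
    intro T
    obtain ⟨F, hF⟩ := hfin T
    refine ⟨E' F, fun j hj => ?_⟩
    simp only [LinearMap.comp_apply]
    rw [hE', hF j hj]; rfl)
  refine ⟨E F, fun j => e.symm.injective (hF j)⟩

lemma LS_padic (p : ℕ) [Fact p.Prime] (n : ℕ) : LS ℤ_[p] (Fin n → ℤ_[p]) :=
  LS_top (fun a => LinearMap.continuous_on_pi a)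

end

lemma dual_factor {k : Type} [Field k] {M N : Type} [AddCommGroup M] [Module k M] [AddCommGroup N] [Module k N]
    (Ψ : M →ₗ[k] N) (Y : M →ₗ[k] k) (h : ∀ m, Ψ m = 0 → Y m = 0) : ∃ u : N →ₗ[k] k, ∀ m, u (Ψ m) = Y m := by
  obtain ⟨u, hu⟩ := (LinearMap.range_dualMap_eq_dualAnnihilator_ker Ψ).ge ((Submodule.mem_dualAnnihilator Y).2 (fun m hm => h m hm))
  exact ⟨u, fun m => LinearMap.congr_fun hu m⟩

lemma LS_field {k : Type} [Field k] {V : Type} [AddCommGroup V] [Module k V] [Module.Finite k V] : LS k V := by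
  classical
  intro I J Φ y hΦ hfin
  let Ψ : (J →₀ Module.Dual k V) →ₗ[k] Module.Dual k (I → V) :=
    Finsupp.lsum k (fun j => (Φ j).dualMap)
  let Y : (J →₀ Module.Dual k V) →ₗ[k] k := Finsupp.lsum k (fun j => Module.Dual.eval k V (y j))
  have key : ∀ m, Ψ m = 0 → Y m = 0 := by
    intro m hm
    obtain ⟨F, hF⟩ := hfin m.support
    have h1 : Ψ m F = 0 := by rw [hm]; rfl
    rw [← h1]
    simp only [Y, Ψ, Finsupp.lsum_apply, Finsupp.sum, LinearMap.sum_apply]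
    apply Finset.sum_congr rfl
    intro j hj
    rw [LinearMap.dualMap_apply, hF j hj]; rfl
  obtain ⟨u, hu⟩ := dual_factor (k := k) (M := J →₀ Module.Dual k V) (N := Module.Dual k (I → V)) Ψ Y key
  let F : I → V := fun i => (Module.evalEquiv k V).symm (u.comp ((LinearMap.proj i : (I → V) →ₗ[k] V).dualMap))
  have hF : ∀ i (f : Module.Dual k V), f (F i) = u (f.comp (LinearMap.proj i)) := by
    intro i f
    have := (Module.evalEquiv k V).apply_symm_apply (u.comp ((LinearMap.proj i : (I → V) →ₗ[k] V).dualMap))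
    have h2 := LinearMap.congr_fun this f
    exact h2
  refine ⟨F, fun j => ?_⟩
  rw [← sub_eq_zero, ← Module.forall_dual_apply_eq_zero_iff k]
  intro f
  rw [map_sub, sub_eq_zero]
  have h1 : u (f.comp (Φ j)) = f (y j) := by
    have := hu (Finsupp.single j f)
    simp only [Ψ, Y, Finsupp.lsum_single] at this
    exact this
  rw [← h1]
  obtain ⟨s, hs⟩ := hΦ j
  rw [FS_sum _ s hs]
  have h3 : f.comp (Φ j) = ∑ i ∈ s, ((f.comp (Φ j)).comp (LinearMap.single k (fun _ : I => V) i)).comp (LinearMap.proj i) := by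
    apply LinearMap.ext
    intro F
    rw [LinearMap.comp_apply, FS_sum _ s hs, map_sum, LinearMap.sum_apply]
    rfl
  rw [h3, map_sum, map_sum]
  apply Finset.sum_congr rfl
  intro i _
  rw [← hF]; rfl

end TB

namespace TB

section iota
variable {k : Type} [CommRing k] {H : Type} [Group H] {V : Type} [AddCommGroup V] [Module k V]
variable {H' : Type} [Group H'] {V' : Type} [AddCommGroup V'] [Module k V']

def iota (z : H) : ∀ n : ℕ, ((Fin (n + 1) → H) → V) → ((Fin n → H) → V)
  | 0, F, t => F (Fin.cons z t)
  | n + 1, F, t => F (Fin.cons z t) - iota z n (fun s => F (Fin.cons (t 0) s)) (Fin.tail t)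

lemma iota_zero (z : H) (F : (Fin 1 → H) → V) (t : Fin 0 → H) : iota z 0 F t = F (Fin.cons z t) := rfl

lemma iota_cons (z : H) (n : ℕ) (F : (Fin (n + 2) → H) → V) (a : H) (t : Fin n → H) :
    iota z (n + 1) F (Fin.cons a t : Fin (n + 1) → H) =
      F (Fin.cons z (Fin.cons a t : Fin (n + 1) → H)) - iota z n (fun s => F (Fin.cons a s)) t := rfl

lemma iota_add (z : H) (n : ℕ) (F G : (Fin (n + 1) → H) → V) (t : Fin n → H) :
    iota z n (fun s => F s + G s) t = iota z n F t + iota z n G t := by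
  induction n with
  | zero => rfl
  | succ n ih =>
    refine Fin.consCases (fun a t => ?_) t
    rw [iota_cons, iota_cons, iota_cons, ih]; abel

lemma iota_lin (z : H) (φ : V →ₗ[k] V') (n : ℕ) (F : (Fin (n + 1) → H) → V) (t : Fin n → H) :
    iota z n (fun s => φ (F s)) t = φ (iota z n F t) := by
  induction n with
  | zero => rfl
  | succ n ih =>
    refine Fin.consCases (fun a t => ?_) t
    rw [iota_cons, iota_cons, ih, map_sub]

lemma iota_neg (z : H) (n : ℕ) (F : (Fin (n + 1) → H) → V) (t : Fin n → H) :
    iota z n (fun s => - F s) t = - iota z n F t :=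
  iota_lin (k := ℤ) z (-LinearMap.id) n F t

lemma iota_sub (z : H) (n : ℕ) (F G : (Fin (n + 1) → H) → V) (t : Fin n → H) :
    iota z n (fun s => F s - G s) t = iota z n F t - iota z n G t := by
  simp only [sub_eq_add_neg]
  rw [iota_add, iota_neg]

lemma iota_map (α : H' →* H) (z : H') (n : ℕ) (F : (Fin (n + 1) → H) → V) (t : Fin n → H') :
    iota z n (fun s => F (α ∘ s)) t = iota (α z) n F (α ∘ t) := by
  induction n with
  | zero =>
    rw [iota_zero, iota_zero]; congr 1; ext i
    refine Fin.cases rfl (fun i => i.elim0) i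
  | succ n ih =>
    refine Fin.consCases (fun a t => ?_) t
    have e : ∀ (m : ℕ) (b : H') (s : Fin m → H'), α ∘ (Fin.cons b s : Fin (m + 1) → H') =
        Fin.cons (α b) (α ∘ s) := by
      intro m b s; ext i; refine Fin.cases rfl (fun i => rfl) i
    rw [e, iota_cons, iota_cons, e, e]
    simp only [e]
    rw [ih (fun s => F (Fin.cons (α a) s))]

lemma dp_sub' (n : ℕ) (F G : (Fin n → H) → V) (t : Fin (n + 1) → H) :
    dp n (fun s => F s - G s) t = dp n F t - dp n G t := by
  induction n with
  | zero => rw [dp_zero, dp_zero, dp_zero]; abel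
  | succ n ih =>
    refine Fin.consCases (fun a t => ?_) t
    rw [dp_cons, dp_cons, dp_cons, ih]; abel

lemma iota_dp (z : H) (hz : ∀ x, z * x = x * z) (n : ℕ) (F : (Fin (n + 1) → H) → V) (t : Fin (n + 1) → H) :
    dp n (iota z n F) t + iota z (n + 1) (dp (n + 1) F) t = - F t := by
  induction n with
  | zero =>
    refine Fin.consCases (fun a t => ?_) t
    rw [iota_cons, dp_cons, dp_zero, iota_zero, iota_zero, dp_cons, dp_zero, dp_zero]
    simp only [Fin.tail_cons, Fin.cons_zero]
    rw [hz a]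
    abel
  | succ n ih =>
    refine Fin.consCases (fun a t => ?_) t
    refine Fin.consCases (fun b t => ?_) t
    have h1 : dp (n + 1) (iota z (n + 1) F) (Fin.cons a (Fin.cons b t : Fin (n + 1) → H) : Fin (n + 2) → H) =
      - F (Fin.cons z (Fin.cons (a * b) t : Fin (n + 1) → H)) + iota z n (fun s => F (Fin.cons (a * b) s)) t
      - dp n (fun s => F (Fin.cons z (Fin.cons a s : Fin (n + 1) → H))) (Fin.cons b t : Fin (n + 1) → H)
      + dp n (iota z n (fun s => F (Fin.cons a s))) (Fin.cons b t : Fin (n + 1) → H) := by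
      rw [dp_cons]
      simp only [Fin.tail_cons, Fin.cons_zero]
      rw [iota_cons]
      have : (fun s => iota z (n + 1) F (Fin.cons a s : Fin (n + 1) → H)) =
        fun s => F (Fin.cons z (Fin.cons a s : Fin (n + 1) → H)) - iota z n (fun s => F (Fin.cons a s)) s := by
        funext s; rw [iota_cons]
      rw [this]
      rw [dp_sub']; abel
    rw [h1, iota_cons, dp_cons, dp_cons]
    have h5 : (fun s => dp (n + 2) F (Fin.cons a s : Fin (n + 3) → H)) =
      fun s : Fin (n + 2) → H => (- F (Fin.cons (a * s 0) (Fin.tail s))) - dp (n + 1) (fun s => F (Fin.cons a s)) s := by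
      funext s; rw [dp_cons]
    rw [h5, iota_sub, iota_neg z (n + 1) (fun s : Fin (n + 2) → H => F (Fin.cons (a * s 0) (Fin.tail s)))]
    have ih' := ih (fun s => F (Fin.cons a s)) (Fin.cons b t)
    rw [iota_cons z n (fun s : Fin (n + 2) → H => F (Fin.cons (a * s 0) (Fin.tail s)))]
    simp only [Fin.tail_cons, Fin.cons_zero] at ih' ⊢
    rw [hz a, ← ih']
    abel

lemma iota_anti (z w : H) (n : ℕ) (F : (Fin (n + 2) → H) → V) (t : Fin n → H) :
    iota w n (iota z (n + 1) F) t + iota z n (iota w (n + 1) F) t = 0 := by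
  induction n with
  | zero =>
    rw [iota_zero, iota_zero, iota_cons, iota_cons, iota_zero, iota_zero]; abel
  | succ n ih =>
    refine Fin.consCases (fun a t => ?_) t
    have e : ∀ z w : H, iota w (n + 1) (iota z (n + 2) F) (Fin.cons a t : Fin (n + 1) → H) =
      F (Fin.cons z (Fin.cons w (Fin.cons a t : Fin (n + 1) → H) : Fin (n + 2) → H)) -
      F (Fin.cons w (Fin.cons z (Fin.cons a t : Fin (n + 1) → H) : Fin (n + 2) → H)) +
      iota z n (fun s => F (Fin.cons w (Fin.cons a s : Fin (n + 2) → H))) t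
      - iota w n (fun s => F (Fin.cons z (Fin.cons a s : Fin (n + 2) → H))) t
      + iota w n (iota z (n + 1) (fun s => F (Fin.cons a s))) t := by
      intro z w
      rw [iota_cons, iota_cons, iota_cons]
      have : (fun s => iota z (n + 2) F (Fin.cons a s : Fin (n + 2) → H)) =
        fun s => F (Fin.cons z (Fin.cons a s : Fin (n + 2) → H)) - iota z (n + 1) (fun s => F (Fin.cons a s)) s := by
        funext s; rw [iota_cons]
      rw [this, iota_sub]; abel
    have := ih (fun s => F (Fin.cons a s)) t
    rw [e, e, ← this]
    abel

end iota
end TB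

namespace TB

section iotaH
variable {k : Type} [CommRing k] {H : Type} [Group H] {V : Type} [AddCommGroup V] [Module k V]
variable {H' : Type} [Group H'] {V' : Type} [AddCommGroup V'] [Module k V']

lemma iota_dfun (σ : Representation k H V) (z : H) (hz : ∀ x, z * x = x * z) (n : ℕ)
    (F : (Fin (n + 1) → H) → V) (t : Fin (n + 1) → H) :
    dfun σ n (iota z n F) t + iota z (n + 1) (dfun σ (n + 1) F) t = σ z (F t) - F t := by
  have h := iota_dp z hz n F t
  revert h
  refine Fin.consCases (fun a t => ?_) t
  intro h
  rw [dfun_cons, iota_cons, dfun_cons]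
  rw [iota_cons] at h
  have e : (fun s => dfun σ (n + 1) F (Fin.cons a s : Fin (n + 2) → H)) =
    fun s => σ a (F s) + dp (n + 1) F (Fin.cons a s : Fin (n + 2) → H) := by funext s; rfl
  rw [e, iota_add, iota_lin (k := k) z (σ a), sub_eq_add_neg (σ z (F _)), ← h]
  abel

lemma iota_dfun0 (σ : Representation k H V) (z : H) (F : (Fin 0 → H) → V) (t : Fin 0 → H) :
    iota z 0 (dfun σ 0 F) t = σ z (F t) - F t := by
  rw [iota_zero, dfun_cons, dp_zero, sub_eq_add_neg]; rfl

lemma iota_Z (σ : Representation k H V) (hσ : ∀ x v, σ x v = v) (z : H) (hz : ∀ x, z * x = x * z) (n : ℕ)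
    (F : (Fin (n + 1) → H) → V) (hF : dfun σ (n + 1) F = 0) : dfun σ n (iota z n F) = 0 := by
  funext t
  have h := iota_dfun σ z hz n F t
  rw [hF, hσ, sub_self] at h
  have h0 : iota z (n + 1) (0 : (Fin (n + 2) → H) → V) t = 0 := by
    have := iota_lin (k := ℤ) z (0 : V →ₗ[ℤ] V) (n + 1) 0 t
    exact this
  rw [h0, add_zero] at h
  exact h

/-- The contraction as a map on cochains. -/
def iotaL (k : Type) [CommRing k] [Module k V] (z : H) (n : ℕ) : ((Fin (n + 1) → H) → V) →ₗ[k] ((Fin n → H) → V) where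
  toFun := iota z n
  map_add' F G := by funext t; exact iota_add z n F G t
  map_smul' r F := by funext t; exact iota_lin (k := k) z (LinearMap.lsmul k V r) n F t

def iotaH (σ : Representation k H V) (hσ : ∀ x v, σ x v = v) (z : H) (hz : ∀ x, z * x = x * z) (n : ℕ) :
    gH σ (n + 1) →ₗ[k] gH σ n :=
  Submodule.mapQ _ _ ((iotaL k z n).restrict (p := (gc σ).Z (n + 1)) (q := (gc σ).Z n)
    (fun x hx => iota_Z σ hσ z hz n x hx)) (by
    rintro ⟨x, hx⟩ ⟨s, hs⟩
    have hs' : dfun σ n s = x := hs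
    cases n with
    | zero =>
      change iota z 0 x = 0
      funext t
      rw [← hs']
      refine (iota_dfun0 σ z s t).trans ?_
      rw [hσ, sub_self]; rfl
    | succ n =>
      refine ⟨- iota z n s, ?_⟩
      change dfun σ n (- iota z n s) = iota z (n + 1) x
      rw [dfun_neg, ← hs']
      funext t
      have h := iota_dfun σ z hz n s t
      rw [hσ, sub_self] at h
      rw [Pi.neg_apply]
      exact neg_eq_of_add_eq_zero_right h)

lemma iotaH_cl (σ : Representation k H V) (hσ : ∀ x v, σ x v = v) (z : H) (hz : ∀ x, z * x = x * z) (n : ℕ)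
    (F : (Fin (n + 1) → H) → V) (hF : dfun σ (n + 1) F = 0) :
    iotaH σ hσ z hz n (gcl σ (n + 1) F hF) = gcl σ n (iota z n F) (iota_Z σ hσ z hz n F hF) := rfl

lemma iotaH_anti (σ : Representation k H V) (hσ : ∀ x v, σ x v = v) (z : H) (hz : ∀ x, z * x = x * z)
    (w : H) (hw : ∀ x, w * x = x * w) (n : ℕ) (c : gH σ (n + 2)) :
    iotaH σ hσ w hw n (iotaH σ hσ z hz (n + 1) c) = - iotaH σ hσ z hz n (iotaH σ hσ w hw (n + 1) c) := by
  obtain ⟨F, hF, rfl⟩ := gcl_surj σ _ c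
  rw [← add_eq_zero_iff_eq_neg, iotaH_cl, iotaH_cl, iotaH_cl, iotaH_cl, gcl_add]
  refine (gcl_congr σ n _ 0 _ ?_).trans ?_
  · funext t; exact iota_anti z w n F t
  · exact (gcl_smul σ n 0 0 (dfun_map_zero σ n)).symm.trans (zero_smul _ _) |> fun h => by
      refine Eq.trans ?_ h
      congr 1
      rw [zero_smul]

lemma iotaH_gmap {σ : Representation k H V} {τ : Representation k H' V'} (hσ : ∀ x v, σ x v = v)
    (hτ : ∀ x v, τ x v = v) (α : H' →* H) (φ : V →ₗ[k] V')
    (h : ∀ x v, φ (σ (α x) v) = τ x (φ v)) (z : H') (hz : ∀ x, z * x = x * z)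
    (hz' : ∀ x, α z * x = x * α z) (n : ℕ) (c : gH σ (n + 1)) :
    iotaH τ hτ z hz n ((gmap α φ h).H (n + 1) c) = (gmap α φ h).H n (iotaH σ hσ (α z) hz' n c) := by
  obtain ⟨F, hF, rfl⟩ := gcl_surj σ _ c
  rw [gmap_cl, iotaH_cl, iotaH_cl, gmap_cl]
  refine gcl_congr τ n _ _ _ ?_
  funext t
  rw [iota_lin z φ n (fun s => F (α ∘ s)), iota_map]

end iotaH

section wang
variable {k : Type} [CommRing k] {L : Type} [Group L] {V : Type} [AddCommGroup V] [Module k V]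
variable {V' : Type} [AddCommGroup V'] [Module k V']

def EZ (f : L →* Multiplicative ℤ) (ρ : Representation k L V) : Representation k L (ℤ → V) where
  toFun l :=
    { toFun := fun φ n => ρ l (φ (n + (f l).toAdd))
      map_add' := fun _ _ => by funext n; simp
      map_smul' := fun _ _ => by funext n; simp }
  map_one' := by ext; simp
  map_mul' a b := by
    apply LinearMap.ext; intro φ; funext n
    simp [add_assoc]

lemma EZ_apply (f : L →* Multiplicative ℤ) (ρ : Representation k L V) (l : L) (φ : ℤ → V) (n : ℤ) :
    EZ f ρ l φ n = ρ l (φ (n + (f l).toAdd)) := rfl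

lemma EZ_coind (f : L →* Multiplicative ℤ) (n : ℕ) (c : gH (EZ f (coind k L V)) (n + 1)) : c = 0 := by
  refine acyclic (EZ f (coind k L V)) (Ω := ℤ × L) (A := V)
    (LinearEquiv.curry k V ℤ L).symm (fun x h => (x.1 + (f h).toAdd, x.2 * h))
    (by intro x; simp) (by intro x a b; simp [add_assoc, mul_assoc]) (fun x => x.2) (by intro x a; rfl)
    ?_ n c
  intro h v x
  rfl

def evZ (f : L →* Multiplicative ℤ) (ρ : Representation k L V) :
    RHom (gc (EZ f ρ)) (gc (res f.ker.subtype ρ)) :=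
  gmap (σ := EZ f ρ) (τ := res f.ker.subtype ρ) f.ker.subtype (LinearMap.proj 0) (by
    intro x v
    have : f (x : L) = 1 := x.2
    simp [EZ_apply, this, res])

def mapEZ (φ : V →ₗ[k] V') : (ℤ → V) →ₗ[k] (ℤ → V') :=
  LinearMap.pi (fun n => φ.comp (LinearMap.proj n))

lemma EZ_SES (f : L →* Multiplicative ℤ) (ρ : Representation k L V) :
    RSES (gmap (σ := EZ f ρ) (τ := EZ f (coind k L V)) (MonoidHom.id L) (mapEZ (iE ρ)) (fun x v => by
        funext n; exact iE_eq ρ _ _))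
      (gmap (σ := EZ f (coind k L V)) (τ := EZ f (shift ρ)) (MonoidHom.id L) (mapEZ (pE ρ)) (fun x v => by
        funext n; exact pE_eq ρ _ _)) := by
  apply gses
  · intro a b h
    funext n
    exact iE_inj ρ (congrFun h n)
  · intro b
    choose a ha using fun n => Submodule.mkQ_surjective _ (b n)
    exact ⟨a, funext ha⟩
  · intro v
    constructor
    · intro h
      choose a ha using fun n => (pE_zero ρ (v n)).1 (congrFun h n)
      exact ⟨a, funext ha⟩
    · rintro ⟨w, rfl⟩
      funext n
      exact (pE_zero ρ _).2 ⟨w n, rfl⟩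

lemma evZ_h0 (f : L →* Multiplicative ℤ) (ρ : Representation k L V) (c : gH (EZ f ρ) 0) :
    h0 (res f.ker.subtype ρ) ((evZ f ρ).H 0 c) = h0 (EZ f ρ) c 0 := h0_gmap _ _ _ c

lemma evZ_h0inj (f : L →* Multiplicative ℤ) (z : L) (hz : f z = Multiplicative.ofAdd 1)
    (ρ : Representation k L V) (c : gH (EZ f ρ) 0) (h : (evZ f ρ).H 0 c = 0) : c = 0 := by
  apply h0_inj
  rw [map_zero]
  have h1 := congrArg (h0 (res f.ker.subtype ρ)) h
  rw [map_zero, evZ_h0] at h1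
  funext n
  have h2 := congrFun (h0_inv (EZ f ρ) c (z ^ (-n))) n
  rw [EZ_apply, map_zpow f, hz] at h2
  rw [← h2]
  have : (n + (Multiplicative.ofAdd (1:ℤ) ^ (-n)).toAdd) = 0 := by simp
  rw [this]
  have h3 : h0 (EZ f ρ) c 0 = 0 := h1
  rw [h3, map_zero]; rfl

lemma evZ_h0surj (hcomm : ∀ x y : L, x * y = y * x) (f : L →* Multiplicative ℤ) (z : L) (hz : f z = Multiplicative.ofAdd 1)
    (ρ : Representation k L V) (d : gH (res f.ker.subtype ρ) 0) : ∃ c, (evZ f ρ).H 0 c = d := by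
  obtain ⟨c, hc⟩ := h0_surj (EZ f ρ) (fun n => ρ (z ^ (-n)) (h0 _ d)) (by
    intro x
    funext n
    rw [EZ_apply]
    have hm : x * z ^ (-(f x).toAdd) ∈ f.ker := by
      rw [MonoidHom.mem_ker, map_mul, map_zpow, hz]
      apply Multiplicative.toAdd.injective
      simp
    have h1 := h0_inv (res f.ker.subtype ρ) d ⟨_, hm⟩
    change ρ (x * z ^ (-(f x).toAdd)) _ = _ at h1
    conv_rhs => rw [← h1]
    rw [← Module.End.mul_apply, ← Module.End.mul_apply, ← map_mul, ← map_mul]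
    congr 2
    rw [hcomm x, hcomm x, ← mul_assoc, ← zpow_add, neg_add])
  refine ⟨c, h0_inj _ ?_⟩
  rw [evZ_h0, hc]
  simp

lemma evZ_inj (hcomm : ∀ x y : L, x * y = y * x) (f : L →* Multiplicative ℤ) (z : L) (hz : f z = Multiplicative.ofAdd 1)
    (n : ℕ) : ∀ {V : Type} [AddCommGroup V] [Module k V] (ρ : Representation k L V) (c : gH (EZ f ρ) n)
    (h : (evZ f ρ).H n c = 0), c = 0 := by
  induction n with
  | zero => intro V _ _ ρ c h; exact evZ_h0inj f z hz ρ c h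
  | succ n ih =>
    intro V _ _ ρ c h
    obtain ⟨y, rfl⟩ := (EZ_SES f ρ).exact1 n c (EZ_coind f n _)
    rw [(EZ_SES f ρ).δ_nat (shiftSES f.ker.subtype ρ) (evZ f ρ) (evZ f (coind k L V)) (evZ f (shift ρ))
      (fun n x => rfl) (fun n x => rfl)] at h
    obtain ⟨u, hu⟩ := (shiftSES f.ker.subtype ρ).exact3 n _ h
    have : ∃ u', (evZ f (coind k L V)).H n u' = u := by
      cases n with
      | zero => exact evZ_h0surj hcomm f z hz _ u
      | succ n =>
        refine ⟨0, ?_⟩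
        rw [coind_acyclic _ _ u, map_zero]
    obtain ⟨u', rfl⟩ := this
    have h2 : y = (gmap (σ := EZ f (coind k L V)) (τ := EZ f (shift ρ)) (MonoidHom.id L) (mapEZ (pE ρ)) (fun x v => by
        funext n; exact pE_eq ρ _ _)).H n u' := by
      rw [← sub_eq_zero]
      apply ih
      rw [map_sub, sub_eq_zero, ← hu]
      obtain ⟨F, hF, rfl⟩ := gcl_surj _ _ u'
      rfl
    rw [h2, (EZ_SES f ρ).exact3']

end wang
end TB

namespace TB

section
variable {k : Type} [CommRing k] {L : Type} [Group L] {V : Type} [AddCommGroup V] [Module k V]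

lemma antideriv (ψ : ℤ → V) : ∃ φ : ℤ → V, ∀ n, φ (n + 1) - φ n = ψ n := by
  refine ⟨fun n => match n with
    | Int.ofNat n => ∑ i ∈ Finset.range n, ψ i
    | Int.negSucc n => - ∑ i ∈ Finset.range (n + 1), ψ (Int.negSucc i), ?_⟩
  intro n
  match n with
  | Int.ofNat n =>
    change ∑ i ∈ Finset.range (n + 1), ψ i - ∑ i ∈ Finset.range n, ψ i = ψ n
    rw [Finset.sum_range_succ]; abel
  | Int.negSucc 0 =>
    change ∑ i ∈ Finset.range 0, ψ i - - ∑ i ∈ Finset.range (0 + 1), ψ (Int.negSucc i) = ψ _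
    simp
  | Int.negSucc (n + 1) =>
    change - ∑ i ∈ Finset.range (n + 1), ψ (Int.negSucc i) - - ∑ i ∈ Finset.range (n + 1 + 1), ψ (Int.negSucc i) = ψ _
    rw [Finset.sum_range_succ _ (n + 1)]; abel

/-- Constant functions. -/
def cZ (k V : Type) [CommRing k] [AddCommGroup V] [Module k V] : V →ₗ[k] (ℤ → V) :=
  LinearMap.pi (fun _ => LinearMap.id)

/-- The difference operator. -/
def DZ (k V : Type) [CommRing k] [AddCommGroup V] [Module k V] : (ℤ → V) →ₗ[k] (ℤ → V) :=
  LinearMap.pi (fun n => (LinearMap.proj (n + 1) : (ℤ → V) →ₗ[k] V) - (LinearMap.proj n : (ℤ → V) →ₗ[k] V))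

lemma DZ_apply (φ : ℤ → V) (n : ℤ) : DZ k V φ n = φ (n + 1) - φ n := rfl

lemma wangSES (f : L →* Multiplicative ℤ) (σ : Representation k L V) (hσ : ∀ x v, σ x v = v) :
    RSES (gmap (σ := σ) (τ := EZ f σ) (MonoidHom.id L) (cZ k V) (fun x v => rfl))
      (gmap (σ := EZ f σ) (τ := EZ f σ) (MonoidHom.id L) (DZ k V) (fun x v => by
        funext n
        change DZ k V (EZ f σ x v) n = _
        rw [EZ_apply, DZ_apply, DZ_apply, EZ_apply, EZ_apply, map_sub]
        congr 3; ring)) := by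
  apply gses
  · intro a b h
    exact congrFun h 0
  · intro ψ
    obtain ⟨φ, hφ⟩ := antideriv ψ
    exact ⟨φ, funext hφ⟩
  · intro φ
    constructor
    · intro h
      refine ⟨φ 0, ?_⟩
      funext n
      change φ 0 = φ n
      have hs : ∀ n, φ (n + 1) = φ n := fun n => sub_eq_zero.1 (congrFun h n)
      induction n using Int.induction_on with
      | zero => rfl
      | succ i hi => rw [hs]; exact hi
      | pred i hi => rw [hi, ← hs (-(i:ℤ) - 1)]; congr 1; ring
    · rintro ⟨w, rfl⟩
      funext n
      exact sub_self w

lemma wang_zero (hcomm : ∀ x y : L, x * y = y * x) (f : L →* Multiplicative ℤ) (z : L)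
    (hz : f z = Multiplicative.ofAdd 1) (σ : Representation k L V) (hσ : ∀ x v, σ x v = v) (n : ℕ)
    (c : gH σ (n + 1)) (h1 : rst σ f.ker (n + 1) c = 0) (h2 : iotaH σ hσ z (hcomm z) n c = 0) : c = 0 := by
  have h3 : (gmap (σ := σ) (τ := EZ f σ) (MonoidHom.id L) (cZ k V) (fun x v => rfl)).H (n + 1) c = 0 := by
    apply evZ_inj hcomm f z hz
    rw [← h1]
    obtain ⟨F, hF, rfl⟩ := gcl_surj _ _ c
    rfl
  obtain ⟨e, rfl⟩ := (wangSES f σ hσ).exact1 n c h3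
  obtain ⟨a, y, x, hy, hx, hxy, he, ha⟩ := (wangSES f σ hσ).delta_exists n e
  suffices he0 : e = 0 by rw [he0, map_zero]
  have h4 : (wangSES f σ hσ).δ n e = gcl σ (n + 1) x hx := by
    rw [← he]; exact (wangSES f σ hσ).δ_cl n y x hy hx hxy
  rw [h4] at h2
  have h2' : gcl σ n (iota z n x) (iota_Z σ hσ z (hcomm z) n x hx) = 0 := h2
  have h5 := congrArg ((gmap (σ := σ) (τ := EZ f σ) (MonoidHom.id L) (cZ k V) (fun x v => rfl)).H n) h2'
  rw [map_zero] at h5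
  rw [← he]
  refine Eq.trans ?_ h5
  refine ((gc (EZ f σ)).cl_eq_cl n _ _ _ _).2 ?_
  have key : ∀ t : Fin n → L, cZ k V (iota z n x t) = iota z n (dfun (EZ f σ) n y) t := by
    intro t
    refine (iota_lin (k := k) z (cZ k V) n x t).symm.trans ?_
    congr 1
  have hzy : ∀ φ : ℤ → V, EZ f σ z φ - φ = DZ k V φ := by
    intro φ; funext m
    rw [Pi.sub_apply, EZ_apply, hσ, hz]; rfl
  cases n with
  | zero =>
    change _ = _
    rw [sub_eq_zero]
    funext t
    change DZ k V (y t) = cZ k V (iota z 0 x t)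
    rw [key, ← hzy]
    exact (iota_dfun0 (EZ f σ) z y t).symm
  | succ n =>
    refine ⟨iota z n y, ?_⟩
    funext t
    change dfun (EZ f σ) n (iota z n y) t = DZ k V (y t) - cZ k V (iota z (n + 1) x t)
    rw [key, ← hzy]
    exact eq_sub_of_add_eq (iota_dfun (EZ f σ) z (hcomm z) n y t)

lemma iota_inj_free (n : ℕ) : ∀ {L : Type} [Group L] (e : L ≃* Multiplicative (Fin n → ℤ))
    (hcomm : ∀ x y : L, x * y = y * x) (σ : Representation k L V) (hσ : ∀ x v, σ x v = v) (j : ℕ)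
    (c : gH σ (j + 1)) (h : ∀ z, iotaH σ hσ z (hcomm z) j c = 0), c = 0 := by
  induction n with
  | zero =>
    intro L _ e hcomm σ hσ j c h
    haveI : Unique L := e.toEquiv.unique
    have := finite_kill σ j c
    simpa using this
  | succ n ih =>
    intro L _ e hcomm σ hσ j c h
    let f : L →* Multiplicative ℤ :=
      (AddMonoidHom.toMultiplicative (Pi.evalAddMonoidHom (fun _ : Fin (n + 1) => ℤ) 0)).comp e.toMonoidHom
    have hf : ∀ x, f x = Multiplicative.ofAdd ((e x).toAdd 0) := fun _ => rfl
    let z : L := e.symm (Multiplicative.ofAdd (Fin.cons 1 0))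
    refine wang_zero hcomm f z (by rw [hf, e.apply_symm_apply]; rfl) σ hσ j c ?_ (h z)
    let e' : f.ker ≃* Multiplicative (Fin n → ℤ) :=
      { toFun := fun x => Multiplicative.ofAdd (Fin.tail (e x).toAdd)
        invFun := fun y => ⟨e.symm (Multiplicative.ofAdd (Fin.cons 0 y.toAdd)), by
          rw [MonoidHom.mem_ker, hf, e.apply_symm_apply]; rfl⟩
        left_inv := by
          rintro ⟨x, hx⟩
          apply Subtype.ext
          apply e.injective
          change e (e.symm _) = e x
          rw [e.apply_symm_apply]
          have h0 : (e x).toAdd 0 = 0 := hx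
          apply Multiplicative.toAdd.injective
          change (Fin.cons 0 (Fin.tail (e x).toAdd) : Fin (n + 1) → ℤ) = (e x).toAdd
          rw [← h0, Fin.cons_self_tail]
        right_inv := by
          intro y
          change Multiplicative.ofAdd (Fin.tail (e (e.symm (Multiplicative.ofAdd (Fin.cons 0 y.toAdd)))).toAdd) = y
          rw [e.apply_symm_apply]; rfl
        map_mul' := by
          intro x y
          change Multiplicative.ofAdd (Fin.tail (e ((x : L) * y)).toAdd) = _
          rw [map_mul]; rfl }
    refine ih e' (fun x y => Subtype.ext (hcomm _ _)) _ (fun x v => hσ _ v) j _ (fun w => ?_)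
    have := iotaH_gmap hσ (τ := res f.ker.subtype σ) (fun x v => hσ _ v) f.ker.subtype LinearMap.id (fun x v => rfl) w
      (fun y => Subtype.ext (hcomm _ _)) (hcomm _) j c
    refine this.trans ?_
    have h6 := h (w : L)
    change (gmap _ _ _).H j (iotaH σ hσ (w : L) _ j c) = 0
    rw [h6, map_zero]

end
end TB

namespace TB

lemma free_of_tf {L : Type} [Group L] (hcomm : ∀ x y : L, x * y = y * x) (hfg : Group.FG L)
    (htf : ∀ (x : L) (m : ℕ), m ≠ 0 → x ^ m = 1 → x = 1) :
    ∃ n : ℕ, Nonempty (L ≃* Multiplicative (Fin n → ℤ)) := by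
  letI : CommGroup L := { ‹Group L› with mul_comm := hcomm }
  haveI : Module.Finite ℤ (Additive L) := Module.Finite.iff_addGroup_fg.2 (GroupFG.iff_add_fg.1 hfg)
  haveI : IsAddTorsionFree (Additive L) := by
    refine ⟨fun n hn a b h => ?_⟩
    have h' : (a.toMul) ^ n = (b.toMul) ^ n := h
    have : (a.toMul / b.toMul) ^ n = 1 := by rw [div_pow, h', div_self']
    have h2 := htf _ n hn this
    have h3 : a.toMul = b.toMul := div_eq_one.1 h2
    exact Additive.toMul.injective h3
  let b := Module.finBasis ℤ (Additive L)
  exact ⟨Module.finrank ℤ (Additive L), ⟨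
    { toFun := fun x => Multiplicative.ofAdd (b.equivFun (Additive.ofMul x))
      invFun := fun y => (b.equivFun.symm y.toAdd).toMul
      left_inv := fun x => congrArg Additive.toMul (b.equivFun.symm_apply_apply (Additive.ofMul x))
      right_inv := fun x => congrArg Multiplicative.ofAdd (b.equivFun.apply_symm_apply x.toAdd)
      map_mul' := fun x y => by
        rw [ofMul_mul, map_add]; rfl }⟩⟩

section
variable {k : Type} [CommRing k] {K : Type} [Group K] {V : Type} [AddCommGroup V] [Module k V]

lemma iota_inj (hV : LS k V) (hcomm : ∀ x y : K, x * y = y * x)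
    (htf : ∀ (x : K) (m : ℕ), m ≠ 0 → x ^ m = 1 → x = 1)
    (σ : Representation k K V) (hσ : ∀ x v, σ x v = v) (j : ℕ)
    (c : gH σ (j + 1)) (h : ∀ z, iotaH σ hσ z (hcomm z) j c = 0) : c = 0 := by
  apply local_zero hV
  intro T
  obtain ⟨n, ⟨e⟩⟩ := free_of_tf (L := Subgroup.closure (T : Set K)) (fun x y => Subtype.ext (hcomm _ _))
    ((Group.fg_iff_subgroup_fg _).2 ⟨T, rfl⟩) (fun x m hm hx => Subtype.ext (htf _ m hm (congrArg Subtype.val hx)))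
  refine iota_inj_free n e (fun x y => Subtype.ext (hcomm _ _)) _ (fun x v => hσ _ v) j _ (fun w => ?_)
  have := iotaH_gmap hσ (τ := res (Subgroup.closure (T : Set K)).subtype σ) (fun x v => hσ _ v) (Subgroup.closure (T : Set K)).subtype LinearMap.id (fun x v => rfl) w
    (fun y => Subtype.ext (hcomm _ _)) (hcomm _) j c
  refine this.trans ?_
  have h6 := h (w : K)
  change (gmap _ _ _).H j (iotaH σ hσ (w : K) _ j c) = 0
  rw [h6, map_zero]

lemma iota_mul (hV : LS k V) (hcomm : ∀ x y : K, x * y = y * x)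
    (htf : ∀ (x : K) (m : ℕ), m ≠ 0 → x ^ m = 1 → x = 1)
    (σ : Representation k K V) (hσ : ∀ x v, σ x v = v) (z w : K) (j : ℕ)
    (c : gH σ (j + 1)) : iotaH σ hσ (z * w) (hcomm _) j c =
      iotaH σ hσ z (hcomm _) j c + iotaH σ hσ w (hcomm _) j c := by
  induction j with
  | zero =>
    obtain ⟨F, hF, rfl⟩ := gcl_surj _ _ c
    rw [iotaH_cl, iotaH_cl, iotaH_cl, gcl_add]
    refine gcl_congr σ 0 _ _ _ ?_
    funext t
    have h := congrFun hF (Fin.cons z (Fin.cons w t : Fin 1 → K))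
    rw [dfun_cons, dp_cons, dp_zero, hσ] at h
    simp only [Fin.tail_cons, Fin.cons_zero, Pi.zero_apply] at h
    rw [Pi.add_apply, iota_zero, iota_zero, iota_zero]
    rw [← sub_eq_zero, ← neg_eq_zero, ← h]
    abel
  | succ j ih =>
    rw [← sub_eq_zero]
    apply iota_inj hV hcomm htf σ hσ j
    intro u
    rw [map_sub, map_add, iotaH_anti σ hσ _ _ u, iotaH_anti σ hσ z _ u, iotaH_anti σ hσ w _ u, ih]
    abel

end
end TB

namespace TB

/-- Every element has a multiple by an element of `S` in a fixed finitely generated subgroup. -/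
def FGm (S : ℕ → Prop) (B : Type) [AddCommGroup B] : Prop :=
  ∃ T : Finset B, ∀ x : B, ∃ s, S s ∧ s • x ∈ AddSubgroup.closure (T : Set B)

structure MS (S : ℕ → Prop) : Prop where
  one : S 1
  mul : ∀ a b, S a → S b → S (a * b)
  ne : ∀ a, S a → a ≠ 0

def SS (π : Set ℕ) (S : ℕ → Prop) : Prop :=
  S = (fun s => s ≠ 0) ∨ ∃ q : ℕ, q.Prime ∧ q ∉ π ∧ S = (fun s => ¬ q ∣ s)

lemma SS.ms {π : Set ℕ} {S : ℕ → Prop} (h : SS π S) : MS S := by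
  rcases h with rfl | ⟨q, hq, -, rfl⟩
  · exact ⟨one_ne_zero, fun a b => mul_ne_zero, fun a h => h⟩
  · exact ⟨hq.not_dvd_one, fun a b ha hb h => by rcases (hq.dvd_mul).1 h with h | h <;> contradiction,
      fun a h h0 => h (h0 ▸ dvd_zero q)⟩

def Fm (π : Set ℕ) (B : Type) [AddCommGroup B] : Prop := ∀ S, SS π S → FGm S B

section
variable {S : ℕ → Prop} {A B C : Type} [AddCommGroup A] [AddCommGroup B] [AddCommGroup C]

lemma FGm_quo (f : B →+ A) (hf : Function.Surjective f) (h : FGm S B) : FGm S A := by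
  classical
  obtain ⟨T, hT⟩ := h
  refine ⟨T.image f, fun x => ?_⟩
  obtain ⟨y, rfl⟩ := hf x
  obtain ⟨s, hs, h⟩ := hT y
  refine ⟨s, hs, ?_⟩
  rw [← map_nsmul, Finset.coe_image, ← AddMonoidHom.map_closure]
  exact AddSubgroup.mem_map_of_mem f h

lemma FGm_of (h : ∃ F : AddSubgroup B, F.FG ∧ ∀ x, ∃ s, S s ∧ s • x ∈ F) : FGm S B := by
  obtain ⟨F, ⟨T, rfl⟩, h⟩ := h
  exact ⟨T, h⟩

lemma fg_comap (f : A →+ B) (hf : Function.Injective f) (F : AddSubgroup B) (hF : F.FG) : (F.comap f).FG := by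
  haveI : Module.Finite ℤ F := Module.Finite.iff_addGroup_fg.2 ((AddGroup.fg_iff_addSubgroup_fg F).2 hF)
  haveI : IsNoetherian ℤ F := isNoetherian_of_isNoetherianRing_of_finite ℤ F
  let g : (F.comap f) →+ F := f.addSubgroupComap F
  have hg : Function.Injective g := by
    intro a b h
    apply Subtype.ext
    exact hf (congrArg Subtype.val h)
  haveI : IsNoetherian ℤ (F.comap f) := isNoetherian_of_injective g.toIntLinearMap hg
  exact (AddGroup.fg_iff_addSubgroup_fg _).1 (Module.Finite.iff_addGroup_fg.1 inferInstance)

lemma FGm_sub (f : A →+ B) (hf : Function.Injective f) (h : FGm S B) : FGm S A := by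
  obtain ⟨T, hT⟩ := h
  refine FGm_of ⟨(AddSubgroup.closure (T : Set B)).comap f, fg_comap f hf _ ⟨T, rfl⟩, fun x => ?_⟩
  obtain ⟨s, hs, h⟩ := hT (f x)
  exact ⟨s, hs, by rw [AddSubgroup.mem_comap, map_nsmul]; exact h⟩

lemma FGm_ext (hS : MS S) (f : A →+ B) (g : B →+ C) (hg : Function.Surjective g)
    (hfg : ∀ b, g b = 0 → ∃ a, f a = b)
    (hA : FGm S A) (hC : FGm S C) : FGm S B := by
  classical
  obtain ⟨T, hT⟩ := hA
  obtain ⟨U, hU⟩ := hC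
  choose r hr using hg
  refine ⟨T.image f ∪ U.image r, fun x => ?_⟩
  obtain ⟨s, hs, h⟩ := hU (g x)
  have h1 : ∃ y ∈ AddSubgroup.closure ((U.image r : Finset B) : Set B), g y = s • g x := by
    have : AddSubgroup.closure (U : Set C) = (AddSubgroup.closure ((U.image r : Finset B) : Set B)).map g := by
      rw [AddMonoidHom.map_closure, Finset.coe_image, ← Set.image_comp]
      congr 1
      ext c
      simp [hr]
    rw [this] at h
    exact h
  obtain ⟨y, hy, e⟩ := h1
  obtain ⟨a, ha⟩ := hfg (s • x - y) (by rw [map_sub, map_nsmul, e, sub_self])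
  obtain ⟨t, ht, h2⟩ := hT a
  refine ⟨t * s, hS.mul _ _ ht hs, ?_⟩
  have e2 : (t * s) • x = f (t • a) + t • y := by
    rw [map_nsmul, ha, smul_sub, mul_smul]; abel
  rw [e2, Finset.coe_union, AddSubgroup.closure_union]
  refine AddSubgroup.add_mem_sup ?_ (AddSubgroup.nsmul_mem _ hy t)
  rw [Finset.coe_image, ← AddMonoidHom.map_closure]
  exact AddSubgroup.mem_map_of_mem f h2

lemma FGm_bil (hS : MS S) (β : A →+ B →+ C) (hA : FGm S A) (hB : FGm S B)
    (hspan : AddSubgroup.closure {c | ∃ a b, β a b = c} = ⊤) : FGm S C := by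
  classical
  obtain ⟨T, hT⟩ := hA
  obtain ⟨U, hU⟩ := hB
  let W : Finset C := (T ×ˢ U).image (fun p => β p.1 p.2)
  have hW : ∀ a ∈ AddSubgroup.closure (T : Set A), ∀ b ∈ AddSubgroup.closure (U : Set B),
      β a b ∈ AddSubgroup.closure (W : Set C) := by
    intro a ha b hb
    induction ha using AddSubgroup.closure_induction with
    | mem a ha =>
      induction hb using AddSubgroup.closure_induction with
      | mem b hb =>
        apply AddSubgroup.subset_closure
        simp only [W, Finset.coe_image]
        exact ⟨(a, b), by simpa using ⟨ha, hb⟩, rfl⟩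
      | zero => rw [map_zero]; exact zero_mem _
      | add x y _ _ hx hy => rw [map_add]; exact add_mem hx hy
      | neg x _ hx => rw [map_neg]; exact neg_mem hx
    | zero => rw [map_zero]; exact zero_mem _
    | add x y _ _ hx hy => rw [map_add]; exact add_mem hx hy
    | neg x _ hx => rw [map_neg]; exact neg_mem hx
  refine ⟨W, fun x => ?_⟩
  have hx : x ∈ AddSubgroup.closure {c | ∃ a b, β a b = c} := hspan ▸ AddSubgroup.mem_top x
  induction hx using AddSubgroup.closure_induction with
  | mem c hc =>
    obtain ⟨a, b, rfl⟩ := hc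
    obtain ⟨s, hs, h⟩ := hT a
    obtain ⟨t, ht, h'⟩ := hU b
    refine ⟨s * t, hS.mul _ _ hs ht, ?_⟩
    have : (s * t) • β a b = β (s • a) (t • b) := by
      rw [map_nsmul, map_nsmul, AddMonoidHom.nsmul_apply, mul_smul, smul_comm]
    rw [this]
    exact hW _ h _ h'
  | zero => exact ⟨1, hS.one, by rw [smul_zero]; exact zero_mem _⟩
  | add x y _ _ hx hy =>
    obtain ⟨s, hs, h⟩ := hx
    obtain ⟨t, ht, h'⟩ := hy
    refine ⟨s * t, hS.mul _ _ hs ht, ?_⟩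
    rw [smul_add]
    refine add_mem ?_ ?_
    · rw [mul_comm, mul_smul]; exact AddSubgroup.nsmul_mem _ h t
    · rw [mul_smul]; exact AddSubgroup.nsmul_mem _ h' s
  | neg x _ hx =>
    obtain ⟨s, hs, h⟩ := hx
    exact ⟨s, hs, by rw [smul_neg]; exact neg_mem h⟩

end

section
variable {π : Set ℕ} {A B C : Type} [AddCommGroup A] [AddCommGroup B] [AddCommGroup C]
lemma Fm_quo (f : B →+ A) (hf : Function.Surjective f) (h : Fm π B) : Fm π A := fun S hS => FGm_quo f hf (h S hS)
lemma Fm_sub (f : A →+ B) (hf : Function.Injective f) (h : Fm π B) : Fm π A := fun S hS => FGm_sub f hf (h S hS)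
lemma Fm_ext (f : A →+ B) (g : B →+ C) (hg : Function.Surjective g)
    (hfg : ∀ b, g b = 0 → ∃ a, f a = b) (hA : Fm π A) (hC : Fm π C) : Fm π B :=
  fun S hS => FGm_ext hS.ms f g hg hfg (hA S hS) (hC S hS)
lemma Fm_bil (β : A →+ B →+ C) (hA : Fm π A) (hB : Fm π B)
    (hspan : AddSubgroup.closure {c | ∃ a b, β a b = c} = ⊤) : Fm π C :=
  fun S hS => FGm_bil hS.ms β (hA S hS) (hB S hS) hspan
lemma Fm_range (f : A →+ B) (h : Fm π A) : Fm π f.range := Fm_quo f.rangeRestrict f.rangeRestrict_surjective h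
lemma Fm_le {N N' : AddSubgroup A} (hle : N ≤ N') (h : Fm π N') : Fm π N :=
  Fm_sub (AddSubgroup.inclusion hle) (AddSubgroup.inclusion_injective hle) h
lemma Fm_cyclic (x : A) : Fm π (AddSubgroup.zmultiples x) := by
  intro S hS
  refine ⟨{⟨x, AddSubgroup.mem_zmultiples x⟩}, ?_⟩
  rintro ⟨_, n, rfl⟩
  refine ⟨1, hS.ms.one, ?_⟩
  rw [one_smul, Finset.coe_singleton, AddSubgroup.mem_closure_singleton]
  exact ⟨n, by apply Subtype.ext; simp⟩

/-- The subgroup spanned by the values of a biadditive map. -/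
lemma Fm_bilspan (β : A →+ B →+ C) (hA : Fm π A) (hB : Fm π B) :
    Fm π (AddSubgroup.closure {c | ∃ a b, β a b = c}) := by
  let P := AddSubgroup.closure {c | ∃ a b, β a b = c}
  let β' : A →+ B →+ P := AddMonoidHom.mk' (fun a => AddMonoidHom.mk' (fun b =>
    (⟨β a b, AddSubgroup.subset_closure ⟨a, b, rfl⟩⟩ : P)) (fun x y => Subtype.ext (map_add _ _ _)))
    (fun x y => by ext b; simp)
  apply Fm_bil β' hA hB
  rw [eq_top_iff]
  rintro ⟨x, hx⟩ -
  have hle : P ≤ (AddSubgroup.closure {c | ∃ a b, β' a b = c}).map P.subtype := by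
    refine (AddSubgroup.closure_le _).2 ?_
    rintro _ ⟨a, b, rfl⟩
    exact ⟨β' a b, AddSubgroup.subset_closure ⟨a, b, rfl⟩, rfl⟩
  obtain ⟨y, hy, e⟩ := hle hx
  have : y = ⟨x, hx⟩ := Subtype.ext e
  rw [← this]; exact hy
end

/-- A torsion abelian group. -/
def Tor (A : Type) [AddCommGroup A] : Prop := ∀ x : A, ∃ m : ℕ, m ≠ 0 ∧ m • x = 0

section
variable {k : Type} [CommRing k]

/-- No invariant `Fm`-subgroups except bounded ones. -/
def Av (π : Set ℕ) {Γ W : Type} [Group Γ] [AddCommGroup W] [Module k W] (ρ : Representation k Γ W) : Prop :=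
  ∀ N : AddSubgroup W, (∀ g, ∀ x ∈ N, ρ g x ∈ N) → Fm π N → ∃ m : ℕ, m ≠ 0 ∧ ∀ x ∈ N, m • x = 0

variable {π : Set ℕ} {Γ W W' : Type} [Group Γ] [AddCommGroup W] [Module k W] [AddCommGroup W'] [Module k W']
  {ρ : Representation k Γ W} {ρ' : Representation k Γ W'}

lemma Av.map (h : Av π ρ) {M : Type} [AddCommGroup M] (hM : Fm π M) (μ : Γ → M → M) (φ : M →+ W)
    (hφ : ∀ g x, φ (μ g x) = ρ g (φ x)) : ∃ m : ℕ, m ≠ 0 ∧ ∀ x, m • φ x = 0 := by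
  obtain ⟨m, hm, h2⟩ := h φ.range (by rintro g _ ⟨x, rfl⟩; exact ⟨μ g x, hφ g x⟩) (Fm_range φ hM)
  exact ⟨m, hm, fun x => h2 _ ⟨x, rfl⟩⟩

/-- Pull back along a map with bounded kernel. -/
lemma Av.comap (h : Av π ρ') (φ : W →+ W') (hφ : ∀ g x, φ (ρ g x) = ρ' g (φ x)) (e : ℕ) (he : e ≠ 0)
    (hk : ∀ x, φ x = 0 → e • x = 0) : Av π ρ := by
  intro N hN hF
  obtain ⟨m, hm, h2⟩ := h.map hF (fun g x => (⟨ρ g x, hN g x x.2⟩ : N)) (φ.comp N.subtype) (fun g x => hφ g x)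
  refine ⟨e * m, mul_ne_zero he hm, fun x hx => ?_⟩
  rw [mul_smul]
  apply hk
  rw [map_nsmul]
  exact h2 ⟨x, hx⟩

lemma Tor_gH0 (h : Av π ρ) : Tor (gH ρ 0) := by
  intro c
  have hi := h0_inv ρ c
  obtain ⟨m, hm, h2⟩ := h (AddSubgroup.zmultiples (h0 ρ c)) (by
    rintro g _ ⟨n, rfl⟩
    refine ⟨n, ?_⟩
    simp only []
    rw [map_zsmul, hi]) (Fm_cyclic _)
  refine ⟨m, hm, h0_inj ρ ?_⟩
  rw [map_nsmul, map_zero]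
  exact h2 _ (AddSubgroup.mem_zmultiples _)

lemma SC_Tor (k : Type) [CommRing k] : True := trivial
end

/-- The coefficient rings. -/
structure PK (p : ℕ) (k : Type) [CommRing k] : Prop where
  dom : IsDomain k
  pid : IsPrincipalIdealRing k
  cz : CharZero k
  dvd : ∀ c : k, c ≠ 0 → ∃ m : ℕ, m ≠ 0 ∧ c ∣ (m : k)
  unit : ∀ q : ℕ, q.Prime → q ≠ p → IsUnit (q : k)
  ls : ∀ n, LS k (Fin n → k)

end TB

namespace TB

section
variable {k : Type} [CommRing k] {P : ∀ (M : Type) [AddCommGroup M] [Module k M], Prop}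
lemma RSES.scB {A B C : RC k} {i : RHom A B} {p : RHom B C} (h : RSES i p) (hP : SC k P) (n : ℕ)
    (hA : P (A.H n)) (hC : P (C.H n)) : P (B.H n) := hP.mid _ _ _ (i.H n) (p.H n) (h.exact2 n) hA hC
lemma RSES.scC {A B C : RC k} {i : RHom A B} {p : RHom B C} (h : RSES i p) (hP : SC k P) (n : ℕ)
    (hB : P (B.H n)) (hA : P (A.H (n + 1))) : P (C.H n) := hP.mid _ _ _ (p.H n) (h.δ n) (h.exact3 n) hB hA
lemma RSES.scA {A B C : RC k} {i : RHom A B} {p : RHom B C} (h : RSES i p) (hP : SC k P) (n : ℕ)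
    (hC : P (C.H n)) (hB : P (B.H (n + 1))) : P (A.H (n + 1)) := hP.mid _ _ _ (h.δ n) (i.H (n + 1)) (h.exact1 n) hC hB

variable (k) in
lemma SC_T : SC k (fun M _ _ => Tor M) where
  zero M _ _ h x := ⟨1, one_ne_zero, by rw [h x, smul_zero]⟩
  mid X Y Z _ _ _ _ _ _ f g h hX hZ y := by
    obtain ⟨m, hm, e⟩ := hZ (g y)
    obtain ⟨x, hx⟩ := h (m • y) (by rw [map_nsmul, e])
    obtain ⟨n, hn, e'⟩ := hX x
    exact ⟨n * m, mul_ne_zero hn hm, by rw [mul_smul, ← hx, ← map_nsmul, e', map_zero]⟩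

lemma Tor_of_kill {A : Type} [AddCommGroup A] (m : ℕ) (hm : m ≠ 0) (h : ∀ x : A, m • x = 0) : Tor A :=
  fun x => ⟨m, hm, h x⟩

variable {Γ V : Type} [Group Γ] [AddCommGroup V] [Module k V]

lemma dfun_nsmul (σ : Representation k Γ V) (n : ℕ) (m : ℕ) (F : (Fin n → Γ) → V) :
    dfun σ n (m • F) = m • dfun σ n F := by
  rw [← Nat.cast_smul_eq_nsmul k, dfun_smul, Nat.cast_smul_eq_nsmul]

lemma gH_kill (σ : Representation k Γ V) (m : ℕ) (h : ∀ v : V, m • v = 0) (n : ℕ) (c : gH σ n) : m • c = 0 := by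
  obtain ⟨F, hF, rfl⟩ := gcl_surj σ n c
  rw [← Nat.cast_smul_eq_nsmul k, gcl_smul]
  have : (m : k) • F = 0 := by funext t; rw [Nat.cast_smul_eq_nsmul]; exact h _
  refine (gcl_congr σ n _ _ _ this).trans ?_
  exact (RC.cl_eq_zero _ n _ _).2 (Submodule.zero_mem _)

lemma gH_triv (σ : Representation k Γ V) (h : ∀ v : V, v = 0) (n : ℕ) (c : gH σ n) : c = 0 := by
  have := gH_kill σ 1 (fun v => by rw [h v, smul_zero]) n c
  rwa [one_smul] at this

end

/-- torsion-free. -/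
def TF (W : Type) [AddCommGroup W] : Prop := ∀ (x : W) (m : ℕ), m ≠ 0 → m • x = 0 → x = 0

lemma TF.sub {A B : Type} [AddCommGroup A] [AddCommGroup B] (h : TF B) (f : A →+ B) (hf : Function.Injective f) : TF A :=
  fun x m hm e => hf (by rw [map_zero]; exact h _ m hm (by rw [← map_nsmul, e, map_zero]))

section
variable {p : ℕ} {k : Type} [CommRing k] (hk : PK p k)
  {W : Type} [AddCommGroup W] [Module k W]

lemma PK.noeth (hk : PK p k) : IsNoetherianRing k := haveI := hk.pid; inferInstance

lemma PK.fsub (hk : PK p k) [Module.Finite k W] (U : Submodule k W) : Module.Finite k U := by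
  haveI := hk.noeth
  haveI : IsNoetherian k W := isNoetherian_of_isNoetherianRing_of_finite k W
  infer_instance

lemma PK.finj (hk : PK p k) {W' : Type} [AddCommGroup W'] [Module k W'] [Module.Finite k W] (f : W' →ₗ[k] W)
    (hf : Function.Injective f) : Module.Finite k W' := by
  haveI := hk.noeth
  haveI : IsNoetherian k W := isNoetherian_of_isNoetherianRing_of_finite k W
  exact Module.Finite.of_injective f hf

lemma PK.tf (hk : PK p k) (h : TF W) (c : k) (x : W) (hc : c ≠ 0) (e : c • x = 0) : x = 0 := by
  obtain ⟨m, hm, b, hb⟩ := hk.dvd c hc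
  refine h x m hm ?_
  rw [← Nat.cast_smul_eq_nsmul k, hb, mul_comm, mul_smul, e, smul_zero]

lemma PK.itf (hk : PK p k) (h : TF W) : Module.IsTorsionFree k W := by
  haveI := hk.dom
  refine ⟨fun c hc a b e => ?_⟩
  have := hk.tf h c (a - b) hc.ne_zero (by rw [smul_sub]; exact sub_eq_zero.2 e)
  exact sub_eq_zero.1 this

lemma PK.free (hk : PK p k) [Module.Finite k W] (h : TF W) : Module.Free k W := by
  haveI := hk.dom
  haveI := hk.pid
  haveI := hk.itf h
  infer_instance

lemma PK.lsW (hk : PK p k) [Module.Finite k W] (h : TF W) : LS k W := by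
  haveI := hk.free h
  haveI := hk.dom
  exact LS_equiv (Module.finBasis k W).equivFun.symm (hk.ls _)

/-- The torsion submodule. -/
def tors (k W : Type) [CommRing k] [AddCommGroup W] [Module k W] : Submodule k W where
  carrier := {x | ∃ m : ℕ, m ≠ 0 ∧ m • x = 0}
  zero_mem' := ⟨1, one_ne_zero, smul_zero _⟩
  add_mem' := by
    rintro a b ⟨m, hm, e⟩ ⟨n, hn, e'⟩
    refine ⟨m * n, mul_ne_zero hm hn, ?_⟩
    rw [smul_add, mul_smul m n b, e', smul_zero, mul_comm, mul_smul, e, smul_zero, add_zero]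
  smul_mem' := by
    rintro c x ⟨m, hm, e⟩
    exact ⟨m, hm, by rw [smul_comm, e, smul_zero]⟩

lemma bounded_of_fg {A : Type} [AddCommGroup A] [Module k A] [Module.Finite k A] (h : Tor A) :
    ∃ e : ℕ, e ≠ 0 ∧ ∀ x : A, e • x = 0 := by
  obtain ⟨s, hs⟩ := Module.Finite.fg_top (R := k) (M := A)
  choose m hm e using h
  refine ⟨∏ a ∈ s, m a, Finset.prod_ne_zero_iff.2 fun a _ => hm a, fun x => ?_⟩
  have hx : x ∈ Submodule.span k (s : Set A) := hs ▸ Submodule.mem_top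
  induction hx using Submodule.span_induction with
  | mem a ha =>
    obtain ⟨c, hc⟩ := Finset.dvd_prod_of_mem m ha
    rw [hc, mul_comm, mul_smul, e, smul_zero]
  | zero => exact smul_zero _
  | add x y _ _ hx hy => rw [smul_add, hx, hy, add_zero]
  | smul c x _ hx => rw [smul_comm, hx, smul_zero]

lemma tors_bdd (hk : PK p k) [Module.Finite k W] : ∃ e : ℕ, e ≠ 0 ∧ ∀ x ∈ tors k W, e • x = 0 := by
  haveI := hk.fsub (tors k W)
  obtain ⟨e, he, h⟩ := bounded_of_fg (k := k) (A := tors k W) (by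
    rintro ⟨x, m, hm, e⟩
    exact ⟨m, hm, Subtype.ext e⟩)
  exact ⟨e, he, fun x hx => congrArg Subtype.val (h ⟨x, hx⟩)⟩

lemma tors_inv {Γ : Type} [Group Γ] (ρ : Representation k Γ W) (g : Γ) (v : W) (hv : v ∈ tors k W) : ρ g v ∈ tors k W := by
  obtain ⟨m, hm, e⟩ := hv
  exact ⟨m, hm, by rw [← map_nsmul, e, map_zero]⟩

lemma TF_quo : TF (W ⧸ tors k W) := by
  intro x m hm e
  obtain ⟨x, rfl⟩ := Submodule.mkQ_surjective _ x
  rw [← map_nsmul, Submodule.mkQ_apply, Submodule.Quotient.mk_eq_zero] at e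
  obtain ⟨n, hn, e⟩ := e
  rw [Submodule.mkQ_apply, Submodule.Quotient.mk_eq_zero]
  exact ⟨n * m, mul_ne_zero hn hm, by rw [mul_smul, e]⟩

/-- multiplication by `e` as a map `W / tors → W`. -/
def eMap (e : ℕ) (h : ∀ x ∈ tors k W, e • x = 0) : (W ⧸ tors k W) →ₗ[k] W :=
  (tors k W).liftQ (e • LinearMap.id) (by intro x hx; exact h x hx)

lemma eMap_inj (e : ℕ) (he : e ≠ 0) (h : ∀ x ∈ tors k W, e • x = 0) : Function.Injective (eMap e h) := by
  rw [injective_iff_map_eq_zero]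
  intro x hx
  obtain ⟨x, rfl⟩ := Submodule.mkQ_surjective _ x
  rw [Submodule.mkQ_apply, Submodule.Quotient.mk_eq_zero]
  exact ⟨e, he, hx⟩

lemma Av_quo_tors (hk : PK p k) {π : Set ℕ} {Γ : Type} [Group Γ] [Module.Finite k W] {ρ : Representation k Γ W} (h : Av π ρ) :
    Av π (qrep ρ (tors k W) (tors_inv ρ)) := by
  obtain ⟨e, he, h1⟩ := tors_bdd (W := W) hk
  refine h.comap (eMap e h1).toAddMonoidHom ?_ 1 one_ne_zero ?_
  · intro g x
    obtain ⟨x, rfl⟩ := Submodule.mkQ_surjective _ x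
    rw [qrep_apply]
    change e • ρ g x = ρ g (e • x)
    rw [map_nsmul]
  · intro x hx
    rw [one_smul]
    exact eMap_inj e he h1 (hx.trans (map_zero _).symm)
end

/-- The main torsion property of a group. -/
def UU (π : Set ℕ) (p : ℕ) (Γ : Type) [Group Γ] : Prop :=
  ∀ (k : Type) [CommRing k], PK p k → ∀ (W : Type) [AddCommGroup W] [Module k W] [Module.Finite k W]
    (ρ : Representation k Γ W), TF W → Av π ρ → ∀ n, Tor (gH ρ n)

lemma UU.full {π : Set ℕ} {p : ℕ} {Γ : Type} [Group Γ] (h : UU π p Γ) {k : Type} [CommRing k] (hk : PK p k)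
    {W : Type} [AddCommGroup W] [Module k W] [Module.Finite k W] (ρ : Representation k Γ W) (hA : Av π ρ) (n : ℕ) :
    Tor (gH ρ n) := by
  refine (subSES ρ (tors k W) (tors_inv ρ)).scB (P := fun M _ _ => Tor M) (SC_T k) n ?_ ?_
  · obtain ⟨e, he, h1⟩ := tors_bdd (W := W) hk
    refine Tor_of_kill e he (gH_kill _ e (fun v => Subtype.ext (h1 v v.2)) n)
  · exact h k hk _ _ TF_quo (Av_quo_tors hk hA) n

section
variable {k : Type} [CommRing k]
variable {Γ V V' : Type} [Group Γ] [AddCommGroup V] [Module k V] [AddCommGroup V'] [Module k V']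

lemma gmap_sub_id (ρ : Representation k Γ V) (T : V →ₗ[k] V) (hT : ∀ x v, T (ρ x v) = ρ x (T v)) (n : ℕ)
    (h : ∀ c, (gmap (σ := ρ) (τ := ρ) (MonoidHom.id Γ) T hT).H n c = c)
    (q : V →ₗ[k] V) (hq : ∀ x v, q (ρ x v) = ρ x (q v)) (r : k) (e : ∀ v, q (T v - v) = r • v) (c : gH ρ n) :
    r • c = 0 := by
  have h2 : (gmap (σ := ρ) (τ := ρ) (MonoidHom.id Γ) (T - LinearMap.id) (fun x v => by
      simp [hT])).H n c = 0 := by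
    obtain ⟨F, hF, rfl⟩ := gcl_surj ρ n c
    have h1 := h (gcl ρ n F hF)
    rw [gmap_cl] at h1 ⊢
    have h3 := sub_eq_zero.2 h1
    rw [gcl_sub] at h3
    exact h3
  exact kill_of_factor (σ := ρ) (τ := ρ) (T - LinearMap.id) q _ hq r e n c h2

/-- A commutative group acting without invariants has bounded cohomology. -/
lemma bdd_of_noinv {p : ℕ} (hk : PK p k) (hcomm : ∀ x y : Γ, x * y = y * x) (r : ℕ) :
    ∀ (W : Type) [AddCommGroup W] [Module k W] [Module.Finite k W] (ρ : Representation k Γ W), TF W →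
    Module.finrank k W ≤ r → (∀ v, (∀ x, ρ x v = v) → v = 0) →
    ∃ m : ℕ, m ≠ 0 ∧ ∀ n (c : gH ρ n), m • c = 0 := by
  haveI := hk.dom
  haveI := hk.pid
  induction r with
  | zero =>
    intro W _ _ _ ρ hW hr hinv
    haveI := hk.free hW
    refine ⟨1, one_ne_zero, fun n c => ?_⟩
    rw [one_smul]
    have : Subsingleton W := by
      exact (Module.finrank_eq_zero_iff_of_free k _).1 (by omega)
    exact gH_triv ρ (fun v => Subsingleton.elim _ _) n c
  | succ r ih =>
    intro W _ _ _ ρ hW hr hinv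
    haveI := hk.free hW
    by_cases hall : ∀ x v, ρ x v = v
    · refine ⟨1, one_ne_zero, fun n c => ?_⟩
      rw [one_smul]
      exact gH_triv ρ (fun v => hinv v (fun x => hall x v)) n c
    push Not at hall
    obtain ⟨κ, v0, hv0⟩ := hall
    let D : W →ₗ[k] W := ρ κ - LinearMap.id
    have hD : ∀ x v, D (ρ x v) = ρ x (D v) := by
      intro x v
      change ρ κ (ρ x v) - ρ x v = ρ x (ρ κ v - v)
      rw [map_sub, comm_eq ρ κ (hcomm κ)]
    by_cases hinj : Function.Injective D
    · have hdet : LinearMap.det D ≠ 0 := by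
        intro h0
        obtain ⟨v, hv, e⟩ := (LinearMap.bot_lt_ker_of_det_eq_zero h0 : ⊥ < _).ne' |> fun h => (Submodule.ne_bot_iff _).1 h
        exact e (hinj (hv.trans (map_zero D).symm))
      have hc0 : D.charpoly.coeff 0 ≠ 0 := by
        intro h0
        apply hdet
        rw [LinearMap.det_eq_sign_charpoly_coeff, h0, mul_zero]
      obtain ⟨m, hm, b, hb⟩ := hk.dvd _ hc0
      refine ⟨m, hm, fun n c => ?_⟩
      let q : W →ₗ[k] W := - Polynomial.aeval D D.charpoly.divX
      have hq : ∀ x v, q (ρ x v) = ρ x (q v) := by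
        intro x v
        have hcm : Commute (Polynomial.aeval D D.charpoly.divX) (ρ x) := by
          have hDx : Commute D (ρ x) := LinearMap.ext fun v => hD x v
          induction D.charpoly.divX using Polynomial.induction_on' with
          | add a b ha hb => rw [map_add]; exact ha.add_left hb
          | monomial n a =>
            rw [Polynomial.aeval_monomial]
            exact (Algebra.commute_algebraMap_left a (ρ x)).mul_left (hDx.pow_left n)
        have := LinearMap.congr_fun hcm.eq v
        change - (Polynomial.aeval D D.charpoly.divX) (ρ x v) = ρ x (- (Polynomial.aeval D D.charpoly.divX) v)
        rw [map_neg]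
        exact congrArg Neg.neg this
      have hz := gmap_sub_id ρ (ρ κ) (fun x v => comm_eq ρ κ (hcomm κ) x v) n (central_triv ρ κ (hcomm κ) n)
        q hq (D.charpoly.coeff 0) (fun v => by
          have h1 := LinearMap.congr_fun (LinearMap.aeval_self_charpoly D) v
          rw [← Polynomial.divX_mul_X_add D.charpoly] at h1
          simp only [map_add, map_mul, Polynomial.aeval_X, Polynomial.aeval_C] at h1
          have h2 : (Polynomial.aeval D D.charpoly.divX) (D v) + D.charpoly.coeff 0 • v = 0 := h1
          change - (Polynomial.aeval D D.charpoly.divX) (D v) = _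
          exact neg_eq_of_add_eq_zero_right h2) c
      rw [← Nat.cast_smul_eq_nsmul k, hb, mul_comm, mul_smul, hz, smul_zero]
    · let U := LinearMap.ker D
      have hU : ∀ g, ∀ v ∈ U, ρ g v ∈ U := by
        intro g v hv
        change D (ρ g v) = 0
        rw [hD, show D v = 0 from hv, map_zero]
      haveI := hk.fsub U
      have hTU : TF U := hW.sub U.subtype.toAddMonoidHom Subtype.val_injective
      haveI := hk.free hTU
      let φ : (W ⧸ U) →ₗ[k] W := U.liftQ D le_rfl
      have hφ : Function.Injective φ := by
        rw [← LinearMap.ker_eq_bot]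
        exact Submodule.ker_liftQ_eq_bot _ _ _ le_rfl
      have hTQ : TF (W ⧸ U) := hW.sub φ.toAddMonoidHom hφ
      haveI := hk.free hTQ
      have hsum := Submodule.finrank_quotient_add_finrank U
      have p1 : Module.finrank k U ≠ 0 := by
        intro h0
        have := (Module.finrank_eq_zero_iff_of_free k _).1 h0
        apply hinj
        rw [← LinearMap.ker_eq_bot]
        exact (Submodule.subsingleton_iff_eq_bot).1 this
      have p2 : Module.finrank k (W ⧸ U) ≠ 0 := by
        intro h0
        have hs := (Module.finrank_eq_zero_iff_of_free k _).1 h0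
        apply hv0
        have : U.mkQ v0 = 0 := Subsingleton.elim _ _
        rw [Submodule.mkQ_apply, Submodule.Quotient.mk_eq_zero] at this
        exact sub_eq_zero.1 this
      obtain ⟨m1, hm1, e1⟩ := ih U (srep ρ U hU) hTU (by omega) (by
        intro v hv
        exact Subtype.ext (hinv v (fun x => congrArg Subtype.val (hv x))))
      obtain ⟨m2, hm2, e2⟩ := ih (W ⧸ U) (qrep ρ U hU) hTQ (by omega) (by
        intro v hv
        apply hφ
        rw [map_zero]
        apply hinv
        intro x
        nth_rewrite 2 [← hv x]
        obtain ⟨v, rfl⟩ := Submodule.mkQ_surjective _ v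
        rw [qrep_apply]
        exact (hD x v).symm)
      refine ⟨m1 * m2, mul_ne_zero hm1 hm2, fun n c => ?_⟩
      have hS := subSES ρ U hU
      obtain ⟨a, ha⟩ := hS.exact2 n (m2 • c) (by rw [map_nsmul]; exact e2 n _)
      rw [mul_smul]
      change m1 • (m2 • c) = 0
      rw [← ha, ← map_nsmul]
      have := e1 n a
      rw [show m1 • a = 0 from this, map_zero]
end
end TB

namespace TB

section
variable {k : Type} [CommRing k] {Γ Γ' : Type} [Group Γ] [Group Γ'] {W : Type} [AddCommGroup W] [Module k W]

/-- Invariants of the kernel. -/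
def kInv (f : Γ →* Γ') (ρ : Representation k Γ W) : Submodule k W where
  carrier := {v | ∀ x, f x = 1 → ρ x v = v}
  zero_mem' x _ := map_zero _
  add_mem' {a b} ha hb x hx := by rw [map_add, ha x hx, hb x hx]
  smul_mem' c a ha x hx := by rw [map_smul, ha x hx]

lemma kInv_inv (f : Γ →* Γ') (ρ : Representation k Γ W) (g : Γ) (v : W) (hv : v ∈ kInv f ρ) : ρ g v ∈ kInv f ρ := by
  intro x hx
  have := hv (g⁻¹ * x * g) (by simp [hx])
  rw [← Module.End.mul_apply, ← map_mul]
  nth_rewrite 2 [← this]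
  rw [← Module.End.mul_apply, ← map_mul]
  congr 2; group

lemma Av.of_surj {π : Set ℕ} (f : Γ →* Γ') {ρ : Representation k Γ W} {ρ' : Representation k Γ' W}
    (hρ : ∀ g v, ρ' (f g) v = ρ g v) (h : Av π ρ) : Av π ρ' := by
  intro N hN hF
  exact h N (fun g x hx => by rw [← hρ]; exact hN _ x hx) hF

lemma Av.of_surj' {π : Set ℕ} (f : Γ →* Γ') (hf : Function.Surjective f) {ρ : Representation k Γ W} {ρ' : Representation k Γ' W}
    (hρ : ∀ g v, ρ' (f g) v = ρ g v) (h : Av π ρ') : Av π ρ := by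
  intro N hN hF
  exact h N (fun g x hx => by obtain ⟨g, rfl⟩ := hf g; rw [hρ]; exact hN _ x hx) hF

lemma Av_h0 {π : Set ℕ} (f : Γ →* Γ') (hf : Function.Surjective f) (ρ : Representation k Γ W) (h : Av π (srep ρ (kInv f ρ) (kInv_inv f ρ))) :
    Av π (hQ f hf ρ 0) := by
  refine Av.of_surj f (ρ := hrep f ρ 0) (fun g v => by rw [hQ_apply]) ?_
  refine Av.comap (ρ := hrep f ρ 0) (ρ' := srep ρ (kInv f ρ) (kInv_inv f ρ)) h (AddMonoidHom.mk' (fun c => (⟨h0 _ c, fun x hx => h0_inv _ c ⟨x, hx⟩⟩ : kInv f ρ))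
    (fun a b => Subtype.ext (map_add _ _ _))) ?_ 1 one_ne_zero ?_
  · intro g x
    apply Subtype.ext
    change h0 _ (hrep f ρ 0 g x) = ρ g (h0 _ x)
    rw [h0_hrep]
  · intro x hx
    rw [one_smul]
    exact h0_inj _ ((congrArg Subtype.val hx).trans (map_zero _).symm)

lemma Av.srep {π : Set ℕ} {ρ : Representation k Γ W} (h : Av π ρ) (U : Submodule k W) (hU) : Av π (srep ρ U hU) :=
  h.comap U.subtype.toAddMonoidHom (fun _ _ => rfl) 1 one_ne_zero (fun x hx => by rw [one_smul]; exact Subtype.ext hx)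

/-- Steps where the kernel has bounded cohomology. -/
lemma UU_step_bdd {π : Set ℕ} {p : ℕ} (f : Γ →* Γ') (hf : Function.Surjective f) (hU : UU π p Γ')
    (hb : ∀ (k : Type) [CommRing k], PK p k → ∀ (W : Type) [AddCommGroup W] [Module k W] [Module.Finite k W]
      (ρ : Representation k f.ker W), TF W → ∀ n, ∃ m : ℕ, m ≠ 0 ∧ ∀ c : gH ρ (n + 1), m • c = 0) : UU π p Γ := by
  intro k _ hk W _ _ _ ρ hW hA n
  rcases n with _ | n
  · exact Tor_gH0 hA
  refine LHS f hf (P := fun M _ _ => Tor M) (SC_T k) ρ (fun i j hij => ?_) n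
  rcases j with _ | j
  · haveI : Module.Finite k (HK f ρ 0) := hk.finj (h0 (res f.ker.subtype ρ)) (h0_inj _)
    exact hU.full hk (hQ f hf ρ 0) (Av_h0 f hf ρ (hA.srep _ _)) i
  · obtain ⟨m, hm, e⟩ := hb k hk W (res f.ker.subtype ρ) hW j
    exact Tor_of_kill m hm (gH_kill _ m e i)

/-- finite kernel -/
lemma UU_finite {π : Set ℕ} {p : ℕ} (f : Γ →* Γ') (hf : Function.Surjective f) (hU : UU π p Γ')
    [Finite f.ker] : UU π p Γ := by
  refine UU_step_bdd f hf hU fun k _ hk W _ _ _ ρ hW n => ?_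
  haveI := Fintype.ofFinite f.ker
  exact ⟨Fintype.card f.ker, Fintype.card_ne_zero, fun c => by
    rw [← Nat.cast_smul_eq_nsmul k]; exact finite_kill ρ n c⟩

lemma unit_of_primes (N : ℕ) : N ≠ 0 → (∀ q : ℕ, q.Prime → q ∣ N → IsUnit (q : k)) → IsUnit (N : k) := by
  induction N using induction_on_primes with
  | zero => intro h; exact absurd rfl h
  | one => intro _ _; simp
  | prime_mul q a hq ih =>
    intro h0 h
    rw [Nat.cast_mul]
    exact (h q hq (dvd_mul_right _ _)).mul (ih (fun h => h0 (by rw [h, mul_zero])) (fun r hr hd => h r hr (hd.mul_left q)))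

/-- cohomology of a group of order prime to `p` vanishes. -/
lemma pprime_vanish {K : Type} [Group K] (hV : LS k W) (hcomm : ∀ x y : K, x * y = y * x)
    (hq : ∀ x : K, ∃ m : ℕ, IsUnit (m : k) ∧ m ≠ 0 ∧ x ^ m = 1) (ρ : Representation k K W) (n : ℕ) (c : gH ρ (n + 1)) : c = 0 := by
  refine local_zero hV ρ n c fun T => ?_
  letI : CommGroup K := { (inferInstance : Group K) with mul_comm := hcomm }
  let Q := Subgroup.closure (T : Set K)
  choose m hm1 hm2 hm3 using hq
  have key : ∀ x ∈ Q, x ^ (∏ t ∈ T, m t) = 1 := by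
    intro x hx
    induction hx using Subgroup.closure_induction with
    | mem a ha =>
      obtain ⟨c, hc⟩ := Finset.dvd_prod_of_mem m ha
      rw [hc, pow_mul, hm3, one_pow]
    | one => exact one_pow _
    | mul x y _ _ hx hy => rw [mul_pow, hx, hy, one_mul]
    | inv x _ hx => rw [inv_pow, hx, inv_one]
  have hM0 : ∏ t ∈ T, m t ≠ 0 := Finset.prod_ne_zero_iff.2 fun a _ => hm2 a
  have hMu : IsUnit ((∏ t ∈ T, m t : ℕ) : k) := by
    rw [Nat.cast_prod]
    exact Finset.prod_induction _ IsUnit (fun a b ha hb => ha.mul hb) isUnit_one (fun a _ => hm1 a)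
  haveI : Group.FG Q := (Group.fg_iff_subgroup_fg Q).2 ⟨T, rfl⟩
  haveI : Finite Q := CommGroup.finite_of_fg_isMulTorsion Q (fun x => isOfFinOrder_iff_pow_eq_one.2
    ⟨_, Nat.pos_of_ne_zero hM0, Subtype.ext (key x x.2)⟩)
  haveI := Fintype.ofFinite Q
  have hu : IsUnit ((Fintype.card Q : ℕ) : k) := by
    refine unit_of_primes _ Fintype.card_ne_zero fun q hq hd => ?_
    haveI : Fact q.Prime := ⟨hq⟩
    obtain ⟨x, hx⟩ := exists_prime_orderOf_dvd_card q hd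
    have : q ∣ ∏ t ∈ T, m t := by
      rw [← hx]; exact orderOf_dvd_of_pow_eq_one (Subtype.ext (key x x.2))
    exact isUnit_of_dvd_unit (Nat.cast_dvd_cast this) hMu
  exact hu.smul_eq_zero.1 (finite_kill (res Q.subtype ρ) n _)

/-- torsion prime-to-`p` kernel -/
lemma UU_pprime {π : Set ℕ} {p : ℕ} (f : Γ →* Γ') (hf : Function.Surjective f) (hU : UU π p Γ')
    (hcomm : ∀ x y : f.ker, x * y = y * x)
    (hq : ∀ x : f.ker, ∃ m : ℕ, ¬ p ∣ m ∧ x ^ m = 1) (hp : p.Prime) : UU π p Γ := by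
  refine UU_step_bdd f hf hU fun k _ hk W _ _ _ ρ hW n => ⟨1, one_ne_zero, fun c => ?_⟩
  rw [one_smul]
  refine pprime_vanish (hk.lsW hW) hcomm (fun x => ?_) ρ n c
  obtain ⟨m, hm, e⟩ := hq x
  have m0 : m ≠ 0 := fun h => hm (h ▸ dvd_zero p)
  refine ⟨m, ?_, m0, e⟩
  refine unit_of_primes m m0 fun q hq hd => hk.unit q hq ?_
  rintro rfl
  exact hm hd

/-- Reduction to modules on which the kernel acts trivially. -/
lemma red {π : Set ℕ} {p : ℕ} (hk : PK p k) (f : Γ →* Γ') (hf : Function.Surjective f)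
    {A : Type} [AddCommGroup A] (hA : Fm π A) (a : A → Γ) (a_add : ∀ x y, a (x + y) = a x * a y)
    (a_ker : ∀ x, f (a x) = 1) (a_surj : ∀ x, f x = 1 → ∃ y, a y = x)
    (htriv : ∀ (Y : Type) [AddCommGroup Y] [Module k Y] [Module.Finite k Y] (ρ : Representation k Γ Y), TF Y →
      (∀ x, f x = 1 → ∀ v, ρ x v = v) → Av π ρ → ∀ n, Tor (gH ρ n)) (r : ℕ) :
    ∀ (X : Type) [AddCommGroup X] [Module k X] [Module.Finite k X] (ρ : Representation k Γ X), TF X →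
      Module.finrank k X ≤ r → Av π (srep ρ (kInv f ρ) (kInv_inv f ρ)) → ∀ n, Tor (gH ρ n) := by
  haveI := hk.dom
  haveI := hk.pid
  have hcomm : ∀ x y : f.ker, x * y = y * x := by
    intro x y
    obtain ⟨b, hb⟩ := a_surj x x.2
    obtain ⟨c, hc⟩ := a_surj y y.2
    apply Subtype.ext
    change (x : Γ) * y = y * x
    rw [← hb, ← hc, ← a_add, ← a_add, add_comm]
  induction r with
  | zero =>
    intro X _ _ _ ρ hX hr hav n
    haveI := hk.free hX
    have : Subsingleton X := (Module.finrank_eq_zero_iff_of_free k _).1 (by omega)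
    exact Tor_of_kill 1 one_ne_zero (gH_kill ρ 1 (fun v => Subsingleton.elim _ _) n)
  | succ r ih =>
    intro X _ _ _ ρ hX hr hav n
    haveI := hk.free hX
    let X0 := kInv f ρ
    have hX0 : TF X0 := hX.sub X0.subtype.toAddMonoidHom Subtype.val_injective
    haveI := hk.fsub X0
    by_cases hx0 : X0 = ⊥
    · obtain ⟨m, hm, e⟩ := bdd_of_noinv hk hcomm _ X (res f.ker.subtype ρ) hX le_rfl (by
        intro v hv
        have : v ∈ X0 := fun x hx => hv ⟨x, hx⟩
        rw [hx0] at this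
        exact this)
      rcases n with _ | n
      · refine Tor_of_kill 1 one_ne_zero fun c => ?_
        rw [one_smul]
        apply h0_inj
        rw [map_zero]
        have : h0 ρ c ∈ X0 := fun x hx => h0_inv ρ c x
        rw [hx0] at this
        exact this
      · exact LHS f hf (P := fun M _ _ => Tor M) (SC_T k) ρ (fun i j hij => Tor_of_kill m hm (gH_kill _ m (e j) i)) n
    · have hTQ : TF (X ⧸ X0) := by
        intro v m hm e
        obtain ⟨v, rfl⟩ := Submodule.mkQ_surjective _ v
        rw [← map_nsmul, Submodule.mkQ_apply, Submodule.Quotient.mk_eq_zero] at e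
        rw [Submodule.mkQ_apply, Submodule.Quotient.mk_eq_zero]
        intro x hx
        refine sub_eq_zero.1 (hX _ m hm ?_)
        rw [smul_sub, ← map_nsmul, e x hx, sub_self]
      haveI := hk.free hTQ
      haveI := hk.free hX0
      have hsum := Submodule.finrank_quotient_add_finrank X0
      have p1 : Module.finrank k X0 ≠ 0 := by
        intro h1
        have := (Module.finrank_eq_zero_iff_of_free k _).1 h1
        exact hx0 ((Submodule.subsingleton_iff_eq_bot).1 this)
      refine (subSES ρ X0 (kInv_inv f ρ)).scB (P := fun M _ _ => Tor M) (SC_T k) n ?_ ?_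
      · exact htriv X0 _ hX0 (fun x hx v => Subtype.ext (v.2 x hx)) hav n
      · refine ih (X ⧸ X0) (qrep ρ X0 (kInv_inv f ρ)) hTQ (by omega) ?_ n
        let σ := qrep ρ X0 (kInv_inv f ρ)
        intro N hN hF
        refine ⟨1, one_ne_zero, ?_⟩
        -- the pairing
        let D : A → (X ⧸ X0) →ₗ[k] X := fun b => X0.liftQ (ρ (a b) - LinearMap.id) (by
          intro v hv
          exact sub_eq_zero.2 (hv (a b) (a_ker b)))
        have hDX : ∀ b, ∀ v : kInv f σ, D b v ∈ X0 := by
          rintro b ⟨v, hv⟩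
          obtain ⟨v, rfl⟩ := Submodule.mkQ_surjective _ v
          have := hv (a b) (a_ker b)
          rw [qrep_apply] at this
          have h2 := sub_eq_zero.2 this
          rw [← map_sub, Submodule.mkQ_apply, Submodule.Quotient.mk_eq_zero] at h2
          exact h2
        have hDadd : ∀ b c, ∀ v : kInv f σ, D (b + c) v = D b v + D c v := by
          intro b c v
          have h2 := hDX c v
          obtain ⟨v, hv⟩ := v
          obtain ⟨v, rfl⟩ := Submodule.mkQ_surjective _ v
          have h3 : ρ (a b) (ρ (a c) v - v) = ρ (a c) v - v := h2 (a b) (a_ker b)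
          change ρ (a (b + c)) v - v = (ρ (a b) v - v) + (ρ (a c) v - v)
          rw [a_add, map_mul, Module.End.mul_apply]
          rw [map_sub] at h3
          rw [sub_eq_sub_iff_add_eq_add] at h3
          rw [← sub_eq_zero] at h3 ⊢
          rw [← h3]; abel
        let β : N →+ A →+ X0 := AddMonoidHom.mk' (fun v => AddMonoidHom.mk' (fun b => (⟨D b v, hDX b v⟩ : X0))
          (fun b c => Subtype.ext (hDadd b c v))) (by
            intro v w
            ext b
            simp)
        have hinv : ∀ g, ∀ x ∈ AddSubgroup.closure {c | ∃ v b, β v b = c}, srep ρ X0 (kInv_inv f ρ) g x ∈ AddSubgroup.closure {c | ∃ v b, β v b = c} := by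
          intro g x hx
          induction hx using AddSubgroup.closure_induction with
          | mem c hc =>
            obtain ⟨v, b, rfl⟩ := hc
            obtain ⟨b', hb'⟩ := a_surj (g * a b * g⁻¹) (by simp [a_ker])
            refine AddSubgroup.subset_closure ⟨⟨srep σ _ (kInv_inv f σ) g v, hN g v v.2⟩, b', ?_⟩
            apply Subtype.ext
            obtain ⟨⟨v, hv⟩, hv2⟩ := v
            obtain ⟨v, rfl⟩ := Submodule.mkQ_surjective _ v
            change ρ (a b') (ρ g v) - ρ g v = ρ g (ρ (a b) v - v)
            rw [hb', map_sub, ← Module.End.mul_apply, ← Module.End.mul_apply, ← map_mul, ← map_mul]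
            simp
          | zero => rw [map_zero]; exact zero_mem _
          | add x y _ _ hx hy => rw [map_add]; exact add_mem hx hy
          | neg x _ hx => rw [map_neg]; exact neg_mem hx
        obtain ⟨m, hm, e⟩ := hav _ hinv (Fm_bilspan β hF hA)
        intro v hv
        rw [one_smul]
        apply Subtype.ext
        have hz : ∀ b, D b v = 0 := by
          intro b
          have := e _ (AddSubgroup.subset_closure ⟨⟨v, hv⟩, b, rfl⟩)
          exact congrArg Subtype.val (hX0 _ m hm this)
        obtain ⟨v, hv1⟩ := v
        obtain ⟨v, rfl⟩ := Submodule.mkQ_surjective _ v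
        change X0.mkQ v = 0
        rw [Submodule.mkQ_apply, Submodule.Quotient.mk_eq_zero]
        intro x hx
        obtain ⟨b, rfl⟩ := a_surj x hx
        exact sub_eq_zero.1 (hz b)

lemma UU_of_triv {π : Set ℕ} {p : ℕ} (f : Γ →* Γ') (hf : Function.Surjective f)
    {A : Type} [AddCommGroup A] (hA : Fm π A) (a : A → Γ) (a_add : ∀ x y, a (x + y) = a x * a y)
    (a_ker : ∀ x, f (a x) = 1) (a_surj : ∀ x, f x = 1 → ∃ y, a y = x)
    (htriv : ∀ (k : Type) [CommRing k], PK p k → ∀ (Y : Type) [AddCommGroup Y] [Module k Y] [Module.Finite k Y]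
      (ρ : Representation k Γ Y), TF Y →
      (∀ x, f x = 1 → ∀ v, ρ x v = v) → Av π ρ → ∀ n, Tor (gH ρ n)) : UU π p Γ := by
  intro k _ hk W _ _ _ ρ hW hav n
  exact red hk f hf hA a a_add a_ker a_surj (htriv k hk) _ W ρ hW le_rfl (hav.srep _ _) n
end
end TB

namespace TB

section
variable {k : Type} [CommRing k] {Γ : Type} [Group Γ] {X : Type} [AddCommGroup X] [Module k X]
variable {K : Type} [Group K]

/-- Cohomology of torsion-free abelian groups with trivial coefficients. -/
lemma tfcoh {π : Set ℕ} {p : ℕ} (hk : PK p k) [Module.Finite k X] (hX : TF X)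
    {A : Type} [AddCommGroup A] (hA : Fm π A) (a : A → K) (a_add : ∀ x y, a (x + y) = a x * a y)
    (a_surj : Function.Surjective a) (hcomm : ∀ x y : K, x * y = y * x)
    (htf : ∀ (x : K) (m : ℕ), m ≠ 0 → x ^ m = 1 → x = 1)
    (θ : Γ →* MulAut K) (ρ : Representation k Γ X) (σ : Representation k K X) (hσ : ∀ x v, σ x v = v)
    (hc : ∀ g h v, ρ g (σ h v) = σ (θ g h) (ρ g v)) (hav : Av π ρ) (n : ℕ) :
    TF (gH σ n) ∧ Module.Finite k (gH σ n) ∧ Av π (HHrep θ ρ σ hc n) := by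
  induction n with
  | zero =>
    refine ⟨hX.sub (h0 σ).toAddMonoidHom (h0_inj σ), hk.finj (h0 σ) (h0_inj σ), ?_⟩
    refine Av.comap (ρ := HHrep θ ρ σ hc 0) (ρ' := ρ) hav (h0 σ).toAddMonoidHom ?_ 1 one_ne_zero ?_
    · intro g x
      rw [HHrep_apply]
      exact h0_gmap _ _ _ _
    · intro x hx
      rw [one_smul]
      exact h0_inj _ (hx.trans (map_zero _).symm)
  | succ n ih =>
    obtain ⟨h1, h2, h3⟩ := ih
    have hls := hk.lsW hX
    let L : A → gH σ (n + 1) →ₗ[k] gH σ n := fun x => iotaH σ hσ (a x) (hcomm _) n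
    have Ladd : ∀ x y c, L (x + y) c = L x c + L y c := by
      intro x y c
      have := iota_mul hls hcomm htf σ hσ (a x) (a y) n c
      rw [← this]
      simp only [L, a_add]
    let Lh : gH σ (n + 1) →+ A →+ gH σ n := AddMonoidHom.mk' (fun c => AddMonoidHom.mk' (fun x => L x c) (fun x y => Ladd x y c))
      (fun c d => by ext x; exact map_add (L x) c d)
    have Linj : ∀ c, (∀ x, L x c = 0) → c = 0 := by
      intro c h
      refine iota_inj hls hcomm htf σ hσ n c fun z => ?_
      obtain ⟨x, rfl⟩ := a_surj z
      exact h x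
    have Leq : ∀ g x c, ∃ y, HHrep θ ρ σ hc n g (L x c) = L y (HHrep θ ρ σ hc (n + 1) g c) := by
      intro g x c
      obtain ⟨y, hy⟩ := a_surj (θ g (a x))
      refine ⟨y, ?_⟩
      have := iotaH_gmap (σ := σ) (τ := σ) hσ hσ (θ g⁻¹).toMonoidHom (ρ g) (fun x v => by
        rw [hc]; simp) (a y) (hcomm _) (hcomm _) n c
      rw [HHrep_apply, HHrep_apply]
      refine Eq.trans ?_ this.symm
      congr 2
      simp only [L]
      congr 1
      simp [hy]
    refine ⟨?_, ?_, ?_⟩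
    · intro c m hm e
      refine Linj c fun x => h1 _ m hm ?_
      rw [← map_nsmul, e, map_zero]
    · obtain ⟨T, hT⟩ := hA _ (Or.inl rfl)
      let Φ : gH σ (n + 1) →ₗ[k] (T → gH σ n) := LinearMap.pi fun t => L t
      refine hk.finj Φ ?_
      rw [injective_iff_map_eq_zero]
      intro c hc0
      refine Linj c fun x => ?_
      obtain ⟨s, hs, hx⟩ := hT x
      refine h1 _ s hs ?_
      change s • Lh c x = 0
      rw [← map_nsmul]
      have : AddSubgroup.closure (T : Set A) ≤ (Lh c).ker := by
        rw [AddSubgroup.closure_le]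
        intro t ht
        exact congrFun hc0 ⟨t, ht⟩
      exact this hx
    · intro N hN hF
      let β : N →+ A →+ gH σ n := Lh.comp N.subtype
      have hinv : ∀ g, ∀ x ∈ AddSubgroup.closure {c | ∃ v b, β v b = c}, HHrep θ ρ σ hc n g x ∈ AddSubgroup.closure {c | ∃ v b, β v b = c} := by
        intro g x hx
        induction hx using AddSubgroup.closure_induction with
        | mem c hc' =>
          obtain ⟨v, b, rfl⟩ := hc'
          obtain ⟨y, hy⟩ := Leq g b v
          exact AddSubgroup.subset_closure ⟨⟨_, hN g v v.2⟩, y, hy.symm⟩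
        | zero => rw [map_zero]; exact zero_mem _
        | add x y _ _ hx hy => rw [map_add]; exact add_mem hx hy
        | neg x _ hx => rw [map_neg]; exact neg_mem hx
      obtain ⟨m, hm, e⟩ := h3 _ hinv (Fm_bilspan β hF hA)
      refine ⟨1, one_ne_zero, fun c hc' => ?_⟩
      rw [one_smul]
      exact Linj c fun x => h1 _ m hm (e _ (AddSubgroup.subset_closure ⟨⟨c, hc'⟩, x, rfl⟩))

/-- Torsion-free kernel. -/
lemma UU_tf {Γ' : Type} [Group Γ'] {π : Set ℕ} {p : ℕ} (f : Γ →* Γ') (hf : Function.Surjective f) (hU : UU π p Γ')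
    {A : Type} [AddCommGroup A] (hA : Fm π A) (hTA : TF A) (a : A → Γ) (a_add : ∀ x y, a (x + y) = a x * a y)
    (a_inj : Function.Injective a)
    (a_ker : ∀ x, f (a x) = 1) (a_surj : ∀ x, f x = 1 → ∃ y, a y = x) : UU π p Γ := by
  refine UU_of_triv f hf hA a a_add a_ker a_surj ?_
  intro k _ hk Y _ _ _ ρ hY htriv hav n
  rcases n with _ | n
  · exact Tor_gH0 hav
  have a0 : a 0 = 1 := by
    have := a_add 0 0
    rw [add_zero] at this
    exact left_eq_mul.1 this
  have apow : ∀ (m : ℕ) x, a (m • x) = a x ^ m := by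
    intro m x
    induction m with
    | zero => rw [zero_smul, a0, pow_zero]
    | succ m ih => rw [succ_nsmul, a_add, ih, pow_succ]
  have key := fun j => tfcoh hk hY hA (fun x => (⟨a x, a_ker x⟩ : f.ker)) (fun x y => Subtype.ext (a_add x y))
    (fun x => by obtain ⟨y, hy⟩ := a_surj x x.2; exact ⟨y, Subtype.ext hy⟩)
    (by
      intro x y
      obtain ⟨b, hb⟩ := a_surj x x.2
      obtain ⟨c, hc⟩ := a_surj y y.2
      apply Subtype.ext
      change (x : Γ) * y = y * x
      rw [← hb, ← hc, ← a_add, ← a_add, add_comm])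
    (by
      intro x m hm e
      obtain ⟨y, hy⟩ := a_surj x x.2
      apply Subtype.ext
      have e2 : (x : Γ) ^ m = 1 := congrArg Subtype.val e
      change (x : Γ) = 1
      rw [← hy, ← apow] at e2
      rw [← hy, hTA y m hm (a_inj (e2.trans a0.symm)), a0])
    MulAut.conjNormal ρ (res f.ker.subtype ρ) (fun x v => htriv x x.2 v) (conj_compat ρ f.ker) hav j
  refine LHS f hf (P := fun M _ _ => Tor M) (SC_T k) ρ (fun i j hij => ?_) n
  obtain ⟨h1, h2, h3⟩ := key j
  exact hU.full hk (hQ f hf ρ j) (Av.of_surj f (ρ := hrep f ρ j) (fun g v => by rw [hQ_apply]) h3) i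
end
end TB

namespace TB

section
variable {k : Type} [CommRing k] {Γ : Type} [Group Γ]
variable {N : Type} [AddCommGroup N] {V : Type} [AddCommGroup V] [Module k V] {V' : Type} [AddCommGroup V'] [Module k V']

def homrep (ν : Representation ℤ Γ N) (ρ : Representation k Γ V) : Representation k Γ (N →+ V) where
  toFun g :=
    { toFun := fun φ => ((ρ g).toAddMonoidHom.comp φ).comp (ν g⁻¹).toAddMonoidHom
      map_add' := fun φ ψ => by ext x; exact map_add (ρ g) _ _
      map_smul' := fun c φ => by ext x; exact map_smul (ρ g) c _ }
  map_one' := by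
    apply LinearMap.ext; intro φ; apply AddMonoidHom.ext; intro x
    change ρ 1 (φ (ν 1⁻¹ x)) = φ x
    simp
  map_mul' a b := by
    apply LinearMap.ext; intro φ; apply AddMonoidHom.ext; intro x
    change ρ (a * b) (φ (ν (a * b)⁻¹ x)) = ρ a (ρ b (φ (ν b⁻¹ (ν a⁻¹ x))))
    rw [mul_inv_rev, map_mul, map_mul]; rfl

lemma homrep_apply (ν : Representation ℤ Γ N) (ρ : Representation k Γ V) (g : Γ) (φ : N →+ V) (x : N) :
    homrep ν ρ g φ x = ρ g (φ (ν g⁻¹ x)) := rfl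

/-- post-composition -/
def homc (N : Type) [AddCommGroup N] (q : V →ₗ[k] V') : (N →+ V) →ₗ[k] (N →+ V') where
  toFun φ := q.toAddMonoidHom.comp φ
  map_add' φ ψ := by ext x; exact map_add q _ _
  map_smul' c φ := by ext x; exact map_smul q c _

lemma homc_apply (q : V →ₗ[k] V') (φ : N →+ V) (x : N) : homc N q φ x = q (φ x) := rfl

lemma homrep_good {π : Set ℕ} {p : ℕ} (hk : PK p k) [Module.Finite k V] (hV : TF V) (hN : Fm π N)
    (ν : Representation ℤ Γ N) (ρ : Representation k Γ V) (hav : Av π ρ) :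
    TF (N →+ V) ∧ Module.Finite k (N →+ V) ∧ Av π (homrep ν ρ) := by
  refine ⟨?_, ?_, ?_⟩
  · intro φ m hm e
    ext x
    exact hV _ m hm (DFunLike.congr_fun e x)
  · obtain ⟨T, hT⟩ := hN _ (Or.inl rfl)
    let Φ : (N →+ V) →ₗ[k] (T → V) :=
      { toFun := fun φ t => φ t, map_add' := fun _ _ => rfl, map_smul' := fun _ _ => rfl }
    refine hk.finj Φ ?_
    rw [injective_iff_map_eq_zero]
    intro φ h0
    ext x
    obtain ⟨s, hs, hx⟩ := hT x
    refine hV _ s hs ?_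
    rw [← map_nsmul]
    have : AddSubgroup.closure (T : Set N) ≤ φ.ker := by
      rw [AddSubgroup.closure_le]
      intro t ht
      exact congrFun h0 ⟨t, ht⟩
    exact this hx
  · intro B hB hF
    let β : B →+ N →+ V := B.subtype
    have hinv : ∀ g, ∀ x ∈ AddSubgroup.closure {c | ∃ v b, β v b = c}, ρ g x ∈ AddSubgroup.closure {c | ∃ v b, β v b = c} := by
      intro g x hx
      induction hx using AddSubgroup.closure_induction with
      | mem c hc' =>
        obtain ⟨v, b, rfl⟩ := hc'
        refine AddSubgroup.subset_closure ⟨⟨_, hB g v v.2⟩, ν g b, ?_⟩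
        change ρ g ((v : N →+ V) (ν g⁻¹ (ν g b))) = _
        rw [Representation.inv_self_apply]; rfl
      | zero => rw [map_zero]; exact zero_mem _
      | add x y _ _ hx hy => rw [map_add]; exact add_mem hx hy
      | neg x _ hx => rw [map_neg]; exact neg_mem hx
    obtain ⟨m, hm, e⟩ := hav _ hinv (Fm_bilspan β hF hN)
    refine ⟨m, hm, fun c hc' => ?_⟩
    ext x
    exact e _ (AddSubgroup.subset_closure ⟨⟨c, hc'⟩, x, rfl⟩)

/-- the action on an invariant subgroup -/
def subNu (ρ : Representation k Γ V) (N : AddSubgroup V) (hN : ∀ g, ∀ x ∈ N, ρ g x ∈ N) : Representation ℤ Γ N where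
  toFun g := ((((ρ g).toAddMonoidHom.comp N.subtype).codRestrict N (fun x => hN g x x.2))).toIntLinearMap
  map_one' := by
    apply LinearMap.ext; intro x; apply Subtype.ext
    change ρ 1 (x : V) = x
    simp
  map_mul' a b := by
    apply LinearMap.ext; intro x; apply Subtype.ext
    change ρ (a * b) (x : V) = ρ a (ρ b x)
    simp

lemma Av_tfquo {π : Set ℕ} {p : ℕ} (hU : UU π p Γ) (hk : PK p k) [Module.Finite k V] [Module.Finite k V']
    (hV : TF V) (hV' : TF V') (ρ : Representation k Γ V) (ρ' : Representation k Γ V') (q : V →ₗ[k] V')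
    (hq : ∀ g v, q (ρ g v) = ρ' g (q v)) (sq : Function.Surjective q) (hav : Av π ρ) : Av π ρ' := by
  intro N hN hF
  have inv : ∀ g, ∀ v ∈ LinearMap.ker q, ρ g v ∈ LinearMap.ker q := by
    intro g v hv
    rw [LinearMap.mem_ker] at hv ⊢
    rw [hq, hv, map_zero]
  let ν := subNu ρ' N hN
  let W1 := LinearMap.ker q
  haveI := hk.fsub W1
  have g1 := homrep_good (k := k) (V := W1) hk (hV.sub W1.subtype.toAddMonoidHom Subtype.val_injective) hF ν (srep ρ W1 inv)
    (hav.srep W1 inv)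
  haveI := hk.free hV'
  obtain ⟨s, hs⟩ := Module.projective_lifting_property q LinearMap.id sq
  have ses := gses (σ := homrep ν (srep ρ W1 inv)) (τ := homrep ν ρ) (υ := homrep ν ρ') (homc N W1.subtype) (homc N q)
    (fun x v => rfl) (fun x v => by ext y; exact hq _ _) (by
      intro a b h
      ext y
      exact DFunLike.congr_fun h y) (by
      intro φ
      refine ⟨homc N s φ, ?_⟩
      ext y
      exact LinearMap.congr_fun hs (φ y)) (by
      intro φ
      constructor
      · intro h
        refine ⟨AddMonoidHom.codRestrict φ W1.toAddSubgroup (fun x => DFunLike.congr_fun h x), ?_⟩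
        rfl
      · rintro ⟨w, rfl⟩
        ext y
        exact (w y).2)
  obtain ⟨c, hc⟩ := h0_surj (homrep ν ρ') N.subtype (by
    intro g
    ext y
    change ρ' g (ρ' g⁻¹ (y : V')) = y
    simp)
  haveI := g1.2.1
  obtain ⟨m, hm, e⟩ := hU k hk _ (homrep ν (srep ρ W1 inv)) g1.1 g1.2.2 1 (ses.δ 0 c)
  rw [← map_nsmul] at e
  obtain ⟨b, hb⟩ := ses.exact3 0 _ e
  have h2 := congrArg (h0 _) hb
  rw [h0_gmap, map_nsmul, hc] at h2
  obtain ⟨m', hm', e'⟩ := hav.map hF (fun g => ν g) (h0 _ b) (by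
    intro g x
    have := DFunLike.congr_fun (h0_inv _ b g) (ν g x)
    rw [homrep_apply, Representation.inv_self_apply] at this
    exact this.symm)
  refine ⟨m' * m, mul_ne_zero hm' hm, fun x hx => ?_⟩
  have h3 := DFunLike.congr_fun h2 ⟨x, hx⟩
  have h4 : q (h0 _ b ⟨x, hx⟩) = m • x := h3
  rw [mul_smul, ← h4, ← map_nsmul, e', map_zero]

/-- closure under quotients -/
lemma Av_quo {π : Set ℕ} {p : ℕ} (hU : UU π p Γ) (hk : PK p k) [Module.Finite k V] 
    (ρ : Representation k Γ V) (ρ' : Representation k Γ V') (q : V →ₗ[k] V')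
    (hq : ∀ g v, q (ρ g v) = ρ' g (q v)) (sq : Function.Surjective q) (hav : Av π ρ) : Av π ρ' := by
  haveI : Module.Finite k V' := Module.Finite.of_surjective q sq
  obtain ⟨e, he, h⟩ := tors_bdd (W := V') hk
  have hle : tors k V ≤ (tors k V').comap q := by
    rintro x ⟨m, hm, e⟩
    exact ⟨m, hm, by rw [← map_nsmul, e, map_zero]⟩
  have h1 := Av_tfquo hU hk (TF_quo (W := V)) (TF_quo (W := V')) (qrep ρ _ (tors_inv ρ)) (qrep ρ' _ (tors_inv ρ'))
    ((tors k V).mapQ (tors k V') q hle) (by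
      intro g v
      obtain ⟨v, rfl⟩ := Submodule.mkQ_surjective _ v
      rw [qrep_apply]
      change (tors k V').mkQ (q (ρ g v)) = qrep ρ' _ _ g ((tors k V').mkQ (q v))
      rw [qrep_apply, hq]) (by
      intro v
      obtain ⟨v, rfl⟩ := Submodule.mkQ_surjective _ v
      obtain ⟨w, rfl⟩ := sq v
      exact ⟨(tors k V).mkQ w, rfl⟩) (Av_quo_tors hk hav)
  refine Av.comap (ρ := ρ') (ρ' := qrep ρ' _ (tors_inv ρ')) h1 (tors k V').mkQ.toAddMonoidHom (fun g x => rfl) e he ?_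
  intro x hx
  exact h x ((Submodule.Quotient.mk_eq_zero _).1 hx)

lemma Av_ext {π : Set ℕ} {U : Type} [AddCommGroup U] [Module k U] (ρ₀ : Representation k Γ U)
    (ρ : Representation k Γ V) (ρ' : Representation k Γ V') (i : U →ₗ[k] V) (q : V →ₗ[k] V')
    (hi : ∀ g v, i (ρ₀ g v) = ρ g (i v))
    (hq : ∀ g v, q (ρ g v) = ρ' g (q v)) (ii : Function.Injective i) (ex : ∀ v, q v = 0 → ∃ u, i u = v)
    (h1 : Av π ρ₀) (h2 : Av π ρ') : Av π ρ := by
  intro N hN hF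
  obtain ⟨m, hm, e⟩ := h2.map hF (fun g (x : N) => ⟨ρ g x, hN g x x.2⟩) (q.toAddMonoidHom.comp N.subtype) (fun g x => hq g x)
  have key : ∀ x : N, ∃ u, i u = m • (x : V) := by
    intro x
    refine ex _ ?_
    rw [map_nsmul]; exact e x
  choose u hu using key
  obtain ⟨m', hm', e'⟩ := h1.map hF (fun g (x : N) => ⟨ρ g x, hN g x x.2⟩)
    (AddMonoidHom.mk' u (fun x y => ii (by rw [map_add, hu, hu, hu, ← smul_add]; rfl)))
    (fun g x => ii (by
      change i (u _) = i (ρ₀ g (u x))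
      rw [hu, hi, hu, map_nsmul]))
  refine ⟨m' * m, mul_ne_zero hm' hm, fun x hx => ?_⟩
  have := e' ⟨x, hx⟩
  have h5 : i (m' • u ⟨x, hx⟩) = 0 := by
    rw [show m' • u ⟨x, hx⟩ = 0 from this, map_zero]
  rw [map_nsmul, hu] at h5
  rw [mul_smul]; exact h5

def GG (π : Set ℕ) (ρ : Representation k Γ V) : Prop := Module.Finite k V ∧ Av π ρ

lemma GG_mid {π : Set ℕ} {p : ℕ} (hU : UU π p Γ) (hk : PK p k) {U : Type} [AddCommGroup U] [Module k U]
    (ρ₀ : Representation k Γ U) (ρ : Representation k Γ V) (ρ' : Representation k Γ V') (i : U →ₗ[k] V) (q : V →ₗ[k] V')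
    (hi : ∀ g v, i (ρ₀ g v) = ρ g (i v)) (hq : ∀ g v, q (ρ g v) = ρ' g (q v)) 
    (ex : ∀ v, q v = 0 ↔ ∃ u, i u = v) (h1 : GG π ρ₀) (h2 : GG π ρ') : GG π ρ := by
  obtain ⟨f1, a1⟩ := h1
  obtain ⟨f2, a2⟩ := h2
  have inv : ∀ g, ∀ v ∈ LinearMap.range i, ρ g v ∈ LinearMap.range i := by
    rintro g _ ⟨u, rfl⟩
    exact ⟨ρ₀ g u, hi g u⟩
  have a3 : Av π (srep ρ (LinearMap.range i) inv) :=
    Av_quo hU hk ρ₀ _ i.rangeRestrict (fun g v => Subtype.ext (hi g v)) (LinearMap.surjective_rangeRestrict i) a1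
  refine ⟨?_, Av_ext (srep ρ (LinearMap.range i) inv) ρ ρ' (LinearMap.range i).subtype q (fun g v => rfl) hq
    Subtype.val_injective (fun v hv => by
      obtain ⟨u, rfl⟩ := (ex v).1 hv
      exact ⟨⟨_, u, rfl⟩, rfl⟩) a3 a2⟩
  haveI := hk.fsub (LinearMap.range q)
  have e : LinearMap.ker q = LinearMap.range i := by
    ext v
    exact ex v
  haveI : Module.Finite k (LinearMap.ker q) := by rw [e]; infer_instance
  haveI : Module.Finite k (V ⧸ LinearMap.ker q) := Module.Finite.equiv q.quotKerEquivRange.symm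
  exact Module.Finite.of_submodule_quotient (LinearMap.ker q)
end
end TB

namespace TB

section
variable {k : Type} [CommRing k] {Γ : Type} [Group Γ]

/-- A group acting on a complex. -/
structure RAct (Γ : Type) [Group Γ] (C : RC k) where
  t : Γ → RHom C C
  one : ∀ n x, (t 1).f n x = x
  mul : ∀ a b n x, (t (a * b)).f n x = (t a).f n ((t b).f n x)

lemma RHom.H_cl' {C D : RC k} (φ : RHom C D) (n : ℕ) (x : C.X n) (hx) :
    φ.H n (C.cl n x hx) = D.cl n (φ.f n x) (φ.map_Z n x hx) := rfl

def RAct.rep {C : RC k} (T : RAct Γ C) (n : ℕ) : Representation k Γ (C.H n) where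
  toFun g := (T.t g).H n
  map_one' := by
    apply LinearMap.ext; intro c
    obtain ⟨x, hx, rfl⟩ := C.cl_surj n c
    rw [RHom.H_cl']
    simp only [T.one]; rfl
  map_mul' a b := by
    apply LinearMap.ext; intro c
    obtain ⟨x, hx, rfl⟩ := C.cl_surj n c
    change (T.t (a * b)).H n (C.cl n x hx) = (T.t a).H n ((T.t b).H n (C.cl n x hx))
    rw [RHom.H_cl', RHom.H_cl', RHom.H_cl']
    simp only [T.mul]

lemma RAct.rep_apply {C : RC k} (T : RAct Γ C) (n : ℕ) (g : Γ) (c : C.H n) : T.rep n g c = (T.t g).H n c := rfl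

lemma RAct.equiv {C D : RC k} (T : RAct Γ C) (S : RAct Γ D) (φ : RHom C D)
    (e : ∀ g n x, φ.f n ((T.t g).f n x) = (S.t g).f n (φ.f n x)) (n : ℕ) (g : Γ) (c : C.H n) :
    φ.H n (T.rep n g c) = S.rep n g (φ.H n c) := by
  obtain ⟨x, hx, rfl⟩ := C.cl_surj n c
  rw [RAct.rep_apply, RAct.rep_apply, RHom.H_cl', RHom.H_cl', RHom.H_cl', RHom.H_cl']
  simp only [e]

/-- kernel of a map of complexes -/
def kerRC {C D : RC k} (φ : RHom C D) : RC k where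
  X n := LinearMap.ker (φ.f n)
  d n := (C.d n).restrict (fun x hx => by
    rw [LinearMap.mem_ker] at hx ⊢
    rw [φ.comm, hx, map_zero])
  dd n x := Subtype.ext (C.dd n x)

def kerI {C D : RC k} (φ : RHom C D) : RHom (kerRC φ) C where
  f n := (LinearMap.ker (φ.f n)).subtype
  comm n x := rfl

def kerP {C D E : RC k} (φ : RHom C D) (ψ : RHom D E) (h : ∀ n x, ψ.f n (φ.f n x) = 0) : RHom C (kerRC ψ) where
  f n := (φ.f n).codRestrict _ (h n)
  comm n x := Subtype.ext (φ.comm n x)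

lemma kerSES {C D E : RC k} (φ : RHom C D) (ψ : RHom D E) (h : ∀ n x, ψ.f n (φ.f n x) = 0)
    (ex : ∀ n y, ψ.f n y = 0 → ∃ x, φ.f n x = y) : RSES (kerI φ) (kerP φ ψ h) where
  inj n := Subtype.val_injective
  surj n := by
    rintro ⟨y, hy⟩
    obtain ⟨x, hx⟩ := ex n y hy
    exact ⟨x, Subtype.ext hx⟩
  zero n x := Subtype.ext x.2
  ex n y hy := ⟨⟨y, congrArg Subtype.val hy⟩, rfl⟩

def kerAct {C D : RC k} (φ : RHom C D) (T : RAct Γ C) (S : RAct Γ D)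
    (e : ∀ g n x, φ.f n ((T.t g).f n x) = (S.t g).f n (φ.f n x)) : RAct Γ (kerRC φ) where
  t g :=
    { f := fun n => ((T.t g).f n).restrict (fun x hx => by
        rw [LinearMap.mem_ker] at hx ⊢
        rw [e, hx, map_zero])
      comm := fun n x => Subtype.ext ((T.t g).comm n (Subtype.val x)) }
  one n x := Subtype.ext (T.one n (Subtype.val x))
  mul a b n x := Subtype.ext (T.mul a b n (Subtype.val x))

lemma GG_sub {V V' : Type} [AddCommGroup V] [Module k V] [AddCommGroup V'] [Module k V'] {π : Set ℕ} {p : ℕ} (hk : PK p k)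
    (ρ : Representation k Γ V) (ρ' : Representation k Γ V') (i : V →ₗ[k] V')
    (hi : ∀ g v, i (ρ g v) = ρ' g (i v)) (ii : Function.Injective i) (h : GG π ρ') : GG π ρ := by
  haveI := h.1
  refine ⟨hk.finj i ii, Av.comap (ρ := ρ) (ρ' := ρ') h.2 i.toAddMonoidHom hi 1 one_ne_zero fun x hx => ?_⟩
  rw [one_smul]
  exact ii (hx.trans (map_zero i).symm)

/-- The abstract Čech argument. -/
lemma cech_abs {π : Set ℕ} {p : ℕ} (hU : UU π p Γ) (hk : PK p k)
    (C : ℕ → RC k) (T : ∀ q, RAct Γ (C q)) (D : ∀ q, RHom (C q) (C (q + 1)))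
    (hD : ∀ q g n x, (D q).f n (((T q).t g).f n x) = ((T (q + 1)).t g).f n ((D q).f n x))
    (dd : ∀ q n x, (D (q + 1)).f n ((D q).f n x) = 0)
    (ex0 : ∀ n x, (D 0).f n x = 0 → x = 0)
    (ex : ∀ q n y, (D (q + 1)).f n y = 0 → ∃ x, (D q).f n x = y)
    (hG : ∀ q n, GG π ((T (q + 1)).rep n)) (n : ℕ) : GG π ((T 0).rep n) := by
  let TZ : ∀ q, RAct Γ (kerRC (D q)) := fun q => kerAct (D q) (T q) (T (q + 1)) (hD q)
  have ses : ∀ q, RSES (kerI (D q)) (kerP (D q) (D (q + 1)) (dd q)) := fun q =>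
    kerSES (D q) (D (q + 1)) (dd q) (ex q)
  have hZ : ∀ n q, GG π ((TZ (q + 1)).rep n) := by
    intro n
    induction n with
    | zero =>
      intro q
      exact GG_sub hk ((TZ (q + 1)).rep 0) ((T (q + 1)).rep 0) ((kerI (D (q + 1))).H 0)
        (fun g c => RAct.equiv (TZ (q + 1)) (T (q + 1)) (kerI _) (fun _ _ _ => rfl) 0 g c) (ses (q + 1)).inj0 (hG q 0)
    | succ n ih =>
      intro q
      refine GG_mid hU hk ((TZ (q + 2)).rep n) ((TZ (q + 1)).rep (n + 1)) ((T (q + 1)).rep (n + 1))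
        ((ses (q + 1)).δ n) ((kerI (D (q + 1))).H (n + 1)) ?_
        (fun g c => RAct.equiv (TZ (q + 1)) (T (q + 1)) (kerI _) (fun _ _ _ => rfl) (n + 1) g c)
        ?_ (ih (q + 1)) (hG q (n + 1))
      · intro g v
        exact ((ses (q + 1)).δ_nat (ses (q + 1)) ((TZ (q + 1)).t g) ((T (q + 1)).t g) ((TZ (q + 2)).t g)
          (fun _ _ => rfl) (fun n x => Subtype.ext (hD (q + 1) g n x).symm) n v).symm
      · intro v
        constructor
        · exact (ses (q + 1)).exact1 n v
        · rintro ⟨u, rfl⟩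
          exact (ses (q + 1)).exact1' n u
  refine GG_sub hk ((T 0).rep n) ((TZ 1).rep n) ((kerP (D 0) (D 1) (dd 0)).H n)
    (fun g c => RAct.equiv (T 0) (TZ 1) (kerP (D 0) (D 1) (dd 0)) (fun g n x => Subtype.ext (hD 0 g n x)) n g c) ?_ (hZ n 0)
  rw [injective_iff_map_eq_zero]
  intro c hc
  obtain ⟨a, rfl⟩ := (ses 0).exact2 n c hc
  obtain ⟨x, hx, rfl⟩ := RC.cl_surj _ n a
  have : x = 0 := Subtype.ext (ex0 n _ x.2)
  subst this
  rw [RHom.H_cl', RC.cl_eq_zero, map_zero]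
  exact zero_mem _

end

section
variable {X Y : Type} [AddCommGroup X]

def dA (q : ℕ) (F : (Fin q → Y) → X) (x : Fin (q + 1) → Y) : X :=
  ∑ i : Fin (q + 1), (-1 : ℤ) ^ (i : ℕ) • F (fun j => x (i.succAbove j))

lemma dA_zero (F : (Fin 0 → Y) → X) (x : Fin 1 → Y) (y : Fin 0 → Y) : dA 0 F x = F y := by
  simp only [dA, Finset.univ_unique, Fin.default_eq_zero, Finset.sum_singleton]
  simp
  congr 1; exact Subsingleton.elim _ _

lemma dA_cons (q : ℕ) (F : (Fin (q + 1) → Y) → X) (s : Y) (y : Fin (q + 1) → Y) :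
    dA (q + 1) F (Fin.cons s y : Fin (q + 2) → Y) = F y - dA q (fun z => F (Fin.cons s z : Fin (q + 1) → Y)) y := by
  rw [dA, Fin.sum_univ_succ, dA, sub_eq_add_neg, ← Finset.sum_neg_distrib]
  congr 1
  · simp
  · refine Finset.sum_congr rfl fun i _ => ?_
    rw [Fin.val_succ, pow_succ, mul_neg_one, neg_smul]
    congr 3
    funext j
    refine Fin.cases ?_ (fun j => ?_) j
    · simp
    · simp

lemma dA_sub (q : ℕ) (F G : (Fin q → Y) → X) (x) : dA q (fun z => F z - G z) x = dA q F x - dA q G x := by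
  simp only [dA, smul_sub, Finset.sum_sub_distrib]

lemma dA_dA (q : ℕ) : ∀ (F : (Fin q → Y) → X) (x : Fin (q + 2) → Y), dA (q + 1) (dA q F) x = 0 := by
  induction q with
  | zero =>
    intro F x
    rw [← Fin.cons_self_tail x, dA_cons, dA_zero _ _ Fin.elim0, dA_zero _ _ Fin.elim0, dA_zero _ _ Fin.elim0, sub_self]
  | succ q ih =>
    intro F x
    rw [← Fin.cons_self_tail x, dA_cons]
    simp only [dA_cons]
    rw [dA_sub, ih]
    simp
end
end TB

namespace TB

section
variable {k : Type} [CommRing k] {Γ : Type} [Group Γ] {V : Type} [AddCommGroup V] [Module k V] {H : Type} [Group H]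

def gAct (θ : Γ →* MulAut H) (ρ : Representation k Γ V) (σ : Representation k H V)
    (hc : ∀ g h v, ρ g (σ h v) = σ (θ g h) (ρ g v)) : RAct Γ (gc σ) where
  t g := gmap (σ := σ) (τ := σ) (θ g⁻¹).toMonoidHom (ρ g) (fun x v => by
    rw [hc]; simp)
  one n F := funext fun t => by
    refine (gmap_f _ _ _ n F t).trans ?_
    have : (⇑(θ 1⁻¹).toMonoidHom ∘ t) = t := by funext i; simp
    rw [this]; simp
  mul a b n F := funext fun t => by
    have : (⇑(θ (a * b)⁻¹).toMonoidHom ∘ t) = (θ b⁻¹).toMonoidHom ∘ (⇑(θ a⁻¹).toMonoidHom ∘ t) := by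
      funext i; simp
    refine (gmap_f _ _ _ n F t).trans ?_
    rw [this, map_mul]
    rfl

lemma gAct_rep (θ : Γ →* MulAut H) (ρ : Representation k Γ V) (σ : Representation k H V)
    (hc : ∀ g h v, ρ g (σ h v) = σ (θ g h) (ρ g v)) (n : ℕ) : (gAct θ ρ σ hc).rep n = HHrep θ ρ σ hc n := rfl

variable {K : Type} [Group K] {M : Type} [CommGroup M] (a : M →* K)

/-- iterated fibre products -/
def Efb (q : ℕ) : Subgroup (K × (Fin q → M)) where
  carrier := {z | ∀ i, a (z.2 i) = z.1}
  one_mem' i := by simp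
  mul_mem' {x y} hx hy i := by
    change a (x.2 i * y.2 i) = x.1 * y.1
    rw [map_mul, hx, hy]
  inv_mem' {x} hx i := by
    change a (x.2 i)⁻¹ = x.1⁻¹
    rw [map_inv, hx]

def face {q : ℕ} (i : Fin (q + 1)) : Efb a (q + 1) →* Efb a q where
  toFun z := ⟨(z.1.1, fun j => z.1.2 (i.succAbove j)), fun j => z.2 _⟩
  map_one' := rfl
  map_mul' x y := rfl

variable (θ : Γ →* MulAut K) (θM : Γ →* MulAut M) (ha : ∀ g m, a (θM g m) = θ g (a m))

def thE (q : ℕ) : Γ →* MulAut (Efb a q) where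
  toFun g :=
    { toFun := fun z => ⟨(θ g z.1.1, fun j => θM g (z.1.2 j)), fun j => by
        change a (θM g (z.1.2 j)) = θ g z.1.1
        rw [ha, z.2 j]⟩
      invFun := fun z => ⟨(θ g⁻¹ z.1.1, fun j => θM g⁻¹ (z.1.2 j)), fun j => by
        change a (θM g⁻¹ (z.1.2 j)) = θ g⁻¹ z.1.1
        rw [ha, z.2 j]⟩
      left_inv := fun z => by
        apply Subtype.ext; apply Prod.ext
        · simp
        · funext j; simp
      right_inv := fun z => by
        apply Subtype.ext; apply Prod.ext
        · simp
        · funext j; simp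
      map_mul' := fun x y => by
        apply Subtype.ext; apply Prod.ext
        · simp
        · funext j; simp }
  map_one' := by
    apply MulEquiv.ext; intro z
    apply Subtype.ext; apply Prod.ext
    · simp
    · funext j; simp
  map_mul' g h := by
    apply MulEquiv.ext; intro z
    apply Subtype.ext; apply Prod.ext
    · simp
    · funext j; simp

/-- trivial representations -/
abbrev trv (k H V : Type) [CommRing k] [Group H] [AddCommGroup V] [Module k V] : Representation k H V :=
  Representation.trivial k H V

def faceR (k V : Type) [CommRing k] [AddCommGroup V] [Module k V] {q : ℕ} (i : Fin (q + 1)) : RHom (gc (trv k (Efb a q) V)) (gc (trv k (Efb a (q + 1)) V)) :=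
  gmap (σ := trv k (Efb a q) V) (τ := trv k (Efb a (q + 1)) V) (face a i) LinearMap.id (fun x v => rfl)

def cD (k V : Type) [CommRing k] [AddCommGroup V] [Module k V] (q : ℕ) : RHom (gc (trv k (Efb a q) V)) (gc (trv k (Efb a (q + 1)) V)) where
  f n := ∑ i : Fin (q + 1), (-1 : ℤ) ^ (i : ℕ) • (faceR a k V i).f n
  comm n x := by
    simp only [LinearMap.sum_apply, LinearMap.smul_apply, map_sum, map_zsmul, (faceR a k V _).comm]

lemma cD_f (q n : ℕ) (F : (Fin n → Efb a q) → V) (t : Fin n → Efb a (q + 1)) :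
    ((cD a k V q).f n F : (Fin n → Efb a (q + 1)) → V) t =
      ∑ i : Fin (q + 1), (-1 : ℤ) ^ (i : ℕ) • F (fun j => face a i (t j)) := by
  have : ∀ F' : (gc (trv k (Efb a q) V)).X n,
      (cD a k V q).f n F' = ∑ i : Fin (q + 1), (-1 : ℤ) ^ (i : ℕ) • (faceR a k V i).f n F' := by
    intro F'
    change (∑ i : Fin (q + 1), (-1 : ℤ) ^ (i : ℕ) • (faceR a k V i).f n) F' = _
    simp only [LinearMap.sum_apply, LinearMap.smul_apply]
  refine (congrFun (this F) t).trans ?_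
  refine (Finset.sum_apply (M := fun _ : (Fin n → Efb a (q + 1)) => V) t Finset.univ _).trans ?_
  rfl

abbrev Yk {n : ℕ} (κ : Fin n → K) : Type := {m : Fin n → M // ∀ j, a (m j) = κ j}

def bld {n q : ℕ} (κ : Fin n → K) (y : Fin q → Yk a κ) : Fin n → Efb a q :=
  fun j => ⟨(κ j, fun i => (y i).1 j), fun i => (y i).2 j⟩

lemma bld_surj {n q : ℕ} (t : Fin n → Efb a q) : ∃ κ, ∃ y : Fin q → Yk a κ, bld a κ y = t :=
  ⟨fun j => (t j).1.1, fun i => ⟨fun j => (t j).1.2 i, fun j => (t j).2 i⟩, rfl⟩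

lemma cD_bld (q n : ℕ) (F : (Fin n → Efb a q) → V) (κ : Fin n → K) (y : Fin (q + 1) → Yk a κ) :
    ((cD a k V q).f n F : (Fin n → Efb a (q + 1)) → V) (bld a κ y) = dA q (fun z => F (bld a κ z)) y := 
  cD_f a q n F _

lemma cD_eq {q n : ℕ} (F G : (Fin n → Efb a q) → V) (h : ∀ κ (y : Fin q → Yk a κ), F (bld a κ y) = G (bld a κ y)) : F = G := by
  funext t
  obtain ⟨κ, y, rfl⟩ := bld_surj a t
  exact h κ y

lemma cD_dd (q n : ℕ) (F : (Fin n → Efb a q) → V) :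
    (cD a k V (q + 1)).f n ((cD a k V q).f n F) = 0 := by
  refine cD_eq a _ (0 : (Fin n → Efb a (q + 2)) → V) fun κ y => ?_
  refine (cD_bld a (q + 1) n _ κ y).trans ?_
  have : (fun z => ((cD a k V q).f n F : (Fin n → Efb a (q + 1)) → V) (bld a κ z)) = dA q (fun z => F (bld a κ z)) :=
    funext fun z => cD_bld a q n F κ z
  exact (congrArg (fun Q => dA (q + 1) Q y) this).trans (dA_dA q _ y)

lemma cD_ex0 (sa : Function.Surjective a) (n : ℕ) (F : (Fin n → Efb a 0) → V) (h : (cD a k V 0).f n F = 0) : F = 0 := by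
  refine cD_eq a _ (0 : (Fin n → Efb a 0) → V) fun κ y => ?_
  have := congrFun h (bld a κ (fun _ => ⟨fun j => (sa (κ j)).choose, fun j => (sa (κ j)).choose_spec⟩))
  rw [cD_bld, dA_zero _ _ y] at this
  exact this

lemma cD_ex (sa : Function.Surjective a) (q n : ℕ) (F : (Fin n → Efb a (q + 1)) → V) (h : (cD a k V (q + 1)).f n F = 0) :
    ∃ G : (Fin n → Efb a q) → V, (cD a k V q).f n G = F := by
  let s : ∀ κ : Fin n → K, Yk a κ := fun κ => ⟨fun j => (sa (κ j)).choose, fun j => (sa (κ j)).choose_spec⟩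
  refine ⟨fun t => F (bld a (fun j => (t j).1.1) (Fin.cons (s _) (fun i => ⟨fun j => (t j).1.2 i, fun j => (t j).2 i⟩))), ?_⟩
  refine cD_eq a _ F fun κ y => ?_
  rw [cD_bld]
  have := congrFun h (bld a κ (Fin.cons (s κ) y))
  rw [cD_bld, dA_cons] at this
  exact (sub_eq_zero.1 this).symm

lemma cD_equiv (ρ : Representation k Γ V) (q : ℕ) (g : Γ) (n : ℕ) (F : (Fin n → Efb a q) → V) :
    (cD a k V q).f n (((gAct (thE a θ θM ha q) ρ (trv k (Efb a q) V) (fun _ _ _ => rfl)).t g).f n F) =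
    ((gAct (thE a θ θM ha (q + 1)) ρ (trv k (Efb a (q + 1)) V) (fun _ _ _ => rfl)).t g).f n ((cD a k V q).f n F) := by
  funext t
  refine (cD_f a q n _ t).trans ?_
  refine Eq.trans ?_ (congrArg (ρ g) (cD_f (k := k) a q n F (fun j => thE a θ θM ha (q + 1) g⁻¹ (t j)))).symm
  rw [map_sum]
  refine Finset.sum_congr rfl fun i _ => ?_
  rw [map_zsmul]
  rfl
end
end TB

namespace TB

lemma Fm_pi {π : Set ℕ} {B : Type} [AddCommGroup B] (h : Fm π B) (n : ℕ) : Fm π (Fin n → B) := by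
  induction n with
  | zero =>
    intro S hS
    exact ⟨∅, fun x => ⟨1, hS.ms.one, by rw [Subsingleton.elim (1 • x) 0]; exact zero_mem _⟩⟩
  | succ n ih =>
    refine Fm_ext (AddMonoidHom.mk' (fun (x : Fin n → B) => (Fin.cons 0 x : Fin (n + 1) → B)) ?_)
      (AddMonoidHom.mk' (fun (x : Fin (n + 1) → B) => x 0) (fun _ _ => rfl)) (fun b => ⟨fun _ => b, rfl⟩) ?_ ih h
    · intro x y
      funext i
      refine Fin.cases ?_ (fun i => ?_) i
      · simp
      · simp
    · intro b hb
      refine ⟨Fin.tail b, ?_⟩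
      have : b 0 = 0 := hb
      change Fin.cons 0 (Fin.tail b) = b
      rw [← this]; exact Fin.cons_self_tail b

section
variable {k : Type} [CommRing k] {Γ : Type} [Group Γ] {V : Type} [AddCommGroup V] [Module k V]
variable {K : Type} [Group K] {M : Type} [CommGroup M] (a : M →* K)

lemma C4 {π : Set ℕ} {p : ℕ} (hU : UU π p Γ) (hk : PK p k) [Module.Finite k V] (hV : TF V)
    (hM : Fm π (Additive M)) (htf : ∀ (x : M) (m : ℕ), m ≠ 0 → x ^ m = 1 → x = 1) (sa : Function.Surjective a)
    (θ : Γ →* MulAut K) (θM : Γ →* MulAut M) (ha : ∀ g m, a (θM g m) = θ g (a m))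
    (ρ : Representation k Γ V) (hav : Av π ρ) (σ : Representation k K V) (hσ : ∀ x v, σ x v = v)
    (hc : ∀ g h v, ρ g (σ h v) = σ (θ g h) (ρ g v)) (n : ℕ) : GG π (HHrep θ ρ σ hc n) := by
  have hinj : ∀ q (x y : Efb a (q + 1)), (∀ j, x.1.2 j = y.1.2 j) → x = y := by
    intro q x y h
    apply Subtype.ext; apply Prod.ext
    · rw [← x.2 0, ← y.2 0, h 0]
    · funext j; exact h j
  have main := cech_abs hU hk (fun q => gc (trv k (Efb a q) V))
    (fun q => gAct (thE a θ θM ha q) ρ (trv k (Efb a q) V) (fun _ _ _ => rfl)) (fun q => cD a k V q)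
    (fun q g n x => cD_equiv a θ θM ha ρ q g n x) (fun q n x => cD_dd a q n x) (fun n x => cD_ex0 a sa n x)
    (fun q n y hy => cD_ex a sa q n y hy) (fun q n => ?_) n
  · refine GG_sub hk (HHrep θ ρ σ hc n) _ ((gmap (σ := σ) (τ := trv k (Efb a 0) V)
      ((MonoidHom.fst K (Fin 0 → M)).comp (Efb a 0).subtype) LinearMap.id (fun x v => hσ _ _)).H n) ?_ ?_ main
    · intro g c
      rw [HHrep_apply]
      change _ = (gmap (σ := trv k (Efb a 0) V) (τ := trv k (Efb a 0) V) (thE a θ θM ha 0 g⁻¹).toMonoidHom (ρ g) (fun x v => rfl)).H n _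
      have hb : ∀ (x : Efb a 0) v, ρ g (σ (θ g⁻¹ x.1.1) v) = trv k (Efb a 0) V x (ρ g v) := by
        intro x v; rw [hσ]; rfl
      refine (gmap_comp _ _ _ _ _ _ ((θ g⁻¹).toMonoidHom.comp ((MonoidHom.fst K (Fin 0 → M)).comp (Efb a 0).subtype)) (ρ g) hb
        (fun x => rfl) (fun v => rfl) n c).trans ?_
      exact (gmap_comp _ _ _ _ _ _ ((θ g⁻¹).toMonoidHom.comp ((MonoidHom.fst K (Fin 0 → M)).comp (Efb a 0).subtype)) (ρ g) hb
        (fun x => rfl) (fun v => rfl) n c).symm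
    · let β : K →* Efb a 0 := 
        { toFun := fun x => ⟨(x, Fin.elim0), fun i => i.elim0⟩
          map_one' := Subtype.ext (Prod.ext rfl (Subsingleton.elim _ _))
          map_mul' := fun x y => Subtype.ext (Prod.ext rfl (Subsingleton.elim _ _)) }
      refine Function.LeftInverse.injective (g := (gmap (σ := trv k (Efb a 0) V) (τ := σ) β LinearMap.id (fun x v => (hσ _ _).symm)).H n) ?_
      intro c
      refine (gmap_comp _ _ _ _ _ _ (MonoidHom.id K) LinearMap.id (fun x v => rfl) (fun x => rfl) (fun v => rfl) n c).trans ?_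
      exact gmap_id _ _ _ (fun _ => rfl) (fun _ => rfl) n c
  · have hcm : ∀ x y : Efb a (q + 1), x * y = y * x := by
      intro x y
      refine hinj q _ _ fun j => ?_
      exact mul_comm (x.1.2 j) (y.1.2 j)
    letI : AddCommGroup (Additive (Efb a (q + 1))) :=
      { (inferInstance : AddGroup (Additive (Efb a (q + 1)))) with add_comm := fun x y => hcm x.toMul y.toMul }
    have := tfcoh (K := Efb a (q + 1)) hk hV (A := Additive (Efb a (q + 1))) ?_ (fun x => x.toMul) (fun x y => rfl)
      (fun x => ⟨Additive.ofMul x, rfl⟩) hcm ?_ (thE a θ θM ha (q + 1)) ρ (trv k (Efb a (q + 1)) V) (fun _ _ => rfl) (fun _ _ _ => rfl) hav n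
    · exact this.2
    · refine Fm_sub (B := Fin (q + 1) → Additive M)
        (AddMonoidHom.mk' (fun x j => Additive.ofMul (x.toMul.1.2 j)) (fun x y => rfl)) ?_ (Fm_pi hM _)
      intro x y h
      exact hinj q x.toMul y.toMul (fun j => congrFun h j)
    · intro x m hm e
      refine hinj q _ _ fun j => ?_
      refine htf _ m hm ?_
      have := congrArg (fun z : Efb a (q + 1) => z.1.2 j) e
      exact this
end

section
variable {Γ Γ' : Type} [Group Γ] [Group Γ']

lemma UU_nice {π : Set ℕ} {p : ℕ} (f : Γ →* Γ') (hf : Function.Surjective f) (hU : UU π p Γ')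
    {M : Type} [AddCommGroup M] (hM : Fm π M) (hTM : TF M) (μ : Representation ℤ Γ' M)
    (a : M → Γ) (a_add : ∀ x y, a (x + y) = a x * a y) (a_ker : ∀ x, f (a x) = 1)
    (a_surj : ∀ x, f x = 1 → ∃ y, a y = x) (a_eq : ∀ g x, a (μ (f g) x) = g * a x * g⁻¹) : UU π p Γ := by
  refine UU_of_triv f hf hM a a_add a_ker a_surj ?_
  intro k _ hk Y _ _ _ ρ hY htriv hav n
  rcases n with _ | n
  · exact Tor_gH0 hav
  have hcomm : ∀ x y : f.ker, x * y = y * x := by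
    intro x y
    obtain ⟨u, hu⟩ := a_surj x x.2
    obtain ⟨v, hv⟩ := a_surj y y.2
    apply Subtype.ext
    rw [Subgroup.coe_mul, Subgroup.coe_mul, ← hu, ← hv, ← a_add, ← a_add, add_comm]
  have hle : f.ker ≤ (MulAut.conjNormal (H := f.ker)).ker := by
    intro x hx
    rw [MonoidHom.mem_ker]
    apply MulEquiv.ext; intro y
    apply Subtype.ext
    rw [MulAut.conjNormal_apply]
    have := congrArg Subtype.val (hcomm ⟨x, hx⟩ y)
    simp only [Subgroup.coe_mul] at this
    rw [this, mul_inv_cancel_right]; rfl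
  let θ : Γ' →* MulAut f.ker := f.liftOfSurjective hf ⟨MulAut.conjNormal, hle⟩
  have hθ : ∀ g, θ (f g) = MulAut.conjNormal g := fun g => 
    MonoidHom.liftOfRightInverse_comp_apply f _ (Function.rightInverse_surjInv hf) ⟨MulAut.conjNormal, hle⟩ g
  have htriv' : ∀ x, f x = 1 → ρ x = 1 := fun x hx => LinearMap.ext (htriv x hx)
  let ρ' := desc f hf ρ htriv'
  have hρ' : ∀ g, ρ' (f g) = ρ g := desc_apply f hf ρ htriv'
  have hav' : Av π ρ' := Av.of_surj f (fun g v => by rw [hρ']) hav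
  let θM : Γ' →* MulAut (Multiplicative M) :=
    { toFun := fun g => 
        { toFun := fun x => Multiplicative.ofAdd (μ g x.toAdd)
          invFun := fun x => Multiplicative.ofAdd (μ g⁻¹ x.toAdd)
          left_inv := fun x => Representation.inv_self_apply μ g _
          right_inv := fun x => Representation.self_inv_apply μ g _
          map_mul' := fun x y => map_add (μ g) x.toAdd y.toAdd }
      map_one' := by
        apply MulEquiv.ext; intro x
        change μ 1 x.toAdd = x.toAdd
        simp
      map_mul' := fun g h => by
        apply MulEquiv.ext; intro x
        change μ (g * h) x.toAdd = μ g (μ h x.toAdd)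
        simp }
  let a' : Multiplicative M →* f.ker := MonoidHom.mk' (fun x => ⟨a x.toAdd, a_ker _⟩) (fun x y => Subtype.ext (a_add _ _))
  let σ := res f.ker.subtype ρ
  have hσ : ∀ x v, σ x v = v := fun x v => htriv x x.2 v
  have hc : ∀ g h v, ρ' g (σ h v) = σ (θ g h) (ρ' g v) := fun g h v => by rw [hσ, hσ]
  have key : ∀ j, GG π (HHrep θ ρ' σ hc j) := fun j =>
    C4 a' hU hk hY hM (fun x m hm e => hTM x.toAdd m hm e) (fun x => by
        obtain ⟨y, hy⟩ := a_surj x x.2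
        exact ⟨Multiplicative.ofAdd y, Subtype.ext hy⟩) θ θM (by
        intro g m
        obtain ⟨g, rfl⟩ := hf g
        rw [hθ]
        apply Subtype.ext
        rw [MulAut.conjNormal_apply]
        exact a_eq g m.toAdd) ρ' hav' σ hσ hc j
  have keq : ∀ j g c, HHrep θ ρ' σ hc j g c = hQ f hf ρ j g c := by
    intro j g c
    obtain ⟨g, rfl⟩ := hf g
    rw [hQ_apply]
    change _ = HHrep MulAut.conjNormal ρ (res f.ker.subtype ρ) (conj_compat ρ f.ker) j g c
    rw [HHrep_apply, HHrep_apply]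
    obtain ⟨F, hF, rfl⟩ := gcl_surj _ _ c
    rw [gmap_cl, gmap_cl]
    apply gcl_congr
    funext t
    rw [hρ', ← map_inv, hθ]
  refine LHS (P := fun M _ _ => Tor M) f hf (SC_T k) ρ ?_ n
  intro i j hij
  haveI := (key j).1
  refine hU.full hk (hQ f hf ρ j) ?_ i
  refine Av.comap (ρ := hQ f hf ρ j) (ρ' := HHrep θ ρ' σ hc j) (key j).2 (AddMonoidHom.id _) (fun g x => (keq j g x).symm) 1 one_ne_zero ?_
  intro x hx
  rw [one_smul]; exact hx
end
end TB

namespace TB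

section
variable {k : Type} [CommRing k] {k' : Type} [CommRing k'] {Γ : Type} [Group Γ] {V : Type} [AddCommGroup V] [Module k V]
  {V' : Type} [AddCommGroup V'] [Module k' V']

def rz (ρ : Representation k Γ V) : Representation ℤ Γ V where
  toFun g := (ρ g).toAddMonoidHom.toIntLinearMap
  map_one' := by apply LinearMap.ext; intro x; change ρ 1 x = x; simp
  map_mul' a b := by apply LinearMap.ext; intro x; change ρ (a * b) x = ρ a (ρ b x); simp

lemma gcl_nsmul (σ : Representation k Γ V) (n : ℕ) (m : ℕ) (F : (Fin n → Γ) → V) (hF) :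
    m • gcl σ n F hF = gcl σ n (m • F) (by rw [dfun_nsmul, hF, smul_zero]) := by
  rw [← Nat.cast_smul_eq_nsmul k m (gcl σ n F hF), gcl_smul]
  exact gcl_congr _ _ _ _ _ (Nat.cast_smul_eq_nsmul k m F)

lemma gcl_kill (σ : Representation k Γ V) (n : ℕ) (m : ℕ) (F : (Fin n → Γ) → V) (hF) :
    m • gcl σ n F hF = 0 ↔ gcl (rz σ) n (m • F) (by change dfun σ n (m • F) = 0; rw [dfun_nsmul, hF, smul_zero]) = 0 := by
  rw [gcl_nsmul]
  cases n with
  | zero => rw [gcl_zero, gcl_zero]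
  | succ n => rw [gcl_succ, gcl_succ]; rfl

lemma Tor_rz (ρ : Representation k Γ V) (n : ℕ) : Tor (gH (rz ρ) n) ↔ Tor (gH ρ n) := by
  constructor
  · intro h c
    obtain ⟨F, hF, rfl⟩ := gcl_surj _ _ c
    obtain ⟨m, hm, e⟩ := h (gcl (rz ρ) n F hF)
    refine ⟨m, hm, ?_⟩
    rw [gcl_kill, ← gcl_nsmul (rz ρ) n m F hF]; exact e
  · intro h c
    obtain ⟨F, hF, rfl⟩ := gcl_surj _ _ c
    obtain ⟨m, hm, e⟩ := h (gcl ρ n F hF)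
    refine ⟨m, hm, ?_⟩
    have e2 := (gcl_kill ρ n m F hF).1 e
    rw [gcl_nsmul (rz ρ) n m F hF]; exact e2

lemma Tor_transfer (ρ : Representation k Γ V) (ρ' : Representation k' Γ V') (e : V ≃+ V')
    (he : ∀ g v, e (ρ g v) = ρ' g (e v)) (n : ℕ) (h : Tor (gH ρ n)) : Tor (gH ρ' n) := by
  rw [← Tor_rz] at h ⊢
  intro c
  have h1 : ∀ g v, e.toIntLinearEquiv.toLinearMap (rz ρ g v) = rz ρ' g (e.toIntLinearEquiv.toLinearMap v) := he
  have h2 : ∀ g v, e.symm.toIntLinearEquiv.toLinearMap (rz ρ' g v) = rz ρ g (e.symm.toIntLinearEquiv.toLinearMap v) := by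
    intro g v
    change e.symm (ρ' g v) = ρ g (e.symm v)
    apply e.injective; rw [he]; simp
  obtain ⟨m, hm, e1⟩ := h ((gmap (MonoidHom.id Γ) _ h2).H n c)
  refine ⟨m, hm, ?_⟩
  have e2 := congrArg ((gmap (MonoidHom.id Γ) _ h1).H n) e1
  rw [map_zero, map_nsmul, gmap_comp (MonoidHom.id Γ) _ h2 (MonoidHom.id Γ) _ h1 (MonoidHom.id Γ) LinearMap.id (fun _ _ => rfl)
    (fun _ => rfl) (fun v => (e.apply_symm_apply v).symm), gmap_id _ _ _ (fun _ => rfl) (fun _ => rfl)] at e2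
  exact e2
end

section
variable {p : ℕ} [hp : Fact p.Prime] {D : Type} [AddCommGroup D]

def PP (p : ℕ) (D : Type) [AddCommGroup D] : Prop := ∀ x : D, ∃ n : ℕ, p ^ n • x = 0

lemma zs_cong {x : D} {n : ℕ} (hx : p ^ n • x = 0) {a b : ℤ} (h : (p ^ n : ℤ_[p]) ∣ (a : ℤ_[p]) - b) : a • x = b • x := by
  have h2 : ((p ^ n : ℕ) : ℤ) ∣ a - b := by
    have := (PadicInt.norm_int_le_pow_iff_dvd (p := p) (k := a - b) (n := n)).1 (by
      rw [PadicInt.norm_le_pow_iff_mem_span_pow, Ideal.mem_span_singleton]; push_cast; exact h)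
    exact_mod_cast this
  obtain ⟨c, hc⟩ := h2
  rw [← sub_eq_zero, ← sub_smul, hc, mul_comm, mul_smul, natCast_zsmul, hx, smul_zero]

lemma appr_dvd (c : ℤ_[p]) (n : ℕ) : ∃ z : ℤ, (p ^ n : ℤ_[p]) ∣ c - z :=
  ⟨c.appr n, by have := PadicInt.appr_spec n c; rw [Ideal.mem_span_singleton] at this; exact_mod_cast this⟩

open Classical in
def psm (hD : PP p D) (c : ℤ_[p]) (x : D) : D := (Classical.choose (appr_dvd c (Classical.choose (hD x)))) • x

lemma psm_eq (hD : PP p D) (c : ℤ_[p]) (x : D) (n : ℕ) (hx : p ^ n • x = 0) (z : ℤ) (hz : (p ^ n : ℤ_[p]) ∣ c - z) :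
    psm hD c x = z • x := by
  unfold psm
  have h1 := Classical.choose_spec (hD x)
  have h2 := Classical.choose_spec (appr_dvd c (Classical.choose (hD x)))
  set m := Classical.choose (hD x)
  set y := Classical.choose (appr_dvd c m)
  rcases le_total m n with h | h
  · apply zs_cong h1
    have := (pow_dvd_pow (p : ℤ_[p]) h).trans hz
    have := dvd_sub this h2
    simpa using this
  · apply zs_cong hx
    have := (pow_dvd_pow (p : ℤ_[p]) h).trans h2
    have := dvd_sub hz this
    simpa using this

lemma pp_up {x : D} {n m : ℕ} (h : n ≤ m) (hx : p ^ n • x = 0) : p ^ m • x = 0 := by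
  obtain ⟨c, hc⟩ := pow_dvd_pow p h
  rw [hc, mul_comm, mul_smul, hx, smul_zero]

@[reducible]
def pmod (hD : PP p D) : Module ℤ_[p] D where
  smul := psm hD
  one_smul x := by
    obtain ⟨n, hn⟩ := hD x
    exact (psm_eq hD 1 x n hn 1 (by simp)).trans (one_smul _ _)
  mul_smul a b x := by
    obtain ⟨n, hn⟩ := hD x
    obtain ⟨y, hy⟩ := appr_dvd a n
    obtain ⟨z, hz⟩ := appr_dvd b n
    change psm hD (a * b) x = psm hD a (psm hD b x)
    rw [psm_eq hD b x n hn z hz, psm_eq hD a (z • x) n (by rw [smul_comm, hn, smul_zero]) y hy,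
      psm_eq hD (a * b) x n hn (y * z), mul_smul]
    have : a * b - ((y * z : ℤ) : ℤ_[p]) = a * (b - z) + (a - y) * z := by push_cast; ring
    rw [this]
    exact dvd_add (hz.mul_left _) (hy.mul_right _)
  smul_zero a := (smul_zero (Classical.choose (appr_dvd a (Classical.choose (hD 0)))) : _)
  smul_add a x x' := by
    obtain ⟨n, hn⟩ := hD x
    obtain ⟨n', hn'⟩ := hD x'
    obtain ⟨y, hy⟩ := appr_dvd a (max n n')
    have h1 := pp_up (le_max_left n n') hn
    have h2 := pp_up (le_max_right n n') hn'
    change psm hD a (x + x') = psm hD a x + psm hD a x'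
    rw [psm_eq hD a x _ h1 y hy, psm_eq hD a x' _ h2 y hy,
      psm_eq hD a (x + x') _ (by rw [smul_add, h1, h2, add_zero]) y hy, smul_add]
  add_smul a b x := by
    obtain ⟨n, hn⟩ := hD x
    obtain ⟨y, hy⟩ := appr_dvd a n
    obtain ⟨z, hz⟩ := appr_dvd b n
    change psm hD (a + b) x = psm hD a x + psm hD b x
    rw [psm_eq hD a x n hn y hy, psm_eq hD b x n hn z hz,
      psm_eq hD (a + b) x n hn (y + z), add_smul]
    have : a + b - ((y + z : ℤ) : ℤ_[p]) = (a - y) + (b - z) := by push_cast; ring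
    rw [this]
    exact dvd_add hy hz
  zero_smul x := by
    obtain ⟨n, hn⟩ := hD x
    exact (psm_eq hD 0 x n hn 0 (by simp)).trans (zero_smul _ _)

lemma padic_eq [Module ℤ_[p] D] {x : D} {n : ℕ} (hx : p ^ n • x = 0) {c : ℤ_[p]} {z : ℤ} (hz : (p ^ n : ℤ_[p]) ∣ c - z) :
    c • x = z • x := by
  obtain ⟨b, hb⟩ := hz
  have : c = (z : ℤ_[p]) + b * ((p ^ n : ℕ) : ℤ_[p]) := by push_cast; linear_combination hb
  rw [this, add_smul, mul_smul, Nat.cast_smul_eq_nsmul, hx, smul_zero, add_zero, Int.cast_smul_eq_zsmul]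

lemma padic_lin [Module ℤ_[p] D] {D' : Type} [AddCommGroup D'] [Module ℤ_[p] D'] (hD : PP p D) (φ : D →+ D') (c : ℤ_[p]) (x : D) :
    φ (c • x) = c • φ x := by
  obtain ⟨n, hn⟩ := hD x
  obtain ⟨z, hz⟩ := appr_dvd c n
  rw [padic_eq hn hz, map_zsmul, padic_eq (n := n) _ hz]
  rw [← map_nsmul, hn, map_zero]
end

section
variable {p : ℕ} [hp : Fact p.Prime] 

lemma mem_pow_smul {M : Type} [AddCommGroup M] [Module ℤ_[p] M] (n : ℕ) (x : M) :
    x ∈ ((Ideal.span {(p : ℤ_[p])}) ^ n • ⊤ : Submodule ℤ_[p] M) ↔ ∃ y, x = p ^ n • y := by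
  rw [Ideal.span_singleton_pow, Submodule.ideal_span_singleton_smul, Submodule.mem_smul_pointwise_iff_exists]
  constructor
  · rintro ⟨y, -, rfl⟩
    exact ⟨y, by rw [← Nat.cast_smul_eq_nsmul ℤ_[p]]; push_cast; rfl⟩
  · rintro ⟨y, rfl⟩
    exact ⟨y, trivial, by rw [← Nat.cast_smul_eq_nsmul ℤ_[p]]; push_cast; rfl⟩

lemma precomp_pi (I : Type) [Finite I] : IsPrecomplete (Ideal.span {(p : ℤ_[p])}) (I → ℤ_[p]) := by
  have h0 : IsPrecomplete (Ideal.span {(p : ℤ_[p])}) ℤ_[p] := by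
    rw [← PadicInt.maximalIdeal_eq_span_p]; infer_instance
  constructor
  intro f hf
  have h1 : ∀ i : I, ∃ L : ℤ_[p], ∀ n, f n i ≡ L [SMOD ((Ideal.span {(p : ℤ_[p])}) ^ n • ⊤ : Submodule ℤ_[p] ℤ_[p])] := by
    intro i
    apply h0.prec'
    intro m n hmn
    have := hf hmn
    rw [SModEq.sub_mem, mem_pow_smul] at this ⊢
    obtain ⟨y, hy⟩ := this
    exact ⟨y i, congrFun hy i⟩
  choose L hL using h1
  refine ⟨L, fun n => ?_⟩
  rw [SModEq.sub_mem, mem_pow_smul]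
  have : ∀ i, ∃ y, f n i - L i = p ^ n • y := by
    intro i
    have := hL i n
    rwa [SModEq.sub_mem, mem_pow_smul] at this
  choose y hy using this
  exact ⟨y, funext hy⟩

/-- finite generation criterion over `ℤ_p`. -/
lemma padic_fg {T F : Type} [AddCommGroup T] [Module ℤ_[p] T] [AddCommGroup F] (φ : T →+ F) (hfin : Finite (Set.range φ))
    (hk : ∀ x, φ x = 0 → ∃ y, x = p • y) (hH : ∀ x : T, (∀ n : ℕ, ∃ y, x = p ^ n • y) → x = 0) : Module.Finite ℤ_[p] T := by
  let I := Set.range φ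
  haveI : Finite I := hfin
  haveI := Fintype.ofFinite I
  have hs : ∀ i : I, ∃ x, φ x = i := fun i => i.2
  choose s hs using hs
  classical
  haveI := precomp_pi (p := p) I
  haveI : IsHausdorff (Ideal.span {(p : ℤ_[p])}) T := by
    constructor
    intro x hx
    apply hH
    intro n
    have := hx n
    rw [SModEq.sub_mem, sub_zero, mem_pow_smul] at this
    exact this
  let f : (I → ℤ_[p]) →ₗ[ℤ_[p]] T := Fintype.linearCombination ℤ_[p] s
  apply Module.Finite.of_surjective f
  apply surjective_of_mkQ_comp_surjective (I := Ideal.span {(p : ℤ_[p])})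
  intro y
  obtain ⟨y, rfl⟩ := Submodule.mkQ_surjective _ y
  refine ⟨Pi.single ⟨φ y, y, rfl⟩ 1, ?_⟩
  rw [LinearMap.comp_apply, ← sub_eq_zero, ← map_sub, Submodule.mkQ_apply, Submodule.Quotient.mk_eq_zero]
  have := (mem_pow_smul (p := p) 1 (f (Pi.single ⟨φ y, y, rfl⟩ 1) - y)).2 (by
    simp only [pow_one]
    apply hk
    rw [map_sub]
    change φ (Fintype.linearCombination ℤ_[p] s _) - _ = 0
    rw [Fintype.linearCombination_apply_single, one_smul, hs, sub_self])
  rwa [pow_one] at this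

lemma PK_padic : PK p ℤ_[p] where
  dom := inferInstance
  pid := inferInstance
  cz := inferInstance
  dvd c hc := by
    refine ⟨p ^ c.valuation, pow_ne_zero _ hp.1.ne_zero, ?_⟩
    have := PadicInt.unitCoeff_spec hc
    conv_lhs => rw [this]
    push_cast
    exact (Units.mul_left_dvd).2 dvd_rfl
  unit q hq hqp := by
    rw [PadicInt.isUnit_iff]
    by_contra h
    have h1 : ‖((q : ℤ) : ℤ_[p])‖ < 1 := by
      push_cast; exact lt_of_le_of_ne (PadicInt.norm_le_one _) h
    rw [PadicInt.norm_int_lt_one_iff_dvd] at h1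
    have := Int.natCast_dvd_natCast.1 h1
    exact hqp ((Nat.prime_dvd_prime_iff_eq hp.1 hq).1 this).symm
  ls n := LS_padic p n

lemma PK_Qp : PK p ℚ_[p] where
  dom := inferInstance
  pid := inferInstance
  cz := inferInstance
  dvd c hc := ⟨1, one_ne_zero, (IsUnit.mk0 c hc).dvd⟩
  unit q hq _ := IsUnit.mk0 _ (by exact_mod_cast hq.ne_zero)
  ls n := LS_field
end
end TB

namespace TB

lemma PK_field {p : ℕ} {K : Type} [Field K] [CharZero K] : PK p K where
  dom := inferInstance
  pid := inferInstance
  cz := inferInstance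
  dvd c hc := ⟨1, one_ne_zero, (IsUnit.mk0 c hc).dvd⟩
  unit q hq _ := IsUnit.mk0 _ (by exact_mod_cast hq.ne_zero)
  ls n := LS_field

def AvD (π : Set ℕ) {Γ D : Type} [Group Γ] [AddCommGroup D] (ρ : Representation ℤ Γ D) : Prop :=
  ∀ (M : Type) [AddCommGroup M] (μ : Representation ℤ Γ M) (φ : M →+ D), Fm π M → TF M →
    (∀ g x, φ (μ g x) = ρ g (φ x)) → ∃ m : ℕ, m ≠ 0 ∧ ∀ x, m • φ x = 0

lemma loc_tor {p : ℕ} [Fact p.Prime] {Γ T V : Type} [Group Γ] [AddCommGroup T] [Module ℤ_[p] T] [Module.Finite ℤ_[p] T] [AddCommGroup V] [Module ℤ_[p] V]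
    {π : Set ℕ} (hU : UU π p Γ) (f : T →ₗ[ℤ_[p]] V) [IsLocalizedModule (nonZeroDivisors ℤ_[p]) f] (σ : Representation ℤ_[p] Γ V)
    (hTF : TF V) (hV : Av π σ) (n : ℕ) : Tor (gH σ n) := by
  let S := nonZeroDivisors ℤ_[p]
  let e := IsLocalizedModule.iso S f
  let r : Representation (FractionRing ℤ_[p]) Γ (LocalizedModule S T) :=
    { toFun := fun g => LinearMap.extendScalarsOfIsLocalization S (FractionRing ℤ_[p]) (e.symm.toLinearMap ∘ₗ σ g ∘ₗ e.toLinearMap)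
      map_one' := by
        apply LinearMap.ext; intro x; change e.symm (σ 1 (e x)) = x; simp
      map_mul' := fun a b => by
        apply LinearMap.ext; intro x; change e.symm (σ (a * b) (e x)) = e.symm (σ a (e (e.symm (σ b (e x))))); simp }
  have hr : ∀ g v, e (r g v) = σ g (e v) := by
    intro g v
    exact e.apply_symm_apply _
  refine Tor_transfer (V := LocalizedModule S T) (V' := V) r σ e.toAddEquiv hr n ?_
  refine hU (FractionRing ℤ_[p]) PK_field _ r (hTF.sub e.toLinearMap.toAddMonoidHom e.injective) ?_ n
  intro N hN hF
  obtain ⟨m, hm, h1⟩ := hV (N.map e.toLinearMap.toAddMonoidHom) (by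
    rintro g _ ⟨x, hx, rfl⟩
    exact ⟨r g x, hN g x hx, hr g x⟩) (Fm_quo (e.toLinearMap.toAddMonoidHom.addSubgroupMap N) (AddMonoidHom.addSubgroupMap_surjective _ _) hF)
  refine ⟨m, hm, fun x hx => e.injective ?_⟩
  rw [map_nsmul, map_zero]
  exact h1 _ ⟨x, hx, rfl⟩

section
variable (p : ℕ) [hp : Fact p.Prime] (D : Type) [AddCommGroup D] [Module ℤ_[p] D]

def VV : Submodule ℤ_[p] (ℕ → D) where
  carrier := {v | ∀ n, p • v (n + 1) = v n}
  zero_mem' n := smul_zero _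
  add_mem' := by
    intro a b ha hb n
    change p • (a (n + 1) + b (n + 1)) = a n + b n
    rw [smul_add, ha, hb]
  smul_mem' := by
    intro c a ha n
    change p • (c • a (n + 1)) = c • a n
    rw [smul_comm, ha]

def ev0 : VV p D →ₗ[ℤ_[p]] D where
  toFun v := v.1 0
  map_add' _ _ := rfl
  map_smul' _ _ := rfl

def TT : Submodule ℤ_[p] (VV p D) := LinearMap.ker (ev0 p D)

variable {p D}
def sh (v : VV p D) : VV p D := ⟨fun n => v.1 (n + 1), fun n => v.2 (n + 1)⟩

lemma sh_p (v : VV p D) : p • sh v = v := Subtype.ext (funext fun n => v.2 n)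

lemma VV_pow (v : VV p D) (n m : ℕ) : p ^ n • v.1 (m + n) = v.1 m := by
  induction n with
  | zero => simp
  | succ n ih => rw [pow_succ, mul_smul, ← add_assoc, v.2, ih]

lemma VV_p (v : VV p D) (h : p • v = 0) : v = 0 := by
  apply Subtype.ext; funext n
  rw [← v.2 n]
  exact congrFun (congrArg Subtype.val h) (n + 1)

lemma VV_TF : TF (VV p D) := by
  intro v m hm h
  obtain ⟨a, b, hb, rfl⟩ := Nat.exists_eq_pow_mul_and_not_dvd hm p hp.1.ne_one
  have hu : IsUnit (b : ℤ_[p]) := unit_of_primes b (by rintro rfl; exact hb (dvd_zero _)) (fun q hq hqb =>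
    PK_padic.unit q hq (by rintro rfl; exact hb hqb))
  have h1 : ∀ a : ℕ, ∀ w : VV p D, p ^ a • w = 0 → w = 0 := by
    intro a
    induction a with
    | zero => intro w hw; simpa using hw
    | succ a ih => intro w hw; rw [pow_succ, mul_smul] at hw; exact VV_p _ (ih _ hw)
  rw [mul_smul] at h
  have h2 := h1 a _ h
  rw [← Nat.cast_smul_eq_nsmul ℤ_[p]] at h2
  obtain ⟨u, hu⟩ := hu
  rw [← hu] at h2
  have := congrArg (fun x => (↑u⁻¹ : ℤ_[p]) • x) h2
  simpa [smul_smul] using this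

lemma TT_fg (hfin : {x : D | p • x = 0}.Finite) : Module.Finite ℤ_[p] (TT p D) := by
  let φ : TT p D →+ D := ⟨⟨fun v => v.1.1 1, rfl⟩, fun _ _ => rfl⟩
  apply padic_fg (p := p) φ
  · apply Set.Finite.to_subtype
    apply hfin.subset
    rintro _ ⟨v, rfl⟩
    change p • v.1.1 (0 + 1) = 0
    rw [v.1.2]
    exact v.2
  · intro x hx
    exact ⟨⟨sh x.1, hx⟩, Subtype.ext (sh_p x.1).symm⟩
  · intro x hx
    apply Subtype.ext; apply Subtype.ext; funext n
    obtain ⟨y, hy⟩ := hx n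
    rw [hy]
    change p ^ n • y.1.1 n = 0
    have := VV_pow y.1 n 0
    rw [zero_add] at this
    rw [this]; exact y.2

lemma ev0_surj (hdiv : ∀ x : D, ∃ y, p • y = x) : Function.Surjective (ev0 p D) := by
  intro x
  choose f hf using hdiv
  exact ⟨⟨fun n => Nat.rec x (fun _ y => f y) n, fun n => hf _⟩, rfl⟩

lemma VV_loc (hD : PP p D) : IsLocalizedModule (nonZeroDivisors ℤ_[p]) (TT p D).subtype where
  map_units := by
    rintro ⟨s, hs⟩
    have hs0 : s ≠ 0 := nonZeroDivisors.ne_zero hs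
    have hpow : ∀ (n : ℕ) (w : VV p D), ∃ w', p ^ n • w' = w := by
      intro n
      induction n with
      | zero => intro w; exact ⟨w, by simp⟩
      | succ n ih => 
        intro w
        obtain ⟨w', hw'⟩ := ih w
        exact ⟨sh w', by rw [pow_succ, mul_smul, sh_p, hw']⟩
    rw [Module.End.isUnit_iff]
    constructor
    · rw [injective_iff_map_eq_zero]
      intro v hv
      exact PK.tf PK_padic VV_TF s v hs0 hv
    · intro v
      obtain ⟨u, e⟩ : ∃ u : ℤ_[p]ˣ, s = u * p ^ s.valuation := ⟨_, PadicInt.unitCoeff_spec hs0⟩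
      obtain ⟨w, hw⟩ := hpow s.valuation v
      refine ⟨(↑u⁻¹ : ℤ_[p]) • w, ?_⟩
      change s • ((↑u⁻¹ : ℤ_[p]) • w) = v
      rw [smul_smul]
      rw [e, mul_comm, ← mul_assoc, Units.inv_mul, one_mul, ← Nat.cast_pow, Nat.cast_smul_eq_nsmul, hw]
  surj := by
    intro v
    obtain ⟨n, hn⟩ := hD (v.1 0)
    refine ⟨⟨⟨p ^ n • v, hn⟩, ⟨((p ^ n : ℕ) : ℤ_[p]), mem_nonZeroDivisors_of_ne_zero (by exact_mod_cast pow_ne_zero _ hp.1.ne_zero)⟩⟩, ?_⟩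
    change ((p ^ n : ℕ) : ℤ_[p]) • v = p ^ n • v
    rw [Nat.cast_smul_eq_nsmul]
  exists_of_eq := by
    intro x y h
    exact ⟨1, by rw [Subtype.ext h]⟩

variable {Γ : Type} [Group Γ] 
def repP (hD : PP p D) (ρ : Representation ℤ Γ D) : Representation ℤ_[p] Γ D where
  toFun g := { toFun := ρ g, map_add' := map_add (ρ g), map_smul' := fun c x => padic_lin hD (ρ g).toAddMonoidHom c x }
  map_one' := by apply LinearMap.ext; intro x; change ρ 1 x = x; simp
  map_mul' a b := by apply LinearMap.ext; intro x; change ρ (a * b) x = ρ a (ρ b x); simp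

def repV (ρ : Representation ℤ_[p] Γ D) : Representation ℤ_[p] Γ (VV p D) where
  toFun g := { toFun := fun v => ⟨fun n => ρ g (v.1 n), fun n => by rw [← map_nsmul, v.2]⟩, 
               map_add' := fun v w => Subtype.ext (funext fun n => map_add (ρ g) _ _), 
               map_smul' := fun c x => Subtype.ext (funext fun n => map_smul (ρ g) _ _) }
  map_one' := by apply LinearMap.ext; intro x; apply Subtype.ext; funext n; change ρ 1 _ = _; simp
  map_mul' a b := by apply LinearMap.ext; intro x; apply Subtype.ext; funext n; change ρ (a * b) _ = ρ a (ρ b _); simp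

lemma repV_TT (ρ : Representation ℤ_[p] Γ D) (g : Γ) (v : VV p D) (hv : v ∈ TT p D) : repV ρ g v ∈ TT p D := by
  change ρ g (v.1 0) = 0
  have : v.1 0 = 0 := hv
  rw [this, map_zero]

lemma Av_V {π : Set ℕ} (hpπ : p ∈ π) (hD : PP p D) (ρ : Representation ℤ Γ D) (h : AvD π ρ) : Av π (repV (repP hD ρ)) := by
  intro N hN hF
  set σ := repV (repP hD ρ) with hσ
  let N' : AddSubgroup (VV p D) :=
    { carrier := {v | ∃ i : ℕ, p ^ i • v ∈ N}
      zero_mem' := ⟨0, by rw [smul_zero]; exact N.zero_mem⟩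
      add_mem' := by
        rintro a b ⟨i, hi⟩ ⟨j, hj⟩
        refine ⟨i + j, ?_⟩
        rw [smul_add]
        refine N.add_mem ?_ ?_
        · rw [add_comm, pow_add, mul_smul]; exact N.nsmul_mem hi _
        · rw [pow_add, mul_smul]; exact N.nsmul_mem hj _
      neg_mem' := by
        rintro a ⟨i, hi⟩
        exact ⟨i, by rw [smul_neg]; exact N.neg_mem hi⟩ }
  have hN' : ∀ g, ∀ x ∈ N', σ g x ∈ N' := by
    rintro g x ⟨i, hi⟩
    exact ⟨i, by rw [← map_nsmul]; exact hN g _ hi⟩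
  have hle : N ≤ N' := fun x hx => ⟨0, by simpa using hx⟩
  have hF' : Fm π N' := by
    intro S hS
    obtain ⟨T, hT⟩ := hF S hS
    have hpS : ∀ i : ℕ, S (p ^ i) := by
      intro i
      rcases hS with rfl | ⟨q, hq, hqπ, rfl⟩
      · exact pow_ne_zero _ hp.1.ne_zero
      · intro hd
        have := (Nat.prime_dvd_prime_iff_eq hq hp.1).1 (hq.dvd_of_dvd_pow hd)
        exact hqπ (this ▸ hpπ)
    classical
    apply FGm_of
    refine ⟨(AddSubgroup.closure (T : Set N)).map (AddSubgroup.inclusion hle), ?_, ?_⟩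
    · exact ⟨T.image (AddSubgroup.inclusion hle), by rw [Finset.coe_image, AddMonoidHom.map_closure]⟩
    · rintro ⟨x, i, hi⟩
      obtain ⟨s, hs, h1⟩ := hT ⟨_, hi⟩
      refine ⟨s * p ^ i, hS.ms.mul _ _ hs (hpS i), _, h1, ?_⟩
      apply Subtype.ext
      change s • p ^ i • x = (s * p ^ i) • x
      rw [mul_smul]
  obtain ⟨m, hm, hb⟩ := h N' (subNu σ N' hN') ((ev0 p D).toAddMonoidHom.comp N'.subtype) hF' (VV_TF.sub N'.subtype Subtype.val_injective)
    (fun g x => rfl)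
  refine ⟨m, hm, ?_⟩
  intro x hx
  have key : ∀ n : ℕ, ∀ v ∈ N', m • v.1 n = 0 := by
    intro n
    induction n with
    | zero => intro v hv; exact hb ⟨v, hv⟩
    | succ n ih =>
      intro v hv
      refine ih (sh v) ?_
      obtain ⟨i, hi⟩ := hv
      exact ⟨i + 1, by rw [pow_succ, mul_smul, sh_p]; exact hi⟩
  apply Subtype.ext; funext n
  exact key n x (hle hx)

/-- Vanishing (up to torsion) for divisible modules. -/
theorem UD {π : Set ℕ} (hpπ : p ∈ π) (hU : UU π p Γ) (hD : PP p D) (hdiv : ∀ x : D, ∃ y, p • y = x)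
    (hfin : {x : D | p • x = 0}.Finite) (ρ : Representation ℤ Γ D) (h : AvD π ρ) (n : ℕ) : Tor (gH ρ n) := by
  have hV := Av_V hpπ hD ρ h
  set σ := repV (repP hD ρ) with hσ
  haveI := TT_fg hfin
  have hinv : ∀ g v, v ∈ TT p D → σ g v ∈ TT p D := fun g v hv => repV_TT _ g v hv
  have hTT : ∀ n, Tor (gH (V := TT p D) (srep σ (TT p D) hinv) n) := by
    intro n
    refine hU ℤ_[p] PK_padic _ _ (VV_TF.sub (TT p D).subtype.toAddMonoidHom Subtype.val_injective) ?_ n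
    exact Av.srep hV (TT p D) hinv
  have hVV : ∀ n, Tor (gH σ n) := by
    intro n
    haveI := VV_loc (p := p) hD
    exact loc_tor (T := TT p D) hU (TT p D).subtype σ VV_TF hV n
  have hs := gses (V := TT p D) (V' := VV p D) (V'' := D) (σ := srep σ (TT p D) hinv) (τ := σ) (υ := repP hD ρ) (TT p D).subtype (ev0 p D) (fun _ _ => rfl) (fun _ _ => rfl)
    Subtype.val_injective (ev0_surj hdiv) (fun v => ⟨fun hv => ⟨⟨v, hv⟩, rfl⟩, fun ⟨w, hw⟩ => hw ▸ w.2⟩)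
  have h3 := hs.scC (SC_T ℤ_[p]) n (hVV n) (hTT (n + 1))
  exact Tor_transfer (repP hD ρ) ρ (AddEquiv.refl D) (fun _ _ => rfl) n h3
end
end TB

namespace TB

section
variable {p : ℕ} {D : Type} [AddCommGroup D]

lemma anti_finite {X : Type} (A : ℕ → Set X) (hA : Antitone A) (h0 : ∀ i, (A i).Finite) : ∃ i, ∀ j, i ≤ j → A j = A i := by
  have hne : (Set.range fun i => (A i).ncard).Nonempty := ⟨_, 0, rfl⟩
  obtain ⟨i, hi⟩ := Nat.sInf_mem hne
  refine ⟨i, fun j hj => Set.eq_of_subset_of_ncard_le (hA hj) ?_ (h0 i)⟩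
  have : (A i).ncard = sInf (Set.range fun i => (A i).ncard) := hi
  rw [this]
  exact Nat.sInf_le ⟨j, rfl⟩

/-- A `p`-primary group with finite socle is artinian. -/
lemma artin_of_socle (hD : PP p D) (hfin : {x : D | p • x = 0}.Finite) : IsArtinian ℤ D := by
  rw [← monotone_stabilizes_iff_artinian]
  intro N
  let A : ℕ → ℕ → Set D := fun i n => {y | ∃ x, x ∈ (OrderDual.ofDual (N i)) ∧ p ^ (n + 1) • x = 0 ∧ y = p ^ n • x}
  have hN : ∀ i j, i ≤ j → OrderDual.ofDual (N j) ≤ OrderDual.ofDual (N i) := fun i j h => N.monotone h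
  have hAi : ∀ i j n, i ≤ j → A j n ⊆ A i n := by
    rintro i j n h _ ⟨x, hx, e, rfl⟩
    exact ⟨x, hN i j h hx, e, rfl⟩
  have hAn : ∀ i n m, n ≤ m → A i m ⊆ A i n := by
    rintro i n m h _ ⟨x, hx, e, rfl⟩
    obtain ⟨c, rfl⟩ := Nat.exists_eq_add_of_le h
    refine ⟨p ^ c • x, Submodule.smul_of_tower_mem _ _ hx, ?_, ?_⟩
    · rw [← mul_smul, ← pow_add, ← e]; congr 2; omega
    · rw [← mul_smul, ← pow_add]
  have hAf : ∀ i n, (A i n).Finite := by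
    intro i n
    apply hfin.subset
    rintro _ ⟨x, hx, e, rfl⟩
    change p • p ^ n • x = 0
    rw [← mul_smul, ← pow_succ', e]
  obtain ⟨d, hd⟩ := anti_finite (fun i => A i i) (fun i j h => (hAi i j j h).trans (hAn i i j h)) (fun i => hAf i i)
  have h1 : ∀ i n, d ≤ i → d ≤ n → A i n = A d d := by
    intro i n hi hn
    apply Set.Subset.antisymm
    · exact (hAi d i n hi).trans (hAn d d n hn)
    · have : A d d = A (max i n) (max i n) := (hd _ (hi.trans (le_max_left _ _))).symm
      rw [this]
      exact (hAi i _ _ (le_max_left _ _)).trans (hAn i n _ (le_max_right _ _))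
  have h2 : ∀ n : ℕ, ∃ i, ∀ j, i ≤ j → A j n = A i n := fun n => anti_finite (fun i => A i n) (fun i j h => hAi i j n h) (fun i => hAf i n)
  choose I hI using h2
  let i1 := max d ((Finset.range d).sup I)
  have h3 : ∀ j n, i1 ≤ j → A i1 n = A j n := by
    intro j n hj
    by_cases hn : d ≤ n
    · rw [h1 _ _ (le_max_left _ _) hn, h1 _ _ ((le_max_left _ _).trans hj) hn]
    · have : I n ≤ i1 := (Finset.le_sup (f := I) (Finset.mem_range.2 (not_le.1 hn))).trans (le_max_right _ _)
      rw [hI n _ this, hI n _ (this.trans hj)]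
  refine ⟨i1, fun j hj => ?_⟩
  have h4 : ∀ n : ℕ, ∀ x, x ∈ OrderDual.ofDual (N i1) → p ^ n • x = 0 → x ∈ OrderDual.ofDual (N j) := by
    intro n
    induction n with
    | zero => intro x _ h; simp at h; rw [h]; exact zero_mem _
    | succ n ih =>
      intro x hx h
      have : p ^ n • x ∈ A j n := by rw [← h3 j n hj]; exact ⟨x, hx, h, rfl⟩
      obtain ⟨y, hy, e, e'⟩ := this
      have h5 := ih (x - y) (Submodule.sub_mem _ hx (hN _ _ hj hy)) (by rw [smul_sub, e', sub_self])
      have := Submodule.add_mem _ h5 hy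
      rwa [sub_add_cancel] at this
  apply le_antisymm
  · exact N.monotone hj
  · intro x hx
    obtain ⟨n, hn⟩ := hD x
    exact h4 n x hx hn

lemma div_bdd (hp : p.Prime) (hD : PP p D) (hdiv : ∀ x : D, ∃ y, p • y = x) (e : ℕ) (he : e ≠ 0) (h : ∀ x : D, e • x = 0) (x : D) : x = 0 := by
  obtain ⟨a, b, hb, rfl⟩ := Nat.exists_eq_pow_mul_and_not_dvd he p hp.ne_one
  have hpow : ∀ (n : ℕ) (w : D), ∃ w', p ^ n • w' = w := by
    intro n
    induction n with
    | zero => intro w; exact ⟨w, by simp⟩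
    | succ n ih => 
      intro w
      obtain ⟨w', hw'⟩ := ih w
      obtain ⟨w'', h''⟩ := hdiv w'
      exact ⟨w'', by rw [pow_succ, mul_smul, h'', hw']⟩
  obtain ⟨y, hy⟩ := hpow a x
  have h1 : b • x = 0 := by rw [← hy, ← mul_smul, mul_comm]; exact h y
  obtain ⟨n, hn⟩ := hD x
  have hc : Nat.Coprime b (p ^ n) := ((Nat.Prime.coprime_iff_not_dvd hp).2 hb).symm.pow_right n
  have h2 : addOrderOf x ∣ 1 := by
    rw [← hc]
    exact Nat.dvd_gcd (addOrderOf_dvd_iff_nsmul_eq_zero.2 h1) (addOrderOf_dvd_iff_nsmul_eq_zero.2 hn)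
  rw [Nat.dvd_one, AddMonoid.addOrderOf_eq_one_iff] at h2
  exact h2
end

section
variable {Γ Γ' D : Type} [Group Γ] [Group Γ'] [AddCommGroup D] 

lemma conjRep (f : Γ →* Γ') (hf : Function.Surjective f) (a : D → Γ) (a_add : ∀ x y, a (x + y) = a x * a y)
    (a_inj : Function.Injective a) (a_ker : ∀ x, f (a x) = 1) (a_surj : ∀ x, f x = 1 → ∃ y, a y = x) :
    ∃ ρ : Representation ℤ Γ' D, ∀ g x, a (ρ (f g) x) = g * a x * g⁻¹ := by
  have h1 : ∀ g x, ∃ y, a y = g * a x * g⁻¹ := by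
    intro g x
    apply a_surj
    simp [a_ker]
  choose c hc using h1
  have hcong : ∀ g g' x, f g = f g' → c g x = c g' x := by
    intro g g' x h
    apply a_inj
    rw [hc, hc]
    obtain ⟨y, hy⟩ := a_surj (g'⁻¹ * g) (by simp [h])
    have e : g = g' * a y := by rw [hy]; simp
    have : a y * a x = a x * a y := by rw [← a_add, ← a_add, add_comm]
    rw [e, mul_inv_rev]
    calc g' * a y * a x * ((a y)⁻¹ * g'⁻¹) = g' * (a y * a x) * (a y)⁻¹ * g'⁻¹ := by group
      _ = _ := by rw [this]; group
  choose s hs using hf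
  refine ⟨{ toFun := fun γ => (AddMonoidHom.mk' (c (s γ)) (fun x y => ?_)).toIntLinearMap, map_one' := ?_, map_mul' := ?_ }, ?_⟩
  · apply a_inj; rw [a_add, hc, hc, hc, a_add]; group
  · apply LinearMap.ext; intro x
    apply a_inj
    change a (c (s 1) x) = a x
    rw [hcong (s 1) 1 x (by simp [hs]), hc]; simp
  · intro γ γ'
    apply LinearMap.ext; intro x
    apply a_inj
    change a (c (s (γ * γ')) x) = a (c (s γ) (c (s γ') x))
    rw [hcong _ (s γ * s γ') x (by simp [hs]), hc, hc, hc]; group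
  · intro g x
    change a (c (s (f g)) x) = _
    rw [hcong _ g x (by simp [hs]), hc]

/-- If the extension class is torsion, there is a derivation which is multiplication by a nonzero integer on the kernel. -/
lemma deriv_of_tor (f : Γ →* Γ') (hf : Function.Surjective f) (a : D → Γ) (a_add : ∀ x y, a (x + y) = a x * a y)
    (a_inj : Function.Injective a) (a_ker : ∀ x, f (a x) = 1) (a_surj : ∀ x, f x = 1 → ∃ y, a y = x)
    (ρ : Representation ℤ Γ' D) (hρ : ∀ g x, a (ρ (f g) x) = g * a x * g⁻¹) (ht : Tor (gH ρ 2)) :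
    ∃ (m : ℕ) (δ : Γ → D), m ≠ 0 ∧ (∀ g g', δ (g * g') = δ g + ρ (f g) (δ g')) ∧ ∀ x, δ (a x) = m • x := by
  have a0 : a 0 = 1 := by have := a_add 0 0; rw [add_zero] at this; exact left_eq_mul.1 this
  choose s hs using hf
  have h1 : ∀ g, ∃ y, a y = g * (s (f g))⁻¹ := fun g => a_surj _ (by simp [hs])
  choose κ hκ using h1
  have h2 : ∀ u v, ∃ y, a y = s u * s v * (s (u * v))⁻¹ := fun u v => a_surj _ (by simp [hs])
  choose F hF using h2
  have key : ∀ g g', κ (g * g') = κ g + ρ (f g) (κ g') + F (f g) (f g') := by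
    intro g g'
    apply a_inj
    have e : a (ρ (f g) (κ g')) = s (f g) * a (κ g') * (s (f g))⁻¹ := by
      have := hρ (s (f g)) (κ g'); rwa [hs] at this
    rw [a_add, a_add, e, hκ, hκ, hκ, hF, map_mul]; group
  have cocyc : dfun ρ 2 (fun t => F (t 0) (t 1)) = 0 := by
    funext t
    obtain ⟨g0, e0⟩ : ∃ g, f g = t 0 := ⟨s (t 0), hs _⟩
    obtain ⟨g1, e1⟩ : ∃ g, f g = t 1 := ⟨s (t 1), hs _⟩
    obtain ⟨g2, e2⟩ : ∃ g, f g = t 2 := ⟨s (t 2), hs _⟩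
    have k1 := key g0 (g1 * g2)
    have k2 := key (g0 * g1) g2
    rw [key g1 g2, ← mul_assoc, k2, key g0 g1] at k1
    simp only [map_add, map_mul] at k1
    have : dfun ρ 2 (fun t => F (t 0) (t 1)) t = ρ (t 0) (F (t 1) (t 2)) - F (t 0 * t 1) (t 2) + F (t 0) (t 1 * t 2) - F (t 0) (t 1) := by
      simp only [dfun, dp]
      change ρ (t 0) (F (t 1) (t 2)) + (- F (t 0 * t 1) (t 2) - (- F (t 0) (t 1 * t 2) - - F (t 0) (t 1))) = _
      abel
    rw [this, ← e0, ← e1, ← e2]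
    change _ = (0 : D)
    rw [Module.End.mul_apply] at k1
    have k3 := sub_eq_zero.2 k1
    rw [← neg_eq_zero, ← k3]
    abel
  obtain ⟨m, hm, e⟩ := ht (gcl ρ 2 _ cocyc)
  rw [gcl_nsmul, gcl_succ] at e
  obtain ⟨h, hh⟩ := e
  have hh' : ∀ u v, m • F u v = ρ u (h ![v]) - h ![u * v] + h ![u] := by
    intro u v
    have := congrFun hh ![u, v]
    have e1 : dfun ρ 1 h ![u, v] = ρ u (h ![v]) - h ![u * v] + h ![u] := by
      simp only [dfun, dp]
      have x1 : Fin.tail ![u, v] = ![v] := by funext i; fin_cases i; rfl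
      have x2 : (Fin.cons ((![u, v] : Fin 2 → Γ') 0 * ![u, v] 1) (Fin.tail (Fin.tail ![u, v])) : Fin 1 → Γ') = ![u * v] := by
        funext i; fin_cases i; rfl
      have x3 : ∀ w : Fin 0 → Γ', (Fin.cons ((![u, v] : Fin 2 → Γ') 0) w : Fin 1 → Γ') = ![u] := by
        intro w; funext i; fin_cases i; rfl
      rw [x2, x3, x1]
      change ρ u _ + (_ - - _) = _
      abel
    rw [← e1, this]; rfl
  let δ : Γ → D := fun g => m • κ g + h ![f g]
  have hδ : ∀ g g', δ (g * g') = δ g + ρ (f g) (δ g') := by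
    intro g g'
    change m • κ (g * g') + h ![f (g * g')] = m • κ g + h ![f g] + ρ (f g) (m • κ g' + h ![f g'])
    rw [key, smul_add, smul_add, hh', map_mul, map_add, map_nsmul]; abel
  refine ⟨m, δ, hm, hδ, fun x => ?_⟩
  have d1 : δ 1 = 0 := by
    have := hδ 1 1
    rw [mul_one, map_one, map_one] at this
    exact left_eq_add.1 this
  have hκ1 : κ (a x) = x + κ 1 := by
    apply a_inj
    rw [a_add, hκ, hκ, a_ker, map_one]; group
  have : δ (a x) = m • x + δ 1 := by
    change m • κ (a x) + h ![f (a x)] = m • x + (m • κ 1 + h ![f 1])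
    rw [hκ1, a_ker, map_one, smul_add, add_assoc]
  rw [this, d1, add_zero]
end
end TB

namespace TB

lemma UU_div {π : Set ℕ} {p : ℕ} [hp : Fact p.Prime] (hpπ : p ∈ π) (r : ℕ) : ∀ (Γ Γ' D : Type) [Group Γ] [Group Γ'] [AddCommGroup D]
    (f : Γ →* Γ') (hf : Function.Surjective f) (a : D → Γ) (a_add : ∀ x y, a (x + y) = a x * a y)
    (a_inj : Function.Injective a) (a_ker : ∀ x, f (a x) = 1) (a_surj : ∀ x, f x = 1 → ∃ y, a y = x)
    (hU : UU π p Γ') (hfg : Group.FG Γ) (hD : PP p D) (hdiv : ∀ x : D, ∃ y, p • y = x)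
    (hfin : {x : D | p • x = 0}.Finite) (hr : {x : D | p • x = 0}.ncard ≤ r), UU π p Γ := by
  induction r with
  | zero =>
    intro Γ Γ' D _ _ _ f hf a a_add a_inj a_ker a_surj hU hfg hD hdiv hfin hr
    exfalso
    have : {x : D | p • x = 0} = ∅ := (Set.ncard_eq_zero hfin).1 (Nat.le_zero.1 hr)
    have h0 : (0 : D) ∈ {x : D | p • x = 0} := smul_zero _
    rw [this] at h0; exact h0
  | succ r ih =>
    intro Γ Γ' D _ _ _ f hf a a_add a_inj a_ker a_surj hU hfg hD hdiv hfin hr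
    obtain ⟨ρ, hρ⟩ := conjRep f hf a a_add a_inj a_ker a_surj
    letI := pmod hD
    have a0 : a 0 = 1 := by have := a_add 0 0; rw [add_zero] at this; exact left_eq_mul.1 this
    by_cases hA : AvD π ρ
    · obtain ⟨m, δ, hm, hδ, hδa⟩ := deriv_of_tor f hf a a_add a_inj a_ker a_surj ρ hρ (UD hpπ hU hD hdiv hfin ρ hA 2)
      obtain ⟨S, hS⟩ := hfg
      have hex : ∃ N : ℕ, ∀ g ∈ S, p ^ N • δ g = 0 := by
        have hD' : ∀ x : D, ∃ n : ℕ, p ^ n • x = 0 := hD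
        choose n hn using hD'
        exact ⟨S.sup (fun g => n (δ g)), fun g hg => pp_up (Finset.le_sup (f := fun g => n (δ g)) hg) (hn _)⟩
      obtain ⟨N, hN⟩ := hex
      have d1 : δ 1 = 0 := by
        have := hδ 1 1
        rw [mul_one, map_one, map_one] at this
        exact left_eq_add.1 this
      let T : Subgroup Γ :=
        { carrier := {g | p ^ N • δ g = 0}
          one_mem' := by change p ^ N • δ 1 = 0; rw [d1, smul_zero]
          mul_mem' := by
            intro x y hx hy
            change p ^ N • δ (x * y) = 0
            rw [hδ, smul_add, ← map_nsmul, show p ^ N • δ x = 0 from hx, show p ^ N • δ y = 0 from hy, map_zero, add_zero]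
          inv_mem' := by
            intro x hx
            change p ^ N • δ x⁻¹ = 0
            have e := hδ x⁻¹ x
            rw [inv_mul_cancel, d1] at e
            have : δ x⁻¹ = - ρ (f x⁻¹) (δ x) := eq_neg_of_add_eq_zero_left e.symm
            rw [this, smul_neg, ← map_nsmul, show p ^ N • δ x = 0 from hx, map_zero, neg_zero] }
      have hT : T = ⊤ := by
        rw [eq_top_iff, ← hS, Subgroup.closure_le]
        intro g hg; exact hN g hg
      have hzero : ∀ x : D, x = 0 := by
        apply div_bdd hp.1 hD hdiv (p ^ N * m) (mul_ne_zero (pow_ne_zero _ hp.1.ne_zero) hm)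
        intro x
        have : a x ∈ T := by rw [hT]; trivial
        have h2 : p ^ N • δ (a x) = 0 := this
        rwa [hδa, ← mul_smul] at h2
      haveI : Finite f.ker := by
        have : Subsingleton f.ker := by
          constructor
          rintro ⟨x, hx⟩ ⟨y, hy⟩
          obtain ⟨x', rfl⟩ := a_surj x hx
          obtain ⟨y', rfl⟩ := a_surj y hy
          apply Subtype.ext
          change a x' = a y'
          rw [hzero x', hzero y']
        infer_instance
      exact UU_finite f hf hU
    · unfold AvD at hA
      push Not at hA
      obtain ⟨M, _, μ, φ, hM, hTM, hφ, hunb⟩ := hA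
      haveI := artin_of_socle hD hfin
      let c : ℕ →o (Submodule ℤ D)ᵒᵈ := 
        ⟨fun n => OrderDual.toDual (LinearMap.range (p ^ n • φ.toIntLinearMap)), by
          intro i j hij
          change LinearMap.range (p ^ j • φ.toIntLinearMap) ≤ LinearMap.range (p ^ i • φ.toIntLinearMap)
          rintro _ ⟨x, rfl⟩
          obtain ⟨d, hd⟩ := pow_dvd_pow p hij
          refine ⟨d • x, ?_⟩
          change p ^ i • φ (d • x) = p ^ j • φ x
          rw [hd, map_nsmul, mul_smul]⟩
      obtain ⟨N, hN⟩ := IsArtinian.monotone_stabilizes c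
      let φ' : M →+ D := p ^ N • φ
      have hφ' : ∀ x, φ' x = p ^ N • φ x := fun x => rfl
      have hφe : ∀ g x, φ' (μ g x) = ρ g (φ' x) := by
        intro g x; rw [hφ', hφ', hφ, map_nsmul]
      have hsd : ∀ x : M, ∃ y, p • φ' y = φ' x := by
        intro x
        have h1 : LinearMap.range (p ^ N • φ.toIntLinearMap) = LinearMap.range (p ^ (N + 1) • φ.toIntLinearMap) :=
          hN (N + 1) (Nat.le_succ _)
        have h2 : φ' x ∈ LinearMap.range (p ^ (N + 1) • φ.toIntLinearMap) := by rw [← h1]; exact ⟨x, rfl⟩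
        obtain ⟨y, hy⟩ := h2
        refine ⟨y, ?_⟩
        rw [hφ', ← mul_smul, ← pow_succ']; exact hy
      let S := φ'.range
      have hSne : ∃ s ∈ S, s ≠ 0 ∧ p • s = 0 := by
        obtain ⟨x, hx⟩ := hunb (p ^ N) (pow_ne_zero _ hp.1.ne_zero)
        have hx' : ∃ n : ℕ, p ^ n • φ' x = 0 := hD _
        classical
        have h0 : Nat.find hx' ≠ 0 := by
          intro h
          have := Nat.find_spec hx'
          rw [h, pow_zero, one_smul] at this
          exact hx this
        obtain ⟨n, hn⟩ := Nat.exists_eq_succ_of_ne_zero h0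
        refine ⟨p ^ n • φ' x, S.nsmul_mem (show φ' x ∈ S from ⟨x, rfl⟩) _, Nat.find_min hx' (by omega), ?_⟩
        rw [← mul_smul, ← pow_succ']
        have := Nat.find_spec hx'
        rwa [hn] at this
      -- the normal subgroup
      let aS : Multiplicative M →* Γ :=
        { toFun := fun x => a (φ' x.toAdd)
          map_one' := by change a (φ' 0) = 1; rw [map_zero, a0]
          map_mul' := fun x y => by change a (φ' (x.toAdd + y.toAdd)) = _; rw [map_add, a_add] }
      let K : Subgroup Γ := aS.range
      haveI : K.Normal := by
        constructor
        rintro _ ⟨x, rfl⟩ g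
        refine ⟨Multiplicative.ofAdd (μ (f g) x.toAdd), ?_⟩
        change a (φ' (μ (f g) x.toAdd)) = g * a (φ' x.toAdd) * g⁻¹
        rw [hφe, hρ]
      have hKf : ∀ x ∈ K, f x = 1 := by
        rintro _ ⟨x, rfl⟩; exact a_ker _
      let q : Γ →* Γ ⧸ K := QuotientGroup.mk' K
      have hq : Function.Surjective q := QuotientGroup.mk'_surjective K
      let f2 : Γ ⧸ K →* Γ' := QuotientGroup.lift K f hKf
      have hf2 : ∀ g, f2 (q g) = f g := fun g => rfl
      have hf2s : Function.Surjective f2 := fun y => by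
        obtain ⟨g, rfl⟩ := hf y; exact ⟨q g, rfl⟩
      have hqa : ∀ x, q x = 1 ↔ ∃ m : M, a (φ' m) = x := by
        intro x
        rw [show (q x = 1) ↔ x ∈ K from QuotientGroup.eq_one_iff x]
        exact ⟨fun ⟨m, hm⟩ => ⟨m.toAdd, hm⟩, fun ⟨m, hm⟩ => ⟨Multiplicative.ofAdd m, hm⟩⟩
      have hU2 : UU π p (Γ ⧸ K) := by
        let ah : D →+ Additive (Γ) := AddMonoidHom.mk' (fun x => Additive.ofMul (a x)) (fun x y => a_add x y)
        let b : D ⧸ S → Γ ⧸ K := Quotient.lift (fun x => q (a x)) (by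
          intro x y hxy
          have : -x + y ∈ S := QuotientAddGroup.leftRel_apply.1 hxy
          obtain ⟨m, hm⟩ := this
          have e : y = x + φ' m := by rw [hm]; abel
          change q (a x) = q (a y)
          rw [e, a_add, map_mul, (hqa _).2 ⟨m, rfl⟩, mul_one])
        have hb : ∀ x : D, b (x : D ⧸ S) = q (a x) := fun x => rfl
        refine ih (Γ ⧸ K) Γ' (D ⧸ S) f2 hf2s b ?_ ?_ ?_ ?_ hU inferInstance ?_ ?_ ?_ ?_
        · intro x y
          obtain ⟨x, rfl⟩ := QuotientAddGroup.mk_surjective x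
          obtain ⟨y, rfl⟩ := QuotientAddGroup.mk_surjective y
          rw [← QuotientAddGroup.mk_add, hb, hb, hb, a_add, map_mul]
        · intro x y
          obtain ⟨x, rfl⟩ := QuotientAddGroup.mk_surjective x
          obtain ⟨y, rfl⟩ := QuotientAddGroup.mk_surjective y
          rw [hb, hb]
          intro h
          rw [QuotientAddGroup.eq]
          have : q ((a x)⁻¹ * a y) = 1 := by rw [map_mul, map_inv, h, inv_mul_cancel]
          obtain ⟨m, hm⟩ := (hqa _).1 this
          refine ⟨m, a_inj ?_⟩
          rw [hm, a_add]
          congr 1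
          exact (map_neg ah x).symm
        · intro x
          obtain ⟨x, rfl⟩ := QuotientAddGroup.mk_surjective x
          rw [hb, hf2, a_ker]
        · intro x hx
          obtain ⟨x, rfl⟩ := hq x
          obtain ⟨y, rfl⟩ := a_surj x hx
          exact ⟨(y : D ⧸ S), rfl⟩
        · intro x
          obtain ⟨x, rfl⟩ := QuotientAddGroup.mk_surjective x
          obtain ⟨n, hn⟩ := hD x
          exact ⟨n, by rw [← QuotientAddGroup.mk_nsmul, hn]; rfl⟩
        · intro x
          obtain ⟨x, rfl⟩ := QuotientAddGroup.mk_surjective x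
          obtain ⟨y, hy⟩ := hdiv x
          exact ⟨(y : D ⧸ S), by rw [← QuotientAddGroup.mk_nsmul, hy]⟩
        all_goals
          have himg : {x : D ⧸ S | p • x = 0} = (fun x : D => (x : D ⧸ S)) '' {x : D | p • x = 0} := by
            ext x
            constructor
            · obtain ⟨x, rfl⟩ := QuotientAddGroup.mk_surjective x
              intro hx
              have : ((p • x : D) : D ⧸ S) = 0 := hx
              rw [QuotientAddGroup.eq_zero_iff] at this
              obtain ⟨m, hm⟩ := this
              obtain ⟨y, hy⟩ := hsd m
              refine ⟨x - φ' y, ?_, ?_⟩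
              · change p • (x - φ' y) = 0
                rw [smul_sub, hy, hm, sub_self]
              · change ((x - φ' y : D) : D ⧸ S) = x
                rw [QuotientAddGroup.mk_sub, (QuotientAddGroup.eq_zero_iff (φ' y)).2 (show φ' y ∈ S from ⟨y, rfl⟩), sub_zero]
            · rintro ⟨y, hy, rfl⟩
              change p • (y : D ⧸ S) = 0
              rw [← QuotientAddGroup.mk_nsmul, show p • y = 0 from hy]; rfl
        · rw [himg]; exact hfin.image _
        · rw [himg]
          have hle := Set.ncard_image_le (f := fun x : D => (x : D ⧸ S)) hfin
          by_contra hcon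
          have heq : ((fun x : D => (x : D ⧸ S)) '' {x : D | p • x = 0}).ncard = {x : D | p • x = 0}.ncard := by omega
          have hinj := Set.injOn_of_ncard_image_eq heq hfin
          obtain ⟨s, hs, hs0, hsp⟩ := hSne
          apply hs0
          refine hinj hsp (smul_zero _) ?_
          exact (QuotientAddGroup.eq_zero_iff s).2 hs
      refine UU_nice q hq hU2 hM hTM (μ.comp f2) (fun x => a (φ' x)) (fun x y => by rw [map_add, a_add]) (fun x => (hqa _).2 ⟨x, rfl⟩)
        (fun x hx => (hqa x).1 hx) ?_
      intro g x
      change a (φ' (μ (f g) x)) = _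
      rw [hφe, hρ]
end TB

namespace TB

lemma fin_of_art {X : Type} [AddCommGroup X] (h : IsArtinian ℤ X) (m : ℕ) (hm : m ≠ 0) (hX : ∀ x : X, m • x = 0) : Finite X := by
  haveI : NeZero m := ⟨hm⟩
  letI : Module (ZMod m) X := AddCommGroup.zmodModule hX
  haveI : IsScalarTower ℤ (ZMod m) X := ⟨fun a b x => by
    rw [zsmul_eq_mul, mul_smul]
    exact (Int.cast_smul_eq_zsmul (ZMod m) a (b • x))⟩
  have h1 : IsArtinian (ZMod m) X := isArtinian_of_tower ℤ h
  have h2 : IsNoetherian (ZMod m) X := IsSemiprimaryRing.isNoetherian_iff_isArtinian.2 h1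
  have h3 : Module.Finite (ZMod m) X := ⟨(isNoetherian_def.1 h2) _⟩
  exact @Module.finite_of_finite (ZMod m) X _ _ _ _ h3

lemma socle_fin {X : Type} [AddCommGroup X] (h : IsArtinian ℤ X) (m : ℕ) (hm : m ≠ 0) : {x : X | m • x = 0}.Finite := by
  let N : Submodule ℤ X := LinearMap.ker (m • LinearMap.id : X →ₗ[ℤ] X)
  have h1 : IsArtinian ℤ N := inferInstance
  have : Finite N := fin_of_art h1 m hm (fun x => Subtype.ext (by have := x.2; exact this))
  have h3 : (N : Set X).Finite := this
  exact h3.subset (fun x hx => hx)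

def AF (B : Type) [AddCommGroup B] : Prop := ∃ F : Submodule ℤ B, F.FG ∧ IsArtinian ℤ (B ⧸ F)

lemma AF_quo {A B : Type} [AddCommGroup A] [AddCommGroup B] (f : B →+ A) (hf : Function.Surjective f) (h : AF B) : AF A := by
  obtain ⟨F, hF, hA⟩ := h
  refine ⟨F.map f.toIntLinearMap, hF.map _, ?_⟩
  refine isArtinian_of_surjective (B ⧸ F) (F.mapQ (F.map f.toIntLinearMap) f.toIntLinearMap (Submodule.le_comap_map _ _)) ?_
  intro y
  obtain ⟨a, rfl⟩ := Submodule.Quotient.mk_surjective _ y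
  obtain ⟨b, rfl⟩ := hf a
  exact ⟨Submodule.Quotient.mk b, rfl⟩

lemma AF_sub {A B : Type} [AddCommGroup A] [AddCommGroup B] (f : A →+ B) (hf : Function.Injective f) (h : AF B) : AF A := by
  obtain ⟨F, hF, hA⟩ := h
  refine ⟨F.comap f.toIntLinearMap, ?_, ?_⟩
  · haveI : Module.Finite ℤ F := Module.Finite.iff_fg.2 hF
    haveI : IsNoetherian ℤ F := inferInstance
    let g : F.comap f.toIntLinearMap →ₗ[ℤ] F := f.toIntLinearMap.restrict (fun x hx => hx)
    have hg : Function.Injective g := by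
      intro x y e
      apply Subtype.ext; apply hf
      exact congrArg Subtype.val e
    haveI : IsNoetherian ℤ (F.comap f.toIntLinearMap) := isNoetherian_of_injective g hg
    exact Module.Finite.iff_fg.1 inferInstance
  · refine isArtinian_of_injective (Submodule.mapQ (F.comap f.toIntLinearMap) F f.toIntLinearMap le_rfl) ?_
    rw [← LinearMap.ker_eq_bot, LinearMap.ker_eq_bot']
    intro x hx
    obtain ⟨a, rfl⟩ := Submodule.Quotient.mk_surjective _ x
    rw [Submodule.Quotient.mk_eq_zero]
    exact (Submodule.Quotient.mk_eq_zero F).1 hx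

lemma AF_ext {A B C : Type} [AddCommGroup A] [AddCommGroup B] [AddCommGroup C] (f : A →+ B) (g : B →+ C)
    (hg : Function.Surjective g) (hfg : ∀ b, g b = 0 → ∃ a, f a = b) (hgf : ∀ a, g (f a) = 0) (hA : AF A) (hC : AF C) : AF B := by
  obtain ⟨F, hF, hA⟩ := hA
  obtain ⟨E, hE, hC⟩ := hC
  obtain ⟨T, hT⟩ := hE
  let s : C → B := Function.surjInv hg
  have hs : ∀ c, g (s c) = c := Function.surjInv_eq hg
  classical
  let F' : Submodule ℤ B := F.map f.toIntLinearMap ⊔ Submodule.span ℤ (T.image s : Set B)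
  have hF' : F'.FG := (hF.map _).sup ⟨_, rfl⟩
  have hmap : F' ≤ E.comap g.toIntLinearMap := by
    refine sup_le ?_ ?_
    · rintro _ ⟨x, hx, rfl⟩
      change g (f x) ∈ E
      rw [hgf]; exact E.zero_mem
    · rw [Submodule.span_le]
      intro x hx
      rw [Finset.coe_image] at hx
      obtain ⟨t, ht, rfl⟩ := hx
      change g (s t) ∈ E
      rw [hs, ← hT]; exact Submodule.subset_span ht
  have hle : F ≤ F'.comap f.toIntLinearMap := fun x hx => Submodule.mem_sup_left ⟨x, hx, rfl⟩
  have hsE : ∀ c ∈ E, ∃ b ∈ F', g b = c := by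
    intro c hc
    have h1 : E ≤ F'.map g.toIntLinearMap := by
      rw [← hT, Submodule.span_le]
      intro t ht
      refine ⟨s t, Submodule.mem_sup_right (Submodule.subset_span ?_), hs t⟩
      rw [Finset.coe_image]; exact ⟨t, ht, rfl⟩
    obtain ⟨b, hb, e⟩ := h1 hc
    exact ⟨b, hb, e⟩
  refine ⟨F', hF', isArtinian_of_range_eq_ker (F.mapQ F' f.toIntLinearMap hle) (F'.mapQ E g.toIntLinearMap hmap) ?_⟩
  ext x
  constructor
  · rintro ⟨y, rfl⟩
    obtain ⟨a, rfl⟩ := Submodule.Quotient.mk_surjective _ y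
    change (Submodule.Quotient.mk (g (f a)) : C ⧸ E) = 0
    rw [hgf]; exact Submodule.Quotient.mk_zero E
  · intro hx
    obtain ⟨b, rfl⟩ := Submodule.Quotient.mk_surjective _ x
    have hx' : g b ∈ E := (Submodule.Quotient.mk_eq_zero E).1 hx
    obtain ⟨b', hb', e⟩ := hsE _ hx'
    obtain ⟨a, ha⟩ := hfg (b - b') (by rw [map_sub, e, sub_self])
    refine ⟨Submodule.Quotient.mk a, ?_⟩
    change (Submodule.Quotient.mk (f a) : B ⧸ F') = _
    rw [ha, Submodule.Quotient.eq]
    rw [sub_sub_cancel_left]; exact F'.neg_mem hb'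

lemma AF_artin {B : Type} [AddCommGroup B] (h : IsArtinian ℤ B) : AF B := ⟨⊥, Submodule.fg_bot, inferInstance⟩
lemma AF_fg {B : Type} [AddCommGroup B] (h : Module.Finite ℤ B) : AF B :=
  ⟨⊤, Module.Finite.fg_top, inferInstance⟩

/-! Prüfer groups -/
lemma prufer_PP (q : ℕ) : PP q (pruferSubgroup q) := by
  rintro ⟨x, n, hn⟩
  exact ⟨n, Subtype.ext hn⟩

lemma rat_socle (q : ℕ) (hq : q ≠ 0) : {x : RatCircle | q • x = 0}.Finite := by
  let u : RatCircle := QuotientAddGroup.mk (1 / (q : ℚ))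
  have hq' : (q : ℚ) ≠ 0 := Nat.cast_ne_zero.2 hq
  have hu : q • u = 0 := by
    change (QuotientAddGroup.mk (q • (1 / (q : ℚ))) : RatCircle) = 0
    rw [QuotientAddGroup.eq_zero_iff, nsmul_eq_mul, mul_one_div_cancel hq']
    exact AddSubgroup.mem_zmultiples _
  have hfin : (AddSubgroup.zmultiples u : Set RatCircle).Finite := by
    have : IsOfFinAddOrder u := isOfFinAddOrder_iff_nsmul_eq_zero.2 ⟨q, Nat.pos_of_ne_zero hq, hu⟩
    exact (finite_zmultiples.2 this)
  refine hfin.subset ?_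
  intro x hx
  obtain ⟨r, rfl⟩ := QuotientAddGroup.mk_surjective x
  have h1 : (QuotientAddGroup.mk (q • r) : RatCircle) = 0 := hx
  rw [QuotientAddGroup.eq_zero_iff, AddSubgroup.mem_zmultiples_iff] at h1
  obtain ⟨k, hk⟩ := h1
  refine ⟨k, ?_⟩
  change (QuotientAddGroup.mk (k • (1 / (q : ℚ))) : RatCircle) = _
  congr 1
  rw [zsmul_eq_mul] at hk ⊢
  rw [nsmul_eq_mul] at hk
  rw [mul_one] at hk
  rw [hk]; field_simp

lemma prufer_socle (q : ℕ) (hq : q ≠ 0) : {x : pruferSubgroup q | q • x = 0}.Finite := by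
  have := (rat_socle q hq).preimage (f := fun x : pruferSubgroup q => (x : RatCircle)) (Subtype.val_injective.injOn)
  refine this.subset ?_
  intro x hx
  exact congrArg Subtype.val hx

lemma PP_Fm {π : Set ℕ} {q : ℕ} {B : Type} [AddCommGroup B] (hq : q.Prime) (hπ : q ∈ π) (h : PP q B) : Fm π B := by
  intro S hS
  refine ⟨∅, fun x => ?_⟩
  obtain ⟨n, hn⟩ := h x
  refine ⟨q ^ n, ?_, by rw [hn]; exact AddSubgroup.zero_mem _⟩
  rcases hS with rfl | ⟨q', hq', hn', rfl⟩
  · exact pow_ne_zero _ hq.ne_zero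
  · intro hd
    have := (Nat.prime_dvd_prime_iff_eq hq' hq).1 (hq'.dvd_of_dvd_pow hd)
    exact hn' (this ▸ hπ)

/-! the class of minimax groups, inductively -/
def BQ (π : Set ℕ) (Q : Type) [Group Q] : Prop :=
  IsCyclic Q ∨ ∃ q : ℕ, q.Prime ∧ q ∈ π ∧ Nonempty (Q ≃* Multiplicative (pruferSubgroup q))

inductive MM (π : Set ℕ) : ∀ (G : Type) [Group G], Prop
  | one (G : Type) [Group G] (h : ∀ x : G, x = 1) : MM π G
  | step (N G Q : Type) [Group N] [Group G] [Group Q] (i : N →* G) (f : G →* Q) (hi : Function.Injective i)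
    (hf : Function.Surjective f) (hif : ∀ x, f x = 1 ↔ ∃ y, i y = x) (hQ : BQ π Q) (h : MM π N) : MM π G

lemma MM_of {G : Type} [Group G] (h : IsMinimax G) : MM (groupSpectrum G) G := by
  obtain ⟨r, c, hmono, h0, h1, hc⟩ := h
  have key : ∀ (j : ℕ) (hj : j < r + 1), MM (groupSpectrum G) (c ⟨j, hj⟩) := by
    intro j
    induction j with
    | zero =>
      intro hj
      refine MM.one _ ?_
      rintro ⟨x, hx⟩
      have : c ⟨0, hj⟩ = ⊥ := h0
      rw [this, Subgroup.mem_bot] at hx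
      exact Subtype.ext hx
    | succ j ih =>
      intro hj
      have hj' : j < r := by omega
      obtain ⟨hn, hb⟩ := hc ⟨j, hj'⟩
      have hle : c (Fin.castSucc ⟨j, hj'⟩) ≤ c (Fin.succ ⟨j, hj'⟩) := hmono (Fin.castSucc_le_succ _)
      have hI : MM (groupSpectrum G) (c (Fin.castSucc ⟨j, hj'⟩)) := ih (by omega)
      change MM (groupSpectrum G) (c (Fin.succ ⟨j, hj'⟩))
      refine MM.step _ _ _ (Subgroup.inclusion hle) (QuotientGroup.mk' ((c (Fin.castSucc ⟨j, hj'⟩)).subgroupOf (c (Fin.succ ⟨j, hj'⟩))))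
        (Subgroup.inclusion_injective _) (QuotientGroup.mk'_surjective _) ?_ ?_ hI
      · intro x
        rw [← MonoidHom.mem_ker, QuotientGroup.ker_mk', Subgroup.mem_subgroupOf]
        constructor
        · intro hx; exact ⟨⟨x, hx⟩, Subtype.ext rfl⟩
        · rintro ⟨y, rfl⟩; exact y.2
      · rcases hb with hb | ⟨p, hp, e⟩
        · exact Or.inl hb
        · exact Or.inr ⟨p, hp, ⟨hp, _, _, hn, e⟩, e⟩
  have := key r (by omega)
  have e : c ⟨r, by omega⟩ = ⊤ := h1
  rw [e] at this
  exact MM.step _ _ _ (Subgroup.subtype ⊤) (1 : G →* Unit) Subtype.val_injective (fun x => ⟨1, rfl⟩)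
    (fun x => ⟨fun _ => ⟨⟨x, trivial⟩, rfl⟩, fun _ => rfl⟩) (Or.inl inferInstance) this

def Mx (π : Set ℕ) (B : Type) [AddCommGroup B] : Prop := Fm π B ∧ AF B

lemma BQ_Mx {π : Set ℕ} {Q : Type} [Group Q] (hQ : BQ π Q) (T : Subgroup Q) {B : Type} [AddCommGroup B]
    (h : T →* Multiplicative B) (hh : Function.Surjective h) : Mx π B := by
  rcases hQ with hQ | ⟨q, hq, hqπ, ⟨e⟩⟩
  · have h1 : IsCyclic (Multiplicative B) := isCyclic_of_surjective h hh
    obtain ⟨b, hb⟩ := h1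
    have hb' : ∀ x : B, ∃ n : ℤ, n • Multiplicative.toAdd b = x := fun x => by
      obtain ⟨n, hn⟩ := hb (Multiplicative.ofAdd x)
      exact ⟨n, hn⟩
    constructor
    · exact Fm_quo (AddSubgroup.subtype (AddSubgroup.zmultiples (Multiplicative.toAdd b)))
        (fun x => ⟨⟨x, by obtain ⟨n, hn⟩ := hb' x; exact ⟨n, hn⟩⟩, rfl⟩) (Fm_cyclic _)
    · apply AF_fg
      refine ⟨{Multiplicative.toAdd b}, ?_⟩
      rw [Finset.coe_singleton, eq_top_iff]
      intro x _
      exact Submodule.mem_span_singleton.2 (hb' x)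
  · have hP : Mx π (pruferSubgroup q) := ⟨PP_Fm hq hqπ (prufer_PP q), AF_artin (artin_of_socle (p := q) (prufer_PP q) (prufer_socle q hq.ne_zero))⟩
    let T' : AddSubgroup (pruferSubgroup q) :=
      { carrier := {x | e.symm (Multiplicative.ofAdd x) ∈ T}
        zero_mem' := by
          change e.symm 1 ∈ T
          rw [map_one]; exact T.one_mem
        add_mem' := by
          intro a b ha hb
          change e.symm (Multiplicative.ofAdd a * Multiplicative.ofAdd b) ∈ T
          rw [map_mul]; exact T.mul_mem ha hb
        neg_mem' := by
          intro a ha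
          change e.symm (Multiplicative.ofAdd a)⁻¹ ∈ T
          rw [map_inv]; exact T.inv_mem ha }
    let φ : T' →+ B := AddMonoidHom.mk' (fun x => Multiplicative.toAdd (h ⟨e.symm (Multiplicative.ofAdd x.1), x.2⟩)) (by
      intro x y
      have e1 : (⟨e.symm (Multiplicative.ofAdd (x + y).1), (x + y).2⟩ : T) = ⟨e.symm (Multiplicative.ofAdd x.1), x.2⟩ * ⟨e.symm (Multiplicative.ofAdd y.1), y.2⟩ :=
        Subtype.ext (map_mul e.symm (Multiplicative.ofAdd x.1) (Multiplicative.ofAdd y.1))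
      have e2 := congrArg h e1
      rw [map_mul] at e2
      exact e2)
    have hφ : Function.Surjective φ := by
      intro b
      obtain ⟨t, ht⟩ := hh (Multiplicative.ofAdd b)
      refine ⟨⟨Multiplicative.toAdd (e t.1), ?_⟩, ?_⟩
      · change e.symm (e t.1) ∈ T
        rw [e.symm_apply_apply]; exact t.2
      · change h ⟨e.symm (e t.1), _⟩ = Multiplicative.ofAdd b
        rw [← ht]; congr 1
        exact Subtype.ext (e.symm_apply_apply _)
    exact ⟨Fm_quo φ hφ (Fm_sub T'.subtype Subtype.val_injective hP.1), AF_quo φ hφ (AF_sub T'.subtype Subtype.val_injective hP.2)⟩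

lemma MM_Mx {π : Set ℕ} {G : Type} [hG : Group G] (h : MM π G) : ∀ (T : Subgroup G) (B : Type) [AddCommGroup B]
    (h : T →* Multiplicative B) (hh : Function.Surjective h), Mx π B := by
  induction h with
  | one G hG =>
    intro T B _ h hh
    refine BQ_Mx (Q := T) (Or.inl ?_) ⊤ (h.comp (Subgroup.subtype _)) ?_
    · exact ⟨1, fun x => ⟨0, Subtype.ext (by rw [hG x.1]; simp)⟩⟩
    · intro b
      obtain ⟨t, ht⟩ := hh b
      exact ⟨⟨t, trivial⟩, ht⟩
  | step N G Q i f hi hf hif hQ hN ih =>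
    intro T B _ h hh
    let j : T.comap i →* T := (i.comp (Subgroup.subtype _)).codRestrict T (fun x => x.2)
    let B' : AddSubgroup B := (MonoidHom.toAdditive (h.comp j)).range
    have hB' : Mx π B' := by
      refine ih (T.comap i) B' (AddMonoidHom.toMultiplicative ((MonoidHom.toAdditive (h.comp j)).rangeRestrict)) ?_
      intro b
      obtain ⟨x, hx⟩ := AddMonoidHom.rangeRestrict_surjective (MonoidHom.toAdditive (h.comp j)) (Multiplicative.toAdd b)
      exact ⟨x, hx⟩
    let ft : T →* T.map f := (f.comp (Subgroup.subtype _)).codRestrict (T.map f) (fun x => ⟨x, x.2, rfl⟩)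
    have hft : Function.Surjective ft := by
      rintro ⟨_, x, hx, rfl⟩
      exact ⟨⟨x, hx⟩, rfl⟩
    let qh : T →* Multiplicative (B ⧸ B') := (AddMonoidHom.toMultiplicative (QuotientAddGroup.mk' B')).comp h
    have hker : ft.ker ≤ qh.ker := by
      intro x hx
      have h1 : f x.1 = 1 := congrArg Subtype.val hx
      obtain ⟨y, hy⟩ := (hif _).1 h1
      have hyT : y ∈ T.comap i := by
        change i y ∈ T
        rw [hy]; exact x.2
      change (QuotientAddGroup.mk (Multiplicative.toAdd (h x)) : B ⧸ B') = 0
      rw [QuotientAddGroup.eq_zero_iff]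
      refine ⟨⟨y, hyT⟩, ?_⟩
      change h (j ⟨y, hyT⟩) = h x
      congr 1
      exact Subtype.ext hy
    have hC : Mx π (B ⧸ B') := by
      refine BQ_Mx hQ (T.map f) (MonoidHom.liftOfSurjective ft hft ⟨qh, hker⟩) ?_
      intro c
      obtain ⟨b, hb⟩ := QuotientAddGroup.mk_surjective (Multiplicative.toAdd c)
      obtain ⟨t, ht⟩ := hh (Multiplicative.ofAdd b)
      refine ⟨ft t, ?_⟩
      rw [MonoidHom.liftOfRightInverse_comp_apply]
      change (QuotientAddGroup.mk (Multiplicative.toAdd (h t)) : B ⧸ B') = Multiplicative.toAdd c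
      rw [ht]; exact hb
    have hex : ∀ b, QuotientAddGroup.mk' B' b = 0 → ∃ a, B'.subtype a = b := by
      intro b hb
      exact ⟨⟨b, (QuotientAddGroup.eq_zero_iff b).1 hb⟩, rfl⟩
    exact ⟨Fm_ext B'.subtype (QuotientAddGroup.mk' B') (QuotientAddGroup.mk'_surjective _) hex hB'.1 hC.1,
      AF_ext B'.subtype (QuotientAddGroup.mk' B') (QuotientAddGroup.mk'_surjective _) hex
        (fun a => (QuotientAddGroup.eq_zero_iff _).2 a.2) hB'.2 hC.2⟩

end TB

namespace TB

/-- kernel of `f` parametrised by the abelian group `A`. -/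
structure KE {Γ Γ' A : Type} [Group Γ] [Group Γ'] [AddCommGroup A] (f : Γ →* Γ') (a : A → Γ) : Prop where
  surj : Function.Surjective f
  add : ∀ x y, a (x + y) = a x * a y
  inj : Function.Injective a
  ker : ∀ x, f (a x) = 1
  ex : ∀ x, f x = 1 → ∃ y, a y = x

section
variable {Γ Γ' A : Type} [Group Γ] [Group Γ'] [AddCommGroup A] {f : Γ →* Γ'} {a : A → Γ}

lemma KE.zero (h : KE f a) : a 0 = 1 := by
  have := h.add 0 0; rw [add_zero] at this; exact left_eq_mul.1 this

lemma KE.neg (h : KE f a) (x : A) : a (-x) = (a x)⁻¹ := by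
  rw [eq_inv_iff_mul_eq_one, ← h.add, neg_add_cancel, h.zero]

lemma KE.nsmul (h : KE f a) (n : ℕ) (x : A) : a (n • x) = a x ^ n := by
  induction n with
  | zero => rw [zero_smul, h.zero, pow_zero]
  | succ n ih => rw [succ_nsmul, h.add, ih, pow_succ]

lemma KE.conj (h : KE f a) (g : Γ) (x : A) : ∃ y, a y = g * a x * g⁻¹ :=
  h.ex _ (by rw [map_mul, map_mul, h.ker, mul_one, map_inv, mul_inv_cancel])

lemma KE.conj_nsmul (h : KE f a) (g : Γ) (x y : A) (e : a y = g * a x * g⁻¹) (n : ℕ) : a (n • y) = g * a (n • x) * g⁻¹ := by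
  rw [h.nsmul, h.nsmul, e, conj_pow]

lemma KE.split (h : KE f a) (B : AddSubgroup A) (hB : ∀ g x, x ∈ B → ∀ y, a y = g * a x * g⁻¹ → y ∈ B) :
    ∃ (Γ'' : Type) (_ : Group Γ'') (f2 : Γ →* Γ'') (f1 : Γ'' →* Γ') (a1 : (A ⧸ B) → Γ''),
      KE f2 (fun x : B => a x) ∧ KE f1 a1 := by
  let N : Subgroup Γ :=
    { carrier := {x | ∃ b ∈ B, a b = x}
      one_mem' := ⟨0, B.zero_mem, h.zero⟩
      mul_mem' := by
        rintro _ _ ⟨x, hx, rfl⟩ ⟨y, hy, rfl⟩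
        exact ⟨x + y, B.add_mem hx hy, h.add _ _⟩
      inv_mem' := by
        rintro _ ⟨x, hx, rfl⟩
        exact ⟨-x, B.neg_mem hx, h.neg _⟩ }
  have hN : N.Normal := ⟨by
    rintro _ ⟨x, hx, rfl⟩ g
    obtain ⟨y, hy⟩ := h.conj g x
    exact ⟨y, hB g x hx y hy, hy⟩⟩
  have hNf : ∀ x ∈ N, f x = 1 := by
    rintro _ ⟨x, hx, rfl⟩; exact h.ker x
  let aa : A →+ Additive Γ := AddMonoidHom.mk' a h.add
  have hrel : ∀ x y : A, x - y ∈ B → (QuotientGroup.mk (a x) : Γ ⧸ N) = QuotientGroup.mk (a y) := by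
    intro x y hxy
    rw [QuotientGroup.eq]
    refine ⟨-x + y, ?_, ?_⟩
    · rw [← neg_sub] at hxy
      have := B.neg_mem hxy
      rw [neg_neg] at this
      rw [neg_add_eq_sub]; rwa [← neg_mem_iff, neg_sub, ← neg_sub, ]
    · rw [h.add, h.neg]
  let a1 : A ⧸ B → Γ ⧸ N := fun x => QuotientGroup.mk (a x.out)
  have ha1 : ∀ x : A, a1 (QuotientAddGroup.mk x) = QuotientGroup.mk (a x) := by
    intro x
    apply hrel
    have := QuotientAddGroup.mk_out_eq_mul B x
    obtain ⟨b, hb⟩ := this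
    rw [hb, add_sub_cancel_left]; exact b.2
  refine ⟨Γ ⧸ N, inferInstance, QuotientGroup.mk' N, QuotientGroup.lift N f hNf, a1, ?_, ?_⟩
  · refine ⟨QuotientGroup.mk'_surjective _, fun x y => h.add _ _, fun x y e => Subtype.ext (h.inj e), ?_, ?_⟩
    · intro x
      exact (QuotientGroup.eq_one_iff _).2 ⟨x, x.2, rfl⟩
    · intro x hx
      obtain ⟨b, hb, e⟩ := (QuotientGroup.eq_one_iff x).1 hx
      exact ⟨⟨b, hb⟩, e⟩
  · refine ⟨?_, ?_, ?_, ?_, ?_⟩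
    · intro y
      obtain ⟨x, rfl⟩ := h.surj y
      exact ⟨QuotientGroup.mk x, rfl⟩
    · intro x y
      obtain ⟨x, rfl⟩ := QuotientAddGroup.mk_surjective x
      obtain ⟨y, rfl⟩ := QuotientAddGroup.mk_surjective y
      rw [← QuotientAddGroup.mk_add, ha1, ha1, ha1, h.add]; rfl
    · intro x y
      obtain ⟨x, rfl⟩ := QuotientAddGroup.mk_surjective x
      obtain ⟨y, rfl⟩ := QuotientAddGroup.mk_surjective y
      rw [ha1, ha1, QuotientGroup.eq, QuotientAddGroup.eq]
      rintro ⟨b, hb, e⟩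
      rw [← h.neg, ← h.add] at e
      rw [← h.inj e]; exact hb
    · intro x
      obtain ⟨x, rfl⟩ := QuotientAddGroup.mk_surjective x
      rw [ha1]; exact h.ker x
    · intro x hx
      obtain ⟨x, rfl⟩ := QuotientGroup.mk_surjective x
      obtain ⟨y, hy⟩ := h.ex x hx
      exact ⟨QuotientAddGroup.mk y, by rw [ha1, hy]⟩

lemma UU_ab {π : Set ℕ} {p : ℕ} [hp : Fact p.Prime] (hpπ : p ∈ π) (h : KE f a) (hU : UU π p Γ') (hfg : Group.FG Γ)
    (hA : Mx π A) : UU π p Γ := by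
  -- torsion subgroup
  let τ : AddSubgroup A := (tors ℤ A).toAddSubgroup
  obtain ⟨Γ1, _, g1, f1, a1, hg1, hf1⟩ := h.split τ (by
    rintro g x ⟨m, hm, e⟩ y hy
    refine ⟨m, hm, h.inj ?_⟩
    rw [h.conj_nsmul g x y hy, e, h.zero, mul_one, mul_inv_cancel])
  have hU1 : UU π p Γ1 := by
    refine UU_tf f1 hf1.surj hU (A := A ⧸ τ) (Fm_quo (QuotientAddGroup.mk' τ) (QuotientAddGroup.mk'_surjective _) hA.1) ?_ a1 hf1.add hf1.inj hf1.ker hf1.ex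
    exact TF_quo (k := ℤ) (W := A)
  -- p-part
  let P : AddSubgroup τ :=
    { carrier := {x | ∃ n : ℕ, p ^ n • x = 0}
      zero_mem' := ⟨0, smul_zero _⟩
      add_mem' := by
        rintro x y ⟨m, hm⟩ ⟨n, hn⟩
        refine ⟨m + n, ?_⟩
        rw [smul_add, pow_add, mul_smul (p ^ m) (p ^ n) y, hn, smul_zero, mul_comm, mul_smul, hm, smul_zero, add_zero]
      neg_mem' := by
        rintro x ⟨m, hm⟩
        exact ⟨m, by rw [smul_neg, hm, neg_zero]⟩ }
  obtain ⟨Γ2, _, g2, f2, a2, hg2, hf2⟩ := hg1.split P (by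
    rintro g x ⟨m, e⟩ y hy
    refine ⟨m, hg1.inj ?_⟩
    have := hg1.conj_nsmul g x y hy (p ^ m)
    rw [e] at this
    rw [this, hg1.zero, mul_one, mul_inv_cancel])
  have hU2 : UU π p Γ2 := by
    refine UU_pprime f2 hf2.surj hU1 ?_ ?_ hp.out
    · rintro ⟨x, hx⟩ ⟨y, hy⟩
      obtain ⟨x, rfl⟩ := hf2.ex x hx
      obtain ⟨y, rfl⟩ := hf2.ex y hy
      apply Subtype.ext
      change a2 x * a2 y = a2 y * a2 x
      rw [← hf2.add, ← hf2.add, add_comm]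
    · rintro ⟨x, hx⟩
      obtain ⟨x, rfl⟩ := hf2.ex x hx
      obtain ⟨x, rfl⟩ := QuotientAddGroup.mk_surjective x
      obtain ⟨x, m, hm, e⟩ := x
      obtain ⟨n, m', hm', rfl⟩ := Nat.exists_eq_pow_mul_and_not_dvd hm p hp.out.ne_one
      refine ⟨m', hm', Subtype.ext ?_⟩
      change (a2 _) ^ m' = 1
      rw [← hf2.nsmul, ← QuotientAddGroup.mk_nsmul, (QuotientAddGroup.eq_zero_iff _).2, hf2.zero]
      refine ⟨n, Subtype.ext ?_⟩
      change p ^ n • m' • x = 0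
      rw [← mul_smul]; exact e
  -- divisible part
  have hPP : PP p P := by
    rintro ⟨x, n, hn⟩
    exact ⟨n, Subtype.ext hn⟩
  have hPart : IsArtinian ℤ P := by
    obtain ⟨F, hF, hA⟩ := AF_sub P.subtype Subtype.val_injective (AF_sub τ.subtype Subtype.val_injective hA.2)
    haveI : Module.Finite ℤ F := Module.Finite.iff_fg.2 hF
    haveI : Finite F := Module.finite_of_fg_torsion F (by
      intro x
      obtain ⟨n, hn⟩ := hPP x.1
      refine ⟨⟨(p ^ n : ℤ), mem_nonZeroDivisors_of_ne_zero (pow_ne_zero _ (by exact_mod_cast hp.out.ne_zero))⟩, Subtype.ext ?_⟩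
      change (p ^ n : ℤ) • x.1 = 0
      rw [← hn, ← natCast_zsmul]; push_cast; rfl)
    haveI : IsArtinian ℤ F := inferInstance
    exact (isArtinian_iff_submodule_quotient F).2 ⟨this, hA⟩
  obtain ⟨n, hn⟩ : ∃ n : ℕ, ∀ x : P, ∃ y : P, p ^ n • x = p ^ (n + 1) • y := by
    obtain ⟨n, hn⟩ := IsArtinian.monotone_stabilizes (R := ℤ) (M := P)
      ⟨fun n => OrderDual.toDual (LinearMap.range (p ^ n • LinearMap.id : P →ₗ[ℤ] P)), by
        intro i j hij
        change LinearMap.range (p ^ j • LinearMap.id : P →ₗ[ℤ] P) ≤ LinearMap.range (p ^ i • LinearMap.id : P →ₗ[ℤ] P)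
        rintro _ ⟨x, rfl⟩
        refine ⟨p ^ (j - i) • x, ?_⟩
        change p ^ i • p ^ (j - i) • x = p ^ j • x
        rw [← mul_smul, ← pow_add, Nat.add_sub_cancel' hij]⟩
    refine ⟨n, fun x => ?_⟩
    have h1 := hn (n + 1) (Nat.le_succ n)
    have h2 : LinearMap.range (p ^ n • LinearMap.id : P →ₗ[ℤ] P) = LinearMap.range (p ^ (n + 1) • LinearMap.id : P →ₗ[ℤ] P) := h1
    have h3 : p ^ n • x ∈ LinearMap.range (p ^ n • LinearMap.id : P →ₗ[ℤ] P) := ⟨x, rfl⟩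
    rw [h2] at h3
    obtain ⟨y, hy⟩ := h3
    exact ⟨y, hy.symm⟩
  let D : AddSubgroup P := (nsmulAddMonoidHom (p ^ n) : P →+ P).range
  obtain ⟨Γ3, _, g3, f3, a3, hg3, hf3⟩ := hg2.split D (by
    rintro g _ ⟨x, rfl⟩ y hy
    obtain ⟨z, hz⟩ := hg2.conj g x
    refine ⟨z, hg2.inj ?_⟩
    have := hg2.conj_nsmul g x z hz (p ^ n)
    rw [hy]; exact this)
  have hU3 : UU π p Γ3 := by
    haveI : IsArtinian ℤ (P ⧸ D) := isArtinian_of_surjective P (QuotientAddGroup.mk' D).toIntLinearMap (QuotientAddGroup.mk'_surjective _)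
    haveI : Finite (P ⧸ D) := fin_of_art this (p ^ n) (pow_ne_zero _ hp.out.ne_zero) (by
      intro x
      obtain ⟨x, rfl⟩ := QuotientAddGroup.mk_surjective x
      rw [← QuotientAddGroup.mk_nsmul, QuotientAddGroup.eq_zero_iff]
      exact ⟨x, rfl⟩)
    haveI : Finite f3.ker := Finite.of_surjective (fun x : P ⧸ D => (⟨a3 x, hf3.ker x⟩ : f3.ker)) (by
      rintro ⟨x, hx⟩
      obtain ⟨y, rfl⟩ := hf3.ex x hx
      exact ⟨y, rfl⟩)
    exact UU_finite f3 hf3.surj hU2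
  have hDart : IsArtinian ℤ D := isArtinian_of_injective (P := P) D.subtype.toIntLinearMap Subtype.val_injective
  refine UU_div hpπ _ Γ Γ3 D g3 hg3.surj _ hg3.add hg3.inj hg3.ker hg3.ex hU3 hfg ?_ ?_ (socle_fin hDart p hp.out.ne_zero) le_rfl
  · intro x
    obtain ⟨m, hm⟩ := hPP x.1
    exact ⟨m, Subtype.ext hm⟩
  · rintro ⟨_, x, rfl⟩
    obtain ⟨y, hy⟩ := hn x
    refine ⟨⟨p ^ n • y, y, rfl⟩, Subtype.ext ?_⟩
    change p • p ^ n • y = p ^ n • x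
    rw [hy, ← mul_smul, pow_succ, mul_comm]
end

lemma UU_one (π : Set ℕ) (p : ℕ) (Γ : Type) [Group Γ] (h : ∀ x : Γ, x = 1) : UU π p Γ := by
  intro k _ hk W _ _ _ ρ hT hA n
  cases n with
  | zero => exact Tor_gH0 hA
  | succ n =>
    haveI : Subsingleton Γ := ⟨fun x y => by rw [h x, h y]⟩
    haveI : Fintype Γ := Fintype.ofSubsingleton 1
    intro c
    refine ⟨Fintype.card Γ, Fintype.card_ne_zero, ?_⟩
    rw [← Nat.cast_smul_eq_nsmul k]
    exact finite_kill ρ n c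

theorem UU_main {G : Type} [Group G] (hfg : Group.FG G) (hsol : IsSolvable G) {π : Set ℕ} (hM : MM π G) {p : ℕ}
    [hp : Fact p.Prime] (hpπ : p ∈ π) : UU π p G := by
  have key : ∀ i, UU π p (G ⧸ derivedSeries G i) := by
    intro i
    induction i with
    | zero =>
      refine UU_one _ _ _ (fun x => ?_)
      obtain ⟨x, rfl⟩ := QuotientGroup.mk_surjective x
      rw [QuotientGroup.eq_one_iff]; trivial
    | succ i ih =>
      let N := derivedSeries G i
      let N' := derivedSeries G (i + 1)
      have hle : N' ≤ N := derivedSeries_antitone G (Nat.le_succ i)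
      let f : G ⧸ N' →* G ⧸ N := QuotientGroup.map N' N (MonoidHom.id G) hle
      have hcomm : ∀ x y : f.ker, x * y = y * x := by
        have key : ∀ z : G ⧸ N', f z = 1 → ∃ x ∈ N, QuotientGroup.mk x = z := by
          intro z hz
          obtain ⟨x, rfl⟩ := QuotientGroup.mk_surjective z
          exact ⟨x, (QuotientGroup.eq_one_iff x).1 hz, rfl⟩
        rintro ⟨x, hx⟩ ⟨y, hy⟩
        obtain ⟨x, hx', rfl⟩ := key x hx
        obtain ⟨y, hy', rfl⟩ := key y hy
        apply Subtype.ext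
        change (QuotientGroup.mk (x * y) : G ⧸ N') = QuotientGroup.mk (y * x)
        rw [eq_comm, QuotientGroup.eq]
        have h1 := Subgroup.commutator_mem_commutator (N.inv_mem hx') (N.inv_mem hy')
        rw [commutatorElement_def] at h1
        have h2 : (y * x)⁻¹ * (x * y) = x⁻¹ * y⁻¹ * x⁻¹⁻¹ * y⁻¹⁻¹ := by group
        rw [h2]; exact h1
      letI : CommGroup f.ker := { (inferInstance : Group f.ker) with mul_comm := hcomm }
      have hKE : KE f (fun x : Additive f.ker => (x.toMul : G ⧸ N')) := by
        refine ⟨?_, fun x y => rfl, fun x y e => Subtype.ext e, fun x => (x.toMul).2, fun x hx => ⟨Additive.ofMul ⟨x, hx⟩, rfl⟩⟩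
        intro y
        obtain ⟨y, rfl⟩ := QuotientGroup.mk_surjective y
        exact ⟨QuotientGroup.mk y, rfl⟩
      refine UU_ab hpπ hKE ih inferInstance ?_
      let h : N →* f.ker := ((QuotientGroup.mk' N').comp N.subtype).codRestrict f.ker (fun x => (QuotientGroup.eq_one_iff _).2 x.2)
      refine MM_Mx hM N (Additive f.ker) (h : N →* Multiplicative (Additive f.ker)) ?_
      rintro ⟨z, hz⟩
      obtain ⟨x, rfl⟩ := QuotientGroup.mk_surjective z
      exact ⟨⟨x, (QuotientGroup.eq_one_iff x).1 hz⟩, rfl⟩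
  obtain ⟨n, hn⟩ := (isSolvable_def G).1 hsol
  have h1 := key n
  haveI : Finite (QuotientGroup.mk' (derivedSeries G n)).ker := by
    rw [QuotientGroup.ker_mk', hn]; infer_instance
  exact UU_finite (QuotientGroup.mk' (derivedSeries G n)) (QuotientGroup.mk'_surjective _) h1

end TB

namespace TB

section
variable {k : Type} [CommRing k] {P : ∀ (M : Type) [AddCommGroup M] [Module k M], Prop}
variable {Q : Type} [Group Q] {W : Type} [AddCommGroup W] [Module k W]

/-- quotient map from cocycles -/
def zq (ρ : Representation k Q W) (n : ℕ) : (gc ρ).Z n →ₗ[k] gH ρ n := Submodule.mkQ _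

lemma zq_surj (ρ : Representation k Q W) (n : ℕ) : Function.Surjective (zq ρ n) := Submodule.mkQ_surjective _

def zi (ρ : Representation k Q W) (n : ℕ) : (gc ρ).Z n →ₗ[k] ((Fin n → Q) → W) := Submodule.subtype _

lemma zi_inj (ρ : Representation k Q W) (n : ℕ) : Function.Injective (zi ρ n) := Subtype.val_injective

lemma zi_d (ρ : Representation k Q W) (n : ℕ) (z : (gc ρ).Z n) : dfun ρ n (zi ρ n z) = 0 := z.2

lemma gH_of_cochains (hP : SC k P) (ρ : Representation k Q W) (n : ℕ) (h : P ((Fin n → Q) → W)) : P (gH ρ n) :=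
  hP.quo (zq ρ n) (zq_surj ρ n) (hP.sub (zi ρ n) (zi_inj ρ n) h)

/-- cocycles of degree one on a cyclic group are determined by the value at a generator -/
lemma z1_zero (ρ : Representation k Q W) (z : Q) (hz : ∀ x, x ∈ Subgroup.zpowers z) (F : (Fin 1 → Q) → W)
    (hF : dfun ρ 1 F = 0) (h : F (fun _ => z) = 0) : F = 0 := by
  have co : ∀ x y, F (fun _ => x * y) = ρ x (F (fun _ => y)) + F (fun _ => x) := by
    intro x y
    have h1 := congrFun hF (Fin.cons x (fun _ => y))
    rw [dfun_cons, dp_cons, dp_zero, Pi.zero_apply] at h1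
    have e1 : (Fin.cons (x * (fun _ : Fin 1 => y) 0) (Fin.tail (fun _ : Fin 1 => y)) : Fin 1 → Q) = fun _ => x * y := by
      funext i; exact Fin.cases rfl (fun j => j.elim0) i
    have e2 : ∀ s : Fin 0 → Q, (Fin.cons x s : Fin 1 → Q) = fun _ => x := by
      intro s; funext i; exact Fin.cases rfl (fun j => j.elim0) i
    rw [e1, e2] at h1
    rw [sub_neg_eq_add, ← sub_eq_zero]
      at h1
    rw [← sub_eq_zero, ← neg_eq_zero, ← h1]; abel
  have h1 : F (fun _ => 1) = 0 := by
    have := co 1 1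
    rw [mul_one, map_one] at this
    exact (left_eq_add.1 this)
  let S : Subgroup Q :=
    { carrier := {x | F (fun _ => x) = 0}
      one_mem' := h1
      mul_mem' := by
        intro a b ha hb
        change F (fun _ => a * b) = 0
        have ha' : F (fun _ => a) = 0 := ha
        have hb' : F (fun _ => b) = 0 := hb
        rw [co, ha', hb', map_zero, add_zero]
      inv_mem' := by
        intro a ha
        have ha' : F (fun _ => a) = 0 := ha
        have := co a⁻¹ a
        rw [inv_mul_cancel, h1, ha', map_zero, zero_add] at this
        exact this.symm }
  funext t
  have hS : Subgroup.zpowers z ≤ S := by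
    rw [Subgroup.zpowers_le]; exact h
  have : F (fun _ => t 0) = 0 := hS (hz (t 0))
  have e : t = fun _ => t 0 := by funext i; rw [Subsingleton.elim i 0]
  rw [e]; exact this

def ev1 (ρ : Representation k Q W) (z : Q) : (gc ρ).Z 1 →ₗ[k] W :=
  (LinearMap.proj (R := k) (φ := fun _ : (Fin 1 → Q) => W) (fun _ => z)).comp (zi ρ 1)

lemma ev1_inj (ρ : Representation k Q W) (z : Q) (hz : ∀ x, x ∈ Subgroup.zpowers z) : Function.Injective (ev1 ρ z) := by
  rw [← LinearMap.ker_eq_bot, LinearMap.ker_eq_bot']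
  intro c hc
  apply zi_inj
  exact z1_zero ρ z hz _ (zi_d ρ 1 c) hc

def theta (ρ : Representation k Q W) (z : Q) : (Q → W) →ₗ[k] (Q → W) where
  toFun F x := F (z * x) - ρ z (F x)
  map_add' F G := by funext x; simp only [Pi.add_apply, map_add]; abel
  map_smul' c F := by funext x; simp only [Pi.smul_apply, map_smul, RingHom.id_apply, smul_sub]

lemma theta_apply (ρ : Representation k Q W) (z : Q) (F : Q → W) (x : Q) : theta ρ z F x = F (z * x) - ρ z (F x) := rfl

lemma theta_eq (ρ : Representation k Q W) (z : Q) (g : Q) (F : Q → W) :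
    theta ρ z (coind k Q W g F) = coind k Q W g (theta ρ z F) := by
  funext x
  rw [theta_apply, coind_apply, coind_apply, coind_apply, theta_apply, mul_assoc]

lemma theta_ker (ρ : Representation k Q W) (z : Q) (hz : ∀ x, x ∈ Subgroup.zpowers z) (F : Q → W) :
    theta ρ z F = 0 ↔ ∃ v, iE ρ v = F := by
  constructor
  · intro h
    have h' : ∀ x, F (z * x) = ρ z (F x) := fun x => sub_eq_zero.1 (congrFun h x)
    let S : Subgroup Q :=
      { carrier := {y | ∀ x, F (y * x) = ρ y (F x)}
        one_mem' := fun x => by rw [one_mul, map_one]; rfl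
        mul_mem' := fun {a b} ha hb x => by rw [mul_assoc, ha, hb, map_mul]; rfl
        inv_mem' := fun {a} ha x => by
          have h2 : ρ a (F (a⁻¹ * x)) = F x := by rw [← ha, mul_inv_cancel_left]
          rw [← h2]
          change _ = (ρ a⁻¹ * ρ a) _
          rw [← map_mul, inv_mul_cancel, map_one]; rfl }
    refine ⟨F 1, ?_⟩
    funext x
    have hS : Subgroup.zpowers z ≤ S := by rw [Subgroup.zpowers_le]; exact h'
    have := hS (hz x) 1
    rw [mul_one] at this
    exact this.symm
  · rintro ⟨v, rfl⟩
    funext x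
    rw [theta_apply, iE_apply, iE_apply, map_mul]
    exact sub_self _

lemma theta_surj (ρ : Representation k Q W) (z : Q) (hz : ∀ x, x ∈ Subgroup.zpowers z)
    (hinf : Function.Injective (fun n : ℤ => z ^ n)) : Function.Surjective (theta ρ z) := by
  intro ψ
  obtain ⟨φ, hφ⟩ := antideriv (fun n : ℤ => ρ (z ^ (n + 1))⁻¹ (ψ (z ^ n)))
  choose e he using fun x => Subgroup.mem_zpowers_iff.1 (hz x)
  have he1 : ∀ x, e (z * x) = e x + 1 := by
    intro x
    apply hinf
    change z ^ _ = z ^ _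
    rw [he, zpow_add_one, he]
    have hx := he x
    rw [← hx, ← zpow_one_add, ← zpow_add_one, add_comm]
  refine ⟨fun x => ρ x (φ (e x)), ?_⟩
  funext x
  rw [theta_apply, he1]
  have h1 := hφ (e x)
  rw [sub_eq_iff_eq_add] at h1
  rw [h1, he, zpow_add_one, he, map_add]
  have h2 : x * z = z * x := by
    rw [← he x, ← zpow_add_one, ← zpow_one_add, add_comm]
  rw [h2]
  have h3 : ρ (z * x) (ρ (z * x)⁻¹ (ψ x)) = ψ x := by
    change (ρ (z * x) * ρ (z * x)⁻¹) _ = _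
    rw [← map_mul, mul_inv_cancel, map_one]; rfl
  rw [h3, map_mul]
  exact add_sub_cancel_right _ _

lemma inf_cyc_zero (ρ : Representation k Q W) (z : Q) (hz : ∀ x, x ∈ Subgroup.zpowers z)
    (hinf : Function.Injective (fun n : ℤ => z ^ n)) (n : ℕ) (c : gH ρ (n + 2)) : c = 0 := by
  have S := gses (σ := ρ) (τ := coind k Q W) (υ := coind k Q W) (iE ρ) (theta ρ z) (fun x v => iE_eq ρ _ v) (fun x v => theta_eq ρ z x v)
    (iE_inj ρ) (theta_surj ρ z hz hinf) (theta_ker ρ z hz)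
  obtain ⟨d, rfl⟩ := S.exact1 (n + 1) c (coind_acyclic' _ _)
  rw [coind_acyclic' n d, map_zero]

/-- infinite cyclic base case -/
lemma base_inf (hP : SC k P) (ρ : Representation k Q W) (z : Q) (hz : ∀ x, x ∈ Subgroup.zpowers z)
    (hinf : Function.Injective (fun n : ℤ => z ^ n)) (hW : P W) (n : ℕ) : P (gH ρ n) := by
  match n with
  | 0 => exact hP.sub (h0 ρ) (h0_inj ρ) hW
  | 1 => exact hP.quo (zq ρ 1) (zq_surj ρ 1) (hP.sub (ev1 ρ z) (ev1_inj ρ z hz) hW)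
  | n + 2 => exact hP.zero _ (inf_cyc_zero ρ z hz hinf n)

end

section
variable {k : Type} [CommRing k] {Q : Type} [Group Q]

lemma fin_gH [Finite Q] {W : Type} [AddCommGroup W] [Module k W] [Finite W] (ρ : Representation k Q W) (n : ℕ) : Finite (gH ρ n) := by
  haveI : Finite ((gc ρ).Z n) := Finite.of_injective (zi ρ n) (zi_inj ρ n)
  exact Finite.of_surjective (zq ρ n) (zq_surj ρ n)

/-- uniform bound for finite cyclic groups -/
lemma cyc_bound [Finite Q] (z : Q) (hz : ∀ x, x ∈ Subgroup.zpowers z) (n : ℕ) : ∀ {W : Type} [AddCommGroup W] [Module k W] [Finite W]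
    (ρ : Representation k Q W), Nat.card (gH ρ n) ≤ Nat.card W := by
  induction n using Nat.strong_induction_on with
  | _ n ih =>
  intro W _ _ _ ρ
  match n, ih with
  | 0, _ => exact Nat.card_le_card_of_injective (h0 ρ) (h0_inj ρ)
  | 1, _ =>
    haveI : Finite ((gc ρ).Z 1) := Finite.of_injective (zi ρ 1) (zi_inj ρ 1)
    exact (Nat.card_le_card_of_surjective (zq ρ 1) (zq_surj ρ 1)).trans (Nat.card_le_card_of_injective (ev1 ρ z) (ev1_inj ρ z hz))
  | n + 2, ih =>
    let I : Submodule k (Q → W) := LinearMap.range (theta ρ z)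
    have hI : ∀ g, ∀ v ∈ I, coind k Q W g v ∈ I := by
      rintro g _ ⟨F, rfl⟩
      exact ⟨coind k Q W g F, theta_eq ρ z g F⟩
    have S1 := gses (σ := ρ) (τ := coind k Q W) (υ := srep (coind k Q W) I hI) (V'' := ↥I) (iE ρ) (theta ρ z).rangeRestrict (fun x v => iE_eq ρ _ v)
      (fun x v => Subtype.ext (theta_eq ρ z x v))
      (iE_inj ρ) (LinearMap.surjective_rangeRestrict _) (fun v => by
        rw [← theta_ker ρ z hz]
        exact ⟨fun h => congrArg Subtype.val h, fun h => Subtype.ext h⟩)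
    have S2 := subSES (coind k Q W) I hI
    haveI : Finite ((Q → W) ⧸ I) := Finite.of_surjective _ (Submodule.mkQ_surjective I)
    haveI f1 : Finite (gH (qrep (coind k Q W) I hI) n) := fin_gH _ _
    haveI f2 : Finite (gH (V := ↥I) (srep (coind k Q W) I hI) (n + 1)) := fin_gH (W := ↥I) _ _
    have c1 : Nat.card (gH ρ (n + 2)) ≤ Nat.card (gH (V := ↥I) (srep (coind k Q W) I hI) (n + 1)) :=
      Nat.card_le_card_of_surjective (S1.δ (n + 1)) (fun c => S1.exact1 (n + 1) c (coind_acyclic' _ _))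
    have c2 : Nat.card (gH (V := ↥I) (srep (coind k Q W) I hI) (n + 1)) ≤ Nat.card (gH (qrep (coind k Q W) I hI) n) :=
      Nat.card_le_card_of_surjective (S2.δ n) (fun c => S2.exact1 n c (coind_acyclic' _ _))
    have c3 := ih n (by omega) (qrep (coind k Q W) I hI)
    refine c1.trans (c2.trans (c3.trans ?_))
    have e1 : Nat.card (Q → W) = Nat.card ((Q → W) ⧸ I) * Nat.card I := 
      AddSubgroup.card_eq_card_quotient_mul_card_addSubgroup I.toAddSubgroup
    have e2 : Nat.card (Q → W) = Nat.card ((Q → W) ⧸ LinearMap.ker (theta ρ z)) * Nat.card (LinearMap.ker (theta ρ z)) := 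
      AddSubgroup.card_eq_card_quotient_mul_card_addSubgroup (LinearMap.ker (theta ρ z)).toAddSubgroup
    rw [Nat.card_congr (theta ρ z).quotKerEquivRange.toEquiv] at e2
    have e3 : Nat.card (LinearMap.ker (theta ρ z)) ≤ Nat.card W := by
      refine Nat.card_le_card_of_surjective (fun v : W => (⟨iE ρ v, (theta_ker ρ z hz _).2 ⟨v, rfl⟩⟩ : LinearMap.ker (theta ρ z))) ?_
      rintro ⟨F, hF⟩
      obtain ⟨v, hv⟩ := (theta_ker ρ z hz F).1 hF
      exact ⟨v, Subtype.ext hv⟩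
    have hpos : 0 < Nat.card I := Nat.card_pos
    have e4 : Nat.card ((Q → W) ⧸ I) * Nat.card I = Nat.card (LinearMap.ker (theta ρ z)) * Nat.card I := by
      rw [← e1, e2, mul_comm]
    rw [Nat.eq_of_mul_eq_mul_right hpos e4]
    exact e3

/-- locally finite-cyclic groups with finite coefficients -/
lemma loc_cyc_fin (hQ : ∀ T : Finset Q, Finite (Subgroup.closure (T : Set Q)) ∧ IsCyclic (Subgroup.closure (T : Set Q)))
    {W : Type} [AddCommGroup W] [Module k W] [Finite W] (ρ : Representation k Q W) (n : ℕ) : Finite (gH ρ n) := by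
  cases n with
  | zero => exact Finite.of_injective (h0 ρ) (h0_inj ρ)
  | succ n =>
    classical
    by_contra hinf
    rw [not_finite_iff_infinite] at hinf
    obtain ⟨X, hX⟩ := Infinite.exists_subset_card_eq (gH ρ (n + 1)) (Nat.card W + 1)
    have h1 : ∀ c : gH ρ (n + 1), c ≠ 0 → ∃ T : Finset Q, rst ρ (Subgroup.closure (T : Set Q)) (n + 1) c ≠ 0 := by
      intro c hc
      by_contra hn
      push Not at hn
      exact hc (local_zero LS_finite ρ n c hn)
    have h2 : ∀ c : gH ρ (n + 1), ∃ T : Finset Q, c ≠ 0 → rst ρ (Subgroup.closure (T : Set Q)) (n + 1) c ≠ 0 := by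
      intro c
      by_cases hc : c = 0
      · exact ⟨∅, fun h => absurd hc h⟩
      · obtain ⟨T, hT⟩ := h1 c hc; exact ⟨T, fun _ => hT⟩
    choose T hT using h2
    let U : Finset Q := X.biUnion (fun a => X.biUnion (fun b => T (a - b)))
    have hU : ∀ a ∈ X, ∀ b ∈ X, T (a - b) ⊆ U := by
      intro a ha b hb
      exact (Finset.subset_biUnion_of_mem (fun b => T (a - b)) hb).trans (Finset.subset_biUnion_of_mem (fun a => X.biUnion (fun b => T (a - b))) ha)
    obtain ⟨hfin, hcyc⟩ := hQ U
    obtain ⟨z, hz⟩ := hcyc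
    have hb := cyc_bound z hz (n + 1) (res (Subgroup.closure (U : Set Q)).subtype ρ)
    haveI := fin_gH (res (Subgroup.closure (U : Set Q)).subtype ρ) (n + 1)
    have hinj : Set.InjOn (rst ρ (Subgroup.closure (U : Set Q)) (n + 1)) X := by
      intro a ha b hb e
      by_contra hab
      refine hT (a - b) (sub_ne_zero.2 hab) (rst_mono ρ (Subgroup.closure_mono (Finset.coe_subset.2 (hU a ha b hb))) _ _ ?_)
      rw [map_sub, e, sub_self]
    have h4 : X.card ≤ Nat.card (gH (res (Subgroup.closure (U : Set Q)).subtype ρ) (n + 1)) := by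
      rw [← Finset.card_image_of_injOn hinj, ← Nat.card_eq_finsetCard]
      exact Finite.card_subtype_le _
    omega
end

/-- artinian modules are linearly compact -/
lemma LS_art {k : Type} [CommRing k] {V : Type} [AddCommGroup V] [Module k V] (hV : IsArtinian k V) : LS k V := by
  intro I J Φ y hΦ hfin
  classical
  let E := ((I → V) →ₗ[k] V) × V
  let good : Set E → Prop := fun A => ∀ T : Finset E, (T : Set E) ⊆ A → ∃ F, ∀ e ∈ T, e.1 F = e.2
  let A0 : Set E := Set.range (fun j => (Φ j, y j))
  have hA0 : good A0 := by
    intro T hT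
    have hT' : ∀ e : T, ∃ j, (Φ j, y j) = e.1 := fun e => hT e.2
    choose j hj using hT'
    obtain ⟨F, hF⟩ := hfin (Finset.univ.image j)
    refine ⟨F, fun e he => ?_⟩
    have h1 := hF (j ⟨e, he⟩) (Finset.mem_image_of_mem _ (Finset.mem_univ _))
    have h2 := hj ⟨e, he⟩
    change _ = e at h2
    rw [← h2]; exact h1
  obtain ⟨A, hA0A, hA, hmax⟩ : ∃ A, A0 ⊆ A ∧ good A ∧ ∀ B, good B → A ⊆ B → B = A := by
    obtain ⟨A, h1, h2⟩ := zorn_subset_nonempty {A | good A} (by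
      intro c hc hch hne
      refine ⟨⋃₀ c, ?_, fun s hs => Set.subset_sUnion_of_mem hs⟩
      intro T hT
      obtain ⟨s, hs, hTs⟩ := DirectedOn.exists_mem_subset_of_finset_subset_biUnion hne (hch.directedOn) (s := T) (f := id) (by
        intro x hx; obtain ⟨s, hs, hxs⟩ := hT hx; exact Set.mem_biUnion hs hxs)
      exact hc hs T hTs) A0 hA0
    exact ⟨A, h1, h2.1, fun B hB hAB => (Set.Subset.antisymm hAB (h2.2 hB hAB)).symm⟩
  have key : ∀ i, ∃ v, ((LinearMap.proj i : (I → V) →ₗ[k] V), v) ∈ A := by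
    intro i
    -- direction submodules
    let Dm : Finset E → Submodule k V := fun T =>
      (⨅ e ∈ T, LinearMap.ker e.1).map (LinearMap.proj i : (I → V) →ₗ[k] V)
    obtain ⟨M, ⟨T0, hT0, rfl⟩, hmin⟩ := IsArtinian.set_has_minimal {M | ∃ T : Finset E, (T : Set E) ⊆ A ∧ Dm T = M} ⟨_, ∅, by simp, rfl⟩
    obtain ⟨F0, hF0⟩ := hA T0 hT0
    refine ⟨F0 i, ?_⟩
    have hg : good (insert ((LinearMap.proj i : (I → V) →ₗ[k] V), F0 i) A) := by
      intro T hT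
      let T1 := (T.filter (· ∈ A)) ∪ T0
      have hT1 : (T1 : Set E) ⊆ A := by
        intro e he
        rcases Finset.mem_union.1 he with h | h
        · exact (Finset.mem_filter.1 h).2
        · exact hT0 h
      have hle : Dm T1 ≤ Dm T0 := Submodule.map_mono (biInf_mono (fun e he => Finset.mem_union_right _ he))
      have heq : Dm T1 = Dm T0 := by
        by_contra hne
        exact hmin _ ⟨T1, hT1, rfl⟩ (lt_of_le_of_ne hle hne)
      obtain ⟨F1, hF1⟩ := hA T1 hT1
      have hd : F0 i - F1 i ∈ Dm T0 := by
        refine ⟨F0 - F1, ?_, rfl⟩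
        simp only [Submodule.coe_iInf, Set.mem_iInter, SetLike.mem_coe, LinearMap.mem_ker]
        intro e he
        rw [map_sub, hF0 e he, hF1 e (Finset.mem_union_right _ he), sub_self]
      rw [← heq] at hd
      obtain ⟨D, hD, hDi⟩ := hd
      simp only [Submodule.coe_iInf, Set.mem_iInter, SetLike.mem_coe, LinearMap.mem_ker] at hD
      refine ⟨F1 + D, fun e he => ?_⟩
      rcases hT he with h | h
      · rw [h]
        change F1 i + D i = F0 i
        have : D i = F0 i - F1 i := hDi
        rw [this]; abel
      · have h' : e ∈ T1 := Finset.mem_union_left _ (Finset.mem_filter.2 ⟨he, h⟩)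
        rw [map_add, hF1 e h', hD e h', add_zero]
    have := hmax _ hg (Set.subset_insert _ _)
    rw [← this]; exact Set.mem_insert _ _
  choose F hF using key
  refine ⟨F, fun j => ?_⟩
  obtain ⟨s, hs⟩ := hΦ j
  obtain ⟨F', hF'⟩ := hA (insert (Φ j, y j) (s.image (fun i => ((LinearMap.proj i : (I → V) →ₗ[k] V), F i)))) (by
    intro e he
    rcases Finset.mem_insert.1 he with rfl | h
    · exact hA0A ⟨j, rfl⟩
    · obtain ⟨i, _, rfl⟩ := Finset.mem_image.1 h
      exact hF i)
  have h1 := hF' _ (Finset.mem_insert_self _ _)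
  have h2 : Φ j (F - F') = 0 := hs _ (fun i hi => by
    have := hF' _ (Finset.mem_insert_of_mem (Finset.mem_image_of_mem _ hi))
    change F i - F' i = 0
    rw [sub_eq_zero]; exact this.symm)
  rw [map_sub, sub_eq_zero] at h2
  rw [h2]; exact h1

end TB

namespace TB

section
variable {k : Type} [CommRing k] {P : ∀ (M : Type) [AddCommGroup M] [Module k M], Prop}

lemma SC.pow (hP : SC k P) {W : Type} [AddCommGroup W] [Module k W] (hW : P W) (m : ℕ) : P (Fin m → W) := by
  induction m with
  | zero => exact hP.zero _ (fun x => Subsingleton.elim _ _)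
  | succ m ih =>
    refine hP.mid W (Fin (m + 1) → W) (Fin m → W) (LinearMap.single k (fun _ : Fin (m + 1) => W) 0)
      (LinearMap.funLeft k W Fin.succ) ?_ hW ih
    intro y hy
    refine ⟨y 0, ?_⟩
    funext i
    refine Fin.cases ?_ (fun j => ?_) i
    · simp
    · have := congrFun hy j
      rw [LinearMap.funLeft_apply] at this
      rw [this]
      simp

lemma SC.pi (hP : SC k P) {W : Type} [AddCommGroup W] [Module k W] (hW : P W) (ι : Type) [Finite ι] : P (ι → W) := by
  obtain ⟨m, ⟨e⟩⟩ := Finite.exists_equiv_fin ι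
  refine hP.sub (LinearMap.funLeft k W e.symm) (LinearMap.funLeft_injective_of_surjective _ _ _ e.symm.surjective) (hP.pow hW m)

lemma SC.h00 (hP : SC k P) {Q : Type} [Group Q] {W : Type} [AddCommGroup W] [Module k W] (ρ : Representation k Q W) (hW : P W) : P (gH ρ 0) :=
  hP.sub (h0 ρ) (h0_inj ρ) hW

lemma cop_zero {M : Type} [AddCommGroup M] (x : M) (a b : ℕ) (h : Nat.Coprime a b) (ha : a • x = 0) (hb : b • x = 0) : x = 0 := by
  have h1 := addOrderOf_dvd_of_nsmul_eq_zero ha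
  have h2 := addOrderOf_dvd_of_nsmul_eq_zero hb
  have := Nat.dvd_gcd h1 h2
  rw [h.gcd_eq_one, Nat.dvd_one, AddMonoid.addOrderOf_eq_one_iff] at this
  exact this

lemma finite_kill' {Q : Type} [Group Q] [Finite Q] {W : Type} [AddCommGroup W] [Module k W] (ρ : Representation k Q W) (n : ℕ) (c : gH ρ (n + 1)) :
    Nat.card Q • c = 0 := by
  haveI := Fintype.ofFinite Q
  rw [Nat.card_eq_fintype_card, ← Nat.cast_smul_eq_nsmul k]
  exact finite_kill ρ n c

lemma BQ_base (hP : SC k P) {π : Set ℕ}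
    (hpr : ∀ (Q : Type) [Group Q] (q : ℕ), q.Prime → q ∈ π → Nonempty (Q ≃* Multiplicative (pruferSubgroup q)) →
      ∀ (W : Type) [AddCommGroup W] [Module k W] (ρ : Representation k Q W) (n : ℕ), P W → P (gH ρ n))
    (Q : Type) [Group Q] (hQ : BQ π Q) (W : Type) [AddCommGroup W] [Module k W] (ρ : Representation k Q W) (n : ℕ) (hW : P W) :
    P (gH ρ n) := by
  rcases hQ with hc | ⟨q, hq, hqπ, e⟩
  · obtain ⟨z, hz⟩ := hc
    by_cases hinf : Function.Injective (fun n : ℤ => z ^ n)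
    · exact base_inf hP ρ z hz hinf hW n
    · rw [injective_zpow_iff_not_isOfFinOrder, not_not] at hinf
      haveI : Finite (Subgroup.zpowers z) := finite_zpowers.2 hinf
      haveI : Finite Q := Finite.of_surjective (fun x : Subgroup.zpowers z => x.1) (fun x => ⟨⟨x, hz x⟩, rfl⟩)
      exact gH_of_cochains hP ρ n (hP.pi hW _)
  · exact hpr Q q hq hqπ e W ρ n hW

lemma MM_ind (hP : SC k P) {π : Set ℕ}
    (hb : ∀ (Q : Type) [Group Q], BQ π Q →
      ∀ (W : Type) [AddCommGroup W] [Module k W] (ρ : Representation k Q W) (n : ℕ), P W → P (gH ρ n))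
    {G : Type} [hG : Group G] (h : MM π G) : ∀ (K : Type) [Group K] (e : K ≃* G) (W : Type) [AddCommGroup W] [Module k W]
      (ρ : Representation k K W) (n : ℕ), P W → P (gH ρ n) := by
  induction h with
  | one G h =>
    intro K _ e W _ _ ρ n hW
    haveI : Finite K := by
      haveI : Subsingleton G := ⟨fun a b => by rw [h a, h b]⟩
      exact Finite.of_injective e e.injective
    exact gH_of_cochains hP ρ n (hP.pi hW _)
  | step N G Q i f hi hf hif hQ h ih =>
    intro K _ e W _ _ ρ n hW
    cases n with
    | zero => exact hP.sub (h0 ρ) (h0_inj ρ) hW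
    | succ n =>
      let f' : K →* Q := f.comp e.toMonoidHom
      have hf' : Function.Surjective f' := hf.comp e.surjective
      let e' : N →* f'.ker := (e.symm.toMonoidHom.comp i).codRestrict f'.ker (fun y => by
        change f (e (e.symm (i y))) = 1
        rw [e.apply_symm_apply]; exact (hif _).2 ⟨y, rfl⟩)
      have he' : Function.Bijective e' := by
        constructor
        · intro a b hab
          exact hi (e.symm.injective (congrArg Subtype.val hab))
        · rintro ⟨x, hx⟩
          obtain ⟨y, hy⟩ := (hif (e x)).1 hx
          refine ⟨y, Subtype.ext ?_⟩
          change e.symm (i y) = x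
          rw [hy, e.symm_apply_apply]
      refine LHS f' hf' hP ρ (fun a b _ => hb Q hQ _ _ _ ?_) n
      exact ih f'.ker (MulEquiv.ofBijective e' he').symm W _ b hW

end

lemma SC_fin (k : Type) [CommRing k] : SC k (fun M _ _ => Finite M) where
  zero M _ _ h := by
    haveI : Subsingleton M := ⟨fun a b => by rw [h a, h b]⟩
    infer_instance
  mid X Y Z _ _ _ _ _ _ f g h hX hZ := by
    haveI : Finite (LinearMap.range f) := Finite.of_surjective f.rangeRestrict (LinearMap.surjective_rangeRestrict f)
    haveI : Finite (LinearMap.ker g) := Finite.of_injective (fun y : LinearMap.ker g => (⟨y.1, h y.1 y.2⟩ : LinearMap.range f))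
      (fun a b e => Subtype.ext (congrArg (fun z : LinearMap.range f => z.1) e))
    haveI : Finite (Y ⧸ LinearMap.ker g) := Finite.of_injective _ (g.quotKerEquivRange.injective)
    refine Nat.finite_of_card_ne_zero ?_
    rw [AddSubgroup.card_eq_card_quotient_mul_card_addSubgroup (LinearMap.ker g).toAddSubgroup]
    exact mul_ne_zero (Nat.card_pos (α := Y ⧸ LinearMap.ker g)).ne' (Nat.card_pos (α := LinearMap.ker g)).ne'

def Art (M : Type) [AddCommGroup M] : Prop := IsArtinian ℤ M

lemma Art_iff {M : Type} [AddCommGroup M] [i : Module ℤ M] : Art M ↔ @IsArtinian ℤ M _ _ i := by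
  obtain rfl : i = AddCommGroup.toIntModule M := Subsingleton.elim _ _
  rfl

lemma Art_sub {A B : Type} [AddCommGroup A] [AddCommGroup B] (f : A →+ B) (hf : Function.Injective f) (h : Art B) : Art A :=
  @isArtinian_of_injective _ _ _ _ _ _ _ _ f.toIntLinearMap hf h

lemma Art_quo {A B : Type} [AddCommGroup A] [AddCommGroup B] (f : B →+ A) (hf : Function.Surjective f) (h : Art B) : Art A :=
  @isArtinian_of_surjective _ _ _ _ _ _ _ _ f.toIntLinearMap hf h

lemma Art_mid {X Y Z : Type} [AddCommGroup X] [AddCommGroup Y] [AddCommGroup Z] (f : X →+ Y) (g : Y →+ Z)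
    (h : ∀ y, g y = 0 → ∃ x, f x = y) (hX : Art X) (hZ : Art Z) : Art Y := by
  have hK : Art (g.comp f).ker := Art_sub (g.comp f).ker.subtype Subtype.val_injective hX
  refine @isArtinian_of_range_eq_ker _ _ _ _ _ _ _ _ _ _ _ hK hZ (f.comp (g.comp f).ker.subtype).toIntLinearMap g.toIntLinearMap ?_
  ext y
  constructor
  · rintro ⟨x, rfl⟩
    exact x.2
  · intro hy
    obtain ⟨x, rfl⟩ := h y hy
    exact ⟨⟨x, hy⟩, rfl⟩

lemma SC_art (k : Type) [CommRing k] : SC k (fun M _ _ => Art M) where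
  zero M _ _ h := by
    haveI : Subsingleton M := ⟨fun a b => by rw [h a, h b]⟩
    change IsArtinian ℤ M
    infer_instance
  mid X Y Z _ _ _ _ _ _ f g h hX hZ := Art_mid f.toAddMonoidHom g.toAddMonoidHom h hX hZ

lemma SC_PP (k : Type) [CommRing k] (p : ℕ) : SC k (fun M _ _ => PP p M) where
  zero M _ _ h x := ⟨0, h _⟩
  mid X Y Z _ _ _ _ _ _ f g h hX hZ y := by
    obtain ⟨n, hn⟩ := hZ (g y)
    rw [← map_nsmul] at hn
    obtain ⟨x, hx⟩ := h _ hn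
    obtain ⟨m, hm⟩ := hX x
    refine ⟨m + n, ?_⟩
    rw [pow_add, mul_smul, ← hx, ← map_nsmul, hm, map_zero]

lemma SC.and {k : Type} [CommRing k] {P P' : ∀ (M : Type) [AddCommGroup M] [Module k M], Prop} (hP : SC k P) (hP' : SC k P') :
    SC k (fun M _ _ => P M ∧ P' M) where
  zero M _ _ h := ⟨hP.zero M h, hP'.zero M h⟩
  mid X Y Z _ _ _ _ _ _ f g h hX hZ := ⟨hP.mid X Y Z f g h hX.1 hZ.1, hP'.mid X Y Z f g h hX.2 hZ.2⟩

lemma prufer_loc {Q : Type} [Group Q] {q : ℕ} (hq : q.Prime) (e : Q ≃* Multiplicative (pruferSubgroup q)) (T : Finset Q) :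
    Finite (Subgroup.closure (T : Set Q)) ∧ IsCyclic (Subgroup.closure (T : Set Q)) ∧ IsPGroup q (Subgroup.closure (T : Set Q)) := by
  let ψ : Q →* Multiplicative RatCircle := (AddMonoidHom.toMultiplicative (pruferSubgroup q).subtype).comp e.toMonoidHom
  have hψ : Function.Injective ψ := by
    intro a b h
    apply e.injective
    exact Subtype.val_injective h
  have hk : ∀ x : Q, ∃ n : ℕ, (q ^ n) • (ψ x).toAdd = 0 := fun x => (e x).toAdd.2
  choose nn hnn using hk
  let N := T.sup nn
  have hN : q ^ N ≠ 0 := pow_ne_zero _ hq.ne_zero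
  have hN' : ((q ^ N : ℕ) : ℚ) ≠ 0 := Nat.cast_ne_zero.2 hN
  let u : RatCircle := QuotientAddGroup.mk (1 / ((q ^ N : ℕ) : ℚ))
  have hu : (q ^ N) • u = 0 := by
    change (QuotientAddGroup.mk ((q ^ N) • (1 / ((q ^ N : ℕ) : ℚ))) : RatCircle) = 0
    rw [QuotientAddGroup.eq_zero_iff, nsmul_eq_mul, mul_one_div_cancel hN']
    exact AddSubgroup.mem_zmultiples _
  have hmem : ∀ x : RatCircle, (q ^ N) • x = 0 → x ∈ AddSubgroup.zmultiples u := by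
    intro x hx
    obtain ⟨r, rfl⟩ := QuotientAddGroup.mk_surjective x
    have h1 : (QuotientAddGroup.mk ((q ^ N) • r) : RatCircle) = 0 := hx
    rw [QuotientAddGroup.eq_zero_iff, AddSubgroup.mem_zmultiples_iff] at h1
    obtain ⟨k, hk⟩ := h1
    refine ⟨k, ?_⟩
    change (QuotientAddGroup.mk (k • (1 / ((q ^ N : ℕ) : ℚ))) : RatCircle) = _
    congr 1
    rw [zsmul_eq_mul] at hk ⊢
    rw [nsmul_eq_mul] at hk
    rw [mul_one] at hk
    rw [hk]; field_simp
  let U : Subgroup (Multiplicative RatCircle) := AddSubgroup.toSubgroup (AddSubgroup.zmultiples u)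
  have hle : Subgroup.closure (T : Set Q) ≤ U.comap ψ := by
    rw [Subgroup.closure_le]
    intro x hx
    refine hmem _ ?_
    have h1 : nn x ≤ N := Finset.le_sup (f := nn) hx
    obtain ⟨d, hd⟩ := Nat.exists_eq_add_of_le h1
    rw [hd, add_comm, pow_add, mul_smul, hnn, smul_zero]
  have hUz : U = Subgroup.zpowers (Multiplicative.ofAdd u) := by
    ext x; rfl
  let g : Subgroup.closure (T : Set Q) →* U := (ψ.comp (Subgroup.closure (T : Set Q)).subtype).codRestrict U (fun x => hle x.2)
  have hg : Function.Injective g := by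
    intro a b h
    exact Subtype.ext (hψ (congrArg (fun z : U => z.1) h))
  haveI : IsCyclic U := by rw [hUz]; infer_instance
  haveI : Finite U := by
    rw [hUz]
    refine finite_zpowers.2 (isOfFinOrder_iff_pow_eq_one.2 ⟨q ^ N, Nat.pos_of_ne_zero hN, hu⟩)
  refine ⟨Finite.of_injective g hg, isCyclic_of_injective g hg, ?_⟩
  intro x
  refine ⟨N, hg ?_⟩
  rw [map_pow, map_one]
  apply Subtype.ext
  obtain ⟨k, hk⟩ := (g x).2
  have hk' : k • u = Multiplicative.toAdd (g x).1 := hk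
  change (q ^ N) • Multiplicative.toAdd (g x).1 = 0
  rw [← hk', smul_comm, hu, smul_zero]

/-- finite coefficients -/
lemma M1 {π : Set ℕ} {G : Type} [Group G] (h : MM π G) {W : Type} [AddCommGroup W] [Module ℤ W] [Finite W] (ρ : Representation ℤ G W) (n : ℕ) :
    Finite (gH ρ n) :=
  MM_ind (SC_fin ℤ) (BQ_base (SC_fin ℤ) (fun Q _ q hq _ ⟨e⟩ W _ _ ρ n hW => by
    haveI : Finite W := hW
    exact loc_cyc_fin (fun T => ⟨(prufer_loc hq e T).1, (prufer_loc hq e T).2.1⟩) ρ n)) h G (MulEquiv.refl G) W ρ n inferInstance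

lemma M2 {π : Set ℕ} {p : ℕ} (hp : p.Prime) (hpπ : p ∉ π) {G : Type} [Group G] (h : MM π G) {W : Type} [AddCommGroup W] [Module ℤ W]
    (hW : PP p W ∧ Art W) (ρ : Representation ℤ G W) (n : ℕ) : PP p (gH ρ n) ∧ Art (gH ρ n) := by
  have hP := (SC_PP ℤ p).and (SC_art ℤ)
  refine MM_ind hP (BQ_base hP (fun Q _ q hq hqπ ⟨e⟩ W _ _ ρ n hW => ?_)) h G (MulEquiv.refl G) W ρ n hW
  cases n with
  | zero => exact hP.h00 ρ hW
  | succ n =>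
    refine hP.zero _ (fun c => local_zero (LS_art (Art_iff.1 hW.2)) ρ n c (fun T => ?_))
    obtain ⟨h1, h2, h3⟩ := prufer_loc hq e T
    haveI : Fact q.Prime := ⟨hq⟩
    obtain ⟨m, hm⟩ := IsPGroup.iff_card.1 h3
    have hk := finite_kill' (res (Subgroup.closure (T : Set Q)).subtype ρ) n (rst ρ _ (n + 1) c)
    rw [hm] at hk
    obtain ⟨r, hr⟩ := gH_of_cochains (SC_PP ℤ p) (res (Subgroup.closure (T : Set Q)).subtype ρ) (n + 1) 
      ((SC_PP ℤ p).pi hW.1 _) (rst ρ _ (n + 1) c)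
    have hne : p ≠ q := fun e => hpπ (e ▸ hqπ)
    exact cop_zero _ _ _ (Nat.Coprime.pow m r ((Nat.coprime_primes hq hp).2 hne.symm)) hk hr

end TB

namespace TB

/-- divisibility -/
def Dv (D : Type) [AddCommGroup D] : Prop := ∀ (n : ℕ), n ≠ 0 → ∀ x : D, ∃ y, n • y = x

lemma Dv.ext {D : Type} [AddCommGroup D] (h : Dv D) {X Y : Type} [AddCommGroup X] [AddCommGroup Y] (i : X →+ Y)
    (hi : Function.Injective i) (g : X →+ D) : ∃ h : Y →+ D, ∀ x, h (i x) = g x := by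
  haveI : DivisibleBy D ℤ := 
    { div := fun x n => if hn : n = 0 then 0 else (h n.natAbs (Int.natAbs_ne_zero.2 hn) (if 0 ≤ n then x else -x)).choose
      div_zero := fun x => by simp
      div_cancel := by
        intro n x hn
        have hs := (h n.natAbs (Int.natAbs_ne_zero.2 hn) (if 0 ≤ n then x else -x)).choose_spec
        simp only [hn, dite_false]
        generalize (h n.natAbs (Int.natAbs_ne_zero.2 hn) (if 0 ≤ n then x else -x)).choose = y at hs
        split_ifs at hs with h0
        · rw [← hs, ← natCast_zsmul, Int.natAbs_of_nonneg h0]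
        · rw [← natCast_zsmul, Int.ofNat_natAbs_of_nonpos (by omega), neg_smul, neg_inj] at hs
          exact hs }
  obtain ⟨h, hh⟩ := (Module.Baer.of_divisible D).extension_property_addMonoidHom i hi g
  exact ⟨h, fun x => DFunLike.congr_fun hh x⟩

lemma prufer_Dv {p : ℕ} (hp : p.Prime) : Dv (pruferSubgroup p) := by
  have h1 : ∀ x : pruferSubgroup p, ∃ y, p • y = x := by
    rintro ⟨x, N, hx⟩
    obtain ⟨r, rfl⟩ := QuotientAddGroup.mk_surjective x
    have hp0 : (p : ℚ) ≠ 0 := Nat.cast_ne_zero.2 hp.ne_zero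
    have e : p • (QuotientAddGroup.mk (r / p) : RatCircle) = QuotientAddGroup.mk r := by
      change (QuotientAddGroup.mk (p • (r / (p : ℚ))) : RatCircle) = _
      rw [nsmul_eq_mul, mul_div_cancel₀ _ hp0]
    refine ⟨⟨QuotientAddGroup.mk (r / p), N + 1, ?_⟩, Subtype.ext e⟩
    rw [pow_succ, mul_smul, e]; exact hx
  intro n
  induction n using Nat.recOnMul with
  | zero => intro h; exact absurd rfl h
  | one => intro _ x; exact ⟨x, one_smul _ _⟩
  | prime q hq =>
    intro _ x
    by_cases e : q = p
    · rw [e]; exact h1 x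
    · obtain ⟨N, hN⟩ := prufer_PP p x
      have hc : IsCoprime ((q : ℕ) : ℤ) ((p ^ N : ℕ) : ℤ) := by
        rw [Nat.isCoprime_iff_coprime]
        exact Nat.Coprime.pow_right _ ((Nat.coprime_primes hq hp).2 e)
      obtain ⟨a, b, hab⟩ := hc
      refine ⟨a • x, ?_⟩
      rw [← natCast_zsmul] at hN
      rw [← natCast_zsmul, smul_comm, ← mul_smul]
      calc (a * (q : ℤ)) • x = (a * (q : ℤ)) • x + b • (((p ^ N : ℕ) : ℤ) • x) := by rw [hN, smul_zero, add_zero]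
        _ = x := by rw [← mul_smul, ← add_smul, hab, one_smul]
  | mul a b ha hb =>
    intro hab x
    obtain ⟨y, rfl⟩ := ha (left_ne_zero_of_mul hab) x
    obtain ⟨z, rfl⟩ := hb (right_ne_zero_of_mul hab) y
    exact ⟨z, mul_smul _ _ _⟩

/-- a Prüfer subgroup in a divisible group -/
lemma prufer_emb {D : Type} [AddCommGroup D] (hD : Dv D) {p : ℕ} (hp : p.Prime) (x : D) (hx : x ≠ 0) (hpx : p • x = 0) :
    ∃ i : pruferSubgroup p →+ D, Function.Injective i ∧ i ≠ 0 := by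
  have hp0 : (p : ℚ) ≠ 0 := Nat.cast_ne_zero.2 hp.ne_zero
  haveI : Fact p.Prime := ⟨hp⟩
  have hxo : addOrderOf x = p := addOrderOf_eq_prime hpx hx
  -- embed ⟨x⟩ in the Prüfer group
  let u : RatCircle := QuotientAddGroup.mk (1 / (p : ℚ))
  have hu : p • u = 0 := by
    change (QuotientAddGroup.mk (p • (1 / (p : ℚ))) : RatCircle) = 0
    rw [QuotientAddGroup.eq_zero_iff, nsmul_eq_mul, mul_one_div_cancel hp0]
    exact AddSubgroup.mem_zmultiples _
  have hu0 : u ≠ 0 := by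
    intro h
    rw [QuotientAddGroup.eq_zero_iff, AddSubgroup.mem_zmultiples_iff] at h
    obtain ⟨k, hk⟩ := h
    rw [zsmul_eq_mul, mul_one, eq_div_iff hp0] at hk
    have hk' : k * (p : ℤ) = 1 := by exact_mod_cast hk
    have h2 := Int.isUnit_iff.1 (IsUnit.of_mul_eq_one_right _ hk')
    have := hp.two_le
    omega
  let u' : pruferSubgroup p := ⟨u, 1, by rw [pow_one]; exact hu⟩
  have huo : addOrderOf u' = p := addOrderOf_eq_prime (Subtype.ext hu) (fun h => hu0 (congrArg Subtype.val h))
  let i0 : ZMod p →+ pruferSubgroup p := ZMod.lift p ⟨zmultiplesHom _ u', by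
    rw [zmultiplesHom_apply, natCast_zsmul]; exact Subtype.ext hu⟩
  let j0 : ZMod p →+ D := ZMod.lift p ⟨zmultiplesHom _ x, by
    rw [zmultiplesHom_apply, natCast_zsmul]; exact hpx⟩
  have hi0 : Function.Injective i0 := by
    rw [ZMod.lift_injective]
    intro m hm
    change m • u' = 0 at hm
    rw [ZMod.intCast_zmod_eq_zero_iff_dvd, ← huo]
    exact addOrderOf_dvd_iff_zsmul_eq_zero.2 hm
  have hj0 : Function.Injective j0 := by
    rw [ZMod.lift_injective]
    intro m hm
    change m • x = 0 at hm
    rw [ZMod.intCast_zmod_eq_zero_iff_dvd, ← hxo]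
    exact addOrderOf_dvd_iff_zsmul_eq_zero.2 hm
  obtain ⟨i, hi⟩ := hD.ext i0 hi0 j0
  have hiu : i u' = x := by
    have := hi 1
    have e1 : i0 1 = u' := by
      have := ZMod.lift_coe p (⟨zmultiplesHom _ u', by
        rw [zmultiplesHom_apply, natCast_zsmul]; exact Subtype.ext hu⟩ : {f : ℤ →+ pruferSubgroup p // f p = 0}) 1
      rw [Int.cast_one] at this
      rw [show i0 1 = _ from this]; exact one_smul _ _
    have e2 : j0 1 = x := by
      have := ZMod.lift_coe p (⟨zmultiplesHom _ x, by
        rw [zmultiplesHom_apply, natCast_zsmul]; exact hpx⟩ : {f : ℤ →+ D // f p = 0}) 1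
      rw [Int.cast_one] at this
      rw [show j0 1 = _ from this]; exact one_smul _ _
    rw [e1, e2] at this; exact this
  refine ⟨i, ?_, ?_⟩
  · rw [injective_iff_map_eq_zero]
    have soc : ∀ y : pruferSubgroup p, p • y = 0 → i y = 0 → y = 0 := by
      rintro ⟨y, hy'⟩ hy hiy
      obtain ⟨r, rfl⟩ := QuotientAddGroup.mk_surjective y
      have h1 : (QuotientAddGroup.mk (p • r) : RatCircle) = 0 := congrArg Subtype.val hy
      rw [QuotientAddGroup.eq_zero_iff, AddSubgroup.mem_zmultiples_iff] at h1
      obtain ⟨k, hk⟩ := h1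
      have hyu : (⟨QuotientAddGroup.mk r, hy'⟩ : pruferSubgroup p) = k • u' := by
        apply Subtype.ext
        change _ = (QuotientAddGroup.mk (k • (1 / (p : ℚ))) : RatCircle)
        congr 1
        rw [zsmul_eq_mul] at hk ⊢
        rw [nsmul_eq_mul, mul_one] at hk
        rw [hk]; field_simp
      rw [hyu, map_zsmul, hiu] at hiy
      rw [hyu]
      apply addOrderOf_dvd_iff_zsmul_eq_zero.1
      rw [huo, ← hxo]
      exact addOrderOf_dvd_iff_zsmul_eq_zero.2 hiy
    intro y hy
    obtain ⟨N, hN⟩ := prufer_PP p y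
    induction N with
    | zero => rw [pow_zero, one_smul] at hN; exact hN
    | succ N ih =>
      apply ih
      apply soc
      · rw [← mul_smul, ← pow_succ']; exact hN
      · rw [map_nsmul, hy, smul_zero]
  · intro h
    rw [h] at hiu
    exact hx hiu.symm

/-- product decomposition -/
def Cer (D : Type) [AddCommGroup D] : Prop := ∃ (r : ℕ) (p : Fin r → ℕ), (∀ i, (p i).Prime) ∧ Nonempty (D ≃+ ((i : Fin r) → pruferSubgroup (p i)))

lemma Cer_cons {D E : Type} [AddCommGroup D] [AddCommGroup E] {q : ℕ} (hq : q.Prime) (e : D ≃+ pruferSubgroup q × E) (h : Cer E) : Cer D := by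
  obtain ⟨r, p, hp, ⟨e'⟩⟩ := h
  refine ⟨r + 1, Fin.cons q p, ?_, ⟨?_⟩⟩
  · intro i
    refine Fin.cases hq (fun j => hp j) i
  · let c : (pruferSubgroup q × ((i : Fin r) → pruferSubgroup (p i))) ≃+ ((i : Fin (r + 1)) → pruferSubgroup ((Fin.cons q p : Fin (r + 1) → ℕ) i)) :=
      { toFun := fun x => Fin.cons (α := fun i => pruferSubgroup ((Fin.cons q p : Fin (r + 1) → ℕ) i)) x.1 x.2
        invFun := fun F => (F 0, fun i => F i.succ)
        left_inv := fun x => rfl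
        right_inv := fun F => by funext i; exact Fin.cases rfl (fun j => rfl) i
        map_add' := fun x y => by funext i; exact Fin.cases rfl (fun j => rfl) i }
    exact (e.trans ((AddEquiv.refl _).prodCongr e')).trans c

lemma Cer_div {A : Type} [AddCommGroup A] (hA : Art A) (hT : Tor A) (D : Submodule ℤ A) : Dv D → Cer D := by
  haveI : IsArtinian ℤ A := hA
  induction D using WellFoundedLT.induction with
  | ind D ih =>
  intro hD
  by_cases h0 : ∀ x : D, x = 0
  · haveI : Subsingleton D := ⟨fun a b => by rw [h0 a, h0 b]⟩
    refine ⟨0, Fin.elim0, fun i => i.elim0, ⟨?_⟩⟩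
    exact { toFun := fun _ => 0, invFun := fun _ => 0, left_inv := fun x => Subsingleton.elim _ _, right_inv := fun x => Subsingleton.elim _ _, map_add' := fun _ _ => Subsingleton.elim _ _ }
  push Not at h0
  obtain ⟨x, hx⟩ := h0
  -- element of prime order
  obtain ⟨m, hm, hmx⟩ := hT x.1
  have hmx' : m • x = 0 := Subtype.ext hmx
  have hne : addOrderOf x ≠ 1 := fun h => hx (AddMonoid.addOrderOf_eq_one_iff.1 h)
  obtain ⟨p, hp, hpd⟩ := Nat.exists_prime_and_dvd hne
  have hox : addOrderOf x ≠ 0 := by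
    intro h
    exact hm (Nat.eq_zero_of_zero_dvd (h ▸ addOrderOf_dvd_of_nsmul_eq_zero hmx'))
  obtain ⟨d, hd⟩ := hpd
  have hd0 : d ≠ 0 := by rintro rfl; exact hox (by rw [hd, mul_zero])
  have hy0 : d • x ≠ 0 := by
    intro h
    have := Nat.le_of_dvd (Nat.pos_of_ne_zero hd0) (addOrderOf_dvd_of_nsmul_eq_zero h)
    rw [hd] at this
    have h2 := hp.two_le
    have : 2 * d ≤ d := le_trans (Nat.mul_le_mul_right d h2) this
    omega
  have hpy : p • (d • x) = 0 := by rw [← mul_smul, ← hd]; exact addOrderOf_nsmul_eq_zero x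
  obtain ⟨i, hi, hi0⟩ := prufer_emb hD hp _ hy0 hpy
  obtain ⟨r, hr⟩ := (prufer_Dv hp).ext i hi (AddMonoidHom.id _)
  have hr' : ∀ a, r (i a) = a := hr
  let E : Submodule ℤ A := (AddSubgroup.toIntSubmodule (r.ker.map D.toAddSubgroup.subtype))
  have hE : ∀ a, a ∈ E ↔ ∃ h : a ∈ D, r ⟨a, h⟩ = 0 := by
    intro a
    constructor
    · rintro ⟨b, hb, rfl⟩
      exact ⟨b.2, hb⟩
    · rintro ⟨h, e⟩
      exact ⟨⟨a, h⟩, e, rfl⟩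
  have hlt : E < D := by
    refine lt_of_le_of_ne (fun a ha => ((hE a).1 ha).1) ?_
    intro h
    apply hi0
    ext a
    have h1 : (i a).1 ∈ E := by rw [h]; exact (i a).2
    obtain ⟨h2, h3⟩ := (hE _).1 h1
    have h4 : r (i a) = 0 := h3
    rw [hr'] at h4
    rw [h4, map_zero]; rfl
  have hpr : ∀ x : D, (x - i (r x)).1 ∈ E := by
    intro x
    refine (hE _).2 ⟨(x - i (r x)).2, ?_⟩
    change r (x - i (r x)) = 0
    rw [map_sub, hr', sub_self]
  have hEd : Dv E := by
    intro n hn e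
    obtain ⟨h1, h2⟩ := (hE e.1).1 e.2
    obtain ⟨y, hy⟩ := hD n hn ⟨e.1, h1⟩
    refine ⟨⟨_, hpr y⟩, Subtype.ext ?_⟩
    change n • (y - i (r y)).1 = e.1
    have h3 : n • (y - i (r y)) = ⟨e.1, h1⟩ := by
      rw [smul_sub, hy, ← map_nsmul, ← map_nsmul, hy, h2, map_zero, sub_zero]
    exact congrArg Subtype.val h3
  let inc : E → D := fun e => ⟨e.1, ((hE e.1).1 e.2).1⟩
  have hinc : ∀ e, r (inc e) = 0 := fun e => ((hE e.1).1 e.2).2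
  let e : D ≃+ pruferSubgroup p × E :=
    { toFun := fun x => (r x, ⟨_, hpr x⟩)
      invFun := fun z => i z.1 + inc z.2
      left_inv := fun x => by
        change i (r x) + (x - i (r x)) = x
        abel
      right_inv := fun z => by
        have h1 : r (i z.1 + inc z.2) = z.1 := by rw [map_add, hr', hinc, add_zero]
        refine Prod.ext h1 (Subtype.ext ?_)
        change ((i z.1 + inc z.2) - i (r (i z.1 + inc z.2))).1 = z.2.1
        rw [h1, add_sub_cancel_left]
      map_add' := fun x y => by
        refine Prod.ext (map_add r x y) (Subtype.ext ?_)
        change ((x + y) - i (r (x + y))).1 = ((x - i (r x)) + (y - i (r y))).1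
        rw [map_add, map_add]
        congr 1
        abel }
  exact Cer_cons hp e (ih E hlt hEd)

/-- artinian torsion groups are Chernikov -/
lemma Cern_of_art {A : Type} [AddCommGroup A] (hA : Art A) (hT : Tor A) : IsCernikov A := by
  haveI : IsArtinian ℤ A := hA
  let ml : ℕ → A →ₗ[ℤ] A := fun n => ((n.factorial : ℤ)) • LinearMap.id
  have hml : ∀ n x, ml n x = n.factorial • x := fun n x => by
    change ((n.factorial : ℤ)) • x = _
    rw [natCast_zsmul]
  let f : ℕ →o (Submodule ℤ A)ᵒᵈ := ⟨fun n => OrderDual.toDual (LinearMap.range (ml n)), by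
    intro a b hab
    change LinearMap.range (ml b) ≤ LinearMap.range (ml a)
    rintro _ ⟨x, rfl⟩
    obtain ⟨c, hc⟩ := Nat.factorial_dvd_factorial hab
    refine ⟨c • x, ?_⟩
    rw [hml, hml, hc, mul_smul]⟩
  obtain ⟨N, hN⟩ := IsArtinian.monotone_stabilizes f
  let D := LinearMap.range (ml N)
  have hN' : ∀ m, N ≤ m → D = LinearMap.range (ml m) := fun m hm => congrArg OrderDual.ofDual (hN m hm)
  have hD : Dv D := by
    intro n hn x
    have h1 : x.1 ∈ LinearMap.range (ml (N + n)) := by rw [← hN' _ (Nat.le_add_right _ _)]; exact x.2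
    obtain ⟨y, hy⟩ := h1
    rw [hml] at hy
    -- (N+n)! = n * c with N! ∣ c
    have h2 : N.factorial * n.factorial ∣ (N + n).factorial := Nat.factorial_mul_factorial_dvd_factorial_add N n
    obtain ⟨c, hc⟩ := h2
    obtain ⟨d, hd⟩ := Nat.dvd_factorial (Nat.pos_of_ne_zero hn) le_rfl
    refine ⟨⟨N.factorial • ((d * c) • y), ⟨(d * c) • y, hml _ _⟩⟩, Subtype.ext ?_⟩
    change n • (N.factorial • ((d * c) • y)) = x.1
    rw [← hy, ← mul_smul, ← mul_smul, hc, hd]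
    congr 1; ring
  obtain ⟨r, p, hp, he⟩ := Cer_div hA hT D hD
  refine ⟨D.toAddSubgroup, r, p, ?_, hp, he⟩
  haveI : Finite (A ⧸ D.toAddSubgroup) := by
    refine fin_of_art (Art_quo (QuotientAddGroup.mk' D.toAddSubgroup) (QuotientAddGroup.mk'_surjective _) hA) N.factorial (Nat.factorial_ne_zero N) ?_
    intro x
    obtain ⟨x, rfl⟩ := QuotientAddGroup.mk_surjective x
    change (QuotientAddGroup.mk (N.factorial • x) : A ⧸ D.toAddSubgroup) = 0
    rw [QuotientAddGroup.eq_zero_iff]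
    exact ⟨x, hml _ _⟩
  exact AddSubgroup.index_ne_zero_of_finite

lemma art_of_Cern {A : Type} [AddCommGroup A] (h : IsCernikov A) : Art A := by
  obtain ⟨S, r, p, hS, hp, ⟨e⟩⟩ := h
  have h1 : ∀ i, IsArtinian ℤ (pruferSubgroup (p i)) := fun i =>
    artin_of_socle (prufer_PP (p i)) (prufer_socle (p i) (hp i).ne_zero)
  have h2 : Art ((i : Fin r) → pruferSubgroup (p i)) := Art_iff.2 (@isArtinian_pi _ _ _ _ _ _ _ (fun i => by have := h1 i; infer_instance))
  have h3 : Art S := Art_sub e.toAddMonoidHom e.injective h2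
  haveI : Finite (A ⧸ S) := by
    refine Nat.finite_of_card_ne_zero ?_
    exact hS
  refine Art_mid S.subtype (QuotientAddGroup.mk' S) ?_ h3 ?_
  · intro y hy
    exact ⟨⟨y, (QuotientAddGroup.eq_zero_iff y).1 hy⟩, rfl⟩
  · change IsArtinian ℤ (A ⧸ S)
    infer_instance

/-- omega-torsion -/
def OT (ω : Set ℕ) (A : Type) [AddCommGroup A] : Prop :=
  ∀ a : A, ∃ m : ℕ, m ≠ 0 ∧ m • a = 0 ∧ ∀ p : ℕ, p.Prime → p ∣ m → p ∈ ω

lemma OT_iff {ω : Set ℕ} {A : Type} [AddCommGroup A] : OT ω A ↔ IsOmegaTorsion ω A := by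
  constructor
  · intro h a
    obtain ⟨m, hm, hma, hp⟩ := h a
    refine ⟨isOfFinAddOrder_iff_nsmul_eq_zero.2 ⟨m, Nat.pos_of_ne_zero hm, hma⟩, ?_⟩
    intro p hpp hd
    refine hp p hpp ((Int.natCast_dvd_natCast.1 hd).trans (addOrderOf_dvd_of_nsmul_eq_zero hma))
  · intro h a
    obtain ⟨h1, h2⟩ := h a
    exact ⟨addOrderOf a, h1.addOrderOf_pos.ne', addOrderOf_nsmul_eq_zero a, fun p hp hd => h2 p hp (Int.natCast_dvd_natCast.2 hd)⟩

lemma SC_OT (k : Type) [CommRing k] (ω : Set ℕ) : SC k (fun M _ _ => OT ω M) where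
  zero M _ _ h x := ⟨1, one_ne_zero, h _, fun p hp hd => absurd (Nat.dvd_one.1 hd) hp.one_lt.ne'⟩
  mid X Y Z _ _ _ _ _ _ f g h hX hZ y := by
    obtain ⟨n, hn0, hn, hnp⟩ := hZ (g y)
    rw [← map_nsmul] at hn
    obtain ⟨x, hx⟩ := h _ hn
    obtain ⟨m, hm0, hm, hmp⟩ := hX x
    refine ⟨m * n, mul_ne_zero hm0 hn0, ?_, ?_⟩
    · rw [mul_smul, ← hx, ← map_nsmul, hm, map_zero]
    · intro p hp hd
      rcases (Nat.Prime.dvd_mul hp).1 hd with h | h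
      · exact hmp p hp h
      · exact hnp p hp h

lemma CO_iff {ω : Set ℕ} {A : Type} [AddCommGroup A] : IsCernikovOmega ω A ↔ OT ω A ∧ Art A := by
  constructor
  · rintro ⟨h1, h2⟩
    exact ⟨OT_iff.2 h2, art_of_Cern h1⟩
  · rintro ⟨h1, h2⟩
    exact ⟨Cern_of_art h2 (fun x => (h1 x).imp fun m hm => ⟨hm.1, hm.2.1⟩), OT_iff.1 h1⟩

end TB

namespace TB

/-! ### NiceRep -/

lemma rank_of_FGm {M : Type} [AddCommGroup M] (hT : TF M) (h : FGm (fun s => s ≠ 0) M) :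
    ∃ n : ℕ, ∀ k : ℕ, (∃ f : (Fin k →₀ ℤ) →+ M, Function.Injective f) → k ≤ n := by
  obtain ⟨T, hTT⟩ := h
  choose s hs hsT using hTT
  refine ⟨Fintype.card (T : Set M), ?_⟩
  rintro k ⟨f, hf⟩
  let b : Fin k → M := fun i => f (Finsupp.single i 1)
  let S : ℕ := ∏ i, s (b i)
  have hS : S ≠ 0 := Finset.prod_ne_zero_iff.2 (fun i _ => hs _)
  let v : Fin k → M := fun i => S • b i
  have hv : LinearIndependent ℤ v := by
    have h1 : LinearIndependent ℤ b := by
      have h2 : LinearIndependent ℤ (fun i : Fin k => (Finsupp.single i 1 : Fin k →₀ ℤ)) := by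
        exact (Finsupp.basisSingleOne (R := ℤ) (ι := Fin k)).linearIndependent
      exact h2.map' f.toIntLinearMap (LinearMap.ker_eq_bot.2 hf)
    let g : M →ₗ[ℤ] M := (S : ℤ) • LinearMap.id
    have hg : LinearMap.ker g = ⊥ := by
      rw [LinearMap.ker_eq_bot']
      intro m hm
      change (S : ℤ) • m = 0 at hm
      rw [natCast_zsmul] at hm
      exact hT m S hS hm
    have h3 := h1.map' g hg
    have e : v = g ∘ b := by
      funext i
      change S • b i = (S : ℤ) • b i
      rw [natCast_zsmul]
    rw [e]
    exact h3
  have := linearIndependent_le_span_aux' v hv (T : Set M) (by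
    rintro _ ⟨i, rfl⟩
    have h1 : S • b i ∈ AddSubgroup.closure (T : Set M) := by
      obtain ⟨c, hc⟩ := Finset.dvd_prod_of_mem (fun i => s (b i)) (Finset.mem_univ i)
      change (∏ i, s (b i)) • b i ∈ _
      rw [hc, mul_comm, mul_smul]
      exact AddSubgroup.nsmul_mem _ (hsT _) _
    rw [← Submodule.span_int_eq_addSubgroupClosure] at h1
    exact h1)
  rw [Fintype.card_fin] at this
  exact this

lemma prufer_not_FGm {q : ℕ} (hq : q.Prime) (h : FGm (fun s => ¬ q ∣ s) (pruferSubgroup q)) : False := by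
  obtain ⟨T, hT⟩ := h
  choose nn hnn using prufer_PP q
  let N := T.sup nn
  have hcl : ∀ x ∈ AddSubgroup.closure (T : Set (pruferSubgroup q)), q ^ N • x = 0 := by
    intro x hx
    induction hx using AddSubgroup.closure_induction with
    | mem x hx =>
      obtain ⟨d, hd⟩ := Nat.exists_eq_add_of_le (show nn x ≤ N from Finset.le_sup (f := nn) hx)
      rw [hd, add_comm, pow_add, mul_smul, hnn, smul_zero]
    | zero => exact smul_zero _
    | add x y _ _ hx hy => rw [smul_add, hx, hy, add_zero]
    | neg x _ hx => rw [smul_neg, hx, neg_zero]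
  have hall : ∀ x : pruferSubgroup q, q ^ N • x = 0 := by
    intro x
    obtain ⟨s, hs, hsx⟩ := hT x
    have h1 := hcl _ hsx
    rw [smul_comm] at h1
    refine cop_zero _ s (q ^ nn x) (Nat.Coprime.pow_right _ ((Nat.Prime.coprime_iff_not_dvd hq).2 hs).symm) h1 ?_
    rw [smul_comm, hnn, smul_zero]
  have h0 : ∀ x : pruferSubgroup q, x = 0 := div_bdd hq (prufer_PP q) (fun x => prufer_Dv hq q hq.ne_zero x) (q ^ N) (pow_ne_zero _ hq.ne_zero) hall
  have hp0 : (q : ℚ) ≠ 0 := Nat.cast_ne_zero.2 hq.ne_zero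
  let u : RatCircle := QuotientAddGroup.mk (1 / (q : ℚ))
  have hu : q • u = 0 := by
    change (QuotientAddGroup.mk (q • (1 / (q : ℚ))) : RatCircle) = 0
    rw [QuotientAddGroup.eq_zero_iff, nsmul_eq_mul, mul_one_div_cancel hp0]
    exact AddSubgroup.mem_zmultiples _
  have h := congrArg Subtype.val (h0 ⟨u, 1, by rw [pow_one]; exact hu⟩)
  change u = 0 at h
  rw [QuotientAddGroup.eq_zero_iff, AddSubgroup.mem_zmultiples_iff] at h
  obtain ⟨k, hk⟩ := h
  rw [zsmul_eq_mul, mul_one, eq_div_iff hp0] at hk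
  have hk' : k * (q : ℤ) = 1 := by exact_mod_cast hk
  have h2 := Int.isUnit_iff.1 (IsUnit.of_mul_eq_one_right _ hk')
  have := hq.two_le
  omega

lemma nice_of {G : Type} [Group G] {π : Set ℕ} {M : Type} [AddCommGroup M] (μ : Representation ℤ G M) (h : Fm π M) (hT : TF M) :
    NiceRep π (Rep.of μ) := by
  refine ⟨?_, ⟨?_, ?_⟩, ?_⟩
  · intro g hg hf
    obtain ⟨n, hn, hng⟩ := isOfFinAddOrder_iff_nsmul_eq_zero.1 hf
    exact hg (hT g n hn.ne' hng)
  · exact rank_of_FGm hT (h _ (Or.inl rfl))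
  · intro p hp
    refine (Set.finite_singleton (0 : M)).subset ?_
    intro a ha
    exact hT a p hp.ne_zero ha
  · rintro q ⟨hq, H, K, hK, ⟨e⟩⟩
    by_contra hqπ
    have h1 := h _ (Or.inr ⟨q, hq, hqπ, rfl⟩)
    have h2 : FGm (fun s => ¬ q ∣ s) (AddSubgroup.toSubgroup.symm H) := FGm_sub (AddSubgroup.toSubgroup.symm H).subtype Subtype.val_injective h1
    refine prufer_not_FGm hq (FGm_quo (B := AddSubgroup.toSubgroup.symm H)
      { toFun := fun x => (e (QuotientGroup.mk (⟨Multiplicative.ofAdd x.1, x.2⟩ : H))).toAdd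
        map_zero' := map_one (e.toMonoidHom.comp (QuotientGroup.mk' K))
        map_add' := fun x y => map_mul (e.toMonoidHom.comp (QuotientGroup.mk' K)) (⟨Multiplicative.ofAdd x.1, x.2⟩ : H) (⟨Multiplicative.ofAdd y.1, y.2⟩ : H) } ?_ h2)
    intro y
    obtain ⟨z, hz⟩ := e.surjective (Multiplicative.ofAdd y)
    obtain ⟨⟨x, hx⟩, rfl⟩ := QuotientGroup.mk_surjective z
    exact ⟨⟨x.toAdd, hx⟩, congrArg Multiplicative.toAdd hz⟩

lemma AvD_of_hsub {G : Type} [Group G] {π : Set ℕ} (A : Rep.{0} ℤ G)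
    (hsub : ∀ S : AddSubgroup A, (∀ (g : G), ∀ a ∈ S, A.ρ g a ∈ S) → (S : Set A).Infinite → ¬ IsQuotientOfNiceRep π A S) :
    AvD π (@rz ℤ _ G _ A A.hV1 A.hV2 A.ρ) := by
  intro M _ μ φ hM hT hφ
  have hst : ∀ (g : G), ∀ a ∈ φ.range, A.ρ g a ∈ φ.range := by
    rintro g _ ⟨x, rfl⟩
    exact ⟨μ g x, hφ g x⟩
  by_cases hinf : (φ.range : Set A).Infinite
  · exact absurd ⟨Rep.of μ, nice_of μ hM hT, φ, fun m => ⟨m, rfl⟩, fun a ha => ha, hφ⟩ (hsub φ.range hst hinf)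
  · rw [Set.not_infinite] at hinf
    haveI : Finite φ.range := hinf
    refine ⟨Nat.card φ.range, Nat.card_pos.ne', fun x => ?_⟩
    have := card_nsmul_eq_zero' (x := (⟨φ x, x, rfl⟩ : φ.range))
    exact congrArg Subtype.val this

lemma AvD.sub {G : Type} [Group G] {π : Set ℕ} {V V' : Type} [AddCommGroup V] [AddCommGroup V'] {ρ : Representation ℤ G V}
    {ρ' : Representation ℤ G V'} (h : AvD π ρ') (i : V →+ V') (hi : Function.Injective i) (hh : ∀ g v, i (ρ g v) = ρ' g (i v)) : AvD π ρ := by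
  intro M _ μ φ hM hT hφ
  obtain ⟨m, hm, hk⟩ := h M μ (i.comp φ) hM hT (fun g x => by
    change i (φ (μ g x)) = ρ' g (i (φ x))
    rw [hφ, hh])
  refine ⟨m, hm, fun x => hi ?_⟩
  rw [map_nsmul, map_zero]; exact hk x

/-! ### core -/

section
variable {k : Type} [CommRing k] {G : Type} [Group G] {V : Type} [AddCommGroup V] [Module k V]

def mker (k : Type) [CommRing k] (V : Type) [AddCommGroup V] [Module k V] (m : ℕ) : Submodule k V := LinearMap.ker ((m : k) • (LinearMap.id : V →ₗ[k] V))

lemma mem_mker (m : ℕ) (v : V) : v ∈ mker k V m ↔ m • v = 0 := by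
  change (m : k) • v = 0 ↔ _
  rw [Nat.cast_smul_eq_nsmul]

lemma mker_st (ρ : Representation k G V) (m : ℕ) : ∀ g, ∀ v ∈ mker k V m, ρ g v ∈ mker k V m := by
  intro g v hv
  rw [mem_mker] at hv ⊢
  rw [← map_nsmul, hv, map_zero]

lemma mul_ker (ρ : Representation k G V) (m : ℕ) (hdiv : ∀ x : V, ∃ y, m • y = x) (n : ℕ) (c : gH ρ n) (hc : m • c = 0) :
    ∃ a : gH (V := ↥(mker k V m)) (srep ρ (mker k V m) (mker_st ρ m)) n, 
      (gmap (σ := srep ρ (mker k V m) (mker_st ρ m)) (τ := ρ) (MonoidHom.id G) (mker k V m).subtype (fun _ _ => rfl)).H n a = c := by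
  have hml : ∀ v : V, ((m : k) • (LinearMap.id : V →ₗ[k] V)) v = m • v := fun v => by
    change (m : k) • v = _
    rw [Nat.cast_smul_eq_nsmul]
  have S := gses (V := ↥(mker k V m)) (σ := srep ρ (mker k V m) (mker_st ρ m)) (τ := ρ) (υ := ρ) (mker k V m).subtype ((m : k) • (LinearMap.id : V →ₗ[k] V)) (fun _ _ => rfl)
    (fun x v => by rw [hml, hml, map_nsmul]) Subtype.val_injective (fun x => by
      obtain ⟨y, hy⟩ := hdiv x
      exact ⟨y, (hml y).trans hy⟩) (fun v => ⟨fun h => ⟨⟨v, h⟩, rfl⟩, fun ⟨w, hw⟩ => hw ▸ w.2⟩)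
  refine S.exact2 n c ?_
  rw [← hc]
  obtain ⟨F, hF, rfl⟩ := gcl_surj _ _ c
  rw [gmap_cl, gcl_nsmul]
  apply gcl_congr
  funext t
  exact hml _

end

lemma PP_bij {p : ℕ} (hp : p.Prime) {D : Type} [AddCommGroup D] (hD : PP p D) (m : ℕ) (hm : ¬ p ∣ m) (x : D) : ∃ y, m • y = x := by
  obtain ⟨N, hN⟩ := hD x
  have hc : IsCoprime ((m : ℕ) : ℤ) ((p ^ N : ℕ) : ℤ) := by
    rw [Nat.isCoprime_iff_coprime]
    exact Nat.Coprime.pow_right _ ((Nat.Prime.coprime_iff_not_dvd hp).2 hm).symm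
  obtain ⟨a, b, hab⟩ := hc
  refine ⟨a • x, ?_⟩
  rw [← natCast_zsmul] at hN
  rw [← natCast_zsmul, smul_comm, ← mul_smul]
  calc (a * (m : ℤ)) • x = (a * (m : ℤ)) • x + b • (((p ^ N : ℕ) : ℤ) • x) := by rw [hN, smul_zero, add_zero]
    _ = x := by rw [← mul_smul, ← add_smul, hab, one_smul]

lemma PP_gH {k : Type} [CommRing k] {G : Type} [Group G] {p : ℕ} (hp : p.Prime) {D : Type} [AddCommGroup D] [Module k D] (hD : PP p D) (ρ : Representation k G D) (n : ℕ)
    (h : Tor (gH ρ n)) : PP p (gH ρ n) := by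
  intro c
  obtain ⟨m, hm, hmc⟩ := h c
  obtain ⟨e, d, hd, hme⟩ := Nat.exists_eq_pow_mul_and_not_dvd hm p hp.ne_one
  refine ⟨e, ?_⟩
  rw [hme, mul_comm, mul_smul] at hmc
  obtain ⟨a, ha⟩ := mul_ker ρ d (PP_bij hp hD d hd) n _ hmc
  rw [← ha, gH_triv _ (fun v => ?_) n a, map_zero]
  have h1 := (mem_mker d v.1).1 v.2
  obtain ⟨N, hN⟩ := hD v.1
  exact Subtype.ext (cop_zero v.1 d (p ^ N) (Nat.Coprime.pow_right _ ((Nat.Prime.coprime_iff_not_dvd hp).2 hd).symm) h1 hN)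

end TB

namespace TB

/-! ### Core: the `p`-primary case -/

def HM1 (k : Type) [CommRing k] (G : Type) [Group G] : Prop :=
  ∀ (W : Type) [AddCommGroup W] [Module k W] [Finite W] (ρ : Representation k G W) (n : ℕ), Finite (gH ρ n)

def HM2 (k : Type) [CommRing k] (G : Type) [Group G] (p : ℕ) : Prop :=
  ∀ (W : Type) [AddCommGroup W] [Module k W] (ρ : Representation k G W) (n : ℕ), PP p W ∧ Art W → PP p (gH ρ n) ∧ Art (gH ρ n)

lemma core_div {k : Type} [CommRing k] {G : Type} [Group G] {π : Set ℕ} (hM : HM1 k G) {p : ℕ} [hp : Fact p.Prime] (hpπ : p ∈ π) (hU : UU π p G)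
    {D : Type} [AddCommGroup D] [Module k D] (hD : PP p D) (hdiv : ∀ x : D, ∃ y, p • y = x) (hart : Art D)
    (ρ : Representation k G D) (h : AvD π (rz ρ)) (n : ℕ) : PP p (gH ρ n) ∧ Art (gH ρ n) := by
  have hfin : {x : D | p • x = 0}.Finite := socle_fin hart p hp.out.ne_zero
  have ht : Tor (gH ρ n) := by
    rw [← Tor_rz]
    letI := pmod hD
    exact UD hpπ hU hD hdiv hfin (rz ρ) h n
  have hPP := PP_gH hp.out hD ρ n ht
  refine ⟨hPP, artin_of_socle hPP ?_⟩
  haveI : Finite ↥(mker k D p) := by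
    refine Set.Finite.to_subtype (hfin.subset ?_)
    intro x hx
    exact (mem_mker p x).1 hx
  haveI := hM ↥(mker k D p) (srep ρ (mker k D p) (mker_st ρ p)) n
  refine (Set.finite_range ((gmap (σ := srep ρ (mker k D p) (mker_st ρ p)) (τ := ρ) (MonoidHom.id G) (mker k D p).subtype (fun _ _ => rfl)).H n)).subset ?_
  intro c hc
  obtain ⟨a, ha⟩ := mul_ker ρ p hdiv n c hc
  exact ⟨a, ha⟩

lemma core {k : Type} [CommRing k] {G : Type} [Group G] {π : Set ℕ} (hM : HM1 k G) {p : ℕ} [hp : Fact p.Prime] (hM2 : p ∉ π → HM2 k G p) (hU : p ∈ π → UU π p G)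
    {V : Type} [AddCommGroup V] [Module k V] (hV : PP p V) (hart : Art V)
    (ρ : Representation k G V) (h : AvD π (rz ρ)) (n : ℕ) : PP p (gH ρ n) ∧ Art (gH ρ n) := by
  by_cases hpπ : p ∈ π
  swap
  · exact hM2 hpπ V ρ n ⟨hV, hart⟩
  haveI : IsArtinian ℤ V := hart
  obtain ⟨N, hN⟩ := IsArtinian.range_smul_pow_stabilizes (M := V) (p : ℤ)
  let D : Submodule k V := LinearMap.range (((p ^ N : ℕ) : k) • (LinearMap.id : V →ₗ[k] V))
  have hsm : ∀ (m : ℕ) (v : V), ((p : ℤ) ^ m • (LinearMap.id : V →ₗ[ℤ] V)) v = p ^ m • v := by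
    intro m v
    change ((p : ℤ) ^ m) • v = _
    rw [← Nat.cast_pow, natCast_zsmul]
  have hsk : ∀ (v : V), (((p ^ N : ℕ) : k) • (LinearMap.id : V →ₗ[k] V)) v = p ^ N • v := by
    intro v
    change ((p ^ N : ℕ) : k) • v = _
    rw [Nat.cast_smul_eq_nsmul]
  have hst : ∀ g, ∀ v ∈ D, ρ g v ∈ D := by
    rintro g _ ⟨v, rfl⟩
    exact ⟨ρ g v, by rw [hsk, hsk, map_nsmul]⟩
  have hdiv : ∀ x : D, ∃ y, p • y = x := by
    rintro ⟨x, w, hw⟩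
    have hx' : x ∈ LinearMap.range ((p : ℤ) ^ N • (LinearMap.id : V →ₗ[ℤ] V)) := ⟨w, by rw [hsm, ← hw, hsk]⟩
    rw [hN (N + 1) (Nat.le_succ N)] at hx'
    obtain ⟨v, hv⟩ := hx'
    rw [hsm] at hv
    refine ⟨⟨p ^ N • v, ⟨v, hsk v⟩⟩, Subtype.ext ?_⟩
    change p • p ^ N • v = x
    rw [← mul_smul, ← pow_succ']
    exact hv
  refine (subSES ρ D hst).scB (P := fun M _ _ => PP p M ∧ Art M) ((SC_PP k p).and (SC_art k)) n ?_ ?_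
  · refine core_div (D := ↥D) hM hpπ (hU hpπ) ?_ hdiv (Art_sub D.subtype.toAddMonoidHom Subtype.val_injective hart) (srep ρ D hst)
      (AvD.sub h D.subtype.toAddMonoidHom Subtype.val_injective (fun _ _ => rfl)) n
    intro x
    obtain ⟨m, hm⟩ := hV x.1
    exact ⟨m, Subtype.ext hm⟩
  · have hk : ∀ x : V ⧸ D, p ^ N • x = 0 := by
      intro x
      obtain ⟨v, rfl⟩ := Submodule.mkQ_surjective D x
      rw [← map_nsmul, Submodule.mkQ_apply, Submodule.Quotient.mk_eq_zero]
      exact ⟨v, hsk v⟩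
    haveI : Finite (V ⧸ D) := fin_of_art (Art_quo D.mkQ.toAddMonoidHom (Submodule.mkQ_surjective D) hart) (p ^ N) (pow_ne_zero _ hp.out.ne_zero) hk
    haveI := hM _ (qrep ρ D hst) n
    refine ⟨fun c => ⟨N, gH_kill (qrep ρ D hst) _ hk n c⟩, ?_⟩
    change IsArtinian ℤ (gH (qrep ρ D hst) n)
    infer_instance

/-! ### Splitting into primary components -/

section
variable {k : Type} [CommRing k] (V : Type) [AddCommGroup V] [Module k V]

variable (k) in
def primP (p : ℕ) : Submodule k V where
  carrier := {x | ∃ m : ℕ, p ^ m • x = 0}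
  zero_mem' := ⟨0, smul_zero _⟩
  add_mem' := by
    rintro a b ⟨m, hm⟩ ⟨n, hn⟩
    refine ⟨m + n, ?_⟩
    have ha : (p ^ m * p ^ n) • a = 0 := by rw [mul_comm, mul_smul, hm, smul_zero]
    have hb : (p ^ m * p ^ n) • b = 0 := by rw [mul_smul, hn, smul_zero]
    rw [smul_add, pow_add, ha, hb, add_zero]
  smul_mem' := by
    rintro c x ⟨m, hm⟩
    exact ⟨m, by rw [smul_comm, hm, smul_zero]⟩

variable (k) in
def primC (p : ℕ) (hp : p.Prime) : Submodule k V where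
  carrier := {x | ∃ m : ℕ, ¬ p ∣ m ∧ m • x = 0}
  zero_mem' := ⟨1, hp.not_dvd_one, smul_zero _⟩
  add_mem' := by
    rintro a b ⟨m, hm', hm⟩ ⟨n, hn', hn⟩
    refine ⟨m * n, fun h => ((Nat.Prime.dvd_mul hp).1 h).elim hm' hn', ?_⟩
    have ha : (m * n) • a = 0 := by rw [mul_comm, mul_smul, hm, smul_zero]
    have hb : (m * n) • b = 0 := by rw [mul_smul, hn, smul_zero]
    rw [smul_add, ha, hb, add_zero]
  smul_mem' := by
    rintro c x ⟨m, hm', hm⟩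
    exact ⟨m, hm', by rw [smul_comm, hm, smul_zero]⟩

end

theorem split {k : Type} [CommRing k] {G : Type} [Group G] {ω : Set ℕ} {A : Type} [AddCommGroup A] [Module k A] (α : Representation k G A) (hartk : IsArtinian k A) (hart : Art A) (hOT : OT ω A)
    (hcore : ∀ (p : ℕ), p.Prime → ∀ (V : Type) [AddCommGroup V] [Module k V] (ρ : Representation k G V) (i : V →ₗ[k] A), Function.Injective i →
      (∀ g v, i (ρ g v) = α g (i v)) → PP p V → Art V → ∀ n, PP p (gH ρ n) ∧ Art (gH ρ n)) :
    ∀ n, OT ω (gH α n) ∧ Art (gH α n) := by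
  have key : ∀ W : Submodule k A, ∀ (V : Type) [AddCommGroup V] [Module k V] (ρ : Representation k G V) (i : V →ₗ[k] A), Function.Injective i →
      (∀ g v, i (ρ g v) = α g (i v)) → LinearMap.range i = W → ∀ n, OT ω (gH ρ n) ∧ Art (gH ρ n) := by
    intro W
    induction W using WellFoundedLT.induction with
    | ind W ih =>
    intro V _ _ ρ i hi hiα hW n
    by_cases h0 : ∀ v : V, v = 0
    · exact ((SC_OT k ω).and (SC_art k)).zero _ (gH_triv ρ h0 n)
    push Not at h0
    obtain ⟨x0, hx0⟩ := h0
    have hOV : OT ω V := by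
      intro v
      obtain ⟨m, hm, h1, h2⟩ := hOT (i v)
      exact ⟨m, hm, hi (by rw [map_nsmul, h1, map_zero]), h2⟩
    have hAV : Art V := Art_sub i.toAddMonoidHom hi hart
    -- an element of prime order
    obtain ⟨p, hp, hpω, x, hx, hpx⟩ : ∃ p : ℕ, p.Prime ∧ p ∈ ω ∧ ∃ x : V, x ≠ 0 ∧ p • x = 0 := by
      obtain ⟨m, hm, h1, h2⟩ := hOV x0
      replace h1 : ∃ y : V, y ≠ 0 ∧ m • y = 0 := ⟨x0, hx0, h1⟩
      induction m using Nat.strong_induction_on with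
      | _ m ihm =>
        obtain ⟨y, hy, hmy⟩ := h1
        by_cases hm1 : m = 1
        · rw [hm1, one_smul] at hmy; exact absurd hmy hy
        obtain ⟨q, hq, hqm⟩ := Nat.exists_prime_and_dvd hm1
        by_cases hqy : q • y = 0
        · exact ⟨q, hq, h2 q hq hqm, y, hy, hqy⟩
        obtain ⟨d, rfl⟩ := hqm
        have hd : d ≠ 0 := right_ne_zero_of_mul hm
        refine ihm d ?_ hd (fun r hr hrd => h2 r hr (hrd.mul_left q)) ⟨q • y, hqy, by rw [← mul_smul, mul_comm]; exact hmy⟩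
        exact lt_mul_left (Nat.pos_of_ne_zero hd) hq.one_lt
    haveI : Fact p.Prime := ⟨hp⟩
    have hstC : ∀ g, ∀ v ∈ primC k V p hp, ρ g v ∈ primC k V p hp := by
      rintro g v ⟨m, hm, h1⟩
      exact ⟨m, hm, by rw [← map_nsmul, h1, map_zero]⟩
    have hstP : ∀ g, ∀ v ∈ primP k V p, ρ g v ∈ primP k V p := by
      rintro g v ⟨m, h1⟩
      exact ⟨m, by rw [← map_nsmul, h1, map_zero]⟩
    have hcp : ∀ (m e : ℕ), ¬ p ∣ m → Nat.Coprime m (p ^ e) := fun m e hm =>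
      Nat.Coprime.pow_right _ ((Nat.Prime.coprime_iff_not_dvd hp).2 hm).symm
    refine (subSES ρ (primC k V p hp) hstC).scB (P := fun M _ _ => OT ω M ∧ Art M) ((SC_OT k ω).and (SC_art k)) n ?_ ?_
    · refine ih (LinearMap.range (i.comp (primC k V p hp).subtype)) ?_ ↥(primC k V p hp) (srep ρ _ hstC) (i.comp (primC k V p hp).subtype)
        (hi.comp Subtype.val_injective) (fun g v => hiα g v.1) rfl n
      rw [← hW]
      refine lt_of_le_of_ne (LinearMap.range_comp_le_range _ _) ?_
      intro he
      have h1 : i x ∈ LinearMap.range i := ⟨x, rfl⟩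
      rw [← he] at h1
      obtain ⟨⟨y, m, hm, hy⟩, hyx⟩ := h1
      have hyx' : y = x := hi hyx
      subst hyx'
      exact hx (cop_zero y m (p ^ 1) (hcp m 1 hm) hy (by rw [pow_one]; exact hpx))
    · have hc := hcore p hp ↥(primP k V p) (srep ρ _ hstP) (i.comp (primP k V p).subtype) (hi.comp Subtype.val_injective) (fun g v => hiα g v.1)
        (fun v => by obtain ⟨m, hm⟩ := v.2; exact ⟨m, Subtype.ext hm⟩) (Art_sub (primP k V p).subtype.toAddMonoidHom Subtype.val_injective hAV) n
      refine ((SC_OT k ω).and (SC_art k)).congr (V := ↥(primP k V p)) (V' := V ⧸ primC k V p hp) (τ := srep ρ _ hstP) (τ' := qrep ρ _ hstC)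
        ((primC k V p hp).mkQ.comp (primP k V p).subtype) (fun g v => rfl) ⟨?_, ?_⟩ n ⟨?_, hc.2⟩
      · rw [injective_iff_map_eq_zero]
        rintro ⟨v, e, he⟩ hv
        change (primC k V p hp).mkQ v = 0 at hv
        rw [Submodule.mkQ_apply, Submodule.Quotient.mk_eq_zero] at hv
        obtain ⟨m, hm, h1⟩ := hv
        exact Subtype.ext (cop_zero v m (p ^ e) (hcp m e hm) h1 he)
      · intro y
        obtain ⟨v, rfl⟩ := Submodule.mkQ_surjective _ y
        obtain ⟨m, hm, h1, h2⟩ := hOV v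
        obtain ⟨e, d, hd, rfl⟩ := Nat.exists_eq_pow_mul_and_not_dvd hm p hp.ne_one
        have hcc : IsCoprime ((d : ℕ) : ℤ) ((p ^ e : ℕ) : ℤ) := by
          rw [Nat.isCoprime_iff_coprime]; exact hcp d e hd
        obtain ⟨a, b, hab⟩ := hcc
        have hv : v = a • (d • v) + b • (p ^ e • v) := by
          rw [← natCast_zsmul v d, ← natCast_zsmul v (p ^ e), ← mul_smul, ← mul_smul, ← add_smul, hab, one_smul]
        refine ⟨⟨a • (d • v), e, ?_⟩, ?_⟩
        · rw [smul_comm, ← mul_smul, h1, smul_zero]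
        · change (primC k V p hp).mkQ (a • (d • v)) = (primC k V p hp).mkQ v
          rw [← sub_eq_zero, ← map_sub, Submodule.mkQ_apply, Submodule.Quotient.mk_eq_zero]
          refine ⟨d, hd, ?_⟩
          have : a • (d • v) - v = - (b • (p ^ e • v)) := by
            nth_rewrite 2 [hv]; abel
          rw [this, smul_neg, smul_comm, ← mul_smul, mul_comm, h1, smul_zero, neg_zero]
      · intro c
        obtain ⟨e, he⟩ := hc.1 c
        refine ⟨p ^ e, pow_ne_zero _ hp.ne_zero, he, ?_⟩
        intro q hq hqd
        rw [(Nat.prime_dvd_prime_iff_eq hq hp).1 (hq.dvd_of_dvd_pow hqd)]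
        exact hpω
  exact key _ A α LinearMap.id Function.injective_id (fun _ _ => rfl) rfl

end TB

namespace TB

/-! ### Comparison with Mathlib's group cohomology -/

section
variable {k : Type} [CommRing k] {G : Type} [Group G] (A : Rep.{0} k G)

lemma ico_d (n : ℕ) (z : groupCohomology.cocycles A n) :
    dfun A.ρ n ((groupCohomology.iCocycles A n).hom z) = 0 := by
  rw [dfun_eq]
  have h := (groupCohomology.inhomogeneousCochains A).iCycles_d n (n + 1)
  have h2 := congrArg (fun f => f.hom z) h
  rw [groupCohomology.inhomogeneousCochains.d_def] at h2
  exact h2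

lemma ico_inj (n : ℕ) : Function.Injective (groupCohomology.iCocycles A n).hom :=
  (ModuleCat.mono_iff_injective (groupCohomology.iCocycles A n)).1 inferInstance

def ccl (n : ℕ) : groupCohomology.cocycles A n →ₗ[k] gH A.ρ n where
  toFun z := gcl A.ρ n ((groupCohomology.iCocycles A n).hom z) (ico_d A n z)
  map_add' x y := by
    rw [gcl_add]
    exact gcl_congr _ _ _ _ _ (map_add _ x y)
  map_smul' c x := by
    rw [RingHom.id_apply, gcl_smul]
    exact gcl_congr _ _ _ _ _ (map_smul _ c x)

lemma ccl_zero (n : ℕ) (z : groupCohomology.cocycles A n) (h : ccl A n z = 0) : (groupCohomology.π A n).hom z = 0 := by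
  cases n with
  | zero =>
    have h1 := (gcl_zero A.ρ _ (ico_d A 0 z)).1 h
    have : z = 0 := ico_inj A 0 (by rw [map_zero]; exact h1)
    rw [this, map_zero]
  | succ n =>
    obtain ⟨s, hs⟩ := (gcl_succ A.ρ n _ (ico_d A (n + 1) z)).1 h
    have hz : (groupCohomology.toCocycles A n (n + 1)).hom s = z := by
      apply ico_inj A (n + 1)
      rw [← hs, dfun_eq]
      have h1 := (groupCohomology.inhomogeneousCochains A).toCycles_i n (n + 1)
      have h2 := congrArg (fun f => f.hom s) h1
      rw [groupCohomology.inhomogeneousCochains.d_def] at h2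
      exact h2
    rw [← hz]
    have h1 := (groupCohomology.inhomogeneousCochains A).toCycles_comp_homologyπ n (n + 1)
    exact congrArg (fun f => f.hom s) h1

lemma bridge {P : ∀ (M : Type) [AddCommGroup M] [Module k M], Prop} (hP : SC k P) (n : ℕ) (h : P (gH A.ρ n)) :
    P (groupCohomology A n) :=
  hP.quot_of (ccl A n) (groupCohomology.π A n).hom 
    (fun x => groupCohomology_induction_on (C := fun x => ∃ z, (groupCohomology.π A n).hom z = x) x (fun z => ⟨z, rfl⟩)) (ccl_zero A n) h

lemma fin_gen (hM1 : HM1 k G) {π ω : Set ℕ} (hM2 : ∀ p, p.Prime → p ∉ π → HM2 k G p)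
   (hU : ∀ p [Fact p.Prime], p ∈ π → UU π p G) (hav : AvD π (rz A.ρ)) (hartk : IsArtinian k A) (hart : Art A) (hOT : OT ω A) (n : ℕ) :
   OT ω (groupCohomology A n) ∧ Art (groupCohomology A n) := by
  refine bridge A (P := fun M _ _ => OT ω M ∧ Art M) ((SC_OT k ω).and (SC_art k)) n ?_
  refine split A.ρ hartk hart hOT ?_ n
  intro p hp V _ _ ρ i hi hiα hV hVa n
  haveI : Fact p.Prime := ⟨hp⟩
  exact core hM1 (hM2 p hp) (hU p) hV hVa ρ (AvD.sub hav i.toAddMonoidHom hi hiα) n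

end

end TB

end TBsec


/-- Let `G` be a finitely generated solvable minimax group with spectrum `π`, and
let `ω` be a set of primes.  Let `A` be a `ℤG`-module whose underlying abelian
group is a Černikov `ω`-group, and suppose that `A` has no infinite
`ℤG`-submodule that is a `ℤG`-module quotient of some `ℤG`-module whose underlying
abelian group is torsion-free of finite rank and `π`-spectral.  Then `H^n(G, A)`
is a Černikov `ω`-group for all `n ≥ 0`. -/
theorem theoremB_minimax (G : Type) [Group G] (hfg : Group.FG G)
    (hsol : IsSolvable G) (hmm : IsMinimax G) (ω : Set ℕ)
    (A : Rep.{0} ℤ G) (hA : IsCernikovOmega ω A)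
    (hsub : ∀ S : AddSubgroup A, (∀ (g : G), ∀ a ∈ S, A.ρ g a ∈ S) →
      (S : Set A).Infinite → ¬ IsQuotientOfNiceRep (groupSpectrum G) A S) (n : ℕ) :
    IsCernikovOmega ω (groupCohomology A n) := by
  obtain ⟨h1, h2⟩ := TB.CO_iff.1 hA
  have hM := TB.MM_of hmm
  exact TB.CO_iff.2 (TB.fin_gen A (π := groupSpectrum G) (fun W _ _ _ ρ n => TB.M1 hM ρ n) (fun p hp hpπ W _ _ ρ n hW => TB.M2 hp hpπ hM hW ρ n)
    (fun p _ hpπ => TB.UU_main hfg hsol hM hpπ) (TB.AvD_of_hsub A hsub) ((TB.Art_iff (i := A.hV2)).1 h2) h2 h1 n)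


end
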